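/- Let D = {(x,y) ∈ ℝ² : y > x} be the open half-plane above the diagonal, and let ≤ denote the restriction to D of the componentwise order on ℝ². The validity problem over the frame (D, ≤) is decidable: the predicate on temporal formulas 'φ is valid over (D, ≤)' is computable. -/

import Mathlib

namespace Temporal

/-- Temporal propositional formulas: `φ ::= q | ¬φ | φ∨φ' | Fφ | Pφ`. -/
inductive TForm : Type
  | prop : ℕ → TForm
  | neg : TForm → TForm
  | or : TForm → TForm → TForm
  | fut : TForm → TForm
  | past : TForm → TForm
  deriving DecidableEq

/-- Truth of a temporal formula at a point of a Kripke structure. -/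
def TSat {X : Type*} (R : X → X → Prop) (v : ℕ → Set X) : TForm → X → Prop
  | .prop n, x => x ∈ v n
  | .neg φ, x => ¬ TSat R v φ x
  | .or φ ψ, x => TSat R v φ x ∨ TSat R v ψ x
  | .fut φ, x => ∃ y, R x y ∧ TSat R v φ y
  | .past φ, x => ∃ y, R y x ∧ TSat R v φ y

/-- Validity of a temporal formula over a Kripke frame. -/
def TValid {X : Type*} (R : X → X → Prop) (φ : TForm) : Prop :=
  ∀ (v : ℕ → Set X) (x : X), TSat R v φ x

/-- Satisfiability of a temporal formula over a Kripke frame. -/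
def TSatisfiable {X : Type*} (R : X → X → Prop) (φ : TForm) : Prop :=
  ∃ (v : ℕ → Set X) (x : X), TSat R v φ x

/-- An explicit encoding of temporal formulas as natural numbers. -/
def encodeT : TForm → ℕ
  | .prop n => 5 * n
  | .neg φ => 5 * encodeT φ + 1
  | .or φ ψ => 5 * Nat.pair (encodeT φ) (encodeT ψ) + 2
  | .fut φ => 5 * encodeT φ + 3
  | .past φ => 5 * encodeT φ + 4

/-- The inverse decoding of natural numbers as temporal formulas. -/
def decodeT (n : ℕ) : TForm :=
  if h0 : n % 5 = 0 then .prop (n / 5)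
  else
    have hn : 0 < n := Nat.pos_of_ne_zero (by rintro rfl; simp at h0)
    have hlt : n / 5 < n := Nat.div_lt_self hn (by norm_num)
    have h1 : (n / 5).unpair.1 < n := lt_of_le_of_lt (Nat.unpair_left_le _) hlt
    have h2 : (n / 5).unpair.2 < n := lt_of_le_of_lt (Nat.unpair_right_le _) hlt
    if n % 5 = 1 then .neg (decodeT (n / 5))
    else if n % 5 = 2 then .or (decodeT (n / 5).unpair.1) (decodeT (n / 5).unpair.2)
    else if n % 5 = 3 then .fut (decodeT (n / 5))
    else .past (decodeT (n / 5))

theorem decodeT_encodeT (φ : TForm) : decodeT (encodeT φ) = φ := by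
  induction φ with
  | prop n => rw [encodeT, decodeT]; simp [Nat.mul_div_cancel_left, Nat.mul_mod_right]
  | neg φ ih => rw [encodeT, decodeT]; simp [Nat.mul_add_mod, Nat.mul_add_div, ih]
  | or φ ψ ih1 ih2 => rw [encodeT, decodeT]; simp [Nat.mul_add_mod, Nat.mul_add_div, ih1, ih2]
  | fut φ ih => rw [encodeT, decodeT]; simp [Nat.mul_add_mod, Nat.mul_add_div, ih]
  | past φ ih => rw [encodeT, decodeT]; simp [Nat.mul_add_mod, Nat.mul_add_div, ih]

theorem encodeT_decodeT (n : ℕ) : encodeT (decodeT n) = n := by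
  induction n using Nat.strong_induction_on with
  | _ n ih =>
    rw [decodeT]
    by_cases h0 : n % 5 = 0
    · simp only [h0, dif_pos]
      rw [encodeT]
      omega
    · have hn : 0 < n := Nat.pos_of_ne_zero (by rintro rfl; simp at h0)
      have hlt : n / 5 < n := Nat.div_lt_self hn (by norm_num)
      have h1 : (n / 5).unpair.1 < n := lt_of_le_of_lt (Nat.unpair_left_le _) hlt
      have h2 : (n / 5).unpair.2 < n := lt_of_le_of_lt (Nat.unpair_right_le _) hlt
      rw [dif_neg h0]
      by_cases e1 : n % 5 = 1
      · rw [if_pos e1, encodeT, ih _ hlt]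
        omega
      · rw [if_neg e1]
        by_cases e2 : n % 5 = 2
        · rw [if_pos e2, encodeT, ih _ h1, ih _ h2, Nat.pair_unpair]
          omega
        · rw [if_neg e2]
          by_cases e3 : n % 5 = 3
          · rw [if_pos e3, encodeT, ih _ hlt]
            omega
          · rw [if_neg e3, encodeT, ih _ hlt]
            omega

instance : Encodable TForm :=
  ⟨encodeT, fun n => some (decodeT n), fun φ => congrArg some (decodeT_encodeT φ)⟩

instance : Denumerable TForm :=
  ⟨fun n => ⟨decodeT n, rfl, encodeT_decodeT n⟩⟩


/-- The open half-plane `D = {(x,y) ∈ ℝ² : y > x}` above the diagonal. -/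
abbrev HalfPlane : Type := {p : ℝ × ℝ // p.1 < p.2}

open Filter Topology

notation "°" => (by linarith)

section
/-! ### Real induction -/
theorem bis {a b : ℝ} (hab : a < b) (Q : ℝ -> ℝ -> Prop)
    (hadd : ∀ x y z, a <= x -> x < y -> y < z -> z <= b -> Q x y -> Q y z -> Q x z)
    (hr : ∀ x, a <= x -> x < b -> ∀ᶠ y in 𝓝[>] x, Q x y)
    (hl : ∀ x, a < x -> x <= b -> ∀ᶠ y in 𝓝[<] x, Q y x) : Q a b := by
  set S : Set ℝ := {x | a < x /\ x <= b /\ Q a x} with hS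
  have hne : S.Nonempty := by
    have h1 := hr a le_rfl hab
    have h2 : ∀ᶠ y in 𝓝[>] a, y ∈ Set.Ioo a b := Ioo_mem_nhdsGT hab
    obtain ⟨y, hy, hy2⟩ := (h1.and h2).exists
    exact ⟨y, hy2.1, hy2.2.le, hy⟩
  have hbdd : BddAbove S := ⟨b, fun x hx => hx.2.1⟩
  set c := sSup S with hc
  obtain ⟨x0, hx0⟩ := hne
  have hac : a < c := lt_of_lt_of_le hx0.1 (le_csSup hbdd hx0)
  have hcb : c <= b := csSup_le ⟨x0, hx0⟩ (fun x hx => hx.2.1)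
  have hQc : Q a c := by
    obtain ⟨l, hl1, hl2⟩ := (mem_nhdsLT_iff_exists_Ioo_subset).1 (hl c hac hcb)
    have : max l a < c := max_lt hl1 hac
    obtain ⟨y, hyS, hy⟩ := exists_lt_of_lt_csSup ⟨x0, hx0⟩ this
    rcases eq_or_lt_of_le (le_csSup hbdd hyS) with h | h
    . rw [hc, <- h]; exact hyS.2.2
    . exact hadd a y c le_rfl hyS.1 h hcb hyS.2.2
        (hl2 ⟨lt_of_le_of_lt (le_max_left _ _) hy, h⟩)
  rcases hcb.eq_or_lt with h | h
  . rwa [h] at hQc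
  . have h1 := hr c hac.le h
    have h2 : ∀ᶠ y in 𝓝[>] c, y ∈ Set.Ioo c b := Ioo_mem_nhdsGT h
    obtain ⟨y, hy, hy2⟩ := (h1.and h2).exists
    have : y ∈ S := ⟨hac.trans hy2.1, hy2.2.le, hadd a c y le_rfl hac hy2.1 hy2.2.le hQc hy⟩
    exact absurd (le_csSup hbdd this) (not_le.2 hy2.1)

/-! ### Clusters -/

abbrev Clu := ℕ × ℕ

def mb (a s : ℕ) : Prop := s.testBit a = true

def qle (c d : Clu) : Prop := (∀ a, mb a d.1 -> mb a c.1) /\ (∀ b, mb b c.2 -> mb b d.2)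
theorem mb_ext {s t : ℕ} (h : ∀ a, mb a s ↔ mb a t) : s = t :=
  Nat.eq_of_testBit_eq fun i => by
    have := h i
    unfold mb at this
    exact Bool.eq_iff_iff.2 this
theorem mb_sub_le {s t : ℕ} (h : ∀ a, mb a s -> mb a t) : s <= t := by
  have : s ||| t = t := by
    apply mb_ext
    intro a
    have := h a
    unfold mb at *
    simp only [Nat.testBit_or, Bool.or_eq_true]
    tauto
  rw [<- this]
  exact Nat.left_le_or
theorem qle_refl (c : Clu) : qle c c := ⟨fun _ h => h, fun _ h => h⟩
theorem qle.trans {c d e : Clu} (h : qle c d) (h' : qle d e) : qle c e :=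
  ⟨fun a ha => h.1 a (h'.1 a ha), fun a ha => h'.2 a (h.2 a ha)⟩
theorem qle.antisymm {c d : Clu} (h : qle c d) (h' : qle d c) : c = d :=
  Prod.ext (mb_ext fun a => ⟨h'.1 a, h.1 a⟩) (mb_ext fun a => ⟨h.2 a, h'.2 a⟩)

def cmu (c : Clu) : ℤ := (c.2 : ℤ) - c.1
theorem qle.mu {c d : Clu} (h : qle c d) : cmu c <= cmu d := by
  have h1 := mb_sub_le h.1
  have h2 := mb_sub_le h.2
  unfold cmu; omega
theorem qle.eq_of_mu {c d : Clu} (h : qle c d) (h' : cmu d <= cmu c) : c = d := by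
  have h1 := mb_sub_le h.1
  have h2 := mb_sub_le h.2
  unfold cmu at h'
  exact Prod.ext (by omega) (by omega)

/-- A constraint system: number of colours, and which colours are allowed at which cluster. -/
structure Sys where
  n : ℕ
  al : ℕ -> Clu -> Prop
  hal : ∀ t c, al t c -> mb t c.1 /\ mb t c.2

/-- Point types: real flag, cluster, and clusters of the germs in four directions. -/
@[ext] structure PT where
  re : Bool
  c : Clu
  n : Clu
  e : Clu
  s : Clu
  w : Clu
deriving DecidableEq

def Bd (N : ℕ) (c : Clu) : Prop := c.1 < 2 ^ N /\ c.2 < 2 ^ N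

structure Valid (K : Sys) (p : PT) : Prop where
  bc : Bd K.n p.c
  bn : Bd K.n p.n
  be : Bd K.n p.e
  bs : Bd K.n p.s
  bw : Bd K.n p.w
  wc : qle p.w p.c
  sc : qle p.s p.c
  cn : qle p.c p.n
  ce : qle p.c p.e
  ex : p.re = true -> ∃ t, K.al t p.c /\
    (∀ a, mb a p.c.1 -> a = t \/ mb a p.n.1 \/ mb a p.e.1) /\
    (∀ b, mb b p.c.2 -> b = t \/ mb b p.s.2 \/ mb b p.w.2)
  du : p.re = false ->
    (∀ a, mb a p.c.1 -> mb a p.n.1 \/ mb a p.e.1) /\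
    (∀ b, mb b p.c.2 -> mb b p.s.2 \/ mb b p.w.2)

def realF (K : Sys) (p : PT) (a : ℕ) : Prop :=
  p.re = true /\ mb a p.c.1 /\ ((¬ mb a p.n.1 /\ ¬ mb a p.e.1) \/ ((p.n = p.c \/ p.e = p.c) /\ K.al a p.c))

def realP (K : Sys) (p : PT) (b : ℕ) : Prop :=
  p.re = true /\ mb b p.c.2 /\ ((¬ mb b p.s.2 /\ ¬ mb b p.w.2) \/ ((p.s = p.c \/ p.w = p.c) /\ K.al b p.c))

def covF (K : Sys) (re : Bool) (c d1 d2 : Clu) : Prop :=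
  ∀ a, mb a c.1 -> (re = true /\ K.al a c) \/ mb a d1.1 \/ mb a d2.1
def covP (K : Sys) (re : Bool) (c d1 d2 : Clu) : Prop :=
  ∀ a, mb a c.2 -> (re = true /\ K.al a c) \/ mb a d1.2 \/ mb a d2.2

def kap (C : Clu) : PT := ⟨true, C, C, C, C, C⟩

/-! ### Symmetries -/

def Sys.dual (K : Sys) : Sys :=
  ⟨K.n, fun t c => K.al t c.swap, fun t c h => (K.hal t c.swap h).symm⟩

/-- transposition `(x,y) ↦ (y,x)` -/
def PT.tr (p : PT) : PT := ⟨p.re, p.c, p.e, p.n, p.w, p.s⟩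
/-- anti-transposition `(x,y) ↦ (-y,-x)`, time reversing -/
def PT.du (p : PT) : PT := ⟨p.re, p.c.swap, p.w.swap, p.s.swap, p.e.swap, p.n.swap⟩
@[simp] theorem PT.tr_tr (p : PT) : p.tr.tr = p := rfl
@[simp] theorem PT.tr_re (p : PT) : p.tr.re = p.re := rfl
@[simp] theorem PT.tr_c (p : PT) : p.tr.c = p.c := rfl
@[simp] theorem PT.tr_n (p : PT) : p.tr.n = p.e := rfl
@[simp] theorem PT.tr_e (p : PT) : p.tr.e = p.n := rfl
@[simp] theorem PT.tr_s (p : PT) : p.tr.s = p.w := rfl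
@[simp] theorem PT.tr_w (p : PT) : p.tr.w = p.s := rfl
@[simp] theorem PT.du_du (p : PT) : p.du.du = p := rfl
@[simp] theorem PT.du_re (p : PT) : p.du.re = p.re := rfl
@[simp] theorem PT.du_c (p : PT) : p.du.c = p.c.swap := rfl
@[simp] theorem PT.du_n (p : PT) : p.du.n = p.w.swap := rfl
@[simp] theorem PT.du_e (p : PT) : p.du.e = p.s.swap := rfl
@[simp] theorem PT.du_s (p : PT) : p.du.s = p.e.swap := rfl
@[simp] theorem PT.du_w (p : PT) : p.du.w = p.n.swap := rfl
@[simp] theorem kap_tr (C : Clu) : (kap C).tr = kap C := rfl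
@[simp] theorem kap_re (C : Clu) : (kap C).re = true := rfl
@[simp] theorem kap_c (C : Clu) : (kap C).c = C := rfl
@[simp] theorem kap_n (C : Clu) : (kap C).n = C := rfl
@[simp] theorem kap_e (C : Clu) : (kap C).e = C := rfl
@[simp] theorem kap_s (C : Clu) : (kap C).s = C := rfl
@[simp] theorem kap_w (C : Clu) : (kap C).w = C := rfl
theorem PT.tr_inj {p q : PT} (h : p.tr = q.tr) : p = q := by
  rw [<- p.tr_tr, h, q.tr_tr]
theorem qle.swap {c d : Clu} (h : qle c d) : qle d.swap c.swap := ⟨h.2, h.1⟩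
theorem Bd.swap {n : ℕ} {c : Clu} (h : Bd n c) : Bd n c.swap := ⟨h.2, h.1⟩
theorem Valid.tr {K : Sys} {p : PT} (h : Valid K p) : Valid K p.tr := by
  refine ⟨h.bc, h.be, h.bn, h.bw, h.bs, h.sc, h.wc, h.ce, h.cn, fun hr => ?_, fun hr => ?_⟩
  . obtain ⟨t, h1, h2, h3⟩ := h.ex hr
    exact ⟨t, h1, fun a ha => (h2 a ha).imp id Or.symm, fun a ha => (h3 a ha).imp id Or.symm⟩
  . obtain ⟨h2, h3⟩ := h.du hr
    exact ⟨fun a ha => (h2 a ha).symm, fun a ha => (h3 a ha).symm⟩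
theorem Valid.dual {K : Sys} {p : PT} (h : Valid K p) : Valid K.dual p.du := by
  refine ⟨h.bc.swap, h.bw.swap, h.bs.swap, h.be.swap, h.bn.swap, h.cn.swap, h.ce.swap, h.wc.swap,
    h.sc.swap, fun hr => ?_, fun hr => ?_⟩
  . obtain ⟨t, h1, h2, h3⟩ := h.ex hr
    exact ⟨t, h1, fun a ha => (h3 a ha).imp id Or.symm, fun a ha => (h2 a ha).imp id Or.symm⟩
  . obtain ⟨h2, h3⟩ := h.du hr
    exact ⟨fun a ha => (h3 a ha).symm, fun a ha => (h2 a ha).symm⟩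
theorem realF.tr {K : Sys} {p : PT} {a} (h : realF K p a) : realF K p.tr a :=
  ⟨h.1, h.2.1, h.2.2.imp And.symm (fun h => ⟨h.1.symm, h.2⟩)⟩
theorem realP.tr {K : Sys} {p : PT} {a} (h : realP K p a) : realP K p.tr a :=
  ⟨h.1, h.2.1, h.2.2.imp And.symm (fun h => ⟨h.1.symm, h.2⟩)⟩
theorem realF.dual {K : Sys} {p : PT} {a} (h : realF K p a) : realP K.dual p.du a :=
  ⟨h.1, h.2.1, h.2.2.imp And.symm
    (fun h => ⟨by simpa [Prod.swap_inj, or_comm] using h.1, h.2⟩)⟩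
theorem realP.dual {K : Sys} {p : PT} {a} (h : realP K p a) : realF K.dual p.du a :=
  ⟨h.1, h.2.1, h.2.2.imp And.symm
    (fun h => ⟨by simpa [Prod.swap_inj, or_comm] using h.1, h.2⟩)⟩

/-! ### Models on rectangles -/

structure Model (K : Sys) (f : ℝ -> ℝ -> PT) (x0 x1 y0 y1 : ℝ) : Prop where
  val : ∀ x y, x0 <= x -> x <= x1 -> y0 <= y -> y <= y1 -> Valid K (f x y)
  re : ∀ x y, x0 < x -> x < x1 -> y0 < y -> y < y1 -> (f x y).re = true
  gN : ∀ x y, x0 <= x -> x <= x1 -> y0 <= y -> y < y1 -> ∀ᶠ y' in 𝓝[>] y, (f x y').c = (f x y).n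
  gS : ∀ x y, x0 <= x -> x <= x1 -> y0 < y -> y <= y1 -> ∀ᶠ y' in 𝓝[<] y, (f x y').c = (f x y).s
  gE : ∀ x y, x0 <= x -> x < x1 -> y0 <= y -> y <= y1 -> ∀ᶠ x' in 𝓝[>] x, (f x' y).c = (f x y).e
  gW : ∀ x y, x0 < x -> x <= x1 -> y0 <= y -> y <= y1 -> ∀ᶠ x' in 𝓝[<] x, (f x' y).c = (f x y).w
  fF : ∀ x y, x0 <= x -> x <= x1 -> y0 <= y -> y <= y1 -> ∀ a, mb a (f x y).c.1 ->
    ∃ x' y', x <= x' /\ x' <= x1 /\ y <= y' /\ y' <= y1 /\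
      (realF K (f x' y') a \/ (mb a (f x' y').c.1 /\ (x' = x1 \/ y' = y1)))
  fP : ∀ x y, x0 <= x -> x <= x1 -> y0 <= y -> y <= y1 -> ∀ a, mb a (f x y).c.2 ->
    ∃ x' y', x0 <= x' /\ x' <= x /\ y0 <= y' /\ y' <= y /\
      (realP K (f x' y') a \/ (mb a (f x' y').c.2 /\ (x' = x0 \/ y' = y0)))

def fT (f : ℝ -> ℝ -> PT) : ℝ -> ℝ -> PT := fun x y => (f y x).tr
def fD (f : ℝ -> ℝ -> PT) : ℝ -> ℝ -> PT := fun x y => (f (-y) (-x)).du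
@[simp] theorem fT_fT (f) : fT (fT f) = f := rfl
@[simp] theorem fD_fD (f) : fD (fD f) = f := by funext x y; simp [fD]
theorem Model.tr {K f x0 x1 y0 y1} (h : Model K f x0 x1 y0 y1) : Model K (fT f) y0 y1 x0 x1 where
  val x y h1 h2 h3 h4 := (h.val y x h3 h4 h1 h2).tr
  re x y h1 h2 h3 h4 := h.re y x h3 h4 h1 h2
  gN x y h1 h2 h3 h4 := h.gE y x h3 h4 h1 h2
  gE x y h1 h2 h3 h4 := h.gN y x h3 h4 h1 h2
  gS x y h1 h2 h3 h4 := h.gW y x h3 h4 h1 h2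
  gW x y h1 h2 h3 h4 := h.gS y x h3 h4 h1 h2
  fF x y h1 h2 h3 h4 a ha := by
    obtain ⟨x', y', q1, q2, q3, q4, q5⟩ := h.fF y x h3 h4 h1 h2 a ha
    exact ⟨y', x', q3, q4, q1, q2, q5.imp realF.tr (fun h => ⟨h.1, h.2.symm⟩)⟩
  fP x y h1 h2 h3 h4 a ha := by
    obtain ⟨x', y', q1, q2, q3, q4, q5⟩ := h.fP y x h3 h4 h1 h2 a ha
    exact ⟨y', x', q3, q4, q1, q2, q5.imp realP.tr (fun h => ⟨h.1, h.2.symm⟩)⟩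
theorem tendsto_neg_GT (x : ℝ) : Tendsto (fun y : ℝ => -y) (𝓝[>] x) (𝓝[<] (-x)) :=
  tendsto_neg_nhdsGT
theorem tendsto_neg_LT (x : ℝ) : Tendsto (fun y : ℝ => -y) (𝓝[<] x) (𝓝[>] (-x)) :=
  tendsto_neg_nhdsLT
theorem Model.dual {K f x0 x1 y0 y1} (h : Model K f x0 x1 y0 y1) :
    Model K.dual (fD f) (-y1) (-y0) (-x1) (-x0) where
  val x y h1 h2 h3 h4 := (h.val (-y) (-x) ° ° ° °).dual
  re x y h1 h2 h3 h4 := h.re (-y) (-x) ° ° ° °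
  gN x y h1 h2 h3 h4 := ((tendsto_neg_GT y).eventually
    (h.gW (-y) (-x) ° ° ° °)).mono fun _ h => by
      simp only [fD, PT.du_c, PT.du_n, h]
  gE x y h1 h2 h3 h4 := ((tendsto_neg_GT x).eventually
    (h.gS (-y) (-x) ° ° ° °)).mono fun _ h => by
      simp only [fD, PT.du_c, PT.du_e, h]
  gS x y h1 h2 h3 h4 := ((tendsto_neg_LT y).eventually
    (h.gE (-y) (-x) ° ° ° °)).mono fun _ h => by
      simp only [fD, PT.du_c, PT.du_s, h]
  gW x y h1 h2 h3 h4 := ((tendsto_neg_LT x).eventually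
    (h.gN (-y) (-x) ° ° ° °)).mono fun _ h => by
      simp only [fD, PT.du_c, PT.du_w, h]
  fF x y h1 h2 h3 h4 a ha := by
    obtain ⟨x', y', q1, q2, q3, q4, q5⟩ :=
      h.fP (-y) (-x) ° ° ° ° a ha
    refine ⟨-y', -x', °, °, °, °, ?_⟩
    simp only [fD, neg_neg, neg_inj]
    exact q5.imp realP.dual (fun h => ⟨h.1, h.2.symm⟩)
  fP x y h1 h2 h3 h4 a ha := by
    obtain ⟨x', y', q1, q2, q3, q4, q5⟩ :=
      h.fF (-y) (-x) ° ° ° ° a ha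
    refine ⟨-y', -x', °, °, °, °, ?_⟩
    simp only [fD, neg_neg, neg_inj]
    exact q5.imp realF.dual (fun h => ⟨h.1, h.2.symm⟩)
@[simp] theorem Sys.dual_dual (K : Sys) : K.dual.dual = K := rfl
theorem Model.of_dual {K f x0 x1 y0 y1} (h : Model K.dual (fD f) (-y1) (-y0) (-x1) (-x0)) :
    Model K f x0 x1 y0 y1 := by
  have := h.dual
  simpa using this
variable {K : Sys} {f : ℝ -> ℝ -> PT} {x0 x1 y0 y1 : ℝ}
theorem Model.monoY (h : Model K f x0 x1 y0 y1) {x y y' : ℝ} (hx0 : x0 <= x) (hx1 : x <= x1)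
    (hy0 : y0 <= y) (hyy : y <= y') (hy1 : y' <= y1) : qle (f x y).c (f x y').c := by
  rcases hyy.eq_or_lt with rfl | hlt
  . exact qle_refl _
  . refine bis hlt (fun u v => qle (f x u).c (f x v).c) (fun _ _ _ _ _ _ _ h h' => h.trans h')
      (fun u hu hu' => ?_) (fun u hu hu' => ?_)
    . filter_upwards [h.gN x u hx0 hx1 (hy0.trans hu) (hu'.trans_le hy1)] with v hv
      rw [hv]
      exact (h.val x u hx0 hx1 (hy0.trans hu) (hu'.le.trans hy1)).cn
    . filter_upwards [h.gS x u hx0 hx1 (hy0.trans_lt hu) (hu'.trans hy1)] with v hv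
      rw [hv]
      exact (h.val x u hx0 hx1 (hy0.trans hu.le) (hu'.trans hy1)).sc
theorem Model.monoX (h : Model K f x0 x1 y0 y1) {x x' y : ℝ} (hx0 : x0 <= x) (hxx : x <= x')
    (hx1 : x' <= x1) (hy0 : y0 <= y) (hy1 : y <= y1) : qle (f x y).c (f x' y).c :=
  h.tr.monoY (x := y) hy0 hy1 hx0 hxx hx1
theorem Model.mono (h : Model K f x0 x1 y0 y1) {x x' y y' : ℝ} (hx0 : x0 <= x) (hxx : x <= x')
    (hx1 : x' <= x1) (hy0 : y0 <= y) (hyy : y <= y') (hy1 : y' <= y1) :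
    qle (f x y).c (f x' y').c :=
  (h.monoX hx0 hxx hx1 hy0 (hyy.trans hy1)).trans (h.monoY (hx0.trans hxx) hx1 hy0 hyy hy1)

/-- restriction to a sub-rectangle -/
theorem Model.restr (h : Model K f x0 x1 y0 y1) {u0 u1 v0 v1 : ℝ} (hu0 : x0 <= u0)
    (hu1 : u1 <= x1) (hv0 : y0 <= v0) (hv1 : v1 <= y1) : Model K f u0 u1 v0 v1 where
  val x y h1 h2 h3 h4 := h.val x y ° ° ° °
  re x y h1 h2 h3 h4 := h.re x y ° ° ° °
  gN x y h1 h2 h3 h4 := h.gN x y ° ° ° °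
  gS x y h1 h2 h3 h4 := h.gS x y ° ° ° °
  gE x y h1 h2 h3 h4 := h.gE x y ° ° ° °
  gW x y h1 h2 h3 h4 := h.gW x y ° ° ° °
  fF x y h1 h2 h3 h4 a ha := by
    obtain ⟨x', y', q1, q2, q3, q4, q5⟩ :=
      h.fF x y ° ° ° ° a ha
    by_cases hin : x' < u1 /\ y' < v1
    . refine ⟨x', y', q1, hin.1.le, q3, hin.2.le, q5.imp id ?_⟩
      rintro ⟨_, rfl | rfl⟩ <;> exfalso <;> linarith [hin.1, hin.2]
    . refine ⟨min x' u1, min y' v1, le_min q1 h2, min_le_right _ _, le_min q3 h4,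
        min_le_right _ _, .inr ⟨?_, ?_⟩⟩
      . have hm : mb a (f x' y').c.1 := by
          rcases q5 with q | q
          . exact q.2.1
          . exact q.1
        exact (h.mono (by have := le_min q1 h2; linarith) (min_le_left _ _) q2
          (by have := le_min q3 h4; linarith) (min_le_left _ _) q4).1 a hm
      . rw [not_and_or, not_lt, not_lt] at hin
        exact hin.imp min_eq_right min_eq_right
  fP x y h1 h2 h3 h4 a ha := by
    obtain ⟨x', y', q1, q2, q3, q4, q5⟩ :=
      h.fP x y ° ° ° ° a ha
    by_cases hin : u0 < x' /\ v0 < y'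
    . refine ⟨x', y', hin.1.le, q2, hin.2.le, q4, q5.imp id ?_⟩
      rintro ⟨_, rfl | rfl⟩ <;> exfalso <;> linarith [hin.1, hin.2]
    . refine ⟨max x' u0, max y' v0, le_max_right _ _, max_le q2 h1, le_max_right _ _,
        max_le q4 h3, .inr ⟨?_, ?_⟩⟩
      . have hm : mb a (f x' y').c.2 := by
          rcases q5 with q | q
          . exact q.2.1
          . exact q.1
        exact (h.mono q1 (le_max_left _ _) (by have := max_le q2 h1; linarith) q3 (le_max_left _ _)
          (by have := max_le q4 h3; linarith)).2 a hm
      . rw [not_and_or, not_lt, not_lt] at hin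
        exact hin.imp max_eq_right max_eq_right
theorem Model.joinX {xm : ℝ} (h1 : Model K f x0 xm y0 y1) (h2 : Model K f xm x1 y0 y1)
    (hx0 : x0 < xm) (hx1 : xm < x1) (hre : ∀ y, y0 < y -> y < y1 -> (f xm y).re = true) :
    Model K f x0 x1 y0 y1 where
  val x y q1 q2 q3 q4 := by
    rcases le_total x xm with h | h
    . exact h1.val x y q1 h q3 q4
    . exact h2.val x y h q2 q3 q4
  re x y q1 q2 q3 q4 := by
    rcases lt_trichotomy x xm with h | rfl | h
    . exact h1.re x y q1 h q3 q4
    . exact hre y q3 q4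
    . exact h2.re x y h q2 q3 q4
  gN x y q1 q2 q3 q4 := by
    rcases le_total x xm with h | h
    . exact h1.gN x y q1 h q3 q4
    . exact h2.gN x y h q2 q3 q4
  gS x y q1 q2 q3 q4 := by
    rcases le_total x xm with h | h
    . exact h1.gS x y q1 h q3 q4
    . exact h2.gS x y h q2 q3 q4
  gE x y q1 q2 q3 q4 := by
    rcases lt_or_ge x xm with h | h
    . exact h1.gE x y q1 h q3 q4
    . exact h2.gE x y h q2 q3 q4
  gW x y q1 q2 q3 q4 := by
    rcases le_or_gt x xm with h | h
    . exact h1.gW x y q1 h q3 q4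
    . exact h2.gW x y h q2 q3 q4
  fF x y q1 q2 q3 q4 a ha := by
    have key : ∀ x y, xm <= x -> x <= x1 -> y0 <= y -> y <= y1 -> mb a (f x y).c.1 ->
      ∃ x' y', x <= x' /\ x' <= x1 /\ y <= y' /\ y' <= y1 /\
      (realF K (f x' y') a \/ (mb a (f x' y').c.1 /\ (x' = x1 \/ y' = y1))) :=
      fun x y q1 q2 q3 q4 ha => h2.fF x y q1 q2 q3 q4 a ha
    rcases le_total x xm with h | h
    . obtain ⟨x', y', p1, p2, p3, p4, p5⟩ := h1.fF x y q1 h q3 q4 a ha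
      rcases p5 with p5 | ⟨p5, p6 | p6⟩
      . exact ⟨x', y', p1, p2.trans hx1.le, p3, p4, .inl p5⟩
      . obtain ⟨x'', y'', r1, r2, r3, r4, r5⟩ := key x' y' p6.ge (p2.trans hx1.le)
          (q3.trans p3) p4 p5
        exact ⟨x'', y'', p1.trans r1, r2, p3.trans r3, r4, r5⟩
      . exact ⟨x', y', p1, p2.trans hx1.le, p3, p4, .inr ⟨p5, .inr p6⟩⟩
    . exact key x y h q2 q3 q4 ha
  fP x y q1 q2 q3 q4 a ha := by
    have key : ∀ x y, x0 <= x -> x <= xm -> y0 <= y -> y <= y1 -> mb a (f x y).c.2 ->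
      ∃ x' y', x0 <= x' /\ x' <= x /\ y0 <= y' /\ y' <= y /\
      (realP K (f x' y') a \/ (mb a (f x' y').c.2 /\ (x' = x0 \/ y' = y0))) :=
      fun x y q1 q2 q3 q4 ha => h1.fP x y q1 q2 q3 q4 a ha
    rcases le_total xm x with h | h
    . obtain ⟨x', y', p1, p2, p3, p4, p5⟩ := h2.fP x y h q2 q3 q4 a ha
      rcases p5 with p5 | ⟨p5, p6 | p6⟩
      . exact ⟨x', y', hx0.le.trans p1, p2, p3, p4, .inl p5⟩
      . obtain ⟨x'', y'', r1, r2, r3, r4, r5⟩ := key x' y' (hx0.le.trans p1) p6.le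
          p3 (p4.trans q4) p5
        exact ⟨x'', y'', r1, r2.trans p2, r3, r4.trans p4, r5⟩
      . exact ⟨x', y', hx0.le.trans p1, p2, p3, p4, .inr ⟨p5, .inr p6⟩⟩
    . exact key x y q1 h q3 q4 ha
theorem Model.joinY {ym : ℝ} (h1 : Model K f x0 x1 y0 ym) (h2 : Model K f x0 x1 ym y1)
    (hy0 : y0 < ym) (hy1 : ym < y1) (hre : ∀ x, x0 < x -> x < x1 -> (f x ym).re = true) :
    Model K f x0 x1 y0 y1 :=
  (Model.joinX h1.tr h2.tr hy0 hy1 hre).tr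

/-- models only depend on the values on the closed rectangle -/
theorem Model.congr {g : ℝ -> ℝ -> PT} (h : Model K f x0 x1 y0 y1)
    (hfg : ∀ x y, x0 <= x -> x <= x1 -> y0 <= y -> y <= y1 -> g x y = f x y) :
    Model K g x0 x1 y0 y1 where
  val x y h1 h2 h3 h4 := by rw [hfg x y h1 h2 h3 h4]; exact h.val x y h1 h2 h3 h4
  re x y h1 h2 h3 h4 := by rw [hfg x y h1.le h2.le h3.le h4.le]; exact h.re x y h1 h2 h3 h4
  gN x y h1 h2 h3 h4 := by
    have : ∀ᶠ y' in 𝓝[>] y, y' ∈ Set.Ioo y y1 := Ioo_mem_nhdsGT h4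
    filter_upwards [h.gN x y h1 h2 h3 h4, this] with y' e1 e2
    rw [hfg x y h1 h2 h3 h4.le, hfg x y' h1 h2 (h3.trans e2.1.le) e2.2.le, e1]
  gS x y h1 h2 h3 h4 := by
    have : ∀ᶠ y' in 𝓝[<] y, y' ∈ Set.Ioo y0 y := Ioo_mem_nhdsLT h3
    filter_upwards [h.gS x y h1 h2 h3 h4, this] with y' e1 e2
    rw [hfg x y h1 h2 h3.le h4, hfg x y' h1 h2 e2.1.le (e2.2.le.trans h4), e1]
  gE x y h1 h2 h3 h4 := by
    have : ∀ᶠ y' in 𝓝[>] x, y' ∈ Set.Ioo x x1 := Ioo_mem_nhdsGT h2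
    filter_upwards [h.gE x y h1 h2 h3 h4, this] with x' e1 e2
    rw [hfg x y h1 h2.le h3 h4, hfg x' y (h1.trans e2.1.le) e2.2.le h3 h4, e1]
  gW x y h1 h2 h3 h4 := by
    have : ∀ᶠ y' in 𝓝[<] x, y' ∈ Set.Ioo x0 x := Ioo_mem_nhdsLT h1
    filter_upwards [h.gW x y h1 h2 h3 h4, this] with x' e1 e2
    rw [hfg x y h1.le h2 h3 h4, hfg x' y e2.1.le (e2.2.le.trans h2) h3 h4, e1]
  fF x y h1 h2 h3 h4 a ha := by
    rw [hfg x y h1 h2 h3 h4] at ha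
    obtain ⟨x', y', q1, q2, q3, q4, q5⟩ := h.fF x y h1 h2 h3 h4 a ha
    exact ⟨x', y', q1, q2, q3, q4, by rwa [hfg x' y' (h1.trans q1) q2 (h3.trans q3) q4]⟩
  fP x y h1 h2 h3 h4 a ha := by
    rw [hfg x y h1 h2 h3 h4] at ha
    obtain ⟨x', y', q1, q2, q3, q4, q5⟩ := h.fP x y h1 h2 h3 h4 a ha
    exact ⟨x', y', q1, q2, q3, q4, by rwa [hfg x' y' q1 (q2.trans h2) q3 (q4.trans h4)]⟩
end

section
/-! ### Traces of piecewise constant functions -/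

section words
variable {α : Type} {g g' : ℝ -> α} {a b m : ℝ}

inductive IsTr (g : ℝ -> α) : ℝ -> ℝ -> List α -> Prop
  | one {a b : ℝ} {s : α} (hab : a < b) (h : ∀ x, a < x -> x < b -> g x = s) : IsTr g a b [s]
  | cons {a m b : ℝ} {s v : α} {w : List α} (ham : a < m) (h : ∀ x, a < x -> x < m -> g x = s)
      (hv : g m = v) (hw : IsTr g m b w) : IsTr g a b (s :: v :: w)

def Red : List α -> Prop
  | s :: v :: s' :: w => ¬ (s = v /\ v = s') /\ Red (s' :: w)
  | _ => True

def cat [DecidableEq α] : List α -> α -> List α -> List α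
  | [], _, w => w
  | [s], v, w => if s = v /\ w.head? = some v then w else s :: v :: w
  | s :: v' :: u, v, w => s :: v' :: cat u v w
theorem IsTr.lt {w : List α} (h : IsTr g a b w) : a < b := by
  induction h with
  | one hab _ => exact hab
  | cons ham _ _ _ ih => exact ham.trans ih
theorem IsTr.ne_nil {w : List α} (h : IsTr g a b w) : w ≠ [] := by
  cases h <;> simp
theorem IsTr.odd {w : List α} (h : IsTr g a b w) : w.length % 2 = 1 := by
  induction h with
  | one hab _ => rfl
  | cons ham _ _ _ ih => simp only [List.length_cons]; omega
theorem IsTr.head {w : List α} (h : IsTr g a b w) :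
    ∃ s, w.head? = some s /\ ∀ᶠ x in 𝓝[>] a, g x = s := by
  cases h with
  | one hab h =>
    refine ⟨_, rfl, ?_⟩
    filter_upwards [Ioo_mem_nhdsGT hab] with x hx using h x hx.1 hx.2
  | cons ham h hv hw =>
    refine ⟨_, rfl, ?_⟩
    filter_upwards [Ioo_mem_nhdsGT ham] with x hx using h x hx.1 hx.2
theorem IsTr.last {w : List α} (h : IsTr g a b w) :
    ∃ s, w.getLast? = some s /\ ∀ᶠ x in 𝓝[<] b, g x = s := by
  induction h with
  | one hab h =>
    refine ⟨_, rfl, ?_⟩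
    filter_upwards [Ioo_mem_nhdsLT hab] with x hx using h x hx.1 hx.2
  | @cons a m b s v w ham h hv hw ih =>
    obtain ⟨s', h1, h2⟩ := ih
    refine ⟨s', ?_, h2⟩
    rw [List.getLast?_cons_cons, List.getLast?_cons_of_ne_nil hw.ne_nil, h1]
theorem IsTr.congr {w : List α} (h : IsTr g a b w) (hg : ∀ x, a < x -> x < b -> g' x = g x) :
    IsTr g' a b w := by
  induction h with
  | one hab h => exact .one hab fun x h1 h2 => by rw [hg x h1 h2, h x h1 h2]
  | cons ham h hv hw ih =>
    refine .cons ham (fun x h1 h2 => ?_) ?_ (ih fun x h1 h2 => hg x (ham.trans h1) h2)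
    . rw [hg x h1 (h2.trans hw.lt), h x h1 h2]
    . rw [hg _ ham hw.lt, hv]
theorem IsTr.mem {w : List α} (h : IsTr g a b w) : ∀ x, a < x -> x < b -> g x ∈ w := by
  induction h with
  | one hab h => intro x h1 h2; rw [h x h1 h2]; simp
  | @cons a m b s v w ham h hv hw ih =>
    intro x h1 h2
    rcases lt_trichotomy x m with h3 | rfl | h3
    . rw [h x h1 h3]; simp
    . rw [hv]; simp
    . have := ih x h3 h2; simp [this]
theorem IsTr.mem_exists {w : List α} (h : IsTr g a b w) :
    ∀ p ∈ w, ∃ x, a < x /\ x < b /\ g x = p := by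
  induction h with
  | @one a b s hab h =>
    intro p hp
    obtain rfl : p = s := by simpa using hp
    exact ⟨(a + b) / 2, °, °, h _ ° °⟩
  | @cons a m b s v w ham h hv hw ih =>
    intro p hp
    have := hw.lt
    rcases List.mem_cons.1 hp with rfl | hp
    . exact ⟨(a + m) / 2, °, °, h _ ° °⟩
    . rcases List.mem_cons.1 hp with rfl | hp
      . exact ⟨m, ham, this, hv⟩
      . obtain ⟨x, h1, h2, h3⟩ := ih p hp
        exact ⟨x, ham.trans h1, h2, h3⟩
theorem IsTr.map {β : Type} (φ : α -> β) {w : List α} (h : IsTr g a b w) :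
    IsTr (fun x => φ (g x)) a b (w.map φ) := by
  induction h with
  | one hab h => exact .one hab fun x h1 h2 => by rw [h x h1 h2]
  | cons ham h hv hw ih =>
    exact .cons ham (fun x h1 h2 => by rw [h x h1 h2]) (by rw [hv]) ih
theorem Red.map {β : Type} {φ : α -> β} (hφ : Function.Injective φ) :
    ∀ {w : List α}, Red w -> Red (w.map φ)
  | [], _ => trivial
  | [_], _ => trivial
  | [_, _], _ => trivial
  | s :: v :: s' :: w, h => by
    refine ⟨fun h' => h.1 ⟨hφ h'.1, hφ h'.2⟩, ?_⟩
    exact Red.map hφ (w := s' :: w) h.2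
theorem IsTr.extend {w : List α} {s : α} (h : IsTr g m b w) (ham : a < m)
    (hs : w.head? = some s) (hc : ∀ x, a < x -> x < m -> g x = s) (hm : g m = s) : IsTr g a b w := by
  have aux : ∀ m', (∀ x, m < x -> x < m' -> g x = s) -> ∀ x, a < x -> x < m' -> g x = s := by
    intro m' hh x h1 h2
    rcases lt_trichotomy x m with h3 | rfl | h3
    . exact hc x h1 h3
    . exact hm
    . exact hh x h3 h2
  cases h with
  | one hab h =>
    obtain rfl := Option.some.inj hs
    exact .one (ham.trans hab) (aux _ h)
  | cons ham' h hv hw =>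
    obtain rfl := Option.some.inj hs
    exact .cons (ham.trans ham') (aux _ h) hv hw
theorem IsTr.cat [DecidableEq α] {u w : List α} {v : α} (hu : IsTr g a m u) (hv : g m = v)
    (hw : IsTr g m b w) : IsTr g a b (cat u v w) := by
  induction hu with
  | @one a m s ham h =>
    unfold Temporal.cat
    split_ifs with hc
    . exact hw.extend ham hc.2 (by rw [<- hc.1]; exact h) hv
    . exact .cons ham h hv hw
  | @cons a m' m s v' u ham h hv' hu' ih =>
    unfold Temporal.cat
    exact .cons ham h hv' (ih hv hw)
theorem cat_head [DecidableEq α] : ∀ {u w : List α} {v : α}, u ≠ [] -> (cat u v w).head? = u.head?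
  | [], _, _, h => absurd rfl h
  | [s], w, v, _ => by
    unfold Temporal.cat
    split_ifs with hc
    . rw [hc.2, hc.1]; rfl
    . rfl
  | s :: v' :: u, w, v, _ => by unfold Temporal.cat; rfl
theorem Red.tail {s v : α} : ∀ {w : List α}, Red (s :: v :: w) -> Red w
  | [], _ => trivial
  | [_], _ => trivial
  | [_, _], _ => trivial
  | _ :: _ :: _ :: _, h => h.2
theorem Red.cons_of {s v : α} : ∀ {w : List α}, (∀ s', w.head? = some s' -> ¬ (s = v /\ v = s')) ->
    Red w -> Red (s :: v :: w)
  | [], _, _ => trivial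
  | s' :: _, h, h' => ⟨h s' rfl, h'⟩
theorem Red.head_ne {s v s' : α} : ∀ {w : List α}, Red (s :: v :: w) -> w.head? = some s' ->
    ¬ (s = v /\ v = s')
  | [], _, h => by simp at h
  | _ :: _, h, h' => by obtain rfl := Option.some.inj h'; exact h.1
theorem Red.cat [DecidableEq α] : ∀ {u w : List α} {v : α}, Red u -> Red w -> u.length % 2 = 1 ->
    Red (cat u v w)
  | [], _, _, _, h, _ => by unfold Temporal.cat; exact h
  | [s], w, v, _, hw, _ => by
    unfold Temporal.cat
    split_ifs with hc
    . exact hw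
    . exact Red.cons_of (fun s' h1 h2 => hc ⟨h2.1, by rw [h1, h2.2]⟩) hw
  | s :: v' :: u, w, v, hu, hw, ho => by
    unfold Temporal.cat
    have h1 : u.length % 2 = 1 := by simp only [List.length_cons] at ho; omega
    have h2 : u ≠ [] := by rintro rfl; simp at h1
    refine Red.cons_of (fun s' hs => ?_) (Red.cat hu.tail hw h1)
    rw [cat_head h2] at hs
    exact hu.head_ne hs
theorem eventually_eq_unique {l : Filter ℝ} [l.NeBot] {s s' : α} (h : ∀ᶠ x in l, g x = s)
    (h' : ∀ᶠ x in l, g x = s') : s = s' := by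
  obtain ⟨x, h1, h2⟩ := (h.and h').exists
  rw [<- h1, h2]
theorem IsTr.unique {u w : List α} (hu : IsTr g a b u) (hw : IsTr g a b w) (ru : Red u)
    (rw' : Red w) : u = w := by
  have key : ∀ {a b m : ℝ} {s v s' : α} {w : List α}, a < m -> (∀ x, a < x -> x < m -> g x = s) ->
      g m = v -> IsTr g m b w -> Red (s :: v :: w) ->
      ∀ m', m < m' -> (∀ x, a < x -> x < m' -> g x = s') -> False := by
    intro a b m s v s' w ham h hv hw hr m' hm' h'
    obtain ⟨s'', h1, h2⟩ := hw.head
    have e1 : s = s' := by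
      rw [<- h ((a + m) / 2) ° °,
        h' ((a + m) / 2) ° °]
    have e2 : v = s' := by rw [<- hv, h' m ham hm']
    have e3 : s'' = s' := eventually_eq_unique h2 (by
      filter_upwards [Ioo_mem_nhdsGT hm'] with x hx using h' x (ham.trans hx.1) hx.2)
    exact hr.head_ne h1 ⟨by rw [e1, e2], by rw [e2, e3]⟩
  induction hu generalizing w with
  | @one a b s hab h =>
    cases hw with
    | @one _ _ s' hab' h' =>
      rw [<- h ((a + b) / 2) ° °,
        h' ((a + b) / 2) ° °]
    | cons ham h' hv hw => exact (key ham h' hv hw rw' b hw.lt h).elim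
  | @cons a m b s v u ham h hv hu' ih =>
    cases hw with
    | @one _ _ s' hab' h' => exact (key ham h hv hu' ru b hu'.lt h').elim
    | @cons _ m' _ s' v' w' ham' h' hv' hw' =>
      rcases lt_trichotomy m m' with hm | rfl | hm
      . exact (key ham h hv hu' ru m' hm h').elim
      . rw [ih hw' ru.tail rw'.tail, <- hv, <- hv',
          <- h ((a + m) / 2) ° °,
          h' ((a + m) / 2) ° °]
      . exact (key ham' h' hv' hw' rw' m hm h).elim
theorem IsTr.split_first {w : List α} {s : α} (h : IsTr g a b w) (hs : w.head? = some s) :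
    ∃ m, a < m /\ m < b /\ (∀ x, a < x -> x <= m -> g x = s) /\ IsTr g m b w := by
  cases h with
  | one hab h =>
    obtain rfl := Option.some.inj hs
    exact ⟨(a + b) / 2, °, °, fun x h1 h2 => h x h1 °,
      .one ° fun x h1 h2 => h x ° h2⟩
  | @cons _ m _ _ _ _ ham h hv hw =>
    obtain rfl := Option.some.inj hs
    have := hw.lt
    exact ⟨(a + m) / 2, °, °, fun x h1 h2 => h x h1 °,
      .cons ° (fun x h1 h2 => h x ° h2) hv hw⟩
theorem IsTr.cat_split [DecidableEq α] : ∀ {u w : List α} {v : α} {a : ℝ}, IsTr g a b (Temporal.cat u v w) ->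
    u.length % 2 = 1 -> w ≠ [] -> ∃ m, a < m /\ m < b /\ IsTr g a m u /\ g m = v /\ IsTr g m b w
  | [], w, v, a, h, ho, hw => by simp at ho
  | [s], w, v, a, h, _, hw => by
    unfold Temporal.cat at h
    split_ifs at h with hc
    . obtain ⟨m, h1, h2, h3, h4⟩ := h.split_first hc.2
      refine ⟨m, h1, h2, .one h1 fun x h5 h6 => ?_, h3 m h1 le_rfl, h4⟩
      rw [hc.1]; exact h3 x h5 h6.le
    . cases h with
      | cons ham h hv hw => exact ⟨_, ham, hw.lt, .one ham h, hv, hw⟩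
  | s :: v' :: u, w, v, a, h, ho, hw => by
    unfold Temporal.cat at h
    have h1 : u.length % 2 = 1 := by simp only [List.length_cons] at ho; omega
    cases h with
    | cons ham h hv h' =>
      obtain ⟨m', q1, q2, q3, q4, q5⟩ := h'.cat_split h1 hw
      exact ⟨m', ham.trans q1, q2, .cons ham h hv q3, q4, q5⟩
theorem IsTr.exists_of_germs (hab : a < b)
    (hr : ∀ x, a <= x -> x < b -> ∃ s, ∀ᶠ y in 𝓝[>] x, g y = s)
    (hl : ∀ x, a < x -> x <= b -> ∃ s, ∀ᶠ y in 𝓝[<] x, g y = s) :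
    ∃ w, IsTr g a b w /\ Red w := by
  classical
  refine bis hab (fun a b => ∃ w, IsTr g a b w /\ Red w) ?_ ?_ ?_
  . rintro x y z - - - - ⟨u, h1, h2⟩ ⟨w, h3, h4⟩
    exact ⟨_, h1.cat rfl h3, h2.cat h4 h1.odd⟩
  . intro x hx hxb
    obtain ⟨s, hs⟩ := hr x hx hxb
    obtain ⟨y, hy, hy2⟩ := (mem_nhdsGT_iff_exists_Ioo_subset).1 hs
    filter_upwards [Ioo_mem_nhdsGT hy] with z hz
    exact ⟨[s], .one hz.1 fun t h1 h2 => hy2 ⟨h1, h2.trans hz.2⟩, trivial⟩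
  . intro x hx hxb
    obtain ⟨s, hs⟩ := hl x hx hxb
    obtain ⟨y, hy, hy2⟩ := (mem_nhdsLT_iff_exists_Ioo_subset).1 hs
    filter_upwards [Ioo_mem_nhdsLT hy] with z hz
    exact ⟨[s], .one hz.2 fun t h1 h2 => hy2 ⟨hz.1.trans h1, h2⟩, trivial⟩
theorem IsTr.length_le {w : List α} (hw : IsTr g a b w) (hr : Red w) (k : α -> ℤ) (hi : ℤ)
    (hmono : ∀ x y, a < x -> x <= y -> y < b -> k (g x) <= k (g y))
    (hhi : ∀ x, a < x -> x < b -> k (g x) <= hi)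
    (hst : ∀ m s s', a < m -> m < b -> (∀ᶠ x in 𝓝[<] m, g x = s) -> (∀ᶠ x in 𝓝[>] m, g x = s') ->
      k s = k (g m) -> k (g m) = k s' -> s = g m /\ g m = s') (lo : ℤ)
    (hlo : ∀ x, a < x -> x < b -> lo <= k (g x)) :
    (w.length : ℤ) <= 2 * (hi - lo) + 1 := by
  induction hw generalizing lo with
  | @one a b s hab h =>
    have h1 := hhi ((a + b) / 2) ° °
    have h2 := hlo ((a + b) / 2) ° °
    simp; omega
  | @cons a m b s v w ham h hv hw ih =>
    have hmb := hw.lt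
    have h1 := ih hr.tail (fun x y p q r => hmono x y (ham.trans p) q r)
      (fun x p q => hhi x (ham.trans p) q)
      (fun m' s s' p q => hst m' s s' (ham.trans p) q) (lo + 1) ?_
    . simp only [List.length_cons]; push_cast; omega
    . obtain ⟨s', hs1, hs2⟩ := hw.head
      intro x hx1 hx2
      by_contra hlt
      push Not at hlt
      set y := (a + m) / 2 with hy
      have hys : g y = s := h y ° °
      have l1 := hlo y ° °
      have l2 := hmono y m ° ° hmb
      have l3 := hmono m x ham hx1.le hx2
      rw [hys] at l1 l2
      obtain ⟨z, hz1, hz2⟩ := (hs2.and (Ioo_mem_nhdsGT hx1)).exists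
      have l4 := hmono m z ham hz2.1.le (hz2.2.trans hx2)
      have l5 := hmono z x (ham.trans hz2.1) hz2.2.le hx2
      rw [hz1] at l4 l5
      obtain ⟨e1, e2⟩ := hst m s s' ham hmb
        (by filter_upwards [Ioo_mem_nhdsLT ham] with t ht using h t ht.1 ht.2) hs2
        (by omega) (by omega)
      exact hr.head_ne hs1 ⟨by rw [e1, hv], by rw [<- hv, e2]⟩
theorem IsTr.single {s : α} (h : IsTr g a b [s]) : ∀ x, a < x -> x < b -> g x = s := by
  cases h with
  | one hab h => exact h

end words
end

section
/-! ### Labels of rectangles and triangles; rules -/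

@[ext] structure Lab where
  sw : PT
  se : PT
  nw : PT
  ne : PT
  l : List PT
  r : List PT
  b : List PT
  t : List PT
deriving DecidableEq

@[ext] structure TLab where
  nw : PT
  l : List PT
  t : List PT
deriving DecidableEq

def Lab.tr (q : Lab) : Lab :=
  ⟨q.sw.tr, q.nw.tr, q.se.tr, q.ne.tr, q.b.map PT.tr, q.t.map PT.tr, q.l.map PT.tr, q.r.map PT.tr⟩

def dPT : PT := ⟨false, (0, 0), (0, 0), (0, 0), (0, 0), (0, 0)⟩
def hd (w : List PT) : PT := w.head?.getD dPT
def lst (w : List PT) : PT := w.reverse.head?.getD dPT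

def allRe (w : List PT) : Prop := ∀ p ∈ w, p.re = true

structure HasLab (f : ℝ -> ℝ -> PT) (x0 x1 y0 y1 : ℝ) (q : Lab) : Prop where
  sw : f x0 y0 = q.sw
  se : f x1 y0 = q.se
  nw : f x0 y1 = q.nw
  ne : f x1 y1 = q.ne
  l : IsTr (fun y => f x0 y) y0 y1 q.l
  r : IsTr (fun y => f x1 y) y0 y1 q.r
  b : IsTr (fun x => f x y0) x0 x1 q.b
  t : IsTr (fun x => f x y1) x0 x1 q.t

/-- constant-interior rectangle -/
structure RBase (K : Sys) (q : Lab) : Prop where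
  l : q.l = [hd q.l]
  r : q.r = [hd q.r]
  b : q.b = [hd q.b]
  t : q.t = [hd q.t]
  vsw : Valid K q.sw
  vse : Valid K q.se
  vnw : Valid K q.nw
  vne : Valid K q.ne
  vl : Valid K (hd q.l)
  vr : Valid K (hd q.r)
  vb : Valid K (hd q.b)
  vt : Valid K (hd q.t)
  vC : Valid K (kap (hd q.l).e)
  ln : (hd q.l).n = (hd q.l).c
  ls : (hd q.l).s = (hd q.l).c
  rn : (hd q.r).n = (hd q.r).c
  rs : (hd q.r).s = (hd q.r).c
  rw' : (hd q.r).w = (hd q.l).e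
  be : (hd q.b).e = (hd q.b).c
  bw : (hd q.b).w = (hd q.b).c
  bn : (hd q.b).n = (hd q.l).e
  te : (hd q.t).e = (hd q.t).c
  tw : (hd q.t).w = (hd q.t).c
  ts : (hd q.t).s = (hd q.l).e
  swn : q.sw.n = (hd q.l).c
  swe : q.sw.e = (hd q.b).c
  sen : q.se.n = (hd q.r).c
  sew : q.se.w = (hd q.b).c
  nws : q.nw.s = (hd q.l).c
  nwe : q.nw.e = (hd q.t).c
  nes : q.ne.s = (hd q.r).c
  new : q.ne.w = (hd q.t).c
  fC : covF K true (hd q.l).e (hd q.t).c (hd q.r).c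
  fl : covF K (hd q.l).re (hd q.l).c (hd q.l).e q.nw.c
  fb : covF K (hd q.b).re (hd q.b).c (hd q.l).e q.se.c
  pC : covP K true (hd q.l).e (hd q.l).c (hd q.b).c
  pr : covP K (hd q.r).re (hd q.r).c (hd q.l).e q.se.c
  pt : covP K (hd q.t).re (hd q.t).c (hd q.l).e q.nw.c

structure RJoin (p q o : Lab) : Prop where
  rl : p.r = q.l
  re : allRe p.r
  se : p.se = q.sw
  ne : p.ne = q.nw
  eq : o = ⟨p.sw, q.se, p.nw, q.ne, p.l, q.r, cat p.b p.se q.b, cat p.t p.ne q.t⟩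

/-- fan converging to the north-west corner -/
structure RLim (K : Sys) (p1 p2 p3 q : Lab) : Prop where
  e1 : p1.l = p3.r
  e2 : p2.t = p3.b
  e3 : p1.b = p3.t
  e4 : p1.sw = p3.nw
  e5 : p1.se = p3.ne
  e6 : p2.r = p3.l
  e7 : p2.se = p3.sw
  e8 : p2.ne = p3.nw
  e9 : p3.se = p3.nw
  t1 : p1.t = [q.ne]
  t2 : p1.nw = q.ne
  t3 : p1.ne = q.ne
  l1 : p2.l = [q.sw]
  l2 : p2.nw = q.sw
  l3 : p2.sw = q.sw
  r1 : p1.r = [p1.se]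
  r2 : p3.r.reverse.head? = some p1.se
  b1 : p2.b = [p2.se]
  b2 : p3.b.head? = some p2.se
  re1 : allRe p1.l
  re2 : allRe p1.b
  re3 : allRe p2.r
  re4 : allRe p2.t
  re5 : p3.nw.re = true
  z0 : Valid K q.nw
  z0s : q.nw.s = q.sw.c
  z0e : q.nw.e = q.ne.c
  cF : covF K q.sw.re q.sw.c q.sw.e q.nw.c
  cP : covP K q.ne.re q.ne.c q.ne.s q.nw.c
  se : q.se = p3.se
  l : q.l = [q.sw]
  r : q.r = p3.r
  b : q.b = p3.b
  t : q.t = [q.ne]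

structure Compat (K : Sys) (Cm Cp : Clu) (q : Lab) : Prop where
  re1 : allRe q.l
  re2 : allRe q.r
  re3 : allRe q.b
  re4 : allRe q.t
  re5 : q.sw.re = true
  re6 : q.se.re = true
  re7 : q.nw.re = true
  re8 : q.ne.re = true
  nwn : q.nw.n = Cp
  nww : q.nw.w = Cm
  ses : q.se.s = Cm
  see : q.se.e = Cp
  sww : q.sw.w = Cm
  sws : q.sw.s = Cm
  nen : q.ne.n = Cp
  nee : q.ne.e = Cp
  l : ∀ v ∈ q.l, v.w = Cm
  b : ∀ v ∈ q.b, v.s = Cm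
  t : ∀ v ∈ q.t, v.n = Cp
  r : ∀ v ∈ q.r, v.e = Cp
  okt : ∀ v ∈ q.ne :: q.t, covF K true v.w v.c Cp
  okr : ∀ v ∈ q.ne :: q.r, covF K true v.s v.c Cp
  okl : ∀ v ∈ q.sw :: q.l, covP K true v.n v.c Cm
  okb : ∀ v ∈ q.sw :: q.b, covP K true v.e v.c Cm

def fillPT (Cm Cp c : Clu) : PT := ⟨true, c, Cp, Cp, Cm, Cm⟩

structure RShuf (K : Sys) (X : List Lab) (q : Lab) : Prop where
  sw : q.sw = kap q.sw.c
  ne : q.ne = kap q.ne.c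
  l : q.l = [q.sw]
  b : q.b = [q.sw]
  r : q.r = [q.ne]
  t : q.t = [q.ne]
  vsw : Valid K q.sw
  vne : Valid K q.ne
  vnw : Valid K q.nw
  vse : Valid K q.se
  nwe : q.nw.e = q.ne.c
  nws : q.nw.s = q.sw.c
  sen : q.se.n = q.ne.c
  sew : q.se.w = q.sw.c
  fill : ∃ c, Valid K (fillPT q.sw.c q.ne.c c)
  cF : ∀ a, mb a q.sw.c.1 -> K.al a q.sw.c \/ mb a q.ne.c.1 \/
    (∃ c, Valid K (fillPT q.sw.c q.ne.c c) /\ mb a c.1) \/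
    (∃ o ∈ X, Compat K q.sw.c q.ne.c o /\ mb a o.sw.c.1)
  cP : ∀ a, mb a q.ne.c.2 -> K.al a q.ne.c \/ mb a q.sw.c.2 \/
    (∃ c, Valid K (fillPT q.sw.c q.ne.c c) /\ mb a c.2) \/
    (∃ o ∈ X, Compat K q.sw.c q.ne.c o /\ mb a o.ne.c.2)

def Rule (K : Sys) (X : List Lab) (q : Lab) : Prop :=
  RBase K q \/ (∃ p ∈ X, ∃ p' ∈ X, RJoin p p' q) \/ (∃ p ∈ X, q = p.tr) \/
    (∃ p1 ∈ X, ∃ p2 ∈ X, ∃ p3 ∈ X, RLim K p1 p2 p3 q) \/ RShuf K X q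
theorem Rule.mono {K : Sys} {X Y : List Lab} (h : ∀ p ∈ X, p ∈ Y) {q : Lab} (hq : Rule K X q) :
    Rule K Y q := by
  rcases hq with hq | ⟨p, hp, p', hp', hq⟩ | ⟨p, hp, hq⟩ | ⟨p1, h1, p2, h2, p3, h3, hq⟩ | hq
  . exact .inl hq
  . exact .inr (.inl ⟨p, h p hp, p', h p' hp', hq⟩)
  . exact .inr (.inr (.inl ⟨p, h p hp, hq⟩))
  . exact .inr (.inr (.inr (.inl ⟨p1, h _ h1, p2, h _ h2, p3, h _ h3, hq⟩)))
  . refine .inr (.inr (.inr (.inr { hq with cF := ?_, cP := ?_ })))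
    . intro a ha
      refine (hq.cF a ha).imp id (Or.imp id (Or.imp id ?_))
      rintro ⟨o, h1, h2⟩
      exact ⟨o, h _ h1, h2⟩
    . intro a ha
      refine (hq.cP a ha).imp id (Or.imp id (Or.imp id ?_))
      rintro ⟨o, h1, h2⟩
      exact ⟨o, h _ h1, h2⟩

structure OddL (q : Lab) : Prop where
  l : q.l.length % 2 = 1
  r : q.r.length % 2 = 1
  b : q.b.length % 2 = 1
  t : q.t.length % 2 = 1

/-! ### Universe of labels and the least fixed point -/

def Lb (n : ℕ) : ℕ := 12 * 2 ^ n + 1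

structure BdP (N : ℕ) (p : PT) : Prop where
  c : Bd N p.c
  n : Bd N p.n
  e : Bd N p.e
  s : Bd N p.s
  w : Bd N p.w

def BdW (n : ℕ) (w : List PT) : Prop := w.length <= Lb n /\ ∀ p ∈ w, BdP n p

structure BdL (n : ℕ) (q : Lab) : Prop where
  sw : BdP n q.sw
  se : BdP n q.se
  nw : BdP n q.nw
  ne : BdP n q.ne
  l : BdW n q.l
  r : BdW n q.r
  b : BdW n q.b
  t : BdW n q.t

structure BdT (n : ℕ) (q : TLab) : Prop where
  nw : BdP n q.nw
  l : BdW n q.l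
  t : BdW n q.t

/-- all lists of length `<= k` with entries from `P` -/
def wordsLE {α : Type} (P : List α) : ℕ -> List (List α)
  | 0 => [[]]
  | k + 1 => wordsLE P k ++ (wordsLE P k).flatMap fun w => P.map fun p => p :: w
theorem mem_wordsLE {α : Type} {P : List α} {k : ℕ} {w : List α} :
    w ∈ wordsLE P k ↔ w.length <= k /\ ∀ p ∈ w, p ∈ P := by
  induction k generalizing w with
  | zero =>
    simp only [wordsLE, List.mem_singleton, Nat.le_zero, List.length_eq_zero_iff]
    constructor
    . rintro rfl; simp
    . exact fun h => h.1
  | succ k ih =>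
    simp only [wordsLE, List.mem_append, List.mem_flatMap, List.mem_map, ih]
    constructor
    . rintro (⟨h1, h2⟩ | ⟨u, ⟨h1, h2⟩, p, hp, rfl⟩)
      . exact ⟨by omega, h2⟩
      . exact ⟨by simpa using h1, by simpa using ⟨hp, h2⟩⟩
    . rintro ⟨h1, h2⟩
      cases w with
      | nil => left; simp
      | cons p u =>
        right
        simp only [List.mem_cons, forall_eq_or_imp, List.length_cons] at h1 h2
        exact ⟨u, ⟨by omega, h2.2⟩, p, h2.1, rfl⟩

def cluList (n : ℕ) : List Clu :=
  (List.range (2 ^ n)).flatMap fun a => (List.range (2 ^ n)).map fun b => (a, b)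
theorem mem_cluList {n : ℕ} {c : Clu} : c ∈ cluList n ↔ Bd n c := by
  obtain ⟨a, b⟩ := c
  simp [cluList, Bd]

/-- least fixed point by iterated filtering of a finite universe -/
def fixStep {α : Type} (U : List α) (R : List α -> α -> Bool) (X : List α) : List α :=
  U.filter (R X)

def fixIter {α : Type} (U : List α) (R : List α -> α -> Bool) : List α :=
  (fixStep U R)^[U.length] []

section fix
variable {α : Type} {U : List α} {R : List α -> α -> Bool}
theorem fixStep_sub
    (hR : ∀ X Y q, (∀ p ∈ X, p ∈ Y) -> R X q = true -> R Y q = true) (k : ℕ) :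
    List.Sublist ((fixStep U R)^[k] []) ((fixStep U R)^[k + 1] []) := by
  induction k with
  | zero => simp
  | succ k ih =>
    rw [Function.iterate_succ_apply', Function.iterate_succ_apply' (n := k + 1)]
    exact List.monotone_filter_right U fun q => hR _ _ _ (fun p hp => ih.subset hp)
theorem fixIter_fixed
    (hR : ∀ X Y q, (∀ p ∈ X, p ∈ Y) -> R X q = true -> R Y q = true) :
    fixStep U R (fixIter U R) = fixIter U R := by
  by_contra hne
  have key : ∀ k ≤ U.length, k + 1 <= ((fixStep U R)^[k + 1] []).length := by
    intro k
    induction k with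
    | zero =>
      intro _
      by_contra h0
      have h1 : (fixStep U R)^[0 + 1] [] = [] := List.eq_nil_of_length_eq_zero (by omega)
      have h2 : ∀ j, (fixStep U R)^[j] [] = [] := by
        intro j
        exact Function.iterate_fixed (by simpa using h1) j
      apply hne
      unfold fixIter
      rw [h2]; simpa using h1
    | succ k ih =>
      intro hk
      have h1 := ih (by omega)
      by_contra h2
      have hs := fixStep_sub (U := U) hR (k + 1)
      have he := hs.eq_of_length_le (by omega)
      have h3 : ∀ j, (fixStep U R)^[j] ((fixStep U R)^[k + 1] []) = (fixStep U R)^[k + 1] [] :=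
        fun j => Function.iterate_fixed (by
          rw [<- Function.iterate_succ_apply' (fixStep U R) (k + 1) []]; exact he.symm) j
      have h4 := h3 (U.length - (k + 1))
      rw [<- Function.iterate_add_apply, Nat.sub_add_cancel hk] at h4
      apply hne
      unfold fixIter
      rw [h4, <- Function.iterate_succ_apply' (fixStep U R) (k + 1) []]; exact he.symm
  have h1 := key U.length le_rfl
  rw [Function.iterate_succ_apply'] at h1
  have h2 : (fixStep U R ((fixStep U R)^[U.length] [])).length <= U.length := List.length_filter_le _ _
  omega
theorem mem_fixIter
    (hR : ∀ X Y q, (∀ p ∈ X, p ∈ Y) -> R X q = true -> R Y q = true) {q : α} :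
    q ∈ fixIter U R ↔ q ∈ U /\ R (fixIter U R) q = true := by
  conv_lhs => rw [<- fixIter_fixed hR]
  simp [fixStep]

end fix
theorem fixIter_induct {α : Type} {U : List α} {R : List α -> α -> Bool} (P : α -> Prop)
    (h : ∀ X q, (∀ p ∈ X, P p) -> R X q = true -> P q) : ∀ q ∈ fixIter U R, P q := by
  have : ∀ k, ∀ q ∈ (fixStep U R)^[k] [], P q := by
    intro k
    induction k with
    | zero => simp
    | succ k ih =>
      rw [Function.iterate_succ_apply']
      intro q hq
      simp only [fixStep, List.mem_filter] at hq
      exact h _ q ih hq.2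
  exact this _

def ptList (n : ℕ) : List PT :=
  [true, false].flatMap fun re => (cluList n).flatMap fun c => (cluList n).flatMap fun n' =>
    (cluList n).flatMap fun e => (cluList n).flatMap fun s => (cluList n).map fun w =>
      ⟨re, c, n', e, s, w⟩
theorem mem_ptList {n : ℕ} {p : PT} : p ∈ ptList n ↔ BdP n p := by
  obtain ⟨re, c, n', e, s, w⟩ := p
  simp only [ptList, List.mem_flatMap, List.mem_map, mem_cluList, PT.mk.injEq]
  constructor
  . rintro ⟨_, _, _, h1, _, h2, _, h3, _, h4, _, h5, rfl, rfl, rfl, rfl, rfl, rfl⟩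
    exact ⟨h1, h2, h3, h4, h5⟩
  . rintro ⟨h1, h2, h3, h4, h5⟩
    exact ⟨re, by cases re <;> simp, c, h1, n', h2, e, h3, s, h4, w, h5, rfl, rfl, rfl, rfl, rfl, rfl⟩

def wList (n : ℕ) : List (List PT) := wordsLE (ptList n) (Lb n)
theorem mem_wList {n : ℕ} {w : List PT} : w ∈ wList n ↔ BdW n w := by
  simp only [wList, mem_wordsLE, BdW, mem_ptList]

def labList (n : ℕ) : List Lab :=
  (ptList n).flatMap fun sw => (ptList n).flatMap fun se => (ptList n).flatMap fun nw =>
  (ptList n).flatMap fun ne => (wList n).flatMap fun l => (wList n).flatMap fun r =>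
  (wList n).flatMap fun b => (wList n).map fun t => ⟨sw, se, nw, ne, l, r, b, t⟩
theorem mem_labList {n : ℕ} {q : Lab} : q ∈ labList n ↔ BdL n q := by
  obtain ⟨sw, se, nw, ne, l, r, b, t⟩ := q
  simp only [labList, List.mem_flatMap, List.mem_map, mem_ptList, mem_wList, Lab.mk.injEq]
  constructor
  . rintro ⟨_, h1, _, h2, _, h3, _, h4, _, h5, _, h6, _, h7, _, h8, rfl, rfl, rfl, rfl, rfl, rfl, rfl,
      rfl⟩
    exact ⟨h1, h2, h3, h4, h5, h6, h7, h8⟩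
  . rintro ⟨h1, h2, h3, h4, h5, h6, h7, h8⟩
    exact ⟨_, h1, _, h2, _, h3, _, h4, _, h5, _, h6, _, h7, _, h8, rfl, rfl, rfl, rfl, rfl, rfl, rfl,
      rfl⟩

def tlabList (n : ℕ) : List TLab :=
  (ptList n).flatMap fun nw => (wList n).flatMap fun l => (wList n).map fun t => ⟨nw, l, t⟩
theorem mem_tlabList {n : ℕ} {q : TLab} : q ∈ tlabList n ↔ BdT n q := by
  obtain ⟨nw, l, t⟩ := q
  simp only [tlabList, List.mem_flatMap, List.mem_map, mem_ptList, mem_wList, TLab.mk.injEq]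
  constructor
  . rintro ⟨_, h1, _, h2, _, h3, rfl, rfl, rfl⟩
    exact ⟨h1, h2, h3⟩
  . rintro ⟨h1, h2, h3⟩
    exact ⟨_, h1, _, h2, _, h3, rfl, rfl, rfl⟩

open Classical in
/-- derivable rectangle labels -/
noncomputable def derList (K : Sys) : List Lab :=
  fixIter (labList K.n) fun X q => decide (Rule K X q /\ OddL q)

def Der (K : Sys) (q : Lab) : Prop := q ∈ derList K
theorem Der_iff {K : Sys} {q : Lab} :
    Der K q ↔ BdL K.n q /\ Rule K (derList K) q /\ OddL q := by
  classical
  unfold Der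
  conv_lhs => unfold derList
  rw [mem_fixIter, mem_labList, decide_eq_true_iff]
  . rfl
  . intro X Y q h
    simp only [decide_eq_true_iff]
    exact fun h' => ⟨h'.1.mono h, h'.2⟩
theorem Der.induct {K : Sys} (P : Lab -> Prop)
    (h : ∀ X q, (∀ p ∈ X, P p) -> Rule K X q -> OddL q -> P q) : ∀ q, Der K q -> P q := by
  classical
  intro q hq
  unfold Der derList at hq
  refine fixIter_induct P ?_ q hq
  intro X q h1 h2
  simp only [decide_eq_true_iff] at h2
  exact h X q h1 h2.1 h2.2

/-! triangles -/

structure TBase (K : Sys) (C : Clu) (q : TLab) : Prop where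
  l : q.l = [hd q.l]
  t : q.t = [hd q.t]
  vnw : Valid K q.nw
  vl : Valid K (hd q.l)
  vt : Valid K (hd q.t)
  vC : Valid K (kap C)
  ln : (hd q.l).n = (hd q.l).c
  ls : (hd q.l).s = (hd q.l).c
  le : (hd q.l).e = C
  te : (hd q.t).e = (hd q.t).c
  tw : (hd q.t).w = (hd q.t).c
  ts : (hd q.t).s = C
  nws : q.nw.s = (hd q.l).c
  nwe : q.nw.e = (hd q.t).c
  fC : covF K true C (hd q.t).c (hd q.t).c
  fl : covF K (hd q.l).re (hd q.l).c C q.nw.c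
  pC : covP K true C (hd q.l).c (hd q.l).c
  pt : covP K (hd q.t).re (hd q.t).c C q.nw.c

structure TJoin (p o : TLab) (r : Lab) (q : TLab) : Prop where
  eb : r.b = p.t
  er : r.r = o.l
  sw : r.sw = p.nw
  ne : r.ne = o.nw
  re1 : allRe r.b
  re2 : allRe r.r
  sre : r.se.re = false
  sA : ∀ a, mb a r.se.c.1 -> mb a r.se.n.1
  sB : ∀ a, mb a r.se.c.2 -> mb a r.se.w.2
  eq : q = ⟨r.nw, cat p.l r.sw r.l, cat r.t r.ne o.t⟩

def TRule (K : Sys) (D : List Lab) (X : List TLab) (q : TLab) : Prop :=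
  TBase K (hd q.l).e q \/ ∃ p ∈ X, ∃ o ∈ X, ∃ r ∈ D, TJoin p o r q

structure OddT (q : TLab) : Prop where
  l : q.l.length % 2 = 1
  t : q.t.length % 2 = 1

open Classical in
noncomputable def tderList (K : Sys) : List TLab :=
  fixIter (tlabList K.n) fun X q => decide (TRule K (derList K) X q /\ OddT q)

def TDer (K : Sys) (q : TLab) : Prop := q ∈ tderList K
theorem TDer_iff {K : Sys} {q : TLab} :
    TDer K q ↔ BdT K.n q /\ TRule K (derList K) (tderList K) q /\ OddT q := by
  classical
  unfold TDer
  conv_lhs => unfold tderList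
  rw [mem_fixIter, mem_tlabList, decide_eq_true_iff]
  . rfl
  . intro X Y q h
    simp only [decide_eq_true_iff]
    refine fun h' => ⟨h'.1.imp id ?_, h'.2⟩
    rintro ⟨p, hp, o, ho, hh⟩
    exact ⟨p, h _ hp, o, h _ ho, hh⟩
theorem TDer.induct {K : Sys} (P : TLab -> Prop)
    (h : ∀ X q, (∀ p ∈ X, P p) -> TRule K (derList K) X q -> OddT q -> P q) : ∀ q, TDer K q -> P q := by
  classical
  intro q hq
  unfold TDer tderList at hq
  refine fixIter_induct P ?_ q hq
  intro X q h1 h2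
  simp only [decide_eq_true_iff] at h2
  exact h X q h1 h2.1 h2.2

/-- final acceptance: a triangle bounded by dummies with the goal predicate visible -/
structure TGoal (G : ℕ -> Prop) (q : TLab) : Prop where
  l : ∀ p ∈ q.nw :: q.l, p.re = false /\ p.c.2 = 0
  t : ∀ p ∈ q.nw :: q.t, p.re = false /\ p.c.1 = 0
  g : ∃ a, mb a (hd q.l).c.1 /\ G a
end

section
/-! ### Soundness of the rules: base, join, transposition -/

structure Snd (K : Sys) (q : Lab) : Prop where
  odd : OddL q
  ex : ∀ (x0 x1 y0 y1 : ℝ) (gL gB : ℝ -> PT), x0 < x1 -> y0 < y1 -> IsTr gL y0 y1 q.l ->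
    IsTr gB x0 x1 q.b -> ∃ f, Model K f x0 x1 y0 y1 /\ HasLab f x0 x1 y0 y1 q /\
      (∀ y, y0 < y -> y < y1 -> f x0 y = gL y) /\ (∀ x, x0 < x -> x < x1 -> f x y0 = gB x)
theorem HasLab.tr {f : ℝ -> ℝ -> PT} {x0 x1 y0 y1 : ℝ} {q : Lab} (h : HasLab f x0 x1 y0 y1 q) :
    HasLab (fT f) y0 y1 x0 x1 q.tr where
  sw := by simp [fT, Lab.tr, h.sw]
  se := by simp [fT, Lab.tr, h.nw]
  nw := by simp [fT, Lab.tr, h.se]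
  ne := by simp [fT, Lab.tr, h.ne]
  l := h.b.map PT.tr
  r := h.t.map PT.tr
  b := h.l.map PT.tr
  t := h.r.map PT.tr
@[simp] theorem Lab.tr_tr (q : Lab) : q.tr.tr = q := by
  have : ∀ l : List PT, (l.map PT.tr).map PT.tr = l := by
    intro l
    rw [List.map_map]
    exact List.map_id l
  obtain ⟨sw, se, nw, ne, l, r, b, t⟩ := q
  simp only [Lab.tr, this, PT.tr_tr]
theorem Snd.tr {K : Sys} {q : Lab} (h : Snd K q) : Snd K q.tr := by
  refine ⟨⟨?_, ?_, ?_, ?_⟩, ?_⟩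
  . simpa [Lab.tr] using h.odd.b
  . simpa [Lab.tr] using h.odd.t
  . simpa [Lab.tr] using h.odd.l
  . simpa [Lab.tr] using h.odd.r
  . intro x0 x1 y0 y1 gL gB hx hy hl hb
    have hl' := hl.map PT.tr
    have hb' := hb.map PT.tr
    have e1 : q.tr.l.map PT.tr = q.b := congrArg Lab.b q.tr_tr
    have e2 : q.tr.b.map PT.tr = q.l := congrArg Lab.l q.tr_tr
    rw [e1] at hl'
    rw [e2] at hb'
    obtain ⟨f, h1, h2, h3, h4⟩ := h.ex y0 y1 x0 x1 _ _ hy hx hb' hl'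
    refine ⟨fT f, h1.tr, h2.tr, fun y p1 p2 => ?_, fun x p1 p2 => ?_⟩
    . simp only [fT, h4 y p1 p2, PT.tr_tr]
    . simp only [fT, h3 x p1 p2, PT.tr_tr]
theorem IsTr.congr' {g g' : ℝ -> PT} {a b : ℝ} {w : List PT} (h : IsTr g a b w)
    (hg : ∀ x, a < x -> x < b -> g x = g' x) : IsTr g' a b w :=
  h.congr fun x h1 h2 => (hg x h1 h2).symm
theorem Snd.join {K : Sys} {p q o : Lab} (hp : Snd K p) (hq : Snd K q) (h : RJoin p q o)
    (ho : OddL o) : Snd K o := by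
  refine ⟨ho, ?_⟩
  obtain ⟨rl, hre, hse, hne, rfl⟩ := h
  intro x0 x1 y0 y1 gL gB hx hy hl hb
  simp only at hl hb
  obtain ⟨m, hm0, hm1, hb1, hbm, hb2⟩ := hb.cat_split hp.odd.b (by
    intro h; have := hq.odd.b; simp [h] at this)
  obtain ⟨f1, A1, A2, A3, A4⟩ := hp.ex x0 m y0 y1 gL gB hm0 hy hl hb1
  have hr1 := A2.r
  rw [rl] at hr1
  obtain ⟨f2, B1, B2, B3, B4⟩ := hq.ex m x1 y0 y1 (fun y => f1 m y) gB hm1 hy hr1 hb2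
  have hB3 : ∀ y, y0 <= y -> y <= y1 -> f2 m y = f1 m y := by
    intro y h1 h2
    rcases h1.eq_or_lt with rfl | h1
    . rw [B2.sw, A2.se, hse]
    rcases h2.eq_or_lt with rfl | h2
    . rw [B2.nw, A2.ne, hne]
    exact B3 y h1 h2
  set f : ℝ -> ℝ -> PT := fun x y => if x <= m then f1 x y else f2 x y with hf
  have F1 : ∀ x y, x <= m -> f x y = f1 x y := fun x y h => by simp [hf, h]
  have F2 : ∀ x y, m <= x -> y0 <= y -> y <= y1 -> f x y = f2 x y := by
    intro x y h h1 h2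
    rcases h.eq_or_lt with rfl | h
    . rw [F1 _ _ le_rfl, hB3 y h1 h2]
    . simp [hf, not_le.2 h]
  refine ⟨f, Model.joinX (A1.congr fun x y _ h _ _ => F1 x y h)
    (B1.congr fun x y h _ h1 h2 => F2 x y h h1 h2) hm0 hm1 ?_, ⟨?_, ?_, ?_, ?_, ?_, ?_, ?_, ?_⟩, ?_, ?_⟩
  . intro y h1 h2
    rw [F1 _ _ le_rfl]
    exact hre _ (A2.r.mem y h1 h2)
  . rw [F1 _ _ hm0.le, A2.sw]
  . rw [F2 _ _ hm1.le le_rfl hy.le, B2.se]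
  . rw [F1 _ _ hm0.le, A2.nw]
  . rw [F2 _ _ hm1.le hy.le le_rfl, B2.ne]
  . exact A2.l.congr fun y _ _ => F1 _ _ hm0.le
  . exact B2.r.congr fun y h1 h2 => F2 _ _ hm1.le h1.le h2.le
  . refine IsTr.cat (m := m) (A2.b.congr fun x _ h => F1 _ _ h.le) ?_
      (B2.b.congr fun x h _ => F2 _ _ h.le le_rfl hy.le)
    simp only [F1 _ _ le_rfl, A2.se]
  . refine IsTr.cat (m := m) (A2.t.congr fun x _ h => F1 _ _ h.le) ?_
      (B2.t.congr fun x h _ => F2 _ _ h.le hy.le le_rfl)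
    simp only [F1 _ _ le_rfl, A2.ne]
  . intro y h1 h2
    rw [F1 _ _ hm0.le, A3 y h1 h2]
  . intro x h1 h2
    rcases lt_trichotomy x m with h | rfl | h
    . rw [F1 _ _ h.le, A4 x h1 h]
    . rw [F1 _ _ le_rfl, A2.se, hbm]
    . rw [F2 _ _ h.le le_rfl hy.le, B4 x h h2]

/-- at a valid point either a colour is realised or it is seen in the north or east germ -/
theorem Valid.stepF {K : Sys} {p : PT} (h : Valid K p) {a : ℕ} (ha : mb a p.c.1) :
    realF K p a \/ mb a p.n.1 \/ mb a p.e.1 := by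
  by_cases h1 : mb a p.n.1
  . exact .inr (.inl h1)
  by_cases h2 : mb a p.e.1
  . exact .inr (.inr h2)
  rcases hr : p.re with _ | _
  . exact .inr ((h.du hr).1 a ha)
  . exact .inl ⟨hr, ha, .inl ⟨h1, h2⟩⟩
theorem Valid.stepP {K : Sys} {p : PT} (h : Valid K p) {a : ℕ} (ha : mb a p.c.2) :
    realP K p a \/ mb a p.s.2 \/ mb a p.w.2 := by
  by_cases h1 : mb a p.s.2
  . exact .inr (.inl h1)
  by_cases h2 : mb a p.w.2
  . exact .inr (.inr h2)
  rcases hr : p.re with _ | _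
  . exact .inr ((h.du hr).2 a ha)
  . exact .inl ⟨hr, ha, .inl ⟨h1, h2⟩⟩
theorem tri_cases {a b x : ℝ} (h1 : a <= x) (h2 : x <= b) : x = a \/ x = b \/ (a < x /\ x < b) := by
  rcases h1.eq_or_lt with h | h
  . exact .inl h.symm
  rcases h2.eq_or_lt with h' | h'
  . exact .inr (.inl h')
  . exact .inr (.inr ⟨h, h'⟩)
theorem Snd.base {K : Sys} {q : Lab} (h : RBase K q) (ho : OddL q) : Snd K q := by
  refine ⟨ho, ?_⟩
  intro x0 x1 y0 y1 gL gB hx hy hl hb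
  rw [h.l] at hl
  rw [h.b] at hb
  obtain ⟨f, hf⟩ : ∃ f : ℝ -> ℝ -> PT, f = fun x y =>
    if x = x0 then (if y = y0 then q.sw else if y = y1 then q.nw else hd q.l)
    else if x = x1 then (if y = y0 then q.se else if y = y1 then q.ne else hd q.r)
    else if y = y0 then hd q.b else if y = y1 then hd q.t else kap (hd q.l).e := ⟨_, rfl⟩
  have fsw : f x0 y0 = q.sw := by simp [hf]
  have fse : f x1 y0 = q.se := by simp [hf, hx.ne']
  have fnw : f x0 y1 = q.nw := by simp [hf, hy.ne']
  have fne : f x1 y1 = q.ne := by simp [hf, hx.ne', hy.ne']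
  have fl : ∀ y, y0 < y -> y < y1 -> f x0 y = hd q.l := fun y h1 h2 => by
    simp [hf, h1.ne', h2.ne]
  have fr : ∀ y, y0 < y -> y < y1 -> f x1 y = hd q.r := fun y h1 h2 => by
    simp [hf, h1.ne', h2.ne, hx.ne']
  have fb : ∀ x, x0 < x -> x < x1 -> f x y0 = hd q.b := fun y h1 h2 => by
    simp [hf, h1.ne', h2.ne]
  have ft : ∀ x, x0 < x -> x < x1 -> f x y1 = hd q.t := fun y h1 h2 => by
    simp [hf, h1.ne', h2.ne, hy.ne']
  have fi : ∀ x y, x0 < x -> x < x1 -> y0 < y -> y < y1 -> f x y = kap (hd q.l).e :=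
    fun x y h1 h2 h3 h4 => by simp [hf, h1.ne', h2.ne, h3.ne', h4.ne]
  -- future fulfilment
  have FC : ∀ x y a, x0 < x -> x < x1 -> y0 < y -> y < y1 -> mb a (hd q.l).e.1 ->
      ∃ x' y', x <= x' /\ x' <= x1 /\ y <= y' /\ y' <= y1 /\
      (realF K (f x' y') a \/ (mb a (f x' y').c.1 /\ (x' = x1 \/ y' = y1))) := by
    intro x y a h1 h2 h3 h4 ha
    rcases h.fC a ha with e | e | e
    . exact ⟨x, y, le_rfl, h2.le, le_rfl, h4.le, .inl (by
        rw [fi x y h1 h2 h3 h4]; exact ⟨rfl, ha, .inr ⟨.inl rfl, e.2⟩⟩)⟩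
    . exact ⟨x, y1, le_rfl, h2.le, h4.le, le_rfl, .inr (by rw [ft x h1 h2]; exact ⟨e, .inr rfl⟩)⟩
    . exact ⟨x1, y, h2.le, le_rfl, le_rfl, h4.le, .inr (by rw [fr y h3 h4]; exact ⟨e, .inl rfl⟩)⟩
  have FL : ∀ y a, y0 < y -> y < y1 -> mb a (hd q.l).c.1 ->
      ∃ x' y', x0 <= x' /\ x' <= x1 /\ y <= y' /\ y' <= y1 /\
      (realF K (f x' y') a \/ (mb a (f x' y').c.1 /\ (x' = x1 \/ y' = y1))) := by
    intro y a h3 h4 ha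
    rcases h.fl a ha with e | e | e
    . exact ⟨x0, y, le_rfl, hx.le, le_rfl, h4.le, .inl (by
        rw [fl y h3 h4]; exact ⟨e.1, ha, .inr ⟨.inl h.ln, e.2⟩⟩)⟩
    . obtain ⟨x', y', p1, p2⟩ := FC ((x0 + x1) / 2) y a ° ° h3 h4 e
      exact ⟨x', y', °, p2⟩
    . exact ⟨x0, y1, le_rfl, hx.le, h4.le, le_rfl, .inr (by rw [fnw]; exact ⟨e, .inr rfl⟩)⟩
  have FB : ∀ x a, x0 < x -> x < x1 -> mb a (hd q.b).c.1 ->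
      ∃ x' y', x <= x' /\ x' <= x1 /\ y0 <= y' /\ y' <= y1 /\
      (realF K (f x' y') a \/ (mb a (f x' y').c.1 /\ (x' = x1 \/ y' = y1))) := by
    intro x a h3 h4 ha
    rcases h.fb a ha with e | e | e
    . exact ⟨x, y0, le_rfl, h4.le, le_rfl, hy.le, .inl (by
        rw [fb x h3 h4]; exact ⟨e.1, ha, .inr ⟨.inr h.be, e.2⟩⟩)⟩
    . obtain ⟨x', y', p1, p2, p3, p4⟩ := FC x ((y0 + y1) / 2) a h3 h4 ° ° e
      exact ⟨x', y', p1, p2, °, p4⟩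
    . exact ⟨x1, y0, h4.le, le_rfl, le_rfl, hy.le, .inr (by rw [fse]; exact ⟨e, .inl rfl⟩)⟩
  -- past fulfilment
  have PC : ∀ x y a, x0 < x -> x < x1 -> y0 < y -> y < y1 -> mb a (hd q.l).e.2 ->
      ∃ x' y', x0 <= x' /\ x' <= x /\ y0 <= y' /\ y' <= y /\
      (realP K (f x' y') a \/ (mb a (f x' y').c.2 /\ (x' = x0 \/ y' = y0))) := by
    intro x y a h1 h2 h3 h4 ha
    rcases h.pC a ha with e | e | e
    . exact ⟨x, y, h1.le, le_rfl, h3.le, le_rfl, .inl (by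
        rw [fi x y h1 h2 h3 h4]; exact ⟨rfl, ha, .inr ⟨.inl rfl, e.2⟩⟩)⟩
    . exact ⟨x0, y, le_rfl, h1.le, h3.le, le_rfl, .inr (by rw [fl y h3 h4]; exact ⟨e, .inl rfl⟩)⟩
    . exact ⟨x, y0, h1.le, le_rfl, le_rfl, h3.le, .inr (by rw [fb x h1 h2]; exact ⟨e, .inr rfl⟩)⟩
  have PR : ∀ y a, y0 < y -> y < y1 -> mb a (hd q.r).c.2 ->
      ∃ x' y', x0 <= x' /\ x' <= x1 /\ y0 <= y' /\ y' <= y /\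
      (realP K (f x' y') a \/ (mb a (f x' y').c.2 /\ (x' = x0 \/ y' = y0))) := by
    intro y a h3 h4 ha
    rcases h.pr a ha with e | e | e
    . exact ⟨x1, y, hx.le, le_rfl, h3.le, le_rfl, .inl (by
        rw [fr y h3 h4]; exact ⟨e.1, ha, .inr ⟨.inl h.rs, e.2⟩⟩)⟩
    . obtain ⟨x', y', p1, p2, p3⟩ := PC ((x0 + x1) / 2) y a ° ° h3 h4 e
      exact ⟨x', y', p1, °, p3⟩
    . exact ⟨x1, y0, hx.le, le_rfl, le_rfl, h3.le, .inr (by rw [fse]; exact ⟨e, .inr rfl⟩)⟩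
  have PT' : ∀ x a, x0 < x -> x < x1 -> mb a (hd q.t).c.2 ->
      ∃ x' y', x0 <= x' /\ x' <= x /\ y0 <= y' /\ y' <= y1 /\
      (realP K (f x' y') a \/ (mb a (f x' y').c.2 /\ (x' = x0 \/ y' = y0))) := by
    intro x a h3 h4 ha
    rcases h.pt a ha with e | e | e
    . exact ⟨x, y1, h3.le, le_rfl, hy.le, le_rfl, .inl (by
        rw [ft x h3 h4]; exact ⟨e.1, ha, .inr ⟨.inr h.tw, e.2⟩⟩)⟩
    . obtain ⟨x', y', p1, p2, p3, p4, p5⟩ :=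
        PC x ((y0 + y1) / 2) a h3 h4 ° ° e
      exact ⟨x', y', p1, p2, p3, °, p5⟩
    . exact ⟨x0, y1, le_rfl, h3.le, hy.le, le_rfl, .inr (by rw [fnw]; exact ⟨e, .inl rfl⟩)⟩
  have hmx : x0 < (x0 + x1) / 2 /\ (x0 + x1) / 2 < x1 := ⟨°, °⟩
  have hmy : y0 < (y0 + y1) / 2 /\ (y0 + y1) / 2 < y1 := ⟨°, °⟩
  refine ⟨f, ?_, ?_, fun y h1 h2 => by rw [fl y h1 h2, hl.single y h1 h2],
    fun x h1 h2 => by rw [fb x h1 h2, hb.single x h1 h2]⟩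
  . constructor
    . intro x y h1 h2 h3 h4
      rcases tri_cases h1 h2 with rfl | rfl | hx' <;> rcases tri_cases h3 h4 with rfl | rfl | hy'
      . rw [fsw]; exact h.vsw
      . rw [fnw]; exact h.vnw
      . rw [fl _ hy'.1 hy'.2]; exact h.vl
      . rw [fse]; exact h.vse
      . rw [fne]; exact h.vne
      . rw [fr _ hy'.1 hy'.2]; exact h.vr
      . rw [fb _ hx'.1 hx'.2]; exact h.vb
      . rw [ft _ hx'.1 hx'.2]; exact h.vt
      . rw [fi _ _ hx'.1 hx'.2 hy'.1 hy'.2]; exact h.vC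
    . intro x y h1 h2 h3 h4
      rw [fi x y h1 h2 h3 h4]; rfl
    . intro x y h1 h2 h3 h4
      filter_upwards [Ioo_mem_nhdsGT h4] with y' hy'
      have hy0' : y0 < y' := h3.trans_lt hy'.1
      rcases h3.eq_or_lt with rfl | h3 <;> rcases tri_cases h1 h2 with rfl | rfl | hx'
      . rw [fsw, fl y' hy0' hy'.2, h.swn]
      . rw [fse, fr y' hy0' hy'.2, h.sen]
      . rw [fb x hx'.1 hx'.2, fi x y' hx'.1 hx'.2 hy0' hy'.2, h.bn]; rfl
      . rw [fl y h3 h4, fl y' hy0' hy'.2, h.ln]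
      . rw [fr y h3 h4, fr y' hy0' hy'.2, h.rn]
      . rw [fi x y hx'.1 hx'.2 h3 h4, fi x y' hx'.1 hx'.2 hy0' hy'.2]; rfl
    . intro x y h1 h2 h3 h4
      filter_upwards [Ioo_mem_nhdsLT h3] with y' hy'
      have hy0' : y' < y1 := hy'.2.trans_le h4
      rcases h4.eq_or_lt with rfl | h4 <;> rcases tri_cases h1 h2 with rfl | rfl | hx'
      . rw [fnw, fl y' hy'.1 hy0', h.nws]
      . rw [fne, fr y' hy'.1 hy0', h.nes]
      . rw [ft x hx'.1 hx'.2, fi x y' hx'.1 hx'.2 hy'.1 hy0', h.ts]; rfl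
      . rw [fl y h3 h4, fl y' hy'.1 hy0', h.ls]
      . rw [fr y h3 h4, fr y' hy'.1 hy0', h.rs]
      . rw [fi x y hx'.1 hx'.2 h3 h4, fi x y' hx'.1 hx'.2 hy'.1 hy0']; rfl
    . intro x y h1 h2 h3 h4
      filter_upwards [Ioo_mem_nhdsGT h2] with x' hx'
      have hx0' : x0 < x' := h1.trans_lt hx'.1
      rcases h1.eq_or_lt with rfl | h1 <;> rcases tri_cases h3 h4 with rfl | rfl | hy'
      . rw [fsw, fb x' hx0' hx'.2, h.swe]
      . rw [fnw, ft x' hx0' hx'.2, h.nwe]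
      . rw [fl y hy'.1 hy'.2, fi x' y hx0' hx'.2 hy'.1 hy'.2]; rfl
      . rw [fb x h1 h2, fb x' hx0' hx'.2, h.be]
      . rw [ft x h1 h2, ft x' hx0' hx'.2, h.te]
      . rw [fi x y h1 h2 hy'.1 hy'.2, fi x' y hx0' hx'.2 hy'.1 hy'.2]; rfl
    . intro x y h1 h2 h3 h4
      filter_upwards [Ioo_mem_nhdsLT h1] with x' hx'
      have hx0' : x' < x1 := hx'.2.trans_le h2
      rcases h2.eq_or_lt with rfl | h2 <;> rcases tri_cases h3 h4 with rfl | rfl | hy'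
      . rw [fse, fb x' hx'.1 hx0', h.sew]
      . rw [fne, ft x' hx'.1 hx0', h.new]
      . rw [fr y hy'.1 hy'.2, fi x' y hx'.1 hx0' hy'.1 hy'.2, h.rw']; rfl
      . rw [fb x h1 h2, fb x' hx'.1 hx0', h.bw]
      . rw [ft x h1 h2, ft x' hx'.1 hx0', h.tw]
      . rw [fi x y h1 h2 hy'.1 hy'.2, fi x' y hx'.1 hx0' hy'.1 hy'.2]; rfl
    . intro x y h1 h2 h3 h4 a ha
      by_cases e1 : x = x1
      . exact ⟨x, y, le_rfl, h2, le_rfl, h4, .inr ⟨ha, .inl e1⟩⟩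
      by_cases e2 : y = y1
      . exact ⟨x, y, le_rfl, h2, le_rfl, h4, .inr ⟨ha, .inr e2⟩⟩
      replace h2 := lt_of_le_of_ne h2 e1
      replace h4 := lt_of_le_of_ne h4 e2
      rcases h1.eq_or_lt with rfl | h1 <;> rcases h3.eq_or_lt with rfl | h3
      . rw [fsw] at ha
        rcases h.vsw.stepF ha with e | e | e
        . exact ⟨x0, y0, le_rfl, hx.le, le_rfl, hy.le, .inl (by rwa [fsw])⟩
        . rw [h.swn] at e
          obtain ⟨x', y', p1, p2, p3, p4⟩ := FL _ a hmy.1 hmy.2 e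
          exact ⟨x', y', p1, p2, hmy.1.le.trans p3, p4⟩
        . rw [h.swe] at e
          obtain ⟨x', y', p1, p2⟩ := FB _ a hmx.1 hmx.2 e
          exact ⟨x', y', hmx.1.le.trans p1, p2⟩
      . rw [fl y h3 h4] at ha
        exact FL y a h3 h4 ha
      . rw [fb x h1 h2] at ha
        exact FB x a h1 h2 ha
      . rw [fi x y h1 h2 h3 h4] at ha
        exact FC x y a h1 h2 h3 h4 ha
    . intro x y h1 h2 h3 h4 a ha
      by_cases e1 : x = x0
      . exact ⟨x, y, h1, le_rfl, h3, le_rfl, .inr ⟨ha, .inl e1⟩⟩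
      by_cases e2 : y = y0
      . exact ⟨x, y, h1, le_rfl, h3, le_rfl, .inr ⟨ha, .inr e2⟩⟩
      replace h1 := lt_of_le_of_ne h1 (Ne.symm e1)
      replace h3 := lt_of_le_of_ne h3 (Ne.symm e2)
      rcases h2.eq_or_lt with rfl | h2 <;> rcases h4.eq_or_lt with rfl | h4
      . rw [fne] at ha
        rcases h.vne.stepP ha with e | e | e
        . exact ⟨x, y, hx.le, le_rfl, hy.le, le_rfl, .inl (by rwa [fne])⟩
        . rw [h.nes] at e
          obtain ⟨x', y', p1, p2, p3, p4, p5⟩ := PR _ a hmy.1 hmy.2 e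
          exact ⟨x', y', p1, p2, p3, p4.trans hmy.2.le, p5⟩
        . rw [h.new] at e
          obtain ⟨x', y', p1, p2, p3⟩ := PT' _ a hmx.1 hmx.2 e
          exact ⟨x', y', p1, p2.trans hmx.2.le, p3⟩
      . rw [fr y h3 h4] at ha
        exact PR y a h3 h4 ha
      . rw [ft x h1 h2] at ha
        exact PT' x a h1 h2 ha
      . rw [fi x y h1 h2 h3 h4] at ha
        exact PC x y a h1 h2 h3 h4 ha
  . refine ⟨fsw, fse, fnw, fne, ?_, ?_, ?_, ?_⟩
    . rw [h.l]; exact .one hy fl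
    . rw [h.r]; exact .one hy fr
    . rw [h.b]; exact .one hx fb
    . rw [h.t]; exact .one hx ft
end

section
/-! ### Soundness of the limit rule -/

structure Fan (K : Sys) (F : ℝ -> ℝ -> PT) (x0 x1 y0 y1 : ℝ) (B D : ℕ -> ℝ) : Prop where
  B0 : B 0 = x1
  D0 : D 0 = y0
  Banti : StrictAnti B
  Dmono : StrictMono D
  Bgt : ∀ n, x0 < B n
  Dlt : ∀ n, D n < y1
  Blim : ∀ x, x0 < x -> ∃ n, B n < x
  Dlim : ∀ y, y < y1 -> ∃ n, y < D n
  P1 : ∀ n, Model K F (B (n + 1)) (B n) (D (n + 1)) y1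
  P2 : ∀ n, Model K F x0 (B (n + 1)) (D n) (D (n + 1))
  P3 : ∀ n, Model K F (B (n + 1)) (B n) (D n) (D (n + 1))
  re : ∀ x y, x0 < x -> x < x1 -> y0 < y -> y < y1 -> (F x y).re = true
theorem Fan.dual {K F x0 x1 y0 y1 B D} (h : Fan K F x0 x1 y0 y1 B D) :
    Fan K.dual (fD F) (-y1) (-y0) (-x1) (-x0) (fun n => - D n) (fun n => - B n) where
  B0 := by simp [h.D0]
  D0 := by simp [h.B0]
  Banti := fun a b hab => neg_lt_neg (h.Dmono hab)
  Dmono := fun a b hab => neg_lt_neg (h.Banti hab)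
  Bgt n := neg_lt_neg (h.Dlt n)
  Dlt n := neg_lt_neg (h.Bgt n)
  Blim x hx := by
    obtain ⟨n, hn⟩ := h.Dlim (-x) °
    exact ⟨n, °⟩
  Dlim x hx := by
    obtain ⟨n, hn⟩ := h.Blim (-x) °
    exact ⟨n, °⟩
  P1 n := (h.P2 n).dual
  P2 n := (h.P1 n).dual
  P3 n := (h.P3 n).dual
  re x y h1 h2 h3 h4 := h.re (-y) (-x) ° ° ° °
theorem Fan.W {K F x0 x1 y0 y1 B D} (h : Fan K F x0 x1 y0 y1 B D) (k : ℕ) :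
    ∀ n, Model K F (B (n + k + 1)) (B n) (D n) y1 := by
  have hB : ∀ n, B n <= x1 := fun n => h.B0 ▸ h.Banti.antitone (Nat.zero_le n)
  have hD : ∀ n, y0 <= D n := fun n => h.D0 ▸ h.Dmono.monotone (Nat.zero_le n)
  have hD1 : ∀ n, y0 < D (n + 1) := fun n => (hD n).trans_lt (h.Dmono (Nat.lt_succ_self n))
  have hB1 : ∀ n, B (n + 1) < x1 := fun n => (h.Banti (Nat.lt_succ_self n)).trans_le (hB n)
  have base : ∀ n, Model K F (B (n + 1)) (B n) (D n) y1 := fun n =>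
    (h.P3 n).joinY (h.P1 n) (h.Dmono (Nat.lt_succ_self n)) (h.Dlt _) fun x q1 q2 =>
      h.re x _ ((h.Bgt _).trans q1) (q2.trans_le (hB _)) (hD1 n) (h.Dlt _)
  induction k with
  | zero => exact base
  | succ k ih =>
    intro n
    have e : n + 1 + k + 1 = n + (k + 1) + 1 := by omega
    have i1 := ih (n + 1)
    rw [e] at i1
    have lt1 : B (n + (k + 1) + 1) < B (n + 1) := h.Banti (by omega)
    have left : Model K F (B (n + (k + 1) + 1)) (B (n + 1)) (D n) y1 :=
      ((h.P2 n).restr (h.Bgt _).le le_rfl le_rfl le_rfl).joinY i1 (h.Dmono (Nat.lt_succ_self n))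
        (h.Dlt _) fun x q1 q2 =>
          h.re x _ ((h.Bgt _).trans q1) (q2.trans_le (hB _)) (hD1 n) (h.Dlt _)
    exact left.joinX (base n) lt1 (h.Banti (Nat.lt_succ_self n)) fun y q1 q2 =>
      h.re _ y (h.Bgt _) (hB1 _) ((hD n).trans_lt q1) q2
theorem Fan.W' {K F x0 x1 y0 y1 B D} (h : Fan K F x0 x1 y0 y1 B D) {x : ℝ} (hx : x0 < x) :
    ∃ x', x0 < x' /\ x' < x /\ Model K F x' x1 y0 y1 := by
  obtain ⟨n, hn⟩ := h.Blim x hx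
  have := h.W n 0
  rw [h.B0, h.D0] at this
  exact ⟨_, h.Bgt _, (h.Banti (by omega : n < 0 + n + 1)).trans hn, this⟩
theorem Fan.H' {K F x0 x1 y0 y1 B D} (h : Fan K F x0 x1 y0 y1 B D) {y : ℝ} (hy : y < y1) :
    ∃ y', y < y' /\ y' < y1 /\ Model K F x0 x1 y0 y' := by
  obtain ⟨x', h1, h2, h3⟩ := h.dual.W' (x := -y) °
  have h4 := h3.dual
  simp only [Sys.dual_dual, fD_fD, neg_neg] at h4
  exact ⟨-x', °, °, h4⟩

structure FanEnd (K : Sys) (F : ℝ -> ℝ -> PT) (x0 x1 y0 y1 : ℝ) (sL sT : PT) : Prop where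
  lt : x0 < x1
  lty : y0 < y1
  left : ∀ y, y0 <= y -> y < y1 -> F x0 y = sL
  top : ∀ x, x0 < x -> x <= x1 -> F x y1 = sT
  val : Valid K (F x0 y1)
  zs : (F x0 y1).s = sL.c
  ze : (F x0 y1).e = sT.c
  cF : covF K sL.re sL.c sL.e (F x0 y1).c
  cP : covP K sT.re sT.c sT.s (F x0 y1).c
theorem FanEnd.dual {K F x0 x1 y0 y1 sL sT} (h : FanEnd K F x0 x1 y0 y1 sL sT) :
    FanEnd K.dual (fD F) (-y1) (-y0) (-x1) (-x0) sT.du sL.du where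
  lt := neg_lt_neg h.lty
  lty := neg_lt_neg h.lt
  left y q1 q2 := by simp only [fD, neg_neg, h.top (-y) ° °]
  top y q1 q2 := by simp only [fD, neg_neg, h.left (-y) ° °]
  val := by simp only [fD, neg_neg]; exact h.val.dual
  zs := by simp only [fD, neg_neg, PT.du_s, PT.du_c, h.ze]
  ze := by simp only [fD, neg_neg, PT.du_e, PT.du_c, h.zs]
  cF := by simp only [fD, neg_neg]; exact h.cP
  cP := by simp only [fD, neg_neg]; exact h.cF
theorem Fan.fF {K F x0 x1 y0 y1 B D sL sT} (h : Fan K F x0 x1 y0 y1 B D)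
    (he : FanEnd K F x0 x1 y0 y1 sL sT) :
    ∀ x y, x0 <= x -> x <= x1 -> y0 <= y -> y <= y1 -> ∀ a, mb a (F x y).c.1 ->
    ∃ x' y', x <= x' /\ x' <= x1 /\ y <= y' /\ y' <= y1 /\
      (realF K (F x' y') a \/ (mb a (F x' y').c.1 /\ (x' = x1 \/ y' = y1))) := by
  have key : ∀ x y, x0 < x -> x <= x1 -> y0 <= y -> y <= y1 -> ∀ a, mb a (F x y).c.1 ->
    ∃ x' y', x <= x' /\ x' <= x1 /\ y <= y' /\ y' <= y1 /\
      (realF K (F x' y') a \/ (mb a (F x' y').c.1 /\ (x' = x1 \/ y' = y1))) := by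
    intro x y h1 h2 h3 h4 a ha
    obtain ⟨x', p1, p2, p3⟩ := h.W' h1
    exact p3.fF x y p2.le h2 h3 h4 a ha
  intro x y h1 h2 h3 h4 a ha
  rcases h4.eq_or_lt with rfl | h4
  . exact ⟨x, y, le_rfl, h2, le_rfl, le_rfl, .inr ⟨ha, .inr rfl⟩⟩
  rcases h1.eq_or_lt with rfl | h1
  . obtain ⟨y', p1, p2, p3⟩ := h.H' h4
    rw [he.left y h3 h4] at ha
    rcases he.cF a ha with e | e | e
    . refine ⟨x0, y, le_rfl, h2, le_rfl, h4.le, .inl ?_⟩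
      have hn : (F x0 y).n = sL.c := by
        obtain ⟨y'', q1, q2⟩ := ((p3.gN x0 y le_rfl h2 h3 p1).and (Ioo_mem_nhdsGT p1)).exists
        rw [<- q1, he.left y'' (h3.trans q2.1.le) (q2.2.trans p2)]
      rw [he.left y h3 h4] at hn ⊢
      exact ⟨e.1, ha, .inr ⟨.inl hn, e.2⟩⟩
    . obtain ⟨x'', q1, q2⟩ := ((p3.gE x0 y le_rfl he.lt h3 p1.le).and
        (Ioo_mem_nhdsGT he.lt)).exists
      rw [he.left y h3 h4] at q1
      rw [<- q1] at e
      obtain ⟨x', y', r1, r2⟩ := key x'' y q2.1 q2.2.le h3 h4.le a e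
      exact ⟨x', y', q2.1.le.trans r1, r2⟩
    . exact ⟨x0, y1, le_rfl, h2, h4.le, le_rfl, .inr ⟨e, .inr rfl⟩⟩
  . exact key x y h1 h2 h3 h4.le a ha
theorem Fan.model {K F x0 x1 y0 y1 B D sL sT} (h : Fan K F x0 x1 y0 y1 B D)
    (he : FanEnd K F x0 x1 y0 y1 sL sT) : Model K F x0 x1 y0 y1 where
  val x y h1 h2 h3 h4 := by
    rcases h4.eq_or_lt with rfl | h4
    . rcases h1.eq_or_lt with rfl | h1
      . exact he.val
      . obtain ⟨x', p1, p2, p3⟩ := h.W' h1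
        exact p3.val x y p2.le h2 h3 le_rfl
    . obtain ⟨y', p1, p2, p3⟩ := h.H' h4
      exact p3.val x y h1 h2 h3 p1.le
  re := h.re
  gN x y h1 h2 h3 h4 := by
    obtain ⟨y', p1, p2, p3⟩ := h.H' h4
    exact p3.gN x y h1 h2 h3 p1
  gS x y h1 h2 h3 h4 := by
    rcases h4.eq_or_lt with rfl | h4
    . rcases h1.eq_or_lt with rfl | h1
      . rw [he.zs]
        filter_upwards [Ioo_mem_nhdsLT he.lty] with y' hy'
        rw [he.left y' hy'.1.le hy'.2]
      . obtain ⟨x', p1, p2, p3⟩ := h.W' h1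
        exact p3.gS x y p2.le h2 h3 le_rfl
    . obtain ⟨y', p1, p2, p3⟩ := h.H' h4
      exact p3.gS x y h1 h2 h3 p1.le
  gE x y h1 h2 h3 h4 := by
    rcases h4.eq_or_lt with rfl | h4
    . rcases h1.eq_or_lt with rfl | h1
      . rw [he.ze]
        filter_upwards [Ioo_mem_nhdsGT he.lt] with x' hx'
        rw [he.top x' hx'.1 hx'.2.le]
      . obtain ⟨x', p1, p2, p3⟩ := h.W' h1
        exact p3.gE x y p2.le h2 h3 le_rfl
    . obtain ⟨y', p1, p2, p3⟩ := h.H' h4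
      exact p3.gE x y h1 h2 h3 p1.le
  gW x y h1 h2 h3 h4 := by
    obtain ⟨x', p1, p2, p3⟩ := h.W' h1
    exact p3.gW x y p2 h2 h3 h4
  fF := h.fF he
  fP x y h1 h2 h3 h4 a ha := by
    have := h.dual.fF he.dual (-y) (-x) ° ° ° ° a
      (by simpa [fD] using ha)
    obtain ⟨x', y', q1, q2, q3, q4, q5⟩ := this
    refine ⟨-y', -x', °, °, °, °, ?_⟩
    rcases q5 with q5 | ⟨q5, q6⟩
    . left
      have := q5.dual
      simpa [fD] using this
    . right
      refine ⟨by simpa [fD] using q5, ?_⟩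
      rcases q6 with rfl | rfl
      . exact .inr (by simp)
      . exact .inl (by simp)
end

section
theorem cat_last_single {α : Type} [DecidableEq α] : ∀ {u : List α} {s : α}, u.length % 2 = 1 ->
    u.reverse.head? = some s -> cat u s [s] = u
  | [], _, h, _ => by simp at h
  | [x], s, _, h => by
    simp at h
    subst h
    simp [cat]
  | x :: v :: u, s, h, hs => by
    have hu : u.length % 2 = 1 := by simp only [List.length_cons] at h; omega
    have hne : u ≠ [] := by rintro rfl; simp at hu
    unfold Temporal.cat
    rw [cat_last_single hu]
    rw [List.reverse_cons, List.reverse_cons, List.append_assoc, List.head?_append] at hs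
    have : u.reverse.head? ≠ none := by simp [hne]
    cases h' : u.reverse.head? with
    | none => exact absurd h' this
    | some z => rw [h'] at hs; simpa using hs
theorem IsTr.ext_last {g : ℝ -> PT} {a m b : ℝ} {u : List PT} {s : PT} (h : IsTr g a m u)
    (hs : u.reverse.head? = some s) (hmb : m < b) (hc : ∀ x, m <= x -> x < b -> g x = s) :
    IsTr g a b u := by
  have := h.cat (hc m le_rfl hmb) (.one hmb fun x h1 h2 => hc x h1.le h2)
  rwa [cat_last_single h.odd hs] at this
theorem half_index {B : ℕ -> ℝ} {x0 x : ℝ} (hA : StrictAnti B) (hB : ∀ x, x0 < x -> ∃ n, B n < x)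
    (hx : x0 < x) (k : ℕ) (h : x <= B k) : ∃ j, k <= j /\ B (j + 1) < x /\ x <= B j := by
  classical
  have ex := hB x hx
  have h1 := Nat.find_spec ex
  have hk : k < Nat.find ex := by
    by_contra hcon
    have := hA.antitone (not_lt.1 hcon)
    linarith
  obtain ⟨j, hj⟩ : ∃ j, Nat.find ex = j + 1 := ⟨Nat.find ex - 1, by omega⟩
  refine ⟨j, by omega, hj ▸ h1, not_lt.1 (Nat.find_min ex (by omega))⟩
theorem half_fun {B : ℕ -> ℝ} (hA : StrictAnti B) :
    ∃ jx : ℝ -> ℕ, ∀ x k, B (k + 1) < x -> x <= B k -> jx x = k := by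
  classical
  refine ⟨fun x => if h : ∃ k, B (k + 1) < x /\ x <= B k then h.choose else 0, fun x k h1 h2 => ?_⟩
  have ex : ∃ k, B (k + 1) < x /\ x <= B k := ⟨k, h1, h2⟩
  simp only [dif_pos ex]
  obtain ⟨h3, h4⟩ := ex.choose_spec
  generalize ex.choose = j at *
  have a1 : B (k + 1) < B j := h1.trans_le h4
  have a2 : B (j + 1) < B k := h3.trans_le h2
  rw [hA.lt_iff_gt] at a1 a2
  omega
theorem Snd.lim {K : Sys} {p1 p2 p3 q : Lab} (H1 : Snd K p1) (H2 : Snd K p2) (H3 : Snd K p3)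
    (h : RLim K p1 p2 p3 q) (ho : OddL q) : Snd K q := by
  refine ⟨ho, ?_⟩
  intro x0 x1 y0 y1 gL gB hx hy hl hb
  rw [h.l] at hl
  rw [h.b] at hb
  obtain ⟨D, hD⟩ : ∃ D : ℕ -> ℝ, D = fun n => y1 - (y1 - y0) / 2 ^ n := ⟨_, rfl⟩
  have Dlt : ∀ n, D n < y1 := fun n => by
    have : 0 < (y1 - y0) / 2 ^ n := by have : 0 < y1 - y0 := °
                                       positivity
    simp only [hD]; linarith
  have Dstep : ∀ n, D (n + 1) = (D n + y1) / 2 := fun n => by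
    simp only [hD, pow_succ]; field_simp; ring
  have Dlts : ∀ n, D n < D (n + 1) := fun n => by rw [Dstep]; linarith [Dlt n]
  have Dmono : StrictMono D := strictMono_nat_of_lt_succ Dlts
  have D0 : D 0 = y0 := by simp [hD]
  have Dlim : ∀ y, y < y1 -> ∃ n, y < D n := fun y hy' => by
    obtain ⟨n, hn⟩ := exists_nat_gt ((y1 - y0) / (y1 - y))
    refine ⟨n, ?_⟩
    have h2 : (n : ℝ) < 2 ^ n := by exact_mod_cast Nat.lt_two_pow_self
    have h3 : (y1 - y0) / (y1 - y) < 2 ^ n := hn.trans h2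
    rw [div_lt_iff₀ °] at h3
    have : (y1 - y0) / 2 ^ n < y1 - y := by
      rw [div_lt_iff₀ (by positivity)]; linarith
    simp only [hD]; linarith
  obtain ⟨sL, hsL⟩ : ∃ s, s = q.sw := ⟨_, rfl⟩
  obtain ⟨sT, hsT⟩ : ∃ s, s = q.ne := ⟨_, rfl⟩
  obtain ⟨sR, hsR⟩ : ∃ s, s = p1.se := ⟨_, rfl⟩
  obtain ⟨sB, hsB⟩ : ∃ s, s = p2.se := ⟨_, rfl⟩
  -- one step
  have step : ∀ (n : ℕ) (s : {s : ℝ × (ℝ -> PT) // x0 < s.1 /\ IsTr s.2 x0 s.1 p3.b}),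
      ∃ (B' : ℝ) (f2 f3 : ℝ -> ℝ -> PT), x0 < B' /\ B' < s.1.1 /\ B' - x0 <= (s.1.1 - x0) / 2 /\
        (∀ x, x0 < x -> x <= B' -> s.1.2 x = sB) /\
        Model K f2 x0 B' (D n) (D (n + 1)) /\ HasLab f2 x0 B' (D n) (D (n + 1)) p2 /\
        Model K f3 B' s.1.1 (D n) (D (n + 1)) /\ HasLab f3 B' s.1.1 (D n) (D (n + 1)) p3 /\
        (∀ y, D n < y -> y < D (n + 1) -> f3 B' y = f2 B' y) /\
        (∀ x, B' < x -> x < s.1.1 -> f3 x (D n) = s.1.2 x) := by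
    rintro n ⟨⟨b, g⟩, hb0, hg⟩
    simp only at hb0 hg ⊢
    obtain ⟨m, m1, m2, m3, m4⟩ := hg.split_first h.b2
    obtain ⟨B', hB'⟩ : ∃ B', B' = min m ((x0 + b) / 2) := ⟨_, rfl⟩
    have k1 : B' <= m := hB' ▸ min_le_left _ _
    have k2 : B' <= (x0 + b) / 2 := hB' ▸ min_le_right _ _
    have k0 : x0 < B' := hB' ▸ lt_min m1 °
    have m4' : IsTr g B' b p3.b := by
      rcases k1.eq_or_lt with e | e
      . rw [e]; exact m4
      . exact m4.extend e h.b2 (fun x h1 h2 => m3 x (k0.trans h1) h2.le) (m3 m m1 le_rfl)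
    obtain ⟨f2, a1, a2, a3, a4⟩ := H2.ex x0 B' (D n) (D (n + 1)) (fun _ => sL) (fun _ => sB) k0 (Dlts n)
      (by rw [h.l1, hsL]; exact .one (Dlts n) fun _ _ _ => rfl)
      (by rw [h.b1, hsB]; exact .one k0 fun _ _ _ => rfl)
    obtain ⟨f3, c1, c2, c3, c4⟩ := H3.ex B' b (D n) (D (n + 1)) (fun y => f2 B' y) g °
      (Dlts n) (by rw [<- h.e6]; exact a2.r) m4'
    exact ⟨B', f2, f3, k0, °, °, fun x h1 h2 => hsB ▸ m3 x h1 (h2.trans k1),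
      a1, a2, c1, c2, c3, c4⟩
  choose nB nf2 nf3 t1 t2 t3 t4 t5 t6 t7 t8 t9 t10 using step
  obtain ⟨st, st0, stS⟩ : ∃ st : ℕ -> {s : ℝ × (ℝ -> PT) // x0 < s.1 /\ IsTr s.2 x0 s.1 p3.b},
      st 0 = ⟨(x1, gB), hx, hb⟩ /\ ∀ n, (st (n + 1)).1 =
        (nB n (st n), fun x => nf2 n (st n) x (D (n + 1))) := by
    exact ⟨fun n => Nat.rec ⟨(x1, gB), hx, hb⟩ (fun n s =>
      ⟨(nB n s, fun x => nf2 n s x (D (n + 1))), t1 n s, h.e2 ▸ (t6 n s).t⟩) n, rfl, fun n => rfl⟩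
  obtain ⟨B, hB⟩ : ∃ B : ℕ -> ℝ, ∀ n, B n = (st n).1.1 := ⟨_, fun _ => rfl⟩
  obtain ⟨g, hg⟩ : ∃ g : ℕ -> ℝ -> PT, ∀ n, g n = (st n).1.2 := ⟨_, fun _ => rfl⟩
  obtain ⟨f2, hf2⟩ : ∃ f : ℕ -> ℝ -> ℝ -> PT, ∀ n, f n = nf2 n (st n) := ⟨_, fun _ => rfl⟩
  obtain ⟨f3, hf3⟩ : ∃ f : ℕ -> ℝ -> ℝ -> PT, ∀ n, f n = nf3 n (st n) := ⟨_, fun _ => rfl⟩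
  have hBS : ∀ n, nB n (st n) = B (n + 1) := fun n => by rw [hB, stS]
  have gS : ∀ n x, g (n + 1) x = f2 n x (D (n + 1)) := fun n x => by rw [hg, stS, hf2]
  have g0 : g 0 = gB := by rw [hg, st0]
  have B0 : B 0 = x1 := by rw [hB, st0]
  replace t1 := fun n => t1 n (st n)
  replace t2 := fun n => t2 n (st n)
  replace t3 := fun n => t3 n (st n)
  replace t4 := fun n => t4 n (st n)
  replace t5 := fun n => t5 n (st n)
  replace t6 := fun n => t6 n (st n)
  replace t7 := fun n => t7 n (st n)
  replace t8 := fun n => t8 n (st n)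
  replace t9 := fun n => t9 n (st n)
  replace t10 := fun n => t10 n (st n)
  simp only [hBS, <- hB, <- hg, <- hf2, <- hf3] at t1 t2 t3 t4 t5 t6 t7 t8 t9 t10
  clear hBS hB hg hf2 hf3 stS st0
  clear st nB nf2 nf3
  have Bgt : ∀ n, x0 < B n := fun n => by
    cases n with
    | zero => rw [B0]; exact hx
    | succ n => exact t1 n
  have Banti : StrictAnti B := strictAnti_nat_of_succ_lt t2
  have Bbd : ∀ n, B n - x0 <= (x1 - x0) / 2 ^ n := fun n => by
    induction n with
    | zero => simp [B0]
    | succ n ih =>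
      refine (t3 n).trans ?_
      rw [pow_succ, <- div_div]; linarith
  have Blim : ∀ x, x0 < x -> ∃ n, B n < x := fun x hx' => by
    obtain ⟨n, hn⟩ := exists_nat_gt ((x1 - x0) / (x - x0))
    refine ⟨n, ?_⟩
    have h2 : (n : ℝ) < 2 ^ n := by exact_mod_cast Nat.lt_two_pow_self
    have h3 : (x1 - x0) / (x - x0) < 2 ^ n := hn.trans h2
    rw [div_lt_iff₀ °] at h3
    have : (x1 - x0) / 2 ^ n < x - x0 := by
      rw [div_lt_iff₀ (by positivity)]; linarith
    linarith [Bbd n]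
  have hreB : sB.re = true := h.re4 _ (by
    rw [h.e2, hsB]; exact List.mem_of_mem_head? h.b2)
  have hreR : sR.re = true := h.re1 _ (by
    rw [h.e1, hsR]; exact List.mem_reverse.1 (List.mem_of_mem_head? h.r2))
  -- top right cells
  have step1 : ∀ n, ∃ f1 : ℝ -> ℝ -> PT, Model K f1 (B (n + 1)) (B n) (D (n + 1)) y1 /\
      HasLab f1 (B (n + 1)) (B n) (D (n + 1)) y1 p1 /\
      (∀ y, D (n + 1) < y -> y < y1 -> f1 (B (n + 1)) y =
        if y < D (n + 2) then f3 (n + 1) (B (n + 1)) y else sR) /\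
      (∀ x, B (n + 1) < x -> x < B n -> f1 x (D (n + 1)) = f3 n x (D (n + 1))) := fun n => by
    refine H1.ex (B (n + 1)) (B n) (D (n + 1)) y1 _ (fun x => f3 n x (D (n + 1))) (t2 n) (Dlt _) ?_ ?_
    . rw [h.e1]
      refine IsTr.ext_last (m := D (n + 2)) ?_ h.r2 (Dlt _) ?_
      . refine (t8 (n + 1)).r.congr fun x h1 h2 => ?_
        simp only [h2, if_true]
      . intro x h1 h2
        simp only [not_lt.2 h1, if_false, hsR]
    . rw [h.e3]; exact (t8 n).t
  choose f1 u1 u2 u3 u4 using step1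
  obtain ⟨jx, hjx⟩ := half_fun Banti
  have negD : StrictAnti fun n => - D n := fun a b hab => neg_lt_neg (Dmono hab)
  obtain ⟨jy', hjy'⟩ := half_fun negD
  obtain ⟨jy, hjy⟩ : ∃ jy : ℝ -> ℕ, ∀ y n, D n <= y -> y < D (n + 1) -> jy y = n :=
    ⟨fun y => jy' (-y), fun y n h1 h2 => hjy' (-y) n ° °⟩
  have exy : ∀ y k, y < y1 -> D k <= y -> ∃ m, k <= m /\ D m <= y /\ y < D (m + 1) := fun y k h1 h2 => by
    obtain ⟨j, e1, e2, e3⟩ := half_index (x0 := -y1) (x := -y) negD (fun x hx => by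
      obtain ⟨n, hn⟩ := Dlim (-x) °
      exact ⟨n, °⟩) ° k °
    exact ⟨j, e1, °, °⟩
  have exx : ∀ x k, x0 < x -> x <= B k -> ∃ j, k <= j /\ B (j + 1) < x /\ x <= B j := fun x k h1 h2 =>
    half_index Banti Blim h1 k h2
  obtain ⟨F, hF⟩ : ∃ F : ℝ -> ℝ -> PT, F = fun x y =>
    if x = x0 then (if y = y1 then q.nw else sL) else if y = y1 then sT else
      if jx x < jy y then f1 (jx x) x y else if jy y < jx x then f2 (jy y) x y else f3 (jx x) x y :=
    ⟨_, rfl⟩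
  have Fnw : F x0 y1 = q.nw := by simp [hF]
  have Fl : ∀ y, y < y1 -> F x0 y = sL := fun y hy => by simp [hF, hy.ne]
  have Ft : ∀ x, x0 < x -> F x y1 = sT := fun x hx => by simp [hF, hx.ne']
  have F1 : ∀ k m x y, B (k + 1) < x -> x <= B k -> D m <= y -> y < D (m + 1) -> k < m ->
      F x y = f1 k x y := fun k m x y a1 a2 a3 a4 a5 => by
    simp only [hF]
    rw [if_neg ((Bgt _).trans a1).ne', if_neg (a4.trans (Dlt _)).ne, hjx x k a1 a2, hjy y m a3 a4,
      if_pos a5]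
  have F2 : ∀ k m x y, B (k + 1) < x -> x <= B k -> D m <= y -> y < D (m + 1) -> m < k ->
      F x y = f2 m x y := fun k m x y a1 a2 a3 a4 a5 => by
    simp only [hF]
    rw [if_neg ((Bgt _).trans a1).ne', if_neg (a4.trans (Dlt _)).ne, hjx x k a1 a2, hjy y m a3 a4,
      if_neg (by omega), if_pos a5]
  have F3 : ∀ k x y, B (k + 1) < x -> x <= B k -> D k <= y -> y < D (k + 1) ->
      F x y = f3 k x y := fun k x y a1 a2 a3 a4 => by
    simp only [hF]
    rw [if_neg ((Bgt _).trans a1).ne', if_neg (a4.trans (Dlt _)).ne, hjx x k a1 a2, hjy y k a3 a4,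
      if_neg (by omega), if_neg (by omega)]
  clear hF hjx hjy
  have f1r : ∀ n y, D (n + 1) <= y -> y < y1 -> f1 n (B n) y = sR := fun n y a1 a2 => by
    rcases a1.eq_or_lt with rfl | a1
    . rw [(u2 n).se, hsR]
    . have := (u2 n).r
      rw [h.r1] at this
      rw [this.single y a1 a2, hsR]
  have f1t : ∀ n x, B (n + 1) <= x -> x <= B n -> f1 n x y1 = sT := fun n x a1 a2 => by
    rcases tri_cases a1 a2 with rfl | rfl | ⟨a1, a2⟩
    . rw [(u2 n).nw, h.t2, hsT]
    . rw [(u2 n).ne, h.t3, hsT]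
    . have := (u2 n).t
      rw [h.t1] at this
      rw [this.single x a1 a2, hsT]
  have f2l : ∀ n y, D n <= y -> y <= D (n + 1) -> f2 n x0 y = sL := fun n y a1 a2 => by
    rcases tri_cases a1 a2 with rfl | rfl | ⟨a1, a2⟩
    . rw [(t6 n).sw, h.l3, hsL]
    . rw [(t6 n).nw, h.l2, hsL]
    . have := (t6 n).l
      rw [h.l1] at this
      rw [this.single y a1 a2, hsL]
  have f2b : ∀ n x, x0 < x -> x <= B (n + 1) -> f2 n x (D n) = sB := fun n x a1 a2 => by
    rcases a2.eq_or_lt with rfl | a2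
    . rw [(t6 n).se, hsB]
    . have := (t6 n).b
      rw [h.b1] at this
      rw [this.single x a1 a2, hsB]
  have C1 : ∀ n x y, B (n + 1) <= x -> x <= B n -> D (n + 1) <= y -> y <= y1 -> F x y = f1 n x y := by
    intro n x y a1 a2 a3 a4
    rcases a4.eq_or_lt with rfl | a4
    . rw [Ft x ((Bgt _).trans_le a1), f1t n x a1 a2]
    obtain ⟨m, m1, m2, m3⟩ := exy y (n + 1) a4 a3
    rcases a1.eq_or_lt with rfl | a1
    . rcases m1.eq_or_lt with rfl | m1
      . rw [F3 (n + 1) _ y (t2 _) le_rfl m2 m3]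
        rcases a3.eq_or_lt with rfl | a3
        . rw [(t8 _).se, (u2 _).sw, h.e9, h.e4]
        . rw [u3 n y a3 a4, if_pos m3]
      . have : D (n + 2) <= y := (Dmono.monotone (by omega)).trans m2
        rw [F1 (n + 1) m _ y (t2 _) le_rfl m2 m3 m1, f1r _ y this a4,
          u3 n y ((Dlts _).trans_le this) a4, if_neg (not_lt.2 this)]
    . exact F1 n m x y a1 a2 m2 m3 (by omega)
  have C2 : ∀ n x y, x0 <= x -> x <= B (n + 1) -> D n <= y -> y <= D (n + 1) -> F x y = f2 n x y := by
    intro n x y a1 a2 a3 a4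
    rcases a1.eq_or_lt with rfl | a1
    . rw [Fl y (a4.trans_lt (Dlt _)), f2l n y a3 a4]
    obtain ⟨k, k1, k2, k3⟩ := exx x (n + 1) a1 a2
    rcases a4.eq_or_lt with rfl | a4
    . rcases k1.eq_or_lt with rfl | k1
      . rw [F3 (n + 1) x _ k2 k3 le_rfl (Dlts _)]
        rcases a2.eq_or_lt with rfl | a2
        . rw [(t8 _).se, (t6 _).ne, h.e9, h.e8]
        . rw [t10 (n + 1) x k2 a2, gS]
      . have : x <= B (n + 2) := k3.trans (Banti.antitone (by omega))
        rw [F2 k (n + 1) x _ k2 k3 le_rfl (Dlts _) (by omega), f2b _ x a1 this, <- gS,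
          t4 (n + 1) x a1 this]
    . exact F2 k n x y k2 k3 a3 a4 (by omega)
  have C3 : ∀ n x y, B (n + 1) <= x -> x <= B n -> D n <= y -> y <= D (n + 1) -> F x y = f3 n x y := by
    intro n x y a1 a2 a3 a4
    rcases a1.eq_or_lt with rfl | a1
    . rcases a4.eq_or_lt with rfl | a4
      . rw [F3 (n + 1) _ _ (t2 _) le_rfl le_rfl (Dlts _), (t8 _).se, (t8 _).nw, h.e9]
      . rw [F2 (n + 1) n _ y (t2 _) le_rfl a3 a4 (by omega)]
        rcases a3.eq_or_lt with rfl | a3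
        . rw [(t6 _).se, (t8 _).sw, h.e7]
        . rw [t9 n y a3 a4]
    . rcases a4.eq_or_lt with rfl | a4
      . rw [F1 n (n + 1) x _ a1 a2 le_rfl (Dlts _) (by omega)]
        rcases a2.eq_or_lt with rfl | a2
        . rw [(u2 _).se, (t8 _).ne, h.e5]
        . rw [u4 n x a1 a2]
      . exact F3 n x y a1 a2 a3 a4
  have fan : Fan K F x0 x1 y0 y1 B D := by
    refine ⟨B0, D0, Banti, Dmono, Bgt, Dlt, Blim, Dlim, fun n => (u1 n).congr (C1 n),
      fun n => (t5 n).congr (C2 n), fun n => (t7 n).congr (C3 n), ?_⟩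
    intro x y a1 a2 a3 a4
    obtain ⟨k, -, k2, k3⟩ := exx x 0 a1 (B0 ▸ a2.le)
    obtain ⟨m, -, m2, m3⟩ := exy y 0 a4 (D0 ▸ a3.le)
    rcases lt_trichotomy k m with c | rfl | c
    . rw [F1 k m x y k2 k3 m2 m3 c]
      have hy1 : D (k + 1) <= y := (Dmono.monotone (by omega)).trans m2
      rcases k3.eq_or_lt with rfl | k3
      . rw [f1r k y hy1 a4]; exact hreR
      rcases hy1.eq_or_lt with rfl | hy1
      . exact h.re2 _ ((u2 k).b.mem x k2 k3)
      . exact (u1 k).re x y k2 k3 hy1 a4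
    . rw [F3 k x y k2 k3 m2 m3]
      rcases k3.eq_or_lt with rfl | k3
      . rcases m2.eq_or_lt with rfl | m2
        . rw [(t8 _).se, h.e9]; exact h.re5
        . exact h.re1 _ (h.e1 ▸ (t8 k).r.mem y m2 m3)
      . rcases m2.eq_or_lt with rfl | m2
        . exact h.re4 _ (h.e2 ▸ (t8 k).b.mem x k2 k3)
        . exact (t7 k).re x y k2 k3 m2 m3
    . rw [F2 k m x y k2 k3 m2 m3 c]
      have hx1 : x <= B (m + 1) := k3.trans (Banti.antitone (by omega))
      rcases m2.eq_or_lt with rfl | m2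
      . rw [f2b m x a1 hx1]; exact hreB
      rcases hx1.eq_or_lt with rfl | hx1
      . exact h.re3 _ ((t6 m).r.mem y m2 m3)
      . exact (t5 m).re x y a1 hx1 m2 m3
  have fend : FanEnd K F x0 x1 y0 y1 sL sT :=
    ⟨hx, hy, fun y _ a => Fl y a, fun x a _ => Ft x a, by rw [Fnw]; exact h.z0,
      by rw [Fnw, hsL]; exact h.z0s, by rw [Fnw, hsT]; exact h.z0e,
      by rw [Fnw, hsL]; exact h.cF, by rw [Fnw, hsT]; exact h.cP⟩
  have Fb : ∀ x, x0 < x -> x < x1 -> F x y0 = gB x := fun x a1 a2 => by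
    rw [<- g0, <- D0]
    rcases le_or_gt x (B 1) with c | c
    . rw [C2 0 x _ a1.le c le_rfl (Dlts 0).le, f2b 0 x a1 c, t4 0 x a1 c]
    . rw [C3 0 x _ c.le (B0 ▸ a2.le) le_rfl (Dlts 0).le, t10 0 x c (B0 ▸ a2)]
  refine ⟨F, fan.model fend, ⟨?_, ?_, Fnw, ?_, ?_, ?_, ?_, ?_⟩, ?_, Fb⟩
  . rw [Fl y0 hy, hsL]
  . rw [h.se, <- D0, <- B0, C3 0 _ _ (t2 0).le le_rfl le_rfl (Dlts 0).le, (t8 0).se]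
  . rw [Ft x1 hx, hsT]
  . rw [h.l, <- hsL]; exact .one hy fun y a1 a2 => Fl y a2
  . rw [h.r]
    refine IsTr.ext_last (m := D 1) ?_ h.r2 (Dlt _) ?_
    . rw [<- D0, <- B0]
      exact (t8 0).r.congr fun y a1 a2 => C3 0 _ y (t2 0).le le_rfl a1.le a2.le
    . intro y a1 a2
      rw [<- B0, C1 0 _ y (t2 0).le le_rfl a1 a2.le, f1r 0 y a1 a2, hsR]
  . rw [h.b]; exact hb.congr Fb
  . rw [h.t, <- hsT]; exact .one hx fun x a1 a2 => Ft x a1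
  . intro y a1 a2
    rw [Fl y a2, hl.single y a1 a2, hsL]
end

section
/-! ### Soundness of the shuffle rule: abstract part -/
theorem climb {g : ℝ -> PT} {p q : ℝ} {α : ℕ} (hpq : p <= q)
    (gN : ∀ y, p <= y -> y < q -> ∀ᶠ y' in 𝓝[>] y, (g y').c = (g y).n)
    (gS : ∀ y, p < y -> y <= q -> ∀ᶠ y' in 𝓝[<] y, (g y').c = (g y).s)
    (hα : mb α (g p).c.1) :
    ∃ y, p <= y /\ y <= q /\ ((mb α (g y).c.1 /\ (y = q \/ ¬ mb α (g y).n.1)) \/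
      (mb α (g y).s.1 /\ ¬ mb α (g y).c.1 /\ ∃ u, p < u /\ u < y /\ (g u).c = (g y).s /\
        (g u).n = (g u).c)) := by
  obtain ⟨S, hS⟩ : ∃ S : Set ℝ, S = {y | p <= y /\ y <= q /\ mb α (g y).c.1} := ⟨_, rfl⟩
  have hpS : p ∈ S := hS ▸ ⟨le_rfl, hpq, hα⟩
  have hbd : BddAbove S := ⟨q, fun y hy => by rw [hS] at hy; exact hy.2.1⟩
  obtain ⟨y, hy⟩ : ∃ y, y = sSup S := ⟨_, rfl⟩
  have h1 : p <= y := hy ▸ le_csSup hbd hpS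
  have h2 : y <= q := hy ▸ csSup_le ⟨p, hpS⟩ fun y hy => by rw [hS] at hy; exact hy.2.1
  refine ⟨y, h1, h2, ?_⟩
  by_cases hc : mb α (g y).c.1
  . left
    refine ⟨hc, ?_⟩
    rcases h2.eq_or_lt with e | e
    . exact .inl e
    right
    intro hn
    obtain ⟨y', e1, e2⟩ := ((gN y h1 e).and (Ioo_mem_nhdsGT e)).exists
    have : y' ∈ S := hS ▸ ⟨h1.trans e2.1.le, e2.2.le, by rw [e1]; exact hn⟩
    have := le_csSup hbd this
    rw [<- hy] at this
    linarith [e2.1]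
  . right
    have hlt : p < y := by
      rcases h1.eq_or_lt with e | e
      . exact absurd hα (by rw [e]; exact hc)
      . exact e
    have hev := gS y hlt h2
    obtain ⟨l, hl1, hl2⟩ := (mem_nhdsLT_iff_exists_Ioo_subset' hlt).1 hev
    have hl1 : l < y := hl1
    obtain ⟨z, hz1, hz2⟩ := exists_lt_of_lt_csSup ⟨p, hpS⟩ (hy ▸ (max_lt hl1 hlt) : max l p < sSup S)
    rw [hS] at hz1
    have hzy : z < y := by
      rcases eq_or_lt_of_le (hy ▸ le_csSup hbd (hS ▸ hz1) : z <= y) with e | e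
      . exact absurd hz1.2.2 (e ▸ hc)
      . exact e
    have hlz : l < z := (le_max_left _ _).trans_lt hz2
    have hpz : p < z := (le_max_right _ _).trans_lt hz2
    have hzs : (g z).c = (g y).s := hl2 ⟨hlz, hzy⟩
    refine ⟨hzs ▸ hz1.2.2, hc, z, hpz, hzy, hzs, ?_⟩
    obtain ⟨u, u1, u2⟩ := ((gN z hpz.le (hzy.trans_le h2)).and (Ioo_mem_nhdsGT hzy)).exists
    rw [<- u1, hzs]
    exact hl2 ⟨hlz.trans u2.1, u2.2⟩

structure CompatF (K : Sys) (Cm Cp : Clu) (F : ℝ -> ℝ -> PT) (x0 x1 y0 y1 : ℝ) : Prop where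
  hx : x0 < x1
  hy : y0 < y1
  mod : Model K F x0 x1 y0 y1
  re : ∀ x y, x0 <= x -> x <= x1 -> y0 <= y -> y <= y1 -> (F x y).re = true
  l : ∀ y, y0 <= y -> y <= y1 -> (F x0 y).w = Cm
  r : ∀ y, y0 <= y -> y <= y1 -> (F x1 y).e = Cp
  b : ∀ x, x0 <= x -> x <= x1 -> (F x y0).s = Cm
  t : ∀ x, x0 <= x -> x <= x1 -> (F x y1).n = Cp
  okt : ∀ x, x0 < x -> x <= x1 -> covF K true (F x y1).w (F x y1).c Cp
  okr : ∀ y, y0 < y -> y <= y1 -> covF K true (F x1 y).s (F x1 y).c Cp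
  okl : ∀ y, y0 <= y -> y < y1 -> covP K true (F x0 y).n (F x0 y).c Cm
  okb : ∀ x, x0 <= x -> x < x1 -> covP K true (F x y0).e (F x y0).c Cm
theorem covF.dual {K : Sys} {re c d1 d2} (h : covF K re c d1 d2) :
    covP K.dual re c.swap d1.swap d2.swap := fun a ha => h a ha
theorem covP.dual {K : Sys} {re c d1 d2} (h : covP K re c d1 d2) :
    covF K.dual re c.swap d1.swap d2.swap := fun a ha => h a ha
theorem CompatF.dual {K Cm Cp F x0 x1 y0 y1} (h : CompatF K Cm Cp F x0 x1 y0 y1) :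
    CompatF K.dual Cp.swap Cm.swap (fD F) (-y1) (-y0) (-x1) (-x0) where
  hx := neg_lt_neg h.hy
  hy := neg_lt_neg h.hx
  mod := h.mod.dual
  re x y h1 h2 h3 h4 := h.re (-y) (-x) ° ° ° °
  l y h1 h2 := by simp only [fD, neg_neg, PT.du_w, h.t (-y) ° °]
  r y h1 h2 := by simp only [fD, neg_neg, PT.du_e, h.b (-y) ° °]
  b y h1 h2 := by simp only [fD, neg_neg, PT.du_s, h.r (-y) ° °]
  t y h1 h2 := by simp only [fD, neg_neg, PT.du_n, h.l (-y) ° °]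
  okt x h1 h2 := by simp only [fD, neg_neg]; exact (h.okl (-x) ° °).dual
  okr x h1 h2 := by simp only [fD, neg_neg]; exact (h.okb (-x) ° °).dual
  okl x h1 h2 := by simp only [fD, neg_neg]; exact (h.okt (-x) ° °).dual
  okb x h1 h2 := by simp only [fD, neg_neg]; exact (h.okr (-x) ° °).dual

/-- in a compatible cell, future witnesses are found or we may exit to `Cp` -/
theorem CompatF.fF {K Cm Cp F x0 x1 y0 y1} (h : CompatF K Cm Cp F x0 x1 y0 y1) {x y : ℝ}
    (h1 : x0 <= x) (h2 : x <= x1) (h3 : y0 <= y) (h4 : y <= y1) {α : ℕ} (hα : mb α (F x y).c.1) :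
    mb α Cp.1 \/ ∃ x' y', x <= x' /\ x' <= x1 /\ y <= y' /\ y' <= y1 /\ realF K (F x' y') α := by
  by_cases hp : mb α Cp.1
  . exact .inl hp
  right
  obtain ⟨x', y', e1, e2, e3, e4, e5⟩ := h.mod.fF x y h1 h2 h3 h4 α hα
  rcases e5 with e5 | ⟨e5, rfl | rfl⟩
  . exact ⟨x', y', e1, e2, e3, e4, e5⟩
  . obtain ⟨z, z1, z2, z3⟩ := climb (g := fun y => F x' y) (p := y') (q := y1) (α := α) e4
      (fun u u1 u2 => h.mod.gN x' u ° le_rfl ° u2)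
      (fun u u1 u2 => h.mod.gS x' u ° le_rfl ° u2) e5
    have vz := h.mod.val x' z ° le_rfl ° z2
    rcases z3 with ⟨z3, z4⟩ | ⟨z3, z4, u, u1, u2, u3, u4⟩
    . rcases vz.stepF z3 with c | c | c
      . exact ⟨x', z, e1, le_rfl, °, z2, c⟩
      . rcases z4 with rfl | z4
        . rw [h.t x' ° le_rfl] at c; exact absurd c hp
        . exact absurd c z4
      . rw [h.r z ° z2] at c; exact absurd c hp
    . rcases h.okr z ° z2 α z3 with c | c | c
      . refine ⟨x', u, e1, le_rfl, °, °, h.re _ _ ° le_rfl °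
          °, by rw [u3]; exact z3, .inr ⟨.inl u4, ?_⟩⟩
        rw [u3]; exact c.2
      . exact absurd c z4
      . exact absurd c hp
  . obtain ⟨z, z1, z2, z3⟩ := climb (g := fun x => (F x y').tr) (p := x') (q := x1) (α := α) e2
      (fun u u1 u2 => h.mod.gE u y' ° u2 ° le_rfl)
      (fun u u1 u2 => h.mod.gW u y' ° u2 ° le_rfl) e5
    have vz := h.mod.val z y' ° z2 ° le_rfl
    simp only [PT.tr_c, PT.tr_n, PT.tr_s] at z3
    rcases z3 with ⟨z3, z4⟩ | ⟨z3, z4, u, u1, u2, u3, u4⟩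
    . rcases vz.stepF z3 with c | c | c
      . exact ⟨z, y', °, z2, e3, le_rfl, c⟩
      . rw [h.t z ° z2] at c; exact absurd c hp
      . rcases z4 with rfl | z4
        . rw [h.r y' ° le_rfl] at c; exact absurd c hp
        . exact absurd c z4
    . rcases h.okt z ° z2 α z3 with c | c | c
      . refine ⟨u, y', °, °, e3, le_rfl, h.re _ _ ° °
          ° le_rfl, by rw [u3]; exact z3, .inr ⟨.inr u4, ?_⟩⟩
        rw [u3]; exact c.2
      . exact absurd c z4
      . exact absurd c hp

structure ShufM (K : Sys) (F : ℝ -> ℝ -> PT) (x0 x1 y0 y1 : ℝ) (Cm Cp : Clu)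
    (σ τ a b a' b' : ℝ -> ℝ) : Prop where
  hx : x0 < x1
  hy : y0 < y1
  σ0 : ∀ x, x0 <= x -> x <= x1 -> 0 <= σ x
  σ1 : ∀ x, x0 <= x -> x <= x1 -> σ x <= 1
  σa : ∀ x, x0 <= x -> x <= x1 -> a (σ x) <= x
  σb : ∀ x, x0 <= x -> x <= x1 -> x <= b (σ x)
  τ0 : ∀ y, y0 <= y -> y <= y1 -> 0 <= τ y
  τ1 : ∀ y, y0 <= y -> y <= y1 -> τ y <= 1
  τa : ∀ y, y0 <= y -> y <= y1 -> a' (τ y) <= y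
  τb : ∀ y, y0 <= y -> y <= y1 -> y <= b' (τ y)
  ab : ∀ s, 0 <= s -> s <= 1 -> a s <= b s
  ab' : ∀ s, 0 <= s -> s <= 1 -> a' s <= b' s
  iff : ∀ s, 0 <= s -> s <= 1 -> (a s = b s ↔ a' s = b' s)
  lt : ∀ s t, 0 <= s -> s < t -> t <= 1 -> b s < a t
  lt' : ∀ s t, 0 <= s -> s < t -> t <= 1 -> b' t < a' s
  a0 : a 0 = x0
  b0 : b 0 = x0
  a1 : a 1 = x1
  b1 : b 1 = x1
  a0' : a' 0 = y1
  b0' : b' 0 = y1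
  a1' : a' 1 = y0
  b1' : b' 1 = y0
  vm : Valid K (kap Cm)
  vp : Valid K (kap Cp)
  above : ∀ x y, x0 <= x -> x <= x1 -> y0 <= y -> y <= y1 -> τ y < σ x -> F x y = kap Cp
  below : ∀ x y, x0 <= x -> x <= x1 -> y0 <= y -> y <= y1 -> σ x < τ y -> F x y = kap Cm
  vnw : Valid K (F x0 y1)
  vse : Valid K (F x1 y0)
  nwe : (F x0 y1).e = Cp
  nws : (F x0 y1).s = Cm
  sen : (F x1 y0).n = Cp
  sew : (F x1 y0).w = Cm
  fill : ∀ s, 0 < s -> s < 1 -> a s = b s -> ∃ c, Valid K (fillPT Cm Cp c) /\ F (a s) (a' s) = fillPT Cm Cp c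
  cell : ∀ s, 0 < s -> s < 1 -> a s < b s ->
    CompatF K Cm Cp F (a s) (b s) (a' s) (b' s)
  dF : ∀ s t, 0 <= s -> s < t -> t <= 1 -> ∀ α, mb α Cm.1 -> K.al α Cm \/ mb α Cp.1 \/
    ∃ u, s < u /\ u < t /\ mb α (F (a u) (a' u)).c.1
  dP : ∀ s t, 0 <= s -> s < t -> t <= 1 -> ∀ α, mb α Cp.2 -> K.al α Cp \/ mb α Cm.2 \/
    ∃ u, s < u /\ u < t /\ mb α (F (b u) (b' u)).c.2
theorem ShufM.dual {K F x0 x1 y0 y1 Cm Cp σ τ a b a' b'}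
    (h : ShufM K F x0 x1 y0 y1 Cm Cp σ τ a b a' b') :
    ShufM K.dual (fD F) (-y1) (-y0) (-x1) (-x0) Cp.swap Cm.swap (fun x => τ (-x)) (fun y => σ (-y))
      (fun s => - b' s) (fun s => - a' s) (fun s => - b s) (fun s => - a s) where
  hx := neg_lt_neg h.hy
  hy := neg_lt_neg h.hx
  σ0 x q1 q2 := h.τ0 _ ° °
  σ1 x q1 q2 := h.τ1 _ ° °
  σa x q1 q2 := by have := h.τb (-x) ° °; linarith
  σb x q1 q2 := by have := h.τa (-x) ° °; linarith
  τ0 x q1 q2 := h.σ0 _ ° °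
  τ1 x q1 q2 := h.σ1 _ ° °
  τa x q1 q2 := by have := h.σb (-x) ° °; linarith
  τb x q1 q2 := by have := h.σa (-x) ° °; linarith
  ab s q1 q2 := by have := h.ab' s q1 q2; linarith
  ab' s q1 q2 := by have := h.ab s q1 q2; linarith
  iff s q1 q2 := by
    rw [neg_inj, neg_inj, eq_comm, <- h.iff s q1 q2, eq_comm]
  lt s t q1 q2 q3 := by have := h.lt' s t q1 q2 q3; linarith
  lt' s t q1 q2 q3 := by have := h.lt s t q1 q2 q3; linarith
  a0 := by rw [h.b0']
  b0 := by rw [h.a0']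
  a1 := by rw [h.b1']
  b1 := by rw [h.a1']
  a0' := by rw [h.b0]
  b0' := by rw [h.a0]
  a1' := by rw [h.b1]
  b1' := by rw [h.a1]
  vm := h.vp.dual
  vp := h.vm.dual
  above x y q1 q2 q3 q4 q5 := by
    simp only [fD, h.below (-y) (-x) ° ° ° ° q5]; rfl
  below x y q1 q2 q3 q4 q5 := by
    simp only [fD, h.above (-y) (-x) ° ° ° ° q5]; rfl
  vnw := by simp only [fD, neg_neg]; exact h.vnw.dual
  vse := by simp only [fD, neg_neg]; exact h.vse.dual
  nwe := by simp only [fD, neg_neg, PT.du_e, h.nws]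
  nws := by simp only [fD, neg_neg, PT.du_s, h.nwe]
  sen := by simp only [fD, neg_neg, PT.du_n, h.sew]
  sew := by simp only [fD, neg_neg, PT.du_w, h.sen]
  fill s q1 q2 q3 := by
    have e : a' s = b' s := °
    have e' := (h.iff s q1.le q2.le).2 e
    obtain ⟨c, c1, c2⟩ := h.fill s q1 q2 e'
    refine ⟨c.swap, c1.dual, ?_⟩
    simp only [fD, neg_neg]
    rw [<- e, <- e', c2]; rfl
  cell s q1 q2 q3 := by
    refine (h.cell s q1 q2 ?_).dual
    rcases eq_or_lt_of_le (h.ab s q1.le q2.le) with e | e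
    . have := (h.iff s q1.le q2.le).1 e
      linarith
    . exact e
  dF s t q1 q2 q3 α hα := by
    simp only [fD, neg_neg]
    exact h.dP s t q1 q2 q3 α hα
  dP s t q1 q2 q3 α hα := by
    simp only [fD, neg_neg]
    exact h.dF s t q1 q2 q3 α hα

section
variable {K : Sys} {F : ℝ -> ℝ -> PT} {x0 x1 y0 y1 : ℝ} {Cm Cp : Clu} {σ τ a b a' b' : ℝ -> ℝ}
theorem ShufM.mono_a (h : ShufM K F x0 x1 y0 y1 Cm Cp σ τ a b a' b') {s t : ℝ} (h1 : 0 <= s)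
    (h2 : s <= t) (h3 : t <= 1) : a s <= a t := by
  rcases h2.eq_or_lt with rfl | h2
  . exact le_rfl
  . exact (h.ab s h1 °).trans (h.lt s t h1 h2 h3).le
theorem ShufM.mono_b' (h : ShufM K F x0 x1 y0 y1 Cm Cp σ τ a b a' b') {s t : ℝ} (h1 : 0 <= s)
    (h2 : s <= t) (h3 : t <= 1) : b' t <= b' s := by
  rcases h2.eq_or_lt with rfl | h2
  . exact le_rfl
  . exact (h.lt' s t h1 h2 h3).le.trans (h.ab' s h1 °)

/-- `x` strictly left of block `s` -/
theorem ShufM.σlt (h : ShufM K F x0 x1 y0 y1 Cm Cp σ τ a b a' b') {s x : ℝ} (h2 : 0 <= s)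
    (h3 : x0 <= x) (h4 : x <= x1) (hx : x < a s) : σ x < s := by
  by_contra hc
  have := h.mono_a h2 (not_lt.1 hc) (h.σ1 x h3 h4)
  linarith [h.σa x h3 h4]
theorem ShufM.σgt (h : ShufM K F x0 x1 y0 y1 Cm Cp σ τ a b a' b') {s x : ℝ} (h2 : s <= 1)
    (h3 : x0 <= x) (h4 : x <= x1) (hx : b s < x) : s < σ x := by
  by_contra hc
  rcases eq_or_lt_of_le (not_lt.1 hc) with e | e
  . have := h.σb x h3 h4
    rw [e] at this; linarith
  . have := h.lt _ _ (h.σ0 x h3 h4) e h2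
    have := h.ab s (by linarith [h.σ0 x h3 h4]) h2
    linarith [h.σb x h3 h4]
theorem ShufM.τlt (h : ShufM K F x0 x1 y0 y1 Cm Cp σ τ a b a' b') {s y : ℝ} (h2 : 0 <= s)
    (h3 : y0 <= y) (h4 : y <= y1) (hx : b' s < y) : τ y < s := by
  have := h.dual.σlt (s := s) (x := -y) h2 ° ° °
  simpa using this
theorem ShufM.τgt (h : ShufM K F x0 x1 y0 y1 Cm Cp σ τ a b a' b') {s y : ℝ} (h2 : s <= 1)
    (h3 : y0 <= y) (h4 : y <= y1) (hx : y < a' s) : s < τ y := by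
  have := h.dual.σgt (s := s) (x := -y) h2 ° ° °
  simpa using this
theorem ShufM.σmono (h : ShufM K F x0 x1 y0 y1 Cm Cp σ τ a b a' b') {x x' : ℝ}
    (h3 : x0 <= x) (h4 : x' <= x1) (hx : x <= x') : σ x <= σ x' := by
  by_contra hc
  have := h.lt _ _ (h.σ0 x' ° h4) (not_le.1 hc) (h.σ1 x h3 °)
  linarith [h.σb x' ° h4, h.σa x h3 °]
theorem ShufM.τanti (h : ShufM K F x0 x1 y0 y1 Cm Cp σ τ a b a' b') {x x' : ℝ}
    (h3 : y0 <= x) (h4 : x' <= y1) (hx : x <= x') : τ x' <= τ x := by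
  have := h.dual.σmono (x := -x') (x' := -x) ° ° °
  simpa using this
theorem ShufM.a_mem (h : ShufM K F x0 x1 y0 y1 Cm Cp σ τ a b a' b') {s : ℝ} (h1 : 0 <= s)
    (h2 : s <= 1) : x0 <= a s /\ b s <= x1 := by
  constructor
  . rw [<- h.a0]; exact h.mono_a le_rfl h1 h2
  . rcases h2.eq_or_lt with rfl | h2
    . rw [h.b1]
    . have := h.lt s 1 h1 h2 le_rfl
      rw [h.a1] at this; exact this.le
theorem ShufM.a_mem' (h : ShufM K F x0 x1 y0 y1 Cm Cp σ τ a b a' b') {s : ℝ} (h1 : 0 <= s)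
    (h2 : s <= 1) : y0 <= a' s /\ b' s <= y1 := by
  have := h.dual.a_mem h1 h2
  constructor <;> linarith [this.1, this.2]
theorem ShufM.σeq (h : ShufM K F x0 x1 y0 y1 Cm Cp σ τ a b a' b') {s x : ℝ} (h1 : 0 <= s)
    (h2 : s <= 1) (h3 : a s <= x) (h4 : x <= b s) : σ x = s := by
  obtain ⟨m1, m2⟩ := h.a_mem h1 h2
  rcases lt_trichotomy (σ x) s with c | c | c
  . have := h.lt _ _ (h.σ0 x ° °) c h2
    linarith [h.σb x ° °]
  . exact c
  . have := h.lt _ _ h1 c (h.σ1 x ° °)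
    linarith [h.σa x ° °]
theorem ShufM.τeq (h : ShufM K F x0 x1 y0 y1 Cm Cp σ τ a b a' b') {s y : ℝ} (h1 : 0 <= s)
    (h2 : s <= 1) (h3 : a' s <= y) (h4 : y <= b' s) : τ y = s := by
  have := h.dual.σeq (s := s) (x := -y) h1 h2 ° °
  simpa using this

/-- case analysis for points on the antidiagonal -/
theorem ShufM.diag (h : ShufM K F x0 x1 y0 y1 Cm Cp σ τ a b a' b') {x y : ℝ} (h1 : x0 <= x)
    (h2 : x <= x1) (h3 : y0 <= y) (h4 : y <= y1) (he : σ x = τ y) :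
    (x = x0 /\ y = y1 /\ σ x = 0) \/ (x = x1 /\ y = y0 /\ σ x = 1) \/ (0 < σ x /\ σ x < 1 /\
      ((x = b (σ x) /\ y = b' (σ x) /\ ∃ c, Valid K (fillPT Cm Cp c) /\ F x y = fillPT Cm Cp c) \/
      (a (σ x) <= x /\ x <= b (σ x) /\ a' (σ x) <= y /\ y <= b' (σ x) /\
        CompatF K Cm Cp F (a (σ x)) (b (σ x)) (a' (σ x)) (b' (σ x))))) := by
  have q1 := h.σa x h1 h2
  have q2 := h.σb x h1 h2
  have q3 := h.τa y h3 h4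
  have q4 := h.τb y h3 h4
  rw [<- he] at q3 q4
  have q5 := h.σ0 x h1 h2
  have q6 := h.σ1 x h1 h2
  generalize σ x = s at *
  rcases q5.eq_or_lt with rfl | q5
  . left
    rw [h.a0] at q1; rw [h.b0] at q2; rw [h.a0'] at q3; rw [h.b0'] at q4
    exact ⟨le_antisymm q2 q1, le_antisymm q4 q3, rfl⟩
  rcases q6.eq_or_lt with rfl | q6
  . right; left
    rw [h.a1] at q1; rw [h.b1] at q2; rw [h.a1'] at q3; rw [h.b1'] at q4
    exact ⟨le_antisymm q2 q1, le_antisymm q4 q3, rfl⟩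
  refine .inr (.inr ⟨q5, q6, ?_⟩)
  rcases eq_or_lt_of_le (h.ab s q5.le q6.le) with e | e
  . left
    have e' := (h.iff s q5.le q6.le).1 e
    have ex : x = a s := °
    have ey : y = a' s := °
    refine ⟨°, °, ?_⟩
    rw [ex, ey]
    exact h.fill s q5 q6 e
  . exact .inr ⟨q1, q2, q3, q4, h.cell s q5 q6 e⟩
theorem ShufM.gE (h : ShufM K F x0 x1 y0 y1 Cm Cp σ τ a b a' b') : ∀ x y, x0 <= x -> x < x1 -> y0 <= y ->
    y <= y1 -> ∀ᶠ x' in 𝓝[>] x, (F x' y).c = (F x y).e := by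
  intro x y h1 h2 h3 h4
  rcases lt_trichotomy (σ x) (τ y) with c | c | c
  . rw [h.below x y h1 h2.le h3 h4 c]
    have t0 := h.τ0 y h3 h4
    have t1 := h.τ1 y h3 h4
    have hlt : x < a (τ y) := (h.σb x h1 h2.le).trans_lt (h.lt _ _ (h.σ0 x h1 h2.le) c t1)
    filter_upwards [Ioo_mem_nhdsGT hlt] with x' hx'
    have m := (h.ab _ t0 t1).trans (h.a_mem t0 t1).2
    rw [h.below x' y (by linarith [hx'.1]) (by linarith [hx'.2]) h3 h4
      (h.σlt t0 (by linarith [hx'.1]) (by linarith [hx'.2]) hx'.2)]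
    rfl
  . have aux : (F x y).e = Cp -> (∀ x', x < x' -> x' <= x1 -> σ x < σ x') ->
        ∀ᶠ x' in 𝓝[>] x, (F x' y).c = (F x y).e := by
      intro e1 e2
      filter_upwards [Ioo_mem_nhdsGT h2] with x' hx'
      rw [h.above x' y (by linarith [hx'.1]) hx'.2.le h3 h4 (c ▸ e2 x' hx'.1 hx'.2.le), e1]
      rfl
    have aux2 : x = b (σ x) -> ∀ x', x < x' -> x' <= x1 -> σ x < σ x' := fun e x' q1 q2 =>
      h.σgt (h.σ1 x h1 h2.le) ° q2 (e ▸ q1)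
    rcases h.diag h1 h2.le h3 h4 c with ⟨d1, d2, d3⟩ | ⟨d1, d2, d3⟩ | ⟨d1, d2, d3⟩
    . refine aux (by rw [d1, d2]; exact h.nwe) (aux2 (by rw [d3, h.b0, d1]))
    . exact absurd d1 h2.ne
    . rcases d3 with ⟨d4, d5, z, d6, d7⟩ | ⟨d4, d5, d6, d7, d8⟩
      . refine aux (by rw [d7]; rfl) (aux2 d4)
      . rcases d5.eq_or_lt with d5 | d5
        . refine aux ?_ (aux2 d5)
          have := d8.r y d6 d7
          rwa [<- d5] at this
        . exact d8.mod.gE x y d4 d5 d6 d7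
  . rw [h.above x y h1 h2.le h3 h4 c]
    filter_upwards [Ioo_mem_nhdsGT h2] with x' hx'
    rw [h.above x' y (by linarith [hx'.1]) hx'.2.le h3 h4
      (c.trans_le (h.σmono h1 hx'.2.le hx'.1.le))]
    rfl
theorem ShufM.gN (h : ShufM K F x0 x1 y0 y1 Cm Cp σ τ a b a' b') : ∀ x y, x0 <= x -> x <= x1 -> y0 <= y ->
    y < y1 -> ∀ᶠ y' in 𝓝[>] y, (F x y').c = (F x y).n := by
  intro x y h1 h2 h3 h4
  rcases lt_trichotomy (σ x) (τ y) with c | c | c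
  . rw [h.below x y h1 h2 h3 h4.le c]
    have t0 := h.σ0 x h1 h2
    have t1 := h.σ1 x h1 h2
    have hlt : y < a' (σ x) := (h.τb y h3 h4.le).trans_lt (h.lt' _ _ t0 c (h.τ1 y h3 h4.le))
    filter_upwards [Ioo_mem_nhdsGT hlt] with x' hx'
    have m := (h.ab' _ t0 t1).trans (h.a_mem' t0 t1).2
    rw [h.below x x' h1 h2 (by linarith [hx'.1]) (by linarith [hx'.2])
      (h.τgt t1 (by linarith [hx'.1]) (by linarith [hx'.2]) hx'.2)]
    rfl
  . have aux : (F x y).n = Cp -> (∀ x', y < x' -> x' <= y1 -> τ x' < τ y) ->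
        ∀ᶠ x' in 𝓝[>] y, (F x x').c = (F x y).n := by
      intro e1 e2
      filter_upwards [Ioo_mem_nhdsGT h4] with x' hx'
      rw [h.above x x' h1 h2 (by linarith [hx'.1]) hx'.2.le (c ▸ e2 x' hx'.1 hx'.2.le), e1]
      rfl
    have aux2 : y = b' (σ x) -> ∀ x', y < x' -> x' <= y1 -> τ x' < τ y := fun e x' q1 q2 =>
      h.τlt (h.τ0 y h3 h4.le) ° q2 (c ▸ e ▸ q1)
    rcases h.diag h1 h2 h3 h4.le c with ⟨d1, d2, d3⟩ | ⟨d1, d2, d3⟩ | ⟨d1, d2, d3⟩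
    . exact absurd d2 h4.ne
    . refine aux (by rw [d1, d2]; exact h.sen) (aux2 (by rw [d3, h.b1', d2]))
    . rcases d3 with ⟨d4, d5, z, d6, d7⟩ | ⟨d4, d5, d6, d7, d8⟩
      . refine aux (by rw [d7]; rfl) (aux2 d5)
      . rcases d7.eq_or_lt with d7 | d7
        . refine aux ?_ (aux2 d7)
          have := d8.t x d4 d5
          rwa [<- d7] at this
        . exact d8.mod.gN x y d4 d5 d6 d7
  . rw [h.above x y h1 h2 h3 h4.le c]
    filter_upwards [Ioo_mem_nhdsGT h4] with x' hx'
    rw [h.above x x' h1 h2 (by linarith [hx'.1]) hx'.2.le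
      ((h.τanti h3 hx'.2.le hx'.1.le).trans_lt c)]
    rfl
theorem ShufM.fF (h : ShufM K F x0 x1 y0 y1 Cm Cp σ τ a b a' b') :
    ∀ x y, x0 <= x -> x <= x1 -> y0 <= y -> y <= y1 -> ∀ α, mb α (F x y).c.1 ->
    ∃ x' y', x <= x' /\ x' <= x1 /\ y <= y' /\ y' <= y1 /\
      (realF K (F x' y') α \/ (mb α (F x' y').c.1 /\ (x' = x1 \/ y' = y1))) := by
  have hx := h.hx
  have hy := h.hy
  have exit : ∀ x y, x <= x1 -> y <= y1 -> ∀ α, mb α Cp.1 -> ∃ x' y', x <= x' /\ x' <= x1 /\ y <= y' /\ y' <= y1 /\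
      (realF K (F x' y') α \/ (mb α (F x' y').c.1 /\ (x' = x1 \/ y' = y1))) := by
    intro x y q1 q2 α hα
    refine ⟨x1, y1, q1, le_rfl, q2, le_rfl, .inr ⟨?_, .inl rfl⟩⟩
    have e1 : σ x1 = 1 := h.σeq zero_le_one le_rfl h.a1.le h.b1.ge
    have e2 : τ y1 = 0 := h.τeq le_rfl zero_le_one h.a0'.le h.b0'.ge
    rw [h.above x1 y1 h.hx.le le_rfl h.hy.le le_rfl (by rw [e1, e2]; exact zero_lt_one)]
    exact hα
  have eqc : ∀ x y, x0 <= x -> x <= x1 -> y0 <= y -> y <= y1 -> σ x = τ y -> ∀ α, mb α (F x y).c.1 ->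
      ∃ x' y', x <= x' /\ x' <= x1 /\ y <= y' /\ y' <= y1 /\
      (realF K (F x' y') α \/ (mb α (F x' y').c.1 /\ (x' = x1 \/ y' = y1))) := by
    intro x y h1 h2 h3 h4 c α hα
    rcases h.diag h1 h2 h3 h4 c with ⟨d1, d2, d3⟩ | ⟨d1, d2, d3⟩ | ⟨d1, d2, d3⟩
    . exact ⟨x, y, le_rfl, h2, le_rfl, h4, .inr ⟨hα, .inr d2⟩⟩
    . exact ⟨x, y, le_rfl, h2, le_rfl, h4, .inr ⟨hα, .inl d1⟩⟩
    . rcases d3 with ⟨d4, d5, z, d6, d7⟩ | ⟨d4, d5, d6, d7, d8⟩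
      . rw [d7] at hα
        rcases d6.stepF hα with e | e | e
        . exact ⟨x, y, le_rfl, h2, le_rfl, h4, .inl (by rw [d7]; exact e)⟩
        . exact exit x y h2 h4 α e
        . exact exit x y h2 h4 α e
      . have m1 := h.a_mem d1.le d2.le
        have m2 := h.a_mem' d1.le d2.le
        rcases d8.fF d4 d5 d6 d7 hα with e | ⟨x', y', e1, e2, e3, e4, e5⟩
        . exact exit x y h2 h4 α e
        . exact ⟨x', y', e1, °, e3, °, .inl e5⟩
  intro x y h1 h2 h3 h4 α hα
  rcases lt_trichotomy (σ x) (τ y) with c | c | c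
  . have e := h.below x y h1 h2 h3 h4 c
    rw [e] at hα
    have t0 := h.σ0 x h1 h2
    have t1 := h.τ1 y h3 h4
    rcases h.dF _ _ t0 c t1 α hα with d | d | ⟨u, u1, u2, u3⟩
    . exact ⟨x, y, le_rfl, h2, le_rfl, h4, .inl (by rw [e]; exact ⟨rfl, hα, .inr ⟨.inl rfl, d⟩⟩)⟩
    . exact exit x y h2 h4 α d
    . have k1 := h.σb x h1 h2
      have k2 := h.lt _ _ t0 u1 °
      have k3 := h.τb y h3 h4
      have k4 := h.lt' u _ ° u2 t1
      have m1 := h.a_mem (s := u) ° °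
      have m2 := h.a_mem' (s := u) ° °
      have n1 := h.ab u ° °
      have n2 := h.ab' u ° °
      obtain ⟨x', y', e1, e2, e3, e4, e5⟩ := eqc (a u) (a' u) m1.1 ° m2.1 °
        (by rw [h.σeq ° ° le_rfl n1, h.τeq ° ° le_rfl n2])
        α u3
      exact ⟨x', y', °, e2, °, e4, e5⟩
  . exact eqc x y h1 h2 h3 h4 c α hα
  . rw [h.above x y h1 h2 h3 h4 c] at hα
    exact exit x y h2 h4 α hα
theorem ShufM.model (h : ShufM K F x0 x1 y0 y1 Cm Cp σ τ a b a' b') : Model K F x0 x1 y0 y1 := by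
  have key : ∀ x y, x0 <= x -> x <= x1 -> y0 <= y -> y <= y1 -> Valid K (F x y) /\
      (x0 < x -> x < x1 -> (F x y).re = true) := by
    intro x y h1 h2 h3 h4
    rcases lt_trichotomy (σ x) (τ y) with c | c | c
    . rw [h.below x y h1 h2 h3 h4 c]; exact ⟨h.vm, fun _ _ => rfl⟩
    . rcases h.diag h1 h2 h3 h4 c with ⟨d1, d2, d3⟩ | ⟨d1, d2, d3⟩ | ⟨d1, d2, d3⟩
      . exact ⟨d1 ▸ d2 ▸ h.vnw, fun q _ => absurd d1 q.ne'⟩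
      . exact ⟨d1 ▸ d2 ▸ h.vse, fun _ q => absurd d1 q.ne⟩
      . rcases d3 with ⟨d4, d5, z, d6, d7⟩ | ⟨d4, d5, d6, d7, d8⟩
        . rw [d7]; exact ⟨d6, fun _ _ => rfl⟩
        . exact ⟨d8.mod.val x y d4 d5 d6 d7, fun _ _ => d8.re x y d4 d5 d6 d7⟩
    . rw [h.above x y h1 h2 h3 h4 c]; exact ⟨h.vp, fun _ _ => rfl⟩
  have hd : Model K.dual (fD F) (-y1) (-y0) (-x1) (-x0) -> Model K F x0 x1 y0 y1 := Model.of_dual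
  have aux : ∀ (z : ℝ) (P : ℝ -> Prop), (∀ᶠ u in 𝓝[>] (-z), P (-u)) -> ∀ᶠ u in 𝓝[<] z, P u := by
    intro z P hP
    have := (tendsto_neg_nhdsLT (a := z)).eventually hP
    simpa using this
  refine ⟨fun x y h1 h2 h3 h4 => (key x y h1 h2 h3 h4).1, fun x y h1 h2 h3 h4 =>
    (key x y h1.le h2.le h3.le h4.le).2 h1 h2, h.gN, ?_, h.gE, ?_, h.fF, ?_⟩
  . intro x y h1 h2 h3 h4
    have := h.dual.gE (-y) (-x) ° ° ° °
    apply aux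
    filter_upwards [this] with u hu
    simp only [fD, neg_neg, PT.du_c, PT.du_e] at hu
    exact Prod.swap_injective hu
  . intro x y h1 h2 h3 h4
    have := h.dual.gN (-y) (-x) ° ° ° °
    apply aux
    filter_upwards [this] with u hu
    simp only [fD, neg_neg, PT.du_c, PT.du_n] at hu
    exact Prod.swap_injective hu
  . intro x y h1 h2 h3 h4 α hα
    obtain ⟨x', y', e1, e2, e3, e4, e5⟩ := h.dual.fF (-y) (-x) ° ° °
      ° α (by simp only [fD, neg_neg]; exact hα)
    refine ⟨-y', -x', °, °, °, °, ?_⟩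
    rcases e5 with e5 | ⟨e5, e6⟩
    . left
      have := e5.dual
      simpa [fD] using this
    . right
      refine ⟨e5, ?_⟩
      rcases e6 with e6 | e6
      . right; linarith
      . left; linarith

end
end

section
/-! ### Cantor-style blow up, dense colouring -/
theorem cantor (J : Set ℝ) (hJ : J.Countable) (h01 : J ⊆ Set.Ioo 0 1) :
    ∃ (M : ℝ) (α β σ : ℝ -> ℝ), 0 < M /\ (∀ s, α s <= β s) /\ (∀ s, α s = β s ↔ s ∉ J) /\
      (∀ s t, s < t -> β s < α t) /\ α 0 = 0 /\ β 0 = 0 /\ α 1 = M /\ β 1 = M /\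
      (∀ u, 0 <= u -> u <= M -> 0 <= σ u /\ σ u <= 1 /\ α (σ u) <= u /\ u <= β (σ u)) := by
  classical
  haveI : Encodable J := hJ.toEncodable
  obtain ⟨w, wpos, -, ⟨hw, -⟩⟩ := (⟨_, (posSumOfEncodable one_pos J).2.1, 0, by
    obtain ⟨c, hc, -⟩ := (posSumOfEncodable one_pos J).2.2
    exact ⟨hc.summable, trivial⟩⟩ : ∃ w : J -> ℝ, (∀ i, 0 < w i) /\ ∃ c : ℕ, Summable w /\ True)
  obtain ⟨φ, hφ⟩ : ∃ φ : ℝ -> J -> ℝ, φ = fun (s : ℝ) (j : J) => if (j : ℝ) < s then w j else 0 := ⟨_, rfl⟩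
  obtain ⟨ψ, hψ⟩ : ∃ ψ : ℝ -> J -> ℝ, ψ = fun (s : ℝ) (j : J) => if (j : ℝ) <= s then w j else 0 := ⟨_, rfl⟩
  have φ0 : ∀ s j, 0 <= φ s j := fun s j => by simp only [hφ]; split_ifs <;> linarith [wpos j]
  have ψ0 : ∀ s j, 0 <= ψ s j := fun s j => by simp only [hψ]; split_ifs <;> linarith [wpos j]
  have φw : ∀ s j, φ s j <= w j := fun s j => by simp only [hφ]; split_ifs <;> linarith [wpos j]
  have ψw : ∀ s j, ψ s j <= w j := fun s j => by simp only [hψ]; split_ifs <;> linarith [wpos j]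
  have sφ : ∀ s, Summable (φ s) := fun s => Summable.of_nonneg_of_le (φ0 s) (φw s) hw
  have sψ : ∀ s, Summable (ψ s) := fun s => Summable.of_nonneg_of_le (ψ0 s) (ψw s) hw
  have φψ : ∀ s j, φ s j <= ψ s j := fun s j => by
    simp only [hφ, hψ]
    split_ifs <;> linarith [wpos j]
  have ψφ : ∀ s t, s < t -> ∀ j, ψ s j <= φ t j := fun s t hst j => by
    simp only [hφ, hψ]
    split_ifs <;> linarith [wpos j]
  obtain ⟨α, hα⟩ : ∃ α : ℝ -> ℝ, α = fun s => s + ∑' j, φ s j := ⟨_, rfl⟩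
  obtain ⟨β, hβ⟩ : ∃ β : ℝ -> ℝ, β = fun s => s + ∑' j, ψ s j := ⟨_, rfl⟩
  have hle : ∀ s, α s <= β s := fun s => by
    simp only [hα, hβ]
    have := (sφ s).tsum_le_tsum (φψ s) (sψ s)
    linarith
  have hlt : ∀ s t, s < t -> β s < α t := fun s t hst => by
    simp only [hα, hβ]
    have := (sψ s).tsum_le_tsum (ψφ s t hst) (sφ t)
    linarith
  have heq : ∀ s, α s = β s ↔ s ∉ J := fun s => by
    constructor
    . intro h hs
      have : ∑' j, φ s j < ∑' j, ψ s j := by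
        refine Summable.tsum_lt_tsum (i := ⟨s, hs⟩) (φψ s) ?_ (sφ s) (sψ s)
        simp [hφ, hψ, wpos]
      simp only [hα, hβ] at h
      linarith
    . intro h
      have : φ s = ψ s := by
        funext j
        have : (j : ℝ) ≠ s := fun e => h (e ▸ j.2)
        simp only [hφ, hψ, le_iff_lt_or_eq, this, or_false]
      simp only [hα, hβ, this]
  have ha0 : α 0 = 0 := by
    have : φ 0 = fun _ => 0 := by
      funext j; simp only [hφ]; rw [if_neg (not_lt.2 (h01 j.2).1.le)]
    simp [hα, this]
  have hb0 : β 0 = 0 := by rw [<- (heq 0).2 fun h => lt_irrefl _ (h01 h).1, ha0]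
  have hb1 : β 1 = α 1 := ((heq 1).2 fun h => lt_irrefl _ (h01 h).2).symm
  have hM : 0 < α 1 := by have := hlt 0 1 one_pos; rwa [hb0] at this
  have hmono : ∀ s t, s <= t -> α s <= α t := fun s t hst => by
    rcases hst.eq_or_lt with rfl | h
    . exact le_rfl
    . exact (hle s).trans (hlt s t h).le
  have lc : ∀ s, Tendsto α (𝓝[<] s) (𝓝 (α s)) := fun s => by
    simp only [hα]
    refine Tendsto.add (tendsto_id.mono_left nhdsWithin_le_nhds) ?_
    refine tendsto_tsum_of_dominated_convergence hw (fun j => ?_) (Eventually.of_forall fun t j => ?_)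
    . refine tendsto_const_nhds.congr' ?_
      by_cases hj : (j : ℝ) < s
      . filter_upwards [Ioo_mem_nhdsLT hj] with t ht
        simp only [hφ, if_pos hj, if_pos ht.1]
      . filter_upwards [self_mem_nhdsWithin] with t ht
        have ht : t < s := ht
        simp only [hφ, if_neg hj]
        rw [if_neg °]
    . rw [Real.norm_of_nonneg (φ0 t j)]; exact φw t j
  have rc : ∀ s, Tendsto β (𝓝[>] s) (𝓝 (β s)) := fun s => by
    simp only [hβ]
    refine Tendsto.add (tendsto_id.mono_left nhdsWithin_le_nhds) ?_
    refine tendsto_tsum_of_dominated_convergence hw (fun j => ?_) (Eventually.of_forall fun t j => ?_)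
    . refine tendsto_const_nhds.congr' ?_
      by_cases hj : (j : ℝ) <= s
      . filter_upwards [self_mem_nhdsWithin] with t ht
        have ht : s < t := ht
        simp only [hψ, if_pos hj]
        rw [if_pos °]
      . filter_upwards [Ioo_mem_nhdsGT (not_le.1 hj)] with t ht
        simp only [hψ, if_neg hj]
        rw [if_neg (by linarith [ht.2])]
    . rw [Real.norm_of_nonneg (ψ0 t j)]; exact ψw t j
  have ex : ∀ u, 0 <= u -> u <= α 1 -> ∃ s, 0 <= s /\ s <= 1 /\ α s <= u /\ u <= β s := by
    intro u hu0 hu1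
    obtain ⟨S, hS⟩ : ∃ S : Set ℝ, S = {s | 0 <= s /\ s <= 1 /\ α s <= u} := ⟨_, rfl⟩
    have h0S : (0 : ℝ) ∈ S := hS ▸ ⟨le_rfl, zero_le_one, by rw [ha0]; exact hu0⟩
    have hbd : BddAbove S := ⟨1, fun s hs => by rw [hS] at hs; exact hs.2.1⟩
    obtain ⟨s, hs⟩ : ∃ s, s = sSup S := ⟨_, rfl⟩
    have s0 : 0 <= s := hs ▸ le_csSup hbd h0S
    have s1 : s <= 1 := hs ▸ csSup_le ⟨0, h0S⟩ fun s hs => by rw [hS] at hs; exact hs.2.1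
    refine ⟨s, s0, s1, ?_, ?_⟩
    . refine le_of_tendsto (lc s) ?_
      filter_upwards [self_mem_nhdsWithin] with t ht
      have ht : t < s := ht
      obtain ⟨z, hz1, hz2⟩ := exists_lt_of_lt_csSup ⟨0, h0S⟩ (hs ▸ ht)
      rw [hS] at hz1
      exact (hmono _ _ hz2.le).trans hz1.2.2
    . rcases s1.eq_or_lt with e | e
      . rw [e, hb1]; exact hu1
      refine ge_of_tendsto (rc s) ?_
      filter_upwards [Ioo_mem_nhdsGT e] with t ht
      by_contra hc
      have : t ∈ S := hS ▸ ⟨by linarith [ht.1], ht.2.le, (hle t).trans (not_le.1 hc).le⟩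
      have := le_csSup hbd this
      linarith [ht.1]
  have ex' : ∀ u, ∃ s, 0 <= u -> u <= α 1 -> 0 <= s /\ s <= 1 /\ α s <= u /\ u <= β s := fun u => by
    by_cases h : 0 <= u /\ u <= α 1
    . obtain ⟨s, hs⟩ := ex u h.1 h.2
      exact ⟨s, fun _ _ => hs⟩
    . exact ⟨0, fun h1 h2 => absurd ⟨h1, h2⟩ h⟩
  choose σ hσ using ex'
  exact ⟨α 1, α, β, σ, hM, hle, heq, hlt, ha0, hb0, rfl, hb1, hσ⟩
theorem exists_kappa : ∃ κ : ℝ -> ℕ, (∀ s t : ℝ, s < t -> ∀ j, ∃ u, s < u /\ u < t /\ κ u = j) /\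
    {x | κ x ≠ 0}.Countable := by
  classical
  obtain ⟨κ, hκ⟩ : ∃ κ : ℝ -> ℕ, κ = fun x =>
    if h : ∃ (j : ℕ) (r : ℚ), x = r + j * √2 then h.choose else 0 := ⟨_, rfl⟩
  have uniq : ∀ (j j' : ℕ) (r r' : ℚ), (r : ℝ) + j * √2 = r' + j' * √2 -> j = j' := by
    intro j j' r r' h
    by_contra hne
    have hne' : ((j : ℝ) - j') ≠ 0 := sub_ne_zero.2 (by exact_mod_cast hne)
    have : √2 = ((r' - r) / ((j : ℚ) - j') : ℚ) := by
      push_cast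
      rw [eq_div_iff hne']
      linarith
    exact irrational_sqrt_two ⟨_, this.symm⟩
  have val : ∀ (j : ℕ) (r : ℚ), κ (r + j * √2) = j := by
    intro j r
    have h : ∃ (j' : ℕ) (r' : ℚ), (r + j * √2 : ℝ) = r' + j' * √2 := ⟨j, r, rfl⟩
    simp only [hκ]
    rw [dif_pos h]
    obtain ⟨r', hr'⟩ := h.choose_spec
    exact (uniq _ _ _ _ hr').symm
  refine ⟨κ, ?_, ?_⟩
  . intro s t hst j
    obtain ⟨r, h1, h2⟩ := exists_rat_btwn (show s - j * √2 < t - j * √2 by linarith)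
    exact ⟨r + j * √2, °, °, val j r⟩
  . refine (Set.countable_range fun p : ℕ × ℚ => (p.2 : ℝ) + p.1 * √2).mono ?_
    intro x hx
    by_cases h : ∃ (j : ℕ) (r : ℚ), x = r + j * √2
    . obtain ⟨j, r, e⟩ := h
      exact ⟨(j, r), e.symm⟩
    . exact absurd (by simp only [hκ]; rw [dif_neg h]) hx
end

section
/-! ### Soundness of the shuffle rule -/
theorem IsTr.exists_place {α : Type} : ∀ (w : List α) (a b : ℝ), a < b -> w.length % 2 = 1 ->
    ∃ g : ℝ -> α, IsTr g a b w
  | [], _, _, _, h => by simp at h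
  | [s], a, b, hab, _ => ⟨fun _ => s, IsTr.one hab fun _ _ _ => rfl⟩
  | s :: v :: w, a, b, hab, h => by
    classical
    have h1 : a < (a + b) / 2 := °
    have h2 : (a + b) / 2 < b := °
    obtain ⟨g, hg⟩ := IsTr.exists_place w _ b h2 (by simp only [List.length_cons] at h; omega)
    refine ⟨fun x => if x < (a + b) / 2 then s else if x = (a + b) / 2 then v else g x,
      IsTr.cons h1 (fun x _ hx => if_pos hx) (by simp) (hg.congr fun x hx _ => ?_)⟩
    rw [if_neg (not_lt.2 hx.le), if_neg hx.ne']
theorem HasLab.congr {f g : ℝ -> ℝ -> PT} {x0 x1 y0 y1 : ℝ} {q : Lab} (h : HasLab f x0 x1 y0 y1 q)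
    (hg : ∀ x y, x0 <= x -> x <= x1 -> y0 <= y -> y <= y1 -> g x y = f x y) : HasLab g x0 x1 y0 y1 q := by
  have hx := h.b.lt.le
  have hy := h.l.lt.le
  constructor
  . rw [hg _ _ le_rfl hx le_rfl hy, h.sw]
  . rw [hg _ _ hx le_rfl le_rfl hy, h.se]
  . rw [hg _ _ le_rfl hx hy le_rfl, h.nw]
  . rw [hg _ _ hx le_rfl hy le_rfl, h.ne]
  . exact h.l.congr fun y h1 h2 => hg _ _ le_rfl hx h1.le h2.le
  . exact h.r.congr fun y h1 h2 => hg _ _ hx le_rfl h1.le h2.le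
  . exact h.b.congr fun y h1 h2 => hg _ _ h1.le h2.le le_rfl hy
  . exact h.t.congr fun y h1 h2 => hg _ _ h1.le h2.le hy le_rfl
theorem HasLab.edge_l {f : ℝ -> ℝ -> PT} {x0 x1 y0 y1 : ℝ} {q : Lab} (h : HasLab f x0 x1 y0 y1 q)
    {y : ℝ} (h1 : y0 <= y) (h2 : y <= y1) : f x0 y = q.sw \/ f x0 y ∈ q.l \/ (y = y1 /\ f x0 y = q.nw) := by
  rcases h1.eq_or_lt with rfl | h1
  . exact .inl h.sw
  rcases h2.eq_or_lt with rfl | h2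
  . exact .inr (.inr ⟨rfl, h.nw⟩)
  . exact .inr (.inl (h.l.mem y h1 h2))
theorem HasLab.edge_b {f : ℝ -> ℝ -> PT} {x0 x1 y0 y1 : ℝ} {q : Lab} (h : HasLab f x0 x1 y0 y1 q)
    {x : ℝ} (h1 : x0 <= x) (h2 : x <= x1) : f x y0 = q.sw \/ f x y0 ∈ q.b \/ (x = x1 /\ f x y0 = q.se) := by
  rcases h1.eq_or_lt with rfl | h1
  . exact .inl h.sw
  rcases h2.eq_or_lt with rfl | h2
  . exact .inr (.inr ⟨rfl, h.se⟩)
  . exact .inr (.inl (h.b.mem x h1 h2))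
theorem HasLab.edge_r {f : ℝ -> ℝ -> PT} {x0 x1 y0 y1 : ℝ} {q : Lab} (h : HasLab f x0 x1 y0 y1 q)
    {y : ℝ} (h1 : y0 <= y) (h2 : y <= y1) : f x1 y = q.ne \/ f x1 y ∈ q.r \/ (y = y0 /\ f x1 y = q.se) := by
  rcases h1.eq_or_lt with rfl | h1
  . exact .inr (.inr ⟨rfl, h.se⟩)
  rcases h2.eq_or_lt with rfl | h2
  . exact .inl h.ne
  . exact .inr (.inl (h.r.mem y h1 h2))
theorem HasLab.edge_t {f : ℝ -> ℝ -> PT} {x0 x1 y0 y1 : ℝ} {q : Lab} (h : HasLab f x0 x1 y0 y1 q)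
    {x : ℝ} (h1 : x0 <= x) (h2 : x <= x1) : f x y1 = q.ne \/ f x y1 ∈ q.t \/ (x = x0 /\ f x y1 = q.nw) := by
  rcases h1.eq_or_lt with rfl | h1
  . exact .inr (.inr ⟨rfl, h.nw⟩)
  rcases h2.eq_or_lt with rfl | h2
  . exact .inl h.ne
  . exact .inr (.inl (h.t.mem x h1 h2))
theorem HasLab.compatF {K : Sys} {Cm Cp : Clu} {f : ℝ -> ℝ -> PT} {x0 x1 y0 y1 : ℝ} {q : Lab}
    (h : HasLab f x0 x1 y0 y1 q) (m : Model K f x0 x1 y0 y1) (c : Compat K Cm Cp q) :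
    CompatF K Cm Cp f x0 x1 y0 y1 where
  hx := h.b.lt
  hy := h.l.lt
  mod := m
  re x y h1 h2 h3 h4 := by
    rcases h1.eq_or_lt with rfl | h1
    . rcases h.edge_l h3 h4 with e | e | ⟨-, e⟩
      . rw [e, c.re5]
      . exact c.re1 _ e
      . rw [e, c.re7]
    rcases h2.eq_or_lt with rfl | h2
    . rcases h.edge_r h3 h4 with e | e | ⟨-, e⟩
      . rw [e, c.re8]
      . exact c.re2 _ e
      . rw [e, c.re6]
    rcases h3.eq_or_lt with rfl | h3
    . rcases h.edge_b h1.le h2.le with e | e | ⟨-, e⟩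
      . rw [e, c.re5]
      . exact c.re3 _ e
      . rw [e, c.re6]
    rcases h4.eq_or_lt with rfl | h4
    . rcases h.edge_t h1.le h2.le with e | e | ⟨-, e⟩
      . rw [e, c.re8]
      . exact c.re4 _ e
      . rw [e, c.re7]
    exact m.re x y h1 h2 h3 h4
  l y h1 h2 := by
    rcases h.edge_l h1 h2 with e | e | ⟨-, e⟩
    . rw [e, c.sww]
    . exact c.l _ e
    . rw [e, c.nww]
  r y h1 h2 := by
    rcases h.edge_r h1 h2 with e | e | ⟨-, e⟩
    . rw [e, c.nee]
    . exact c.r _ e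
    . rw [e, c.see]
  b y h1 h2 := by
    rcases h.edge_b h1 h2 with e | e | ⟨-, e⟩
    . rw [e, c.sws]
    . exact c.b _ e
    . rw [e, c.ses]
  t y h1 h2 := by
    rcases h.edge_t h1 h2 with e | e | ⟨-, e⟩
    . rw [e, c.nen]
    . exact c.t _ e
    . rw [e, c.nwn]
  okt x h1 h2 := by
    rcases h.edge_t h1.le h2 with e | e | ⟨e, -⟩
    . exact c.okt _ (List.mem_cons.2 (.inl e))
    . exact c.okt _ (List.mem_cons.2 (.inr e))
    . exact absurd e h1.ne'
  okr x h1 h2 := by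
    rcases h.edge_r h1.le h2 with e | e | ⟨e, -⟩
    . exact c.okr _ (List.mem_cons.2 (.inl e))
    . exact c.okr _ (List.mem_cons.2 (.inr e))
    . exact absurd e h1.ne'
  okl x h1 h2 := by
    rcases h.edge_l h1 h2.le with e | e | ⟨e, -⟩
    . exact c.okl _ (List.mem_cons.2 (.inl e))
    . exact c.okl _ (List.mem_cons.2 (.inr e))
    . exact absurd e h2.ne
  okb x h1 h2 := by
    rcases h.edge_b h1 h2.le with e | e | ⟨e, -⟩
    . exact c.okb _ (List.mem_cons.2 (.inl e))
    . exact c.okb _ (List.mem_cons.2 (.inr e))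
    . exact absurd e h2.ne
theorem Snd.shuf {K : Sys} {X : List Lab} {q : Lab} (hX : ∀ o ∈ X, Snd K o) (h : RShuf K X q)
    (ho : OddL q) : Snd K q := by
  classical
  refine ⟨ho, ?_⟩
  intro x0 x1 y0 y1 gL gB hx hy hl hb
  obtain ⟨Cm, hCm⟩ : ∃ c, c = q.sw.c := ⟨_, rfl⟩
  obtain ⟨Cp, hCp⟩ : ∃ c, c = q.ne.c := ⟨_, rfl⟩
  have hsw : q.sw = kap Cm := by rw [hCm]; exact h.sw
  have hne : q.ne = kap Cp := by rw [hCp]; exact h.ne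
  obtain ⟨Ok, hOk⟩ : ∃ Ok : Clu ⊕ Lab -> Prop, Ok = fun p => match p with
    | Sum.inl c => Valid K (fillPT Cm Cp c)
    | Sum.inr o => o ∈ X /\ Compat K Cm Cp o := ⟨_, rfl⟩
  obtain ⟨PA, hPA⟩ : ∃ PA : Clu ⊕ Lab -> ℕ -> Prop, PA = fun p a => match p with
    | Sum.inl c => mb a c.1
    | Sum.inr o => mb a o.sw.c.1 := ⟨_, rfl⟩
  obtain ⟨PB, hPB⟩ : ∃ PB : Clu ⊕ Lab -> ℕ -> Prop, PB = fun p a => match p with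
    | Sum.inl c => mb a c.2
    | Sum.inr o => mb a o.ne.c.2 := ⟨_, rfl⟩
  obtain ⟨c0, hc0⟩ := h.fill
  rw [<- hCm, <- hCp] at hc0
  have hp : ∀ j : ℕ, ∃ p, Ok p /\ (j = 0 -> p = Sum.inl c0) /\
      (∀ a, j = 2 * a + 1 -> (∃ p, Ok p /\ PA p a) -> PA p a) /\
      (∀ a, j = 2 * a + 2 -> (∃ p, Ok p /\ PB p a) -> PB p a) := by
    intro j
    have hok0 : Ok (Sum.inl c0) := by rw [hOk]; exact hc0
    rcases Nat.eq_zero_or_pos j with rfl | hj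
    . exact ⟨Sum.inl c0, hok0, fun _ => rfl, fun a e => by omega, fun a e => by omega⟩
    by_cases e1 : ∃ a, j = 2 * a + 1 /\ ∃ p, Ok p /\ PA p a
    . obtain ⟨a, rfl, p, h1, h2⟩ := e1
      refine ⟨p, h1, fun e => by omega, fun b e _ => ?_, fun b e => by omega⟩
      obtain rfl : a = b := by omega
      exact h2
    by_cases e2 : ∃ a, j = 2 * a + 2 /\ ∃ p, Ok p /\ PB p a
    . obtain ⟨a, rfl, p, h1, h2⟩ := e2
      refine ⟨p, h1, fun e => by omega, fun b e => by omega, fun b e _ => ?_⟩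
      obtain rfl : a = b := by omega
      exact h2
    exact ⟨Sum.inl c0, hok0, fun _ => rfl, fun a e hh => absurd ⟨a, e, hh⟩ e1,
      fun a e hh => absurd ⟨a, e, hh⟩ e2⟩
  choose pc pok pc0 pcA pcB using hp
  obtain ⟨κ, κd, κc⟩ := exists_kappa
  obtain ⟨J, hJ⟩ : ∃ J : Set ℝ, J = {s | 0 < s /\ s < 1 /\ ∃ o, pc (κ s) = Sum.inr o} := ⟨_, rfl⟩
  have Jc : J.Countable := κc.mono (by
    intro s hs
    rw [hJ] at hs
    obtain ⟨-, -, o, e⟩ := hs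
    intro h0
    rw [h0, pc0 0 rfl] at e
    cases e)
  obtain ⟨M, α, β, σ, hM, αβ, αβJ, hlt, α0, β0, α1, β1, hσ⟩ := cantor J Jc
    (fun s hs => by rw [hJ] at hs; exact ⟨hs.1, hs.2.1⟩)
  obtain ⟨kx, hkx⟩ : ∃ k, k = (x1 - x0) / M := ⟨_, rfl⟩
  obtain ⟨ky, hky⟩ : ∃ k, k = (y1 - y0) / M := ⟨_, rfl⟩
  have kx0 : 0 < kx := hkx ▸ div_pos ° hM
  have ky0 : 0 < ky := hky ▸ div_pos ° hM
  have kxM : M * kx = x1 - x0 := by rw [hkx]; field_simp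
  have kyM : M * ky = y1 - y0 := by rw [hky]; field_simp
  obtain ⟨a, ha⟩ : ∃ a : ℝ -> ℝ, a = fun s => x0 + α s * kx := ⟨_, rfl⟩
  obtain ⟨b, hb'⟩ : ∃ a : ℝ -> ℝ, a = fun s => x0 + β s * kx := ⟨_, rfl⟩
  obtain ⟨a', ha'⟩ : ∃ a : ℝ -> ℝ, a = fun s => y1 - β s * ky := ⟨_, rfl⟩
  obtain ⟨b', hbb'⟩ : ∃ a : ℝ -> ℝ, a = fun s => y1 - α s * ky := ⟨_, rfl⟩
  obtain ⟨S, hS⟩ : ∃ a : ℝ -> ℝ, a = fun x => σ ((x - x0) / kx) := ⟨_, rfl⟩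
  obtain ⟨T, hT⟩ : ∃ a : ℝ -> ℝ, a = fun y => σ ((y1 - y) / ky) := ⟨_, rfl⟩
  have Sp : ∀ x, x0 <= x -> x <= x1 -> 0 <= S x /\ S x <= 1 /\ a (S x) <= x /\ x <= b (S x) := by
    intro x h1 h2
    have := hσ ((x - x0) / kx) (div_nonneg ° kx0.le)
      (by rw [div_le_iff₀ kx0, kxM]; linarith)
    rw [le_div_iff₀ kx0, div_le_iff₀ kx0] at this
    simp only [hS, ha, hb']
    exact ⟨this.1, this.2.1, by linarith [this.2.2.1], by linarith [this.2.2.2]⟩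
  have Tp : ∀ y, y0 <= y -> y <= y1 -> 0 <= T y /\ T y <= 1 /\ a' (T y) <= y /\ y <= b' (T y) := by
    intro x h1 h2
    have := hσ ((y1 - x) / ky) (div_nonneg ° ky0.le)
      (by rw [div_le_iff₀ ky0, kyM]; linarith)
    rw [le_div_iff₀ ky0, div_le_iff₀ ky0] at this
    simp only [hT, ha', hbb']
    exact ⟨this.1, this.2.1, by linarith [this.2.2.2], by linarith [this.2.2.1]⟩
  have ab : ∀ s, a s <= b s := fun s => by
    simp only [ha, hb']; have := mul_le_mul_of_nonneg_right (αβ s) kx0.le; linarith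
  have ab' : ∀ s, a' s <= b' s := fun s => by
    simp only [ha', hbb']; have := mul_le_mul_of_nonneg_right (αβ s) ky0.le; linarith
  have eab : ∀ s, a s = b s ↔ s ∉ J := fun s => by
    rw [<- αβJ]; simp only [ha, hb', add_right_inj, mul_left_inj' kx0.ne']
  have eab' : ∀ s, a' s = b' s ↔ s ∉ J := fun s => by
    rw [<- αβJ]; simp only [ha', hbb', sub_right_inj, mul_left_inj' ky0.ne']; exact eq_comm
  have lt : ∀ s t, s < t -> b s < a t := fun s t hst => by
    simp only [ha, hb']; have := mul_lt_mul_of_pos_right (hlt s t hst) kx0; linarith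
  have lt' : ∀ s t, s < t -> b' t < a' s := fun s t hst => by
    simp only [ha', hbb']; have := mul_lt_mul_of_pos_right (hlt s t hst) ky0; linarith
  have Su : ∀ s x, x0 <= x -> x <= x1 -> a s <= x -> x <= b s -> S x = s := fun s x h1 h2 h3 h4 => by
    obtain ⟨-, -, p3, p4⟩ := Sp x h1 h2
    rcases lt_trichotomy (S x) s with e | e | e
    . linarith [lt _ _ e]
    . exact e
    . linarith [lt _ _ e]
  have Tu : ∀ s x, y0 <= x -> x <= y1 -> a' s <= x -> x <= b' s -> T x = s := fun s x h1 h2 h3 h4 => by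
    obtain ⟨-, -, p3, p4⟩ := Tp x h1 h2
    rcases lt_trichotomy (T x) s with e | e | e
    . linarith [lt' _ _ e]
    . exact e
    . linarith [lt' _ _ e]
  have a0 : a 0 = x0 := by simp [ha, α0]
  have b0 : b 0 = x0 := by simp [hb', β0]
  have a1 : a 1 = x1 := by simp only [ha, α1, kxM]; ring
  have b1 : b 1 = x1 := by simp only [hb', β1, kxM]; ring
  have a0' : a' 0 = y1 := by simp [ha', β0]
  have b0' : b' 0 = y1 := by simp [hbb', α0]
  have a1' : a' 1 = y0 := by simp only [ha', β1, kyM]; ring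
  have b1' : b' 1 = y0 := by simp only [hbb', α1, kyM]; ring
  have Sx0 : S x0 = 0 := Su 0 x0 le_rfl hx.le a0.le b0.ge
  have Sx1 : S x1 = 1 := Su 1 x1 hx.le le_rfl a1.le b1.ge
  have Ty0 : T y0 = 1 := Tu 1 y0 le_rfl hy.le a1'.le b1'.ge
  have Ty1 : T y1 = 0 := Tu 0 y1 hy.le le_rfl a0'.le b0'.ge
  have cx : ∀ s, 0 < s -> s < 1 -> x0 < a s /\ b s < x1 /\ y0 < a' s /\ b' s < y1 := fun s h1 h2 =>
    ⟨b0 ▸ lt _ _ h1, a1 ▸ lt _ _ h2, b1' ▸ lt' _ _ h2, a0' ▸ lt' _ _ h1⟩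
  have hg : ∀ s, ∃ g : ℝ -> ℝ -> PT, ∀ o, 0 < s -> s < 1 -> pc (κ s) = Sum.inr o ->
      Model K g (a s) (b s) (a' s) (b' s) /\ HasLab g (a s) (b s) (a' s) (b' s) o := by
    intro s
    by_cases hs : ∃ o, 0 < s /\ s < 1 /\ pc (κ s) = Sum.inr o
    . obtain ⟨o, h1, h2, h3⟩ := hs
      have sJ : s ∈ J := by rw [hJ]; exact ⟨h1, h2, o, h3⟩
      have l1 : a s < b s := lt_of_le_of_ne (ab s) fun e => (eab s).1 e sJ
      have l2 : a' s < b' s := lt_of_le_of_ne (ab' s) fun e => (eab' s).1 e sJ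
      have hok := pok (κ s)
      rw [h3, hOk] at hok
      have so := hX o hok.1
      obtain ⟨g1, hg1⟩ := IsTr.exists_place o.l _ _ l2 so.odd.l
      obtain ⟨g2, hg2⟩ := IsTr.exists_place o.b _ _ l1 so.odd.b
      obtain ⟨f, q1, q2, -⟩ := so.ex _ _ _ _ g1 g2 l1 l2 hg1 hg2
      refine ⟨f, fun o' _ _ e => ?_⟩
      rw [h3] at e
      cases e
      exact ⟨q1, q2⟩
    . exact ⟨fun _ _ => dPT, fun o h1 h2 h3 => absurd ⟨o, h1, h2, h3⟩ hs⟩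
  choose g hg using hg
  obtain ⟨D, hD⟩ : ∃ D : ℝ -> ℝ -> ℝ -> PT, D = fun s x y => match pc (κ s) with
    | Sum.inl c => fillPT Cm Cp c
    | Sum.inr _ => g s x y := ⟨_, rfl⟩
  obtain ⟨F, hF⟩ : ∃ F : ℝ -> ℝ -> PT, F = fun x y =>
    if T y < S x then kap Cp else if S x < T y then kap Cm else
    if S x = 0 then q.nw else if S x = 1 then q.se else D (S x) x y := ⟨_, rfl⟩
  have Fab : ∀ x y, T y < S x -> F x y = kap Cp := fun x y e => by simp only [hF]; rw [if_pos e]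
  have Fbe : ∀ x y, S x < T y -> F x y = kap Cm := fun x y e => by
    simp only [hF]; rw [if_neg e.not_gt, if_pos e]
  have Fnw : F x0 y1 = q.nw := by simp [hF, Sx0, Ty1]
  have Fse : F x1 y0 = q.se := by simp [hF, Sx1, Ty0]
  have FD : ∀ s, 0 < s -> s < 1 -> ∀ x y, a s <= x -> x <= b s -> a' s <= y -> y <= b' s ->
      F x y = D s x y := by
    intro s h1 h2 x y h3 h4 h5 h6
    obtain ⟨c1, c2, c3, c4⟩ := cx s h1 h2
    have e1 : S x = s := Su s x ° ° h3 h4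
    have e2 : T y = s := Tu s y ° ° h5 h6
    simp only [hF, e1, e2, lt_irrefl, if_false, h1.ne', h2.ne]
  have FA : ∀ s, 0 < s -> s < 1 -> ∀ k, PA (pc (κ s)) k -> mb k (F (a s) (a' s)).c.1 := by
    intro s h1 h2 k hk
    rw [FD s h1 h2 _ _ le_rfl (ab s) le_rfl (ab' s)]
    cases e : pc (κ s) with
    | inl c => simp only [hD, e]; rw [e, hPA] at hk; exact hk
    | inr o => simp only [hD, e]; rw [(hg s o h1 h2 e).2.sw]; rw [e, hPA] at hk; exact hk
  have FB : ∀ s, 0 < s -> s < 1 -> ∀ k, PB (pc (κ s)) k -> mb k (F (b s) (b' s)).c.2 := by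
    intro s h1 h2 k hk
    rw [FD s h1 h2 _ _ (ab s) le_rfl (ab' s) le_rfl]
    cases e : pc (κ s) with
    | inl c => simp only [hD, e]; rw [e, hPB] at hk; exact hk
    | inr o => simp only [hD, e]; rw [(hg s o h1 h2 e).2.ne]; rw [e, hPB] at hk; exact hk
  have sm : ShufM K F x0 x1 y0 y1 Cm Cp S T a b a' b' := by
    refine ⟨hx, hy, fun x h1 h2 => (Sp x h1 h2).1, fun x h1 h2 => (Sp x h1 h2).2.1,
      fun x h1 h2 => (Sp x h1 h2).2.2.1, fun x h1 h2 => (Sp x h1 h2).2.2.2,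
      fun x h1 h2 => (Tp x h1 h2).1, fun x h1 h2 => (Tp x h1 h2).2.1,
      fun x h1 h2 => (Tp x h1 h2).2.2.1, fun x h1 h2 => (Tp x h1 h2).2.2.2,
      fun s _ _ => ab s, fun s _ _ => ab' s, fun s _ _ => by rw [eab, eab'],
      fun s t _ e _ => lt s t e, fun s t _ e _ => lt' s t e, a0, b0, a1, b1, a0', b0', a1', b1',
      hsw ▸ h.vsw, hne ▸ h.vne, fun x y _ _ _ _ e => Fab x y e, fun x y _ _ _ _ e => Fbe x y e,
      Fnw ▸ h.vnw, Fse ▸ h.vse, ?_, ?_, ?_, ?_, ?_, ?_, ?_, ?_⟩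
    . rw [Fnw, h.nwe, hCp]
    . rw [Fnw, h.nws, hCm]
    . rw [Fse, h.sen, hCp]
    . rw [Fse, h.sew, hCm]
    . intro s h1 h2 e
      have sJ := (eab s).1 e
      rw [FD s h1 h2 _ _ le_rfl (ab s) le_rfl (ab' s)]
      cases e : pc (κ s) with
      | inl c =>
        have := pok (κ s)
        rw [e, hOk] at this
        exact ⟨c, this, by simp only [hD, e]⟩
      | inr o => exact absurd (by rw [hJ]; exact ⟨h1, h2, o, e⟩) sJ
    . intro s h1 h2 e
      have sJ : s ∈ J := by
        by_contra hs
        exact e.ne ((eab s).2 hs)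
      rw [hJ] at sJ
      obtain ⟨-, -, o, e⟩ := sJ
      obtain ⟨g1, g2⟩ := hg s o h1 h2 e
      have := pok (κ s)
      rw [e, hOk] at this
      have hc : ∀ x y, a s <= x -> x <= b s -> a' s <= y -> y <= b' s -> F x y = g s x y := by
        intro x y h3 h4 h5 h6
        rw [FD s h1 h2 x y h3 h4 h5 h6]
        simp only [hD, e]
      exact (g2.congr hc).compatF (g1.congr hc) this.2
    . intro s t h1 h2 h3 k hk
      rw [hCm] at hk
      have := h.cF k hk
      rw [<- hCm, <- hCp] at this
      rcases this with e | e | e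
      . exact .inl e
      . exact .inr (.inl e)
      have : ∃ p, Ok p /\ PA p k := by
        rw [hOk, hPA]
        rcases e with ⟨c, e1, e2⟩ | ⟨o, e1, e2, e3⟩
        . exact ⟨Sum.inl c, e1, e2⟩
        . exact ⟨Sum.inr o, ⟨e1, e2⟩, e3⟩
      obtain ⟨u, u1, u2, u3⟩ := κd s t h2 (2 * k + 1)
      exact .inr (.inr ⟨u, u1, u2, FA u ° ° k (pcA _ k u3 this)⟩)
    . intro s t h1 h2 h3 k hk
      rw [hCp] at hk
      have := h.cP k hk
      rw [<- hCm, <- hCp] at this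
      rcases this with e | e | e
      . exact .inl e
      . exact .inr (.inl e)
      have : ∃ p, Ok p /\ PB p k := by
        rw [hOk, hPB]
        rcases e with ⟨c, e1, e2⟩ | ⟨o, e1, e2, e3⟩
        . exact ⟨Sum.inl c, e1, e2⟩
        . exact ⟨Sum.inr o, ⟨e1, e2⟩, e3⟩
      obtain ⟨u, u1, u2, u3⟩ := κd s t h2 (2 * k + 2)
      exact .inr (.inr ⟨u, u1, u2, FB u ° ° k (pcB _ k u3 this)⟩)
  have Spos : ∀ x, x0 < x -> x <= x1 -> 0 < S x := fun x h1 h2 => by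
    refine lt_of_le_of_ne (Sp x h1.le h2).1 fun e => ?_
    have := (Sp x h1.le h2).2.2.2
    rw [<- e, b0] at this; linarith
  have Slt : ∀ x, x0 <= x -> x < x1 -> S x < 1 := fun x h1 h2 => by
    refine lt_of_le_of_ne (Sp x h1 h2.le).2.1 fun e => ?_
    have := (Sp x h1 h2.le).2.2.1
    rw [e, a1] at this; linarith
  have Tpos : ∀ x, y0 <= x -> x < y1 -> 0 < T x := fun x h1 h2 => by
    refine lt_of_le_of_ne (Tp x h1 h2.le).1 fun e => ?_
    have := (Tp x h1 h2.le).2.2.1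
    rw [<- e, a0'] at this; linarith
  have Tlt : ∀ x, y0 < x -> x <= y1 -> T x < 1 := fun x h1 h2 => by
    refine lt_of_le_of_ne (Tp x h1.le h2).2.1 fun e => ?_
    have := (Tp x h1.le h2).2.2.2
    rw [e, b1'] at this; linarith
  have Fl : ∀ y, y0 <= y -> y < y1 -> F x0 y = q.sw := fun y h1 h2 => by
    rw [hsw]; exact Fbe _ _ (by rw [Sx0]; exact Tpos y h1 h2)
  have Fb : ∀ x, x0 <= x -> x < x1 -> F x y0 = q.sw := fun y h1 h2 => by
    rw [hsw]; exact Fbe _ _ (by rw [Ty0]; exact Slt y h1 h2)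
  have Fr : ∀ y, y0 < y -> y <= y1 -> F x1 y = q.ne := fun y h1 h2 => by
    rw [hne]; exact Fab _ _ (by rw [Sx1]; exact Tlt y h1 h2)
  have Ft : ∀ x, x0 < x -> x <= x1 -> F x y1 = q.ne := fun y h1 h2 => by
    rw [hne]; exact Fab _ _ (by rw [Ty1]; exact Spos y h1 h2)
  rw [h.l] at hl
  rw [h.b] at hb
  refine ⟨F, sm.model, ⟨Fl _ le_rfl hy, Fse, Fnw, Fr _ hy le_rfl, ?_, ?_, ?_, ?_⟩, ?_, ?_⟩
  . rw [h.l]; exact IsTr.one hy fun y h1 h2 => Fl y h1.le h2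
  . rw [h.r]; exact IsTr.one hy fun y h1 h2 => Fr y h1 h2.le
  . rw [h.b]; exact IsTr.one hx fun y h1 h2 => Fb y h1.le h2
  . rw [h.t]; exact IsTr.one hx fun y h1 h2 => Ft y h1 h2.le
  . intro y h1 h2; rw [Fl y h1.le h2, hl.single y h1 h2]
  . intro y h1 h2; rw [Fb y h1.le h2, hb.single y h1 h2]
theorem Der.snd {K : Sys} {q : Lab} (h : Der K q) : Snd K q := by
  refine Der.induct (Snd K) ?_ q h
  intro X q hX hR ho
  rcases hR with hq | ⟨p, hp, p', hp', hq⟩ | ⟨p, hp, rfl⟩ | ⟨p1, h1, p2, h2, p3, h3, hq⟩ | hq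
  . exact Snd.base hq ho
  . exact Snd.join (hX _ hp) (hX _ hp') hq ho
  . exact (hX _ hp).tr
  . exact Snd.lim (hX _ h1) (hX _ h2) (hX _ h3) hq ho
  . exact Snd.shuf hX hq ho
end

section
/-! ### Triangles -/

structure TM (K : Sys) (f : ℝ -> ℝ -> PT) (lo hi : ℝ) : Prop where
  val : ∀ x y, lo <= x -> x < y -> y <= hi -> Valid K (f x y)
  re : ∀ x y, lo < x -> x < y -> y < hi -> (f x y).re = true
  gN : ∀ x y, lo <= x -> x < y -> y < hi -> ∀ᶠ y' in 𝓝[>] y, (f x y').c = (f x y).n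
  gS : ∀ x y, lo <= x -> x < y -> y <= hi -> ∀ᶠ y' in 𝓝[<] y, (f x y').c = (f x y).s
  gE : ∀ x y, lo <= x -> x < y -> y <= hi -> ∀ᶠ x' in 𝓝[>] x, (f x' y).c = (f x y).e
  gW : ∀ x y, lo < x -> x < y -> y <= hi -> ∀ᶠ x' in 𝓝[<] x, (f x' y).c = (f x y).w
  fF : ∀ x y, lo <= x -> x < y -> y <= hi -> ∀ a, mb a (f x y).c.1 ->
    ∃ x' y', x <= x' /\ y <= y' /\ x' < y' /\ y' <= hi /\
      (realF K (f x' y') a \/ (mb a (f x' y').c.1 /\ y' = hi))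
  fP : ∀ x y, lo <= x -> x < y -> y <= hi -> ∀ a, mb a (f x y).c.2 ->
    ∃ x' y', lo <= x' /\ x' <= x /\ x' < y' /\ y' <= y /\
      (realP K (f x' y') a \/ (mb a (f x' y').c.2 /\ x' = lo))
theorem TM.dual {K f lo hi} (h : TM K f lo hi) : TM K.dual (fD f) (-hi) (-lo) where
  val x y h1 h2 h3 := (h.val (-y) (-x) ° ° °).dual
  re x y h1 h2 h3 := h.re (-y) (-x) ° ° °
  gN x y h1 h2 h3 := ((tendsto_neg_GT y).eventually
    (h.gW (-y) (-x) ° ° °)).mono fun _ h => by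
      simp only [fD, PT.du_c, PT.du_n, h]
  gE x y h1 h2 h3 := ((tendsto_neg_GT x).eventually
    (h.gS (-y) (-x) ° ° °)).mono fun _ h => by
      simp only [fD, PT.du_c, PT.du_e, h]
  gS x y h1 h2 h3 := ((tendsto_neg_LT y).eventually
    (h.gE (-y) (-x) ° ° °)).mono fun _ h => by
      simp only [fD, PT.du_c, PT.du_s, h]
  gW x y h1 h2 h3 := ((tendsto_neg_LT x).eventually
    (h.gN (-y) (-x) ° ° °)).mono fun _ h => by
      simp only [fD, PT.du_c, PT.du_w, h]
  fF x y h1 h2 h3 a ha := by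
    obtain ⟨x', y', q1, q2, q3, q4, q5⟩ :=
      h.fP (-y) (-x) ° ° ° a ha
    refine ⟨-y', -x', °, °, °, °, ?_⟩
    simp only [fD, neg_neg, neg_inj]
    exact q5.imp realP.dual id
  fP x y h1 h2 h3 a ha := by
    obtain ⟨x', y', q1, q2, q3, q4, q5⟩ :=
      h.fF (-y) (-x) ° ° ° a ha
    refine ⟨-y', -x', °, °, °, °, ?_⟩
    simp only [fD, neg_neg, neg_inj]
    exact q5.imp realF.dual id
theorem TM.congr {K f g lo hi} (h : TM K f lo hi)
    (hg : ∀ x y, lo <= x -> x < y -> y <= hi -> g x y = f x y) : TM K g lo hi where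
  val x y h1 h2 h3 := by rw [hg x y h1 h2 h3]; exact h.val x y h1 h2 h3
  re x y h1 h2 h3 := by rw [hg x y h1.le h2 h3.le]; exact h.re x y h1 h2 h3
  gN x y h1 h2 h3 := by
    rw [hg x y h1 h2 h3.le]
    filter_upwards [h.gN x y h1 h2 h3, Ioo_mem_nhdsGT h3] with y' e hy'
    rw [hg x y' h1 (h2.trans hy'.1) hy'.2.le, e]
  gS x y h1 h2 h3 := by
    rw [hg x y h1 h2 h3]
    filter_upwards [h.gS x y h1 h2 h3, Ioo_mem_nhdsLT h2] with y' e hy'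
    rw [hg x y' h1 hy'.1 (by linarith [hy'.2]), e]
  gE x y h1 h2 h3 := by
    rw [hg x y h1 h2 h3]
    filter_upwards [h.gE x y h1 h2 h3, Ioo_mem_nhdsGT h2] with x' e hx'
    rw [hg x' y (by linarith [hx'.1]) hx'.2 h3, e]
  gW x y h1 h2 h3 := by
    rw [hg x y h1.le h2 h3]
    filter_upwards [h.gW x y h1 h2 h3, Ioo_mem_nhdsLT h1] with x' e hx'
    rw [hg x' y hx'.1.le (by linarith [hx'.2]) h3, e]
  fF x y h1 h2 h3 a ha := by
    rw [hg x y h1 h2 h3] at ha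
    obtain ⟨x', y', q1, q2, q3, q4, q5⟩ := h.fF x y h1 h2 h3 a ha
    refine ⟨x', y', q1, q2, q3, q4, ?_⟩
    rw [hg x' y' ° q3 q4]; exact q5
  fP x y h1 h2 h3 a ha := by
    rw [hg x y h1 h2 h3] at ha
    obtain ⟨x', y', q1, q2, q3, q4, q5⟩ := h.fP x y h1 h2 h3 a ha
    refine ⟨x', y', q1, q2, q3, q4, ?_⟩
    rw [hg x' y' q1 q3 °]; exact q5

structure HasTLab (f : ℝ -> ℝ -> PT) (lo hi : ℝ) (q : TLab) : Prop where
  nw : f lo hi = q.nw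
  l : IsTr (fun y => f lo y) lo hi q.l
  t : IsTr (fun x => f x hi) lo hi q.t

structure TSnd (K : Sys) (q : TLab) : Prop where
  odd : OddT q
  ex : ∀ (lo hi : ℝ) (gL : ℝ -> PT), lo < hi -> IsTr gL lo hi q.l -> ∃ f, TM K f lo hi /\
    HasTLab f lo hi q /\ (∀ y, lo < y -> y < hi -> f lo y = gL y)
theorem triF {K f g lo m hi} (hp : TM K f lo m) (ho : TM K f m hi) (hr : Model K g lo m m hi)
    (hlm : lo < m) (hmh : m < hi)
    (hg : ∀ x y, lo <= x -> x <= m -> m <= y -> y <= hi -> x < y -> g x y = f x y)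
    (sre : (g m m).re = false) (sA : ∀ a, mb a (g m m).c.1 -> mb a (g m m).n.1) :
    ∀ x y, lo <= x -> x < y -> y <= hi -> ∀ a, mb a (f x y).c.1 ->
    ∃ x' y', x <= x' /\ y <= y' /\ x' < y' /\ y' <= hi /\
      (realF K (f x' y') a \/ (mb a (f x' y').c.1 /\ y' = hi)) := by
  have stepR : ∀ x y, lo <= x -> x < y -> y <= hi -> x <= m -> m <= y -> ∀ a, mb a (f x y).c.1 ->
    ∃ x' y', x <= x' /\ y <= y' /\ x' < y' /\ y' <= hi /\
      (realF K (f x' y') a \/ (mb a (f x' y').c.1 /\ y' = hi)) := by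
    intro x y h1 h2 h3 h4 h5 a ha
    rw [<- hg x y h1 h4 h5 h3 h2] at ha
    obtain ⟨x', y', q1, q2, q3, q4, q5⟩ := hr.fF x y h1 h4 h5 h3 a ha
    by_cases hc : x' = m /\ y' = m
    . obtain ⟨e1', e2'⟩ := hc
      rw [e1', e2'] at q5
      have hm : mb a (g m m).c.1 := by
        rcases q5 with q5 | q5
        . exact q5.2.1
        . exact q5.1
      have hn := sA a hm
      obtain ⟨y'', e1, e2⟩ := ((hr.gN m m hlm.le le_rfl le_rfl hmh).and
        (Ioo_mem_nhdsGT hmh)).exists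
      rw [<- e1, hg m y'' hlm.le le_rfl e2.1.le e2.2.le e2.1] at hn
      obtain ⟨u, v, r1, r2, r3⟩ := ho.fF m y'' le_rfl e2.1 e2.2.le a hn
      exact ⟨u, v, °, by linarith [e2.1], r3⟩
    . have hlt : x' < y' := by
        rcases q2.eq_or_lt with e | e
        . rcases eq_or_lt_of_le (h5.trans q3) with e' | e'
          . exact absurd ⟨e, e'.symm⟩ hc
          . linarith
        . linarith
      rw [hg x' y' ° q2 ° q4 hlt] at q5
      rcases q5 with q5 | ⟨q5, e | e⟩
      . exact ⟨x', y', q1, q3, hlt, q4, .inl q5⟩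
      . subst e
        obtain ⟨u, v, r1, r2, r3⟩ := ho.fF x' y' le_rfl hlt q4 a q5
        exact ⟨u, v, °, °, r3⟩
      . exact ⟨x', y', q1, q3, hlt, q4, .inr ⟨q5, e⟩⟩
  intro x y h1 h2 h3 a ha
  rcases le_total m x with hx | hx
  . exact ho.fF x y hx h2 h3 a ha
  rcases le_total m y with hy | hy
  . exact stepR x y h1 h2 h3 hx hy a ha
  obtain ⟨x', y', q1, q2, q3, q4, q5⟩ := hp.fF x y h1 h2 hy a ha
  rcases q5 with q5 | ⟨q5, e⟩
  . exact ⟨x', y', q1, q2, q3, °, .inl q5⟩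
  . subst e
    obtain ⟨u, v, r1, r2, r3⟩ := stepR x' y' ° q3 hmh.le q3.le le_rfl a q5
    exact ⟨u, v, °, °, r3⟩
theorem TM.join {K f g lo m hi} (hp : TM K f lo m) (ho : TM K f m hi) (hr : Model K g lo m m hi)
    (hlm : lo < m) (hmh : m < hi)
    (hg : ∀ x y, lo <= x -> x <= m -> m <= y -> y <= hi -> x < y -> g x y = f x y)
    (re1 : ∀ x, lo < x -> x < m -> (f x m).re = true) (re2 : ∀ y, m < y -> y < hi -> (f m y).re = true)
    (sre : (g m m).re = false) (sA : ∀ a, mb a (g m m).c.1 -> mb a (g m m).n.1)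
    (sB : ∀ a, mb a (g m m).c.2 -> mb a (g m m).w.2) : TM K f lo hi where
  val x y h1 h2 h3 := by
    rcases le_total m x with hx | hx
    . exact ho.val x y hx h2 h3
    rcases le_total y m with hy | hy
    . exact hp.val x y h1 h2 hy
    rw [<- hg x y h1 hx hy h3 h2]; exact hr.val x y h1 hx hy h3
  re x y h1 h2 h3 := by
    rcases lt_trichotomy x m with hx | rfl | hx
    . rcases lt_trichotomy y m with hy | rfl | hy
      . exact hp.re x y h1 h2 hy
      . exact re1 x h1 hx
      . rw [<- hg x y h1.le hx.le hy.le h3.le h2]; exact hr.re x y h1 hx hy h3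
    . exact re2 y h2 h3
    . exact ho.re x y hx h2 h3
  gN x y h1 h2 h3 := by
    rcases le_or_gt m x with hx | hx
    . exact ho.gN x y hx h2 h3
    rcases lt_or_ge y m with hy | hy
    . exact hp.gN x y h1 h2 hy
    rw [<- hg x y h1 hx.le hy h3.le h2]
    filter_upwards [hr.gN x y h1 hx.le hy h3, Ioo_mem_nhdsGT h3] with y' e hy'
    rw [<- hg x y' h1 hx.le (by linarith [hy'.1]) hy'.2.le (by linarith [hy'.1]), e]
  gS x y h1 h2 h3 := by
    rcases le_or_gt m x with hx | hx
    . exact ho.gS x y hx h2 h3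
    rcases le_or_gt y m with hy | hy
    . exact hp.gS x y h1 h2 hy
    rw [<- hg x y h1 hx.le hy.le h3 h2]
    filter_upwards [hr.gS x y h1 hx.le hy h3, Ioo_mem_nhdsLT hy] with y' e hy'
    rw [<- hg x y' h1 hx.le hy'.1.le (by linarith [hy'.2]) (by linarith [hy'.1]), e]
  gE x y h1 h2 h3 := by
    rcases le_or_gt m x with hx | hx
    . exact ho.gE x y hx h2 h3
    rcases le_or_gt y m with hy | hy
    . exact hp.gE x y h1 h2 hy
    rw [<- hg x y h1 hx.le hy.le h3 h2]
    filter_upwards [hr.gE x y h1 hx hy.le h3, Ioo_mem_nhdsGT hx] with x' e hx'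
    rw [<- hg x' y (by linarith [hx'.1]) hx'.2.le hy.le h3 (by linarith [hx'.2]), e]
  gW x y h1 h2 h3 := by
    rcases lt_or_ge m x with hx | hx
    . exact ho.gW x y hx h2 h3
    rcases le_or_gt y m with hy | hy
    . exact hp.gW x y h1 h2 hy
    rw [<- hg x y h1.le hx hy.le h3 h2]
    filter_upwards [hr.gW x y h1 hx hy.le h3, Ioo_mem_nhdsLT h1] with x' e hx'
    rw [<- hg x' y hx'.1.le (by linarith [hx'.2]) hy.le h3 (by linarith [hx'.2]), e]
  fF := triF hp ho hr hlm hmh hg sre sA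
  fP x y h1 h2 h3 a ha := by
    have := triF ho.dual hp.dual hr.dual ° °
      (fun x y h1 h2 h3 h4 h5 => by
        simp only [fD]
        rw [hg _ _ ° ° ° ° °])
      (by simp only [fD, neg_neg]; exact sre)
      (by simp only [fD, neg_neg]; exact sB) (-y) (-x) ° ° ° a
      (by simp only [fD, neg_neg]; exact ha)
    obtain ⟨x', y', q1, q2, q3, q4, q5⟩ := this
    refine ⟨-y', -x', °, °, °, °, ?_⟩
    simp only [fD] at q5
    refine q5.imp (fun h => ?_) (fun h => ⟨h.1, by linarith [h.2]⟩)
    have := h.dual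
    simpa using this
theorem TSnd.join {K : Sys} {p o q : TLab} {r : Lab} (hp : TSnd K p) (ho : TSnd K o) (hr : Snd K r)
    (h : TJoin p o r q) (hq : OddT q) : TSnd K q := by
  refine ⟨hq, ?_⟩
  obtain ⟨eb, er, esw, ene, re1, re2, sre, sA, sB, rfl⟩ := h
  intro lo hi gL hlh hl
  simp only at hl
  obtain ⟨m, hm0, hm1, hl1, hlm, hl2⟩ := hl.cat_split hp.odd.l (by
    intro h; have := hr.odd.l; simp [h] at this)
  obtain ⟨f1, A1, A2, A3⟩ := hp.ex lo m gL hm0 hl1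
  have ht1 := A2.t
  rw [<- eb] at ht1
  obtain ⟨g, G1, G2, G3, G4⟩ := hr.ex lo m m hi gL _ hm0 hm1 hl2 ht1
  have hr1 := G2.r
  rw [er] at hr1
  obtain ⟨f2, B1, B2, B3⟩ := ho.ex m hi _ hm1 hr1
  obtain ⟨f, hf⟩ : ∃ f : ℝ -> ℝ -> PT, f = fun x y => if y <= m then f1 x y else if m <= x then f2 x y
    else g x y := ⟨_, rfl⟩
  have F1 : ∀ x y, lo <= x -> x < y -> y <= m -> f x y = f1 x y := fun x y _ _ h3 => by
    simp only [hf]; rw [if_pos h3]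
  have F2 : ∀ x y, m <= x -> x < y -> y <= hi -> f x y = f2 x y := fun x y h1 h2 h3 => by
    simp only [hf]; rw [if_neg °, if_pos h1]
  have Fg : ∀ x y, lo <= x -> x <= m -> m <= y -> y <= hi -> x < y -> g x y = f x y := by
    intro x y h1 h2 h3 h4 h5
    rcases h3.eq_or_lt with rfl | h3
    . rw [F1 _ _ h1 h5 le_rfl]
      rcases h1.eq_or_lt with rfl | h1
      . rw [A2.nw, G2.sw, esw]
      . exact G4 x h1 h5
    . rcases h2.eq_or_lt with rfl | h2
      . rw [F2 _ _ le_rfl h5 h4]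
        rcases h4.eq_or_lt with rfl | h4
        . rw [B2.nw, G2.ne, ene]
        . rw [B3 y h5 h4]
      . simp only [hf]; rw [if_neg °, if_neg °]
  refine ⟨f, TM.join (A1.congr F1) (B1.congr F2) G1 hm0 hm1 Fg ?_ ?_ (by rw [G2.se]; exact sre)
    (by rw [G2.se]; exact sA) (by rw [G2.se]; exact sB), ⟨?_, ?_, ?_⟩, ?_⟩
  . intro x h1 h2
    rw [<- Fg x m h1.le h2.le le_rfl hm1.le h2]
    exact re1 _ (G2.b.mem x h1 h2)
  . intro y h1 h2
    rw [<- Fg m y hm0.le le_rfl h1.le h2.le h1]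
    exact re2 _ (G2.r.mem y h1 h2)
  . rw [<- Fg lo hi le_rfl hm0.le hm1.le le_rfl hlh, G2.nw]
  . refine IsTr.cat (m := m) (A2.l.congr fun x h h' => F1 _ _ le_rfl h h'.le) ?_
      (G2.l.congr fun x h h' => (Fg _ _ le_rfl hm0.le h.le h'.le °).symm)
    rw [<- Fg lo m le_rfl hm0.le le_rfl hm1.le hm0, G2.sw]
  . refine IsTr.cat (m := m) (G2.t.congr fun x h h' => (Fg _ _ h.le h'.le hm1.le le_rfl °).symm)
      ?_ (B2.t.congr fun x h h' => F2 _ _ h.le h' le_rfl)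
    rw [<- Fg m hi hm0.le le_rfl hm1.le le_rfl hm1, G2.ne]
  . intro y h1 h2
    rcases lt_trichotomy y m with h | rfl | h
    . rw [F1 _ _ le_rfl h1 h.le, A3 y h1 h]
    . rw [<- Fg lo y le_rfl hm0.le le_rfl hm1.le hm0, G2.sw, hlm]
    . rw [<- Fg lo y le_rfl hm0.le h.le h2.le h1, G3 y h h2]
theorem TSnd.base {K : Sys} {C : Clu} {q : TLab} (h : TBase K C q) (hq : OddT q) : TSnd K q := by
  refine ⟨hq, ?_⟩
  intro x0 y1 gL hx hl
  rw [h.l] at hl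
  obtain ⟨f, hf⟩ : ∃ f : ℝ -> ℝ -> PT, f = fun x y =>
    if x = x0 then (if y = y1 then q.nw else hd q.l)
    else if y = y1 then hd q.t else kap C := ⟨_, rfl⟩
  have fnw : f x0 y1 = q.nw := by simp [hf]
  have fl : ∀ y, x0 < y -> y < y1 -> f x0 y = hd q.l := fun y h1 h2 => by
    simp [hf, h2.ne]
  have ft : ∀ x, x0 < x -> x < y1 -> f x y1 = hd q.t := fun y h1 h2 => by
    simp [hf, h1.ne']
  have fi : ∀ x y, x0 < x -> y < y1 -> f x y = kap C :=
    fun x y h1 h2 => by simp [hf, h1.ne', h2.ne]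
  have cases' : ∀ x y, x0 <= x -> x < y -> y <= y1 -> (x = x0 /\ y = y1) \/ (x = x0 /\ x0 < y /\ y < y1) \/
      (y = y1 /\ x0 < x /\ x < y1) \/ (x0 < x /\ y < y1) := by
    intro x y h1 h2 h3
    rcases h1.eq_or_lt with rfl | h1 <;> rcases h3.eq_or_lt with rfl | h3
    . exact .inl ⟨rfl, rfl⟩
    . exact .inr (.inl ⟨rfl, h2, h3⟩)
    . exact .inr (.inr (.inl ⟨rfl, h1, h2⟩))
    . exact .inr (.inr (.inr ⟨h1, h3⟩))
  refine ⟨f, ⟨?_, ?_, ?_, ?_, ?_, ?_, ?_, ?_⟩, ⟨fnw, ?_, ?_⟩, ?_⟩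
  . intro x y h1 h2 h3
    rcases cases' x y h1 h2 h3 with ⟨rfl, rfl⟩ | ⟨rfl, e1, e2⟩ | ⟨rfl, e1, e2⟩ | ⟨e1, e2⟩
    . rw [fnw]; exact h.vnw
    . rw [fl y e1 e2]; exact h.vl
    . rw [ft x e1 e2]; exact h.vt
    . rw [fi x y e1 e2]; exact h.vC
  . intro x y h1 h2 h3
    rw [fi x y h1 h3]; rfl
  . intro x y h1 h2 h3
    filter_upwards [Ioo_mem_nhdsGT h3] with y' hy'
    rcases h1.eq_or_lt with rfl | h1
    . rw [fl y h2 h3, fl y' (by linarith [hy'.1]) hy'.2, h.ln]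
    . rw [fi x y h1 h3, fi x y' h1 hy'.2]; rfl
  . intro x y h1 h2 h3
    filter_upwards [Ioo_mem_nhdsLT h2] with y' hy'
    rcases cases' x y h1 h2 h3 with ⟨rfl, rfl⟩ | ⟨rfl, e1, e2⟩ | ⟨rfl, e1, e2⟩ | ⟨e1, e2⟩
    . rw [fnw, fl y' hy'.1 hy'.2, h.nws]
    . rw [fl y e1 e2, fl y' hy'.1 (by linarith [hy'.2]), h.ls]
    . rw [ft x e1 e2, fi x y' e1 hy'.2, h.ts]; rfl
    . rw [fi x y e1 e2, fi x y' e1 (by linarith [hy'.2])]; rfl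
  . intro x y h1 h2 h3
    filter_upwards [Ioo_mem_nhdsGT h2] with x' hx'
    rcases cases' x y h1 h2 h3 with ⟨rfl, rfl⟩ | ⟨rfl, e1, e2⟩ | ⟨rfl, e1, e2⟩ | ⟨e1, e2⟩
    . rw [fnw, ft x' hx'.1 hx'.2, h.nwe]
    . rw [fl y e1 e2, fi x' y hx'.1 e2, h.le]; rfl
    . rw [ft x e1 e2, ft x' (by linarith [hx'.1]) hx'.2, h.te]
    . rw [fi x y e1 e2, fi x' y (by linarith [hx'.1]) e2]; rfl
  . intro x y h1 h2 h3
    filter_upwards [Ioo_mem_nhdsLT h1] with x' hx'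
    rcases h3.eq_or_lt with rfl | h3
    . rw [ft x h1 h2, ft x' hx'.1 (by linarith [hx'.2]), h.tw]
    . rw [fi x y h1 h3, fi x' y hx'.1 h3]; rfl
  . have FC : ∀ x y a, x0 < x -> x < y -> y < y1 -> mb a C.1 -> ∃ x' y', x <= x' /\ y <= y' /\ x' < y' /\
        y' <= y1 /\ (realF K (f x' y') a \/ (mb a (f x' y').c.1 /\ y' = y1)) := by
      intro x y a h1 h2 h3 ha
      rcases (h.fC a ha).imp id (fun h => h.elim id id) with e | e
      . exact ⟨x, y, le_rfl, le_rfl, h2, h3.le, .inl (by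
          rw [fi x y h1 h3]; exact ⟨rfl, ha, .inr ⟨.inl rfl, e.2⟩⟩)⟩
      . exact ⟨x, y1, le_rfl, h3.le, °, le_rfl, .inr (by
          rw [ft x h1 °]; exact ⟨e, rfl⟩)⟩
    intro x y h1 h2 h3 a ha
    rcases cases' x y h1 h2 h3 with ⟨rfl, rfl⟩ | ⟨rfl, e1, e2⟩ | ⟨rfl, e1, e2⟩ | ⟨e1, e2⟩
    . exact ⟨x, y, le_rfl, le_rfl, h2, le_rfl, .inr ⟨ha, rfl⟩⟩
    . rw [fl y e1 e2] at ha
      rcases h.fl a ha with e | e | e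
      . exact ⟨x, y, le_rfl, le_rfl, h2, h3, .inl (by
          rw [fl y e1 e2]; exact ⟨e.1, ha, .inr ⟨.inl h.ln, e.2⟩⟩)⟩
      . obtain ⟨x', y', p1, p2⟩ := FC ((x + y) / 2) y a ° ° e2 e
        exact ⟨x', y', °, p2⟩
      . exact ⟨x, y1, le_rfl, h3, hx, le_rfl, .inr (by rw [fnw]; exact ⟨e, rfl⟩)⟩
    . exact ⟨x, y, le_rfl, le_rfl, h2, le_rfl, .inr ⟨ha, rfl⟩⟩
    . rw [fi x y e1 e2] at ha
      exact FC x y a e1 h2 e2 ha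
  . have FC : ∀ x y a, x0 < x -> x < y -> y < y1 -> mb a C.2 -> ∃ x' y', x0 <= x' /\ x' <= x /\ x' < y' /\
        y' <= y /\ (realP K (f x' y') a \/ (mb a (f x' y').c.2 /\ x' = x0)) := by
      intro x y a h1 h2 h3 ha
      rcases (h.pC a ha).imp id (fun h => h.elim id id) with e | e
      . exact ⟨x, y, h1.le, le_rfl, h2, le_rfl, .inl (by
          rw [fi x y h1 h3]; exact ⟨rfl, ha, .inr ⟨.inl rfl, e.2⟩⟩)⟩
      . exact ⟨x0, y, le_rfl, h1.le, °, le_rfl, .inr (by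
          rw [fl y ° h3]; exact ⟨e, rfl⟩)⟩
    intro x y h1 h2 h3 a ha
    rcases cases' x y h1 h2 h3 with ⟨rfl, rfl⟩ | ⟨rfl, e1, e2⟩ | ⟨rfl, e1, e2⟩ | ⟨e1, e2⟩
    . exact ⟨x, y, le_rfl, le_rfl, h2, le_rfl, .inr ⟨ha, rfl⟩⟩
    . exact ⟨x, y, le_rfl, le_rfl, h2, le_rfl, .inr ⟨ha, rfl⟩⟩
    . rw [ft x e1 e2] at ha
      rcases h.pt a ha with e | e | e
      . exact ⟨x, y, h1, le_rfl, h2, le_rfl, .inl (by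
          rw [ft x e1 e2]; exact ⟨e.1, ha, .inr ⟨.inr h.tw, e.2⟩⟩)⟩
      . obtain ⟨x', y', p1, p2, p3, p4, p5⟩ :=
          FC x ((x + y) / 2) a e1 ° ° e
        exact ⟨x', y', p1, p2, p3, °, p5⟩
      . exact ⟨x0, y, le_rfl, e1.le, °, le_rfl, .inr (by rw [fnw]; exact ⟨e, rfl⟩)⟩
    . rw [fi x y e1 e2] at ha
      exact FC x y a e1 h2 e2 ha
  . rw [h.l]; exact IsTr.one hx fun y h1 h2 => fl y h1 h2
  . rw [h.t]; exact IsTr.one hx fun y h1 h2 => ft y h1 h2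
  . intro y h1 h2
    rw [fl y h1 h2, hl.single y h1 h2]
theorem TDer.snd {K : Sys} {q : TLab} (h : TDer K q) : TSnd K q := by
  refine TDer.induct (TSnd K) ?_ q h
  intro X q hX hR ho
  rcases hR with hq | ⟨p, hp, o, ho', r, hr, hq⟩
  . exact TSnd.base hq ho
  . exact TSnd.join (hX _ hp) (hX _ ho') (Der.snd hr) hq ho

/-- from a derivable accepting triangle label to a cluster structure on the open triangle -/
theorem TDer.struct {K : Sys} {q : TLab} {G : ℕ -> Prop} (h : TDer K q) (hg : TGoal G q) :
    ∃ f, TM K f 0 1 /\ (∀ x y a, 0 < x -> x < y -> y < 1 -> mb a (f x y).c.1 ->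
      ∃ x' y', x <= x' /\ y <= y' /\ x' < y' /\ y' < 1 /\ realF K (f x' y') a) /\
      (∀ x y a, 0 < x -> x < y -> y < 1 -> mb a (f x y).c.2 ->
      ∃ x' y', 0 < x' /\ x' <= x /\ x' < y' /\ y' <= y /\ realP K (f x' y') a) /\
      ∃ x y a, 0 < x /\ x < y /\ y < 1 /\ realF K (f x y) a /\ G a := by
  have hs := h.snd
  obtain ⟨gL, hgL⟩ := IsTr.exists_place q.l 0 1 one_pos hs.odd.l
  obtain ⟨f, A1, A2, A3⟩ := hs.ex 0 1 gL one_pos hgL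
  have top : ∀ x, 0 <= x -> x < 1 -> (f x 1).re = false /\ (f x 1).c.1 = 0 := by
    intro x h1 h2
    rcases h1.eq_or_lt with rfl | h1
    . rw [A2.nw]; exact hg.t _ (List.mem_cons_self ..)
    . exact hg.t _ (List.mem_cons_of_mem _ (A2.t.mem x h1 h2))
  have left : ∀ y, 0 < y -> y <= 1 -> (f 0 y).re = false /\ (f 0 y).c.2 = 0 := by
    intro x h1 h2
    rcases h2.eq_or_lt with rfl | h2
    . rw [A2.nw]; exact hg.l _ (List.mem_cons_self ..)
    . exact hg.l _ (List.mem_cons_of_mem _ (A2.l.mem x h1 h2))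
  have mb0 : ∀ a, ¬ mb a 0 := fun a => by simp [mb]
  have FF : ∀ x y a, 0 <= x -> x < y -> y <= 1 -> mb a (f x y).c.1 ->
      ∃ x' y', 0 < x' /\ x <= x' /\ y <= y' /\ x' < y' /\ y' < 1 /\ realF K (f x' y') a := by
    intro x y a h1 h2 h3 ha
    obtain ⟨x', y', q1, q2, q3, q4, q5⟩ := A1.fF x y h1 h2 h3 a ha
    have hr : realF K (f x' y') a := by
      refine q5.resolve_right ?_
      rintro ⟨e1, rfl⟩
      rw [(top x' ° q3).2] at e1
      exact mb0 _ e1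
    refine ⟨x', y', ?_, q1, q2, q3, ?_, hr⟩
    . refine lt_of_le_of_ne ° ?_
      rintro rfl
      have := (left y' q3 q4).1
      rw [hr.1] at this; cases this
    . refine lt_of_le_of_ne q4 ?_
      rintro rfl
      have := (top x' ° q3).1
      rw [hr.1] at this; cases this
  refine ⟨f, A1, ?_, ?_, ?_⟩
  . intro x y a h1 h2 h3 ha
    obtain ⟨x', y', -, q⟩ := FF x y a h1.le h2 h3.le ha
    exact ⟨x', y', q⟩
  . intro x y a h1 h2 h3 ha
    obtain ⟨x', y', q1, q2, q3, q4, q5⟩ := A1.fP x y h1.le h2 h3.le a ha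
    have hr : realP K (f x' y') a := by
      refine q5.resolve_right ?_
      rintro ⟨e1, rfl⟩
      rw [(left y' q3 °).2] at e1
      exact mb0 _ e1
    refine ⟨x', y', ?_, q2, q3, q4, hr⟩
    refine lt_of_le_of_ne q1 ?_
    rintro rfl
    have := (left y' q3 °).1
    rw [hr.1] at this; cases this
  . obtain ⟨a, ha, hG⟩ := hg.g
    obtain ⟨s, e1, e2⟩ := A2.l.head
    obtain ⟨y, e3, e4⟩ := (e2.and (Ioo_mem_nhdsGT one_pos)).exists
    have : hd q.l = s := by simp [hd, e1]
    rw [this, <- e3] at ha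
    obtain ⟨x', y', q1, q2, q3, q4, q5, q6⟩ := FF 0 y a le_rfl e4.1 e4.2.le ha
    exact ⟨x', y', a, q1, q4, q5, q6, hG⟩
end

section
theorem TM.monoY {K f lo hi} (h : TM K f lo hi) {x y y' : ℝ} (hx0 : lo <= x) (hxy : x < y)
    (hyy : y <= y') (hy1 : y' <= hi) : qle (f x y).c (f x y').c := by
  rcases hyy.eq_or_lt with rfl | hlt
  . exact qle_refl _
  . refine bis hlt (fun u v => qle (f x u).c (f x v).c) (fun _ _ _ _ _ _ _ h h' => h.trans h')
      (fun u hu hu' => ?_) (fun u hu hu' => ?_)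
    . filter_upwards [h.gN x u hx0 ° °] with v hv
      rw [hv]
      exact (h.val x u hx0 ° °).cn
    . filter_upwards [h.gS x u hx0 ° °] with v hv
      rw [hv]
      exact (h.val x u hx0 ° °).sc
theorem TM.monoX {K f lo hi} (h : TM K f lo hi) {x x' y : ℝ} (hx0 : lo <= x) (hxx : x <= x')
    (hxy : x' < y) (hy1 : y <= hi) : qle (f x y).c (f x' y).c := by
  rcases hxx.eq_or_lt with rfl | hlt
  . exact qle_refl _
  . refine bis hlt (fun u v => qle (f u y).c (f v y).c) (fun _ _ _ _ _ _ _ h h' => h.trans h')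
      (fun u hu hu' => ?_) (fun u hu hu' => ?_)
    . filter_upwards [h.gE u y ° ° °] with v hv
      rw [hv]
      exact (h.val u y ° ° °).ce
    . filter_upwards [h.gW u y ° ° °] with v hv
      rw [hv]
      exact (h.val u y ° ° °).wc
theorem TM.mono {K f lo hi} (h : TM K f lo hi) {x x' y y' : ℝ} (hx0 : lo <= x) (hxy : x < y)
    (hxx : x <= x') (hyy : y <= y') (hxy' : x' < y') (hy1 : y' <= hi) :
    qle (f x y).c (f x' y').c :=
  (h.monoY hx0 hxy hyy hy1).trans (h.monoX hx0 hxx hxy' hy1)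

def PT.free (p : PT) : Prop := (p.n = p.c \/ p.e = p.c) /\ (p.s = p.c \/ p.w = p.c)

/-- An actual colouring of the (unit) triangle. -/
structure Colouring (K : Sys) (G : ℕ -> Prop) (c : ℝ -> ℝ -> Clu) (t : ℝ -> ℝ -> ℕ) : Prop where
  al : ∀ x y, 0 < x -> x < y -> y < 1 -> K.al (t x y) (c x y)
  fut : ∀ x y, 0 < x -> x < y -> y < 1 -> ∀ a, mb a (c x y).1 ↔
    ∃ x' y', x <= x' /\ y <= y' /\ x' < y' /\ y' < 1 /\ t x' y' = a
  past : ∀ x y, 0 < x -> x < y -> y < 1 -> ∀ a, mb a (c x y).2 ↔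
    ∃ x' y', 0 < x' /\ x' <= x /\ y' <= y /\ x' < y' /\ t x' y' = a
  goal : ∃ x y, 0 < x /\ x < y /\ y < 1 /\ G (t x y)
theorem TDer.colouring {K G q} (h : TDer K q) (hg : TGoal G q) :
    ∃ c t, Colouring K G c t := by
  classical
  obtain ⟨f, hf, hF, hP, xg, yg, ag, g1, g2, g3, g4, g5⟩ := h.struct hg
  obtain ⟨κ, hκ, -⟩ := exists_kappa
  have hex : ∀ x y, 0 < x -> x < y -> y < 1 -> ∃ t, K.al t (f x y).c /\
      (∀ a, mb a (f x y).c.1 -> a = t \/ mb a (f x y).n.1 \/ mb a (f x y).e.1) /\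
      (∀ b, mb b (f x y).c.2 -> b = t \/ mb b (f x y).s.2 \/ mb b (f x y).w.2) := fun x y h1 h2 h3 =>
    (hf.val x y h1.le h2 h3.le).ex (hf.re x y h1 h2 h3)
  have hex' : ∀ x y, ∃ t, 0 < x -> x < y -> y < 1 -> (K.al t (f x y).c /\
      (∀ a, mb a (f x y).c.1 -> a = t \/ mb a (f x y).n.1 \/ mb a (f x y).e.1) /\
      (∀ b, mb b (f x y).c.2 -> b = t \/ mb b (f x y).s.2 \/ mb b (f x y).w.2)) := by
    intro x y
    by_cases hh : 0 < x /\ x < y /\ y < 1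
    . obtain ⟨t, ht⟩ := hex x y hh.1 hh.2.1 hh.2.2
      exact ⟨t, fun _ _ _ => ht⟩
    . exact ⟨0, fun h1 h2 h3 => absurd ⟨h1, h2, h3⟩ hh⟩
  choose t0 ht0 using hex'
  let t : ℝ -> ℝ -> ℕ := fun x y =>
    if (f x y).free /\ K.al (κ (x + y)) (f x y).c then κ (x + y) else t0 x y
  have hal : ∀ x y, 0 < x -> x < y -> y < 1 -> K.al (t x y) (f x y).c := by
    intro x y h1 h2 h3
    by_cases hc : (f x y).free /\ K.al (κ (x + y)) (f x y).c
    . simp only [t, if_pos hc]; exact hc.2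
    . simp only [t, if_neg hc]; exact (ht0 x y h1 h2 h3).1
  -- vertical / horizontal witnesses
  have vert : ∀ x u v C a, 0 < x -> x < u -> u < v -> v < 1 -> K.al a C ->
      (∀ y, u < y -> y < v -> (f x y).c = C) -> ∃ y, u < y /\ y < v /\ t x y = a := by
    intro x u v C a h1 h2 h3 h4 ha hc
    obtain ⟨w, w1, w2, w3⟩ := hκ (x + u) (x + v) ° a
    have e1 : u < w - x := °
    have e2 : w - x < v := °
    refine ⟨w - x, e1, e2, ?_⟩
    have hC := hc _ e1 e2
    have hn : (f x (w - x)).n = C := by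
      obtain ⟨y', q1, q2⟩ := ((hf.gN x (w - x) h1.le ° °).and
        (Ioo_mem_nhdsGT e2)).exists
      rw [<- q1]; exact hc _ (e1.trans q2.1) q2.2
    have hs : (f x (w - x)).s = C := by
      obtain ⟨y', q1, q2⟩ := ((hf.gS x (w - x) h1.le ° °).and
        (Ioo_mem_nhdsLT e1)).exists
      rw [<- q1]; exact hc _ q2.1 (q2.2.trans e2)
    have hfr : (f x (w - x)).free := ⟨.inl (hn.trans hC.symm), .inl (hs.trans hC.symm)⟩
    have e3 : x + (w - x) = w := by ring
    simp only [t, e3, w3]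
    rw [if_pos ⟨hfr, by rw [hC]; exact ha⟩]
  have horiz : ∀ y u v C a, 0 < u -> u < v -> v < y -> y < 1 -> K.al a C ->
      (∀ x, u < x -> x < v -> (f x y).c = C) -> ∃ x, u < x /\ x < v /\ t x y = a := by
    intro y u v C a h1 h2 h3 h4 ha hc
    obtain ⟨w, w1, w2, w3⟩ := hκ (u + y) (v + y) ° a
    have e1 : u < w - y := °
    have e2 : w - y < v := °
    refine ⟨w - y, e1, e2, ?_⟩
    have hC := hc _ e1 e2
    have hn : (f (w - y) y).e = C := by
      obtain ⟨y', q1, q2⟩ := ((hf.gE (w - y) y ° ° °).and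
        (Ioo_mem_nhdsGT e2)).exists
      rw [<- q1]; exact hc _ (e1.trans q2.1) q2.2
    have hs : (f (w - y) y).w = C := by
      obtain ⟨y', q1, q2⟩ := ((hf.gW (w - y) y ° ° °).and
        (Ioo_mem_nhdsLT e1)).exists
      rw [<- q1]; exact hc _ q2.1 (q2.2.trans e2)
    have hfr : (f (w - y) y).free := ⟨.inr (hn.trans hC.symm), .inr (hs.trans hC.symm)⟩
    have e3 : (w - y) + y = w := by ring
    simp only [t, e3, w3]
    rw [if_pos ⟨hfr, by rw [hC]; exact ha⟩]
  have witF : ∀ x y a, 0 < x -> x < y -> y < 1 -> realF K (f x y) a ->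
      ∃ x' y', x <= x' /\ y <= y' /\ x' < y' /\ y' < 1 /\ t x' y' = a := by
    intro x y a h1 h2 h3 ⟨r1, r2, r3⟩
    rcases r3 with ⟨r3, r4⟩ | ⟨r3 | r3, r4⟩
    . have hnf : ¬ ((f x y).free /\ K.al (κ (x + y)) (f x y).c) := by
        rintro ⟨⟨e | e, -⟩, -⟩
        . rw [e] at r3; exact r3 r2
        . rw [e] at r4; exact r4 r2
      refine ⟨x, y, le_rfl, le_rfl, h2, h3, ?_⟩
      simp only [t, if_neg hnf]
      rcases (ht0 x y h1 h2 h3).2.1 a r2 with e | e | e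
      . exact e.symm
      . exact absurd e r3
      . exact absurd e r4
    . have hev := (hf.gN x y h1.le h2 h3)
      obtain ⟨v, v1, v2⟩ := (mem_nhdsGT_iff_exists_Ioo_subset' h3).1
        (Filter.inter_mem hev (Ioo_mem_nhdsGT h3))
      have hv1 : y < min v 1 := lt_min v1 h3
      obtain ⟨z, z1, z2, z3⟩ := vert x y ((y + min v 1)/2) (f x y).c a h1 h2 °
        (by have := min_le_right v 1; linarith) r4 (fun z z1 z2 => by
          have := min_le_left v 1
          have h := (v2 ⟨z1, (by linarith : z < v)⟩).1
          exact h.trans r3)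
      exact ⟨x, z, le_rfl, z1.le, °, by have := min_le_right v 1; linarith, z3⟩
    . have hev := (hf.gE x y h1.le h2 h3.le)
      obtain ⟨v, v1, v2⟩ := (mem_nhdsGT_iff_exists_Ioo_subset' h2).1
        (Filter.inter_mem hev (Ioo_mem_nhdsGT h2))
      have hv1 : x < min v y := lt_min v1 h2
      obtain ⟨z, z1, z2, z3⟩ := horiz y x ((x + min v y)/2) (f x y).c a h1 °
        (by have := min_le_right v y; linarith) h3 r4 (fun z z1 z2 => by
          have := min_le_left v y
          have h := (v2 ⟨z1, (by linarith : z < v)⟩).1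
          exact h.trans r3)
      exact ⟨z, y, z1.le, le_rfl, by have := min_le_right v y; linarith, h3, z3⟩
  have witP : ∀ x y a, 0 < x -> x < y -> y < 1 -> realP K (f x y) a ->
      ∃ x' y', 0 < x' /\ x' <= x /\ y' <= y /\ x' < y' /\ t x' y' = a := by
    intro x y a h1 h2 h3 ⟨r1, r2, r3⟩
    rcases r3 with ⟨r3, r4⟩ | ⟨r3 | r3, r4⟩
    . have hnf : ¬ ((f x y).free /\ K.al (κ (x + y)) (f x y).c) := by
        rintro ⟨⟨-, e | e⟩, -⟩
        . rw [e] at r3; exact r3 r2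
        . rw [e] at r4; exact r4 r2
      refine ⟨x, y, h1, le_rfl, le_rfl, h2, ?_⟩
      simp only [t, if_neg hnf]
      rcases (ht0 x y h1 h2 h3).2.2 a r2 with e | e | e
      . exact e.symm
      . exact absurd e r3
      . exact absurd e r4
    . have hev := (hf.gS x y h1.le h2 h3.le)
      obtain ⟨v, v1, v2⟩ := (mem_nhdsLT_iff_exists_Ioo_subset' h2).1
        (Filter.inter_mem hev (Ioo_mem_nhdsLT h2))
      have hv1 : max v x < y := max_lt v1 h2
      have m1 := le_max_left v x
      have m2 := le_max_right v x
      obtain ⟨z, z1, z2, z3⟩ := vert x ((y + max v x)/2) y (f x y).c a h1 °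
        ° h3 r4 (fun z z1 z2 => by
          have h := (v2 ⟨(by linarith : v < z), z2⟩).1
          exact h.trans r3)
      exact ⟨x, z, h1, le_rfl, z2.le, °, z3⟩
    . have hev := (hf.gW x y h1 h2 h3.le)
      obtain ⟨v, v1, v2⟩ := (mem_nhdsLT_iff_exists_Ioo_subset' h1).1
        (Filter.inter_mem hev (Ioo_mem_nhdsLT h1))
      have hv1 : max v 0 < x := max_lt v1 h1
      have m1 := le_max_left v 0
      have m2 := le_max_right v 0
      obtain ⟨z, z1, z2, z3⟩ := horiz y ((x + max v 0)/2) x (f x y).c a °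
        ° h2 h3 r4 (fun z z1 z2 => by
          have h := (v2 ⟨(by linarith : v < z), z2⟩).1
          exact h.trans r3)
      exact ⟨z, y, °, z2.le, le_rfl, °, z3⟩
  refine ⟨fun x y => (f x y).c, t, hal, ?_, ?_, ?_⟩
  . intro x y h1 h2 h3 a
    constructor
    . intro ha
      obtain ⟨x', y', p1, p2, p3, p4, p5⟩ := hF x y a h1 h2 h3 ha
      obtain ⟨x'', y'', s1, s2, s3, s4, s5⟩ := witF x' y' a ° p3 p4 p5
      exact ⟨x'', y'', °, °, s3, s4, s5⟩
    . rintro ⟨x', y', p1, p2, p3, p4, rfl⟩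
      exact (hf.mono h1.le h2 p1 p2 p3 p4.le).1 _
        (K.hal _ _ (hal x' y' ° p3 p4)).1
  . intro x y h1 h2 h3 a
    constructor
    . intro ha
      obtain ⟨x', y', p1, p2, p3, p4, p5⟩ := hP x y a h1 h2 h3 ha
      obtain ⟨x'', y'', s1, s2, s3, s4, s5⟩ := witP x' y' a ° ° ° p5
      exact ⟨x'', y'', °, °, °, s4, s5⟩
    . rintro ⟨x', y', p1, p2, p3, p4, rfl⟩
      exact (hf.mono p1.le p4 p2 p3 h2 h3.le).2 _
        (K.hal _ _ (hal x' y' ° p4 °)).2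
  . obtain ⟨x', y', p1, p2, p3, p4, rfl⟩ := witF xg yg ag g1 g2 g3 g4
    exact ⟨x', y', °, p3, p4, g5⟩
end

section
theorem exists_bits (P : ℕ -> Prop) (N : ℕ) : ∃ s, s < 2 ^ N /\ ∀ a, mb a s ↔ a < N /\ P a := by
  classical
  induction N with
  | zero => exact ⟨0, by norm_num, fun a => by simp [mb]⟩
  | succ N ih =>
    obtain ⟨s, hs, h⟩ := ih
    by_cases hP : P N
    . refine ⟨2 ^ N + s, by rw [pow_succ]; omega, fun a => ?_⟩
      unfold mb at *
      rcases lt_trichotomy a N with ha | rfl | ha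
      . rw [Nat.testBit_two_pow_add_gt ha, h]; constructor
        . rintro ⟨-, h⟩; exact ⟨by omega, h⟩
        . rintro ⟨-, h⟩; exact ⟨ha, h⟩
      . rw [Nat.testBit_two_pow_add_eq, Nat.testBit_lt_two_pow hs]; simp [hP]
      . rw [Nat.testBit_lt_two_pow]
        . constructor
          . simp
          . rintro ⟨h, -⟩; omega
        . calc 2 ^ N + s < 2 ^ (N + 1) := by rw [pow_succ]; omega
            _ <= 2 ^ a := Nat.pow_le_pow_right (by norm_num) ha
    . refine ⟨s, by rw [pow_succ]; omega, fun a => ?_⟩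
      rw [h]
      constructor
      . rintro ⟨h, h'⟩; exact ⟨by omega, h'⟩
      . rintro ⟨h, h'⟩
        refine ⟨?_, h'⟩
        rcases eq_or_ne a N with rfl | hne
        . exact absurd h' hP
        . omega

/-- local consistency of a colour with respect to the `e`-th formula -/
def locOK (N t : ℕ) (c : Clu) (e : ℕ) : Prop :=
  (e % 5 = 1 -> (mb e t ↔ ¬ mb (e / 5) t)) /\
  (e % 5 = 2 -> (mb e t ↔ (mb (e / 5).unpair.1 t \/ mb (e / 5).unpair.2 t))) /\
  (e % 5 = 3 -> (mb e t ↔ ∃ a < N, mb a c.1 /\ mb (e / 5) a)) /\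
  (e % 5 = 4 -> (mb e t ↔ ∃ a < N, mb a c.2 /\ mb (e / 5) a))

def sysAl (m t : ℕ) (c : Clu) : Prop :=
  mb t c.1 /\ mb t c.2 /\ t < 2 ^ (m + 1) /\ ∀ e < m + 1, locOK (2 ^ (m + 1)) t c e

def sysM (m : ℕ) : Sys := ⟨2 ^ (m + 1), sysAl m, fun _ _ h => ⟨h.1, h.2.1⟩⟩
theorem sat_of_colouring {φ : TForm} {c t}
    (h : Colouring (sysM (encodeT φ)) (fun a => mb (encodeT φ) a) c t) :
    TSatisfiable (fun p q : HalfPlane => p.val <= q.val) φ := by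
  set g := Real.sigmoid with hg
  have gm : StrictMono g := Real.sigmoid_strictMono
  have gi : ∀ x, 0 < x -> x < 1 -> ∃ u, g u = x := fun x h1 h2 => by
    have : x ∈ Set.range Real.sigmoid := by rw [Real.range_sigmoid]; exact ⟨h1, h2⟩
    exact this
  have g0 : ∀ x, 0 < g x := Real.sigmoid_pos
  have g1 : ∀ x, g x < 1 := Real.sigmoid_lt_one
  let T : HalfPlane -> ℕ := fun p => t (g p.val.1) (g p.val.2)
  have key : ∀ ψ : TForm, encodeT ψ <= encodeT φ -> ∀ p : HalfPlane,
      TSat (fun p q : HalfPlane => p.val <= q.val) (fun i => {p | mb (5 * i) (T p)}) ψ p ↔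
        mb (encodeT ψ) (T p) := by
    intro ψ
    have hal : ∀ p : HalfPlane, sysAl (encodeT φ) (T p) (c (g p.val.1) (g p.val.2)) := fun p =>
      h.al _ _ (g0 _) (gm p.2) (g1 _)
    induction ψ with
    | prop i => intro _ p; exact Iff.rfl
    | neg ψ ih =>
      intro he p
      rw [encodeT] at he ⊢
      have := ((hal p).2.2.2 (5 * encodeT ψ + 1) (by omega)).1 (by omega)
      rw [this, show (5 * encodeT ψ + 1) / 5 = encodeT ψ by omega, TSat, ih (by omega) p]
    | or ψ χ ih1 ih2 =>
      intro he p
      rw [encodeT] at he ⊢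
      have := ((hal p).2.2.2 (5 * Nat.pair (encodeT ψ) (encodeT χ) + 2) (by omega)).2.1 (by omega)
      have l1 := Nat.left_le_pair (encodeT ψ) (encodeT χ)
      have l2 := Nat.right_le_pair (encodeT ψ) (encodeT χ)
      rw [this, show (5 * Nat.pair (encodeT ψ) (encodeT χ) + 2) / 5
        = Nat.pair (encodeT ψ) (encodeT χ) by omega, Nat.unpair_pair, TSat, ih1 (by omega) p,
        ih2 (by omega) p]
    | fut ψ ih =>
      intro he p
      rw [encodeT] at he ⊢
      have := ((hal p).2.2.2 (5 * encodeT ψ + 3) (by omega)).2.2.1 (by omega)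
      rw [this, show (5 * encodeT ψ + 3) / 5 = encodeT ψ by omega, TSat]
      constructor
      . rintro ⟨q, hq, hs⟩
        rw [ih (by omega) q] at hs
        exact ⟨T q, (hal q).2.2.1, (h.fut _ _ (g0 _) (gm p.2) (g1 _) _).2
          ⟨g q.val.1, g q.val.2, gm.monotone hq.1, gm.monotone hq.2, gm q.2, g1 _, rfl⟩, hs⟩
      . rintro ⟨a, -, ha, hb⟩
        obtain ⟨x', y', p1, p2, p3, p4, p5⟩ := (h.fut _ _ (g0 _) (gm p.2) (g1 _) _).1 ha
        obtain ⟨u, rfl⟩ := gi x' ((g0 _).trans_le p1) (p3.trans p4)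
        obtain ⟨v, rfl⟩ := gi y' (((g0 _).trans_le p1).trans p3) p4
        refine ⟨⟨(u, v), gm.lt_iff_lt.1 p3⟩, ⟨gm.le_iff_le.1 p1, gm.le_iff_le.1 p2⟩, ?_⟩
        rw [ih (by omega)]
        rw [<- p5] at hb; exact hb
    | past ψ ih =>
      intro he p
      rw [encodeT] at he ⊢
      have := ((hal p).2.2.2 (5 * encodeT ψ + 4) (by omega)).2.2.2 (by omega)
      rw [this, show (5 * encodeT ψ + 4) / 5 = encodeT ψ by omega, TSat]
      constructor
      . rintro ⟨q, hq, hs⟩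
        rw [ih (by omega) q] at hs
        exact ⟨T q, (hal q).2.2.1, (h.past _ _ (g0 _) (gm p.2) (g1 _) _).2
          ⟨g q.val.1, g q.val.2, g0 _, gm.monotone hq.1, gm.monotone hq.2, gm q.2, rfl⟩, hs⟩
      . rintro ⟨a, -, ha, hb⟩
        obtain ⟨x', y', p1, p2, p3, p4, p5⟩ := (h.past _ _ (g0 _) (gm p.2) (g1 _) _).1 ha
        obtain ⟨u, rfl⟩ := gi x' p1 (p2.trans_lt (g1 _))
        obtain ⟨v, rfl⟩ := gi y' (p1.trans p4) (p3.trans_lt (g1 _))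
        refine ⟨⟨(u, v), gm.lt_iff_lt.1 p4⟩, ⟨gm.le_iff_le.1 p2, gm.le_iff_le.1 p3⟩, ?_⟩
        rw [ih (by omega)]
        rw [<- p5] at hb; exact hb
  obtain ⟨x, y, h1, h2, h3, h4⟩ := h.goal
  obtain ⟨u, rfl⟩ := gi x h1 (h2.trans h3)
  obtain ⟨v, rfl⟩ := gi y (h1.trans h2) h3
  exact ⟨_, ⟨(u, v), gm.lt_iff_lt.1 h2⟩, (key φ le_rfl _).2 h4⟩
theorem colouring_of_sat {φ : TForm}
    (h : TSatisfiable (fun p q : HalfPlane => p.val <= q.val) φ) :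
    ∃ c t, (∀ x y, Bd (sysM (encodeT φ)).n (c x y)) /\
      Colouring (sysM (encodeT φ)) (fun a => mb (encodeT φ) a) c t := by
  classical
  obtain ⟨v, p0, h0⟩ := h
  set g := Real.sigmoid with hg
  have gm : StrictMono g := Real.sigmoid_strictMono
  have gi : ∀ x, 0 < x -> x < 1 -> ∃ u, g u = x := fun x h1 h2 => by
    have : x ∈ Set.range Real.sigmoid := by rw [Real.range_sigmoid]; exact ⟨h1, h2⟩
    exact this
  have g0 : ∀ x, 0 < g x := Real.sigmoid_pos
  have g1 : ∀ x, g x < 1 := Real.sigmoid_lt_one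
  set m := encodeT φ with hm
  set R := (fun p q : HalfPlane => p.val <= q.val) with hR
  choose T hT using
    (fun p : HalfPlane => exists_bits (fun e => TSat R v (decodeT e) p) (m + 1))
  -- transported colouring
  have hpt : ∀ x y : ℝ, ∃ t : ℕ, ∀ p : HalfPlane, g p.val.1 = x -> g p.val.2 = y -> t = T p := by
    intro x y
    by_cases hh : ∃ p : HalfPlane, g p.val.1 = x /\ g p.val.2 = y
    . obtain ⟨p, rfl, rfl⟩ := hh
      refine ⟨T p, fun q h1 h2 => ?_⟩
      congr 1
      exact Subtype.ext (Prod.ext (gm.injective h1.symm) (gm.injective h2.symm))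
    . exact ⟨0, fun p h1 h2 => absurd ⟨p, h1, h2⟩ hh⟩
  choose t ht using hpt
  choose A hA1 hA2 using fun x y : ℝ => exists_bits (fun a => ∃ x' y', x <= x' /\ y <= y' /\ x' < y' /\
    y' < 1 /\ t x' y' = a) (2 ^ (m + 1))
  choose B hB1 hB2 using fun x y : ℝ => exists_bits (fun a => ∃ x' y', 0 < x' /\ x' <= x /\ y' <= y /\
    x' < y' /\ t x' y' = a) (2 ^ (m + 1))
  have pts : ∀ x y, 0 < x -> x < y -> y < 1 -> ∃ p : HalfPlane, g p.val.1 = x /\ g p.val.2 = y := by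
    intro x y h1 h2 h3
    obtain ⟨u, rfl⟩ := gi x h1 (h2.trans h3)
    obtain ⟨v, rfl⟩ := gi y (h1.trans h2) h3
    exact ⟨⟨(u, v), gm.lt_iff_lt.1 h2⟩, rfl, rfl⟩
  have tlt : ∀ x y, 0 < x -> x < y -> y < 1 -> t x y < 2 ^ (m + 1) := by
    intro x y h1 h2 h3
    obtain ⟨p, e1, e2⟩ := pts x y h1 h2 h3
    rw [ht x y p e1 e2]; exact (hT p).1
  have hF : ∀ x y, 0 < x -> x < y -> y < 1 -> ∀ a, mb a (A x y) ↔
      ∃ x' y', x <= x' /\ y <= y' /\ x' < y' /\ y' < 1 /\ t x' y' = a := by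
    intro x y h1 h2 h3 a
    rw [hA2]
    constructor
    . exact And.right
    . rintro ⟨x', y', p1, p2, p3, p4, rfl⟩
      exact ⟨tlt _ _ ° p3 p4, x', y', p1, p2, p3, p4, rfl⟩
  have hP : ∀ x y, 0 < x -> x < y -> y < 1 -> ∀ a, mb a (B x y) ↔
      ∃ x' y', 0 < x' /\ x' <= x /\ y' <= y /\ x' < y' /\ t x' y' = a := by
    intro x y h1 h2 h3 a
    rw [hB2]
    constructor
    . exact And.right
    . rintro ⟨x', y', p1, p2, p3, p4, rfl⟩
      exact ⟨tlt _ _ ° p4 °, x', y', p1, p2, p3, p4, rfl⟩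
  refine ⟨fun x y => (A x y, B x y), t, fun x y => ⟨hA1 x y, hB1 x y⟩, ?_, hF, hP, ?_⟩
  . intro x y h1 h2 h3
    refine ⟨(hF x y h1 h2 h3 _).2 ⟨x, y, le_rfl, le_rfl, h2, h3, rfl⟩,
      (hP x y h1 h2 h3 _).2 ⟨x, y, h1, le_rfl, le_rfl, h2, rfl⟩, tlt x y h1 h2 h3, ?_⟩
    intro e he
    obtain ⟨p, rfl, rfl⟩ := pts x y h1 h2 h3
    have hbit : ∀ (q : HalfPlane) e, e < m + 1 ->
        (mb e (t (g q.val.1) (g q.val.2)) ↔ TSat R v (decodeT e) q) := by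
      intro q e he
      rw [ht _ _ q rfl rfl, (hT q).2]; simp [he]
    have hdiv : e % 5 ≠ 0 -> e / 5 < m + 1 := fun h => by omega
    have hp1 : (e / 5).unpair.1 <= e / 5 := Nat.unpair_left_le _
    have hp2 : (e / 5).unpair.2 <= e / 5 := Nat.unpair_right_le _
    refine ⟨fun h5 => ?_, fun h5 => ?_, fun h5 => ?_, fun h5 => ?_⟩
    . have hd : decodeT e = .neg (decodeT (e / 5)) := by
        rw [decodeT]; simp [h5]
      rw [hbit p e he, hd, TSat, hbit p _ (by omega)]
    . have hd : decodeT e = .or (decodeT (e / 5).unpair.1) (decodeT (e / 5).unpair.2) := by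
        rw [decodeT]; simp [h5]
      rw [hbit p e he, hd, TSat, hbit p _ (by omega), hbit p _ (by omega)]
    . have hd : decodeT e = .fut (decodeT (e / 5)) := by
        rw [decodeT]; simp [h5]
      rw [hbit p e he, hd, TSat]
      constructor
      . rintro ⟨q, hq, hs⟩
        refine ⟨_, tlt _ _ (g0 q.val.1) (gm q.2) (g1 q.val.2), (hF _ _ h1 h2 h3 _).2
          ⟨g q.val.1, g q.val.2, gm.monotone hq.1, gm.monotone hq.2, gm q.2, g1 _, rfl⟩, ?_⟩
        rwa [hbit q _ (by omega)]
      . rintro ⟨a, -, ha, hb⟩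
        obtain ⟨x', y', p1, p2, p3, p4, rfl⟩ := (hF _ _ h1 h2 h3 _).1 ha
        obtain ⟨q, rfl, rfl⟩ := pts x' y' ° p3 p4
        rw [hbit q _ (by omega)] at hb
        exact ⟨q, ⟨gm.le_iff_le.1 p1, gm.le_iff_le.1 p2⟩, hb⟩
    . have hd : decodeT e = .past (decodeT (e / 5)) := by
        rw [decodeT]; simp [h5]
      rw [hbit p e he, hd, TSat]
      constructor
      . rintro ⟨q, hq, hs⟩
        refine ⟨_, tlt _ _ (g0 q.val.1) (gm q.2) (g1 q.val.2), (hP _ _ h1 h2 h3 _).2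
          ⟨g q.val.1, g q.val.2, g0 _, gm.monotone hq.1, gm.monotone hq.2, gm q.2, rfl⟩, ?_⟩
        rwa [hbit q _ (by omega)]
      . rintro ⟨a, -, ha, hb⟩
        obtain ⟨x', y', p1, p2, p3, p4, rfl⟩ := (hP _ _ h1 h2 h3 _).1 ha
        obtain ⟨q, rfl, rfl⟩ := pts x' y' p1 p4 °
        rw [hbit q _ (by omega)] at hb
        exact ⟨q, ⟨gm.le_iff_le.1 p2, gm.le_iff_le.1 p3⟩, hb⟩
  . refine ⟨g p0.val.1, g p0.val.2, g0 _, gm p0.2, g1 _, ?_⟩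
    rw [ht _ _ p0 rfl rfl, (hT p0).2]
    exact ⟨by omega, by rw [hm, decodeT_encodeT]; exact h0⟩
end

section
/-! ### Tame models and existence of labels -/
theorem cmu_bound {N : ℕ} {c : Clu} (h : Bd N c) : - (2 ^ N : ℤ) <= cmu c /\ cmu c <= (2 ^ N : ℤ) := by
  have h1 : (c.1 : ℤ) < 2 ^ N := by exact_mod_cast h.1
  have h2 : (c.2 : ℤ) < 2 ^ N := by exact_mod_cast h.2
  unfold cmu
  constructor <;> omega
theorem exists_min_cmu {ι : Type} {P : ι -> Prop} {N : ℕ} (g : ι -> Clu) (hne : ∃ i, P i)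
    (hb : ∀ i, P i -> Bd N (g i)) : ∃ i, P i /\ ∀ j, P j -> cmu (g i) <= cmu (g j) := by
  classical
  let Q : ℕ -> Prop := fun k => ∃ i, P i /\ (cmu (g i) + 2 ^ N).toNat = k
  have hQ : ∃ k, Q k := by obtain ⟨i, hi⟩ := hne; exact ⟨_, i, hi, rfl⟩
  obtain ⟨i, hi, hik⟩ := Nat.find_spec hQ
  refine ⟨i, hi, fun j hj => ?_⟩
  have := Nat.find_min' hQ ⟨j, hj, rfl⟩
  have h1 := cmu_bound (hb i hi)
  have h2 := cmu_bound (hb j hj)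
  omega
theorem exists_max_cmu {ι : Type} {P : ι -> Prop} {N : ℕ} (g : ι -> Clu) (hne : ∃ i, P i)
    (hb : ∀ i, P i -> Bd N (g i)) : ∃ i, P i /\ ∀ j, P j -> cmu (g j) <= cmu (g i) := by
  obtain ⟨i, hi, h⟩ := exists_min_cmu (fun i => (g i).swap) hne (fun i hi => (hb i hi).swap)
  refine ⟨i, hi, fun j hj => ?_⟩
  have := h j hj
  simp only [cmu, Prod.fst_swap, Prod.snd_swap] at this ⊢
  omega
theorem mono_germ_right {N : ℕ} (g : ℝ -> Clu) {a b : ℝ} (hab : a < b)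
    (hm : ∀ y y', a < y -> y <= y' -> y' < b -> qle (g y) (g y'))
    (hb : ∀ y, a < y -> y < b -> Bd N (g y)) : ∃ s, ∀ᶠ y in 𝓝[>] a, g y = s := by
  obtain ⟨y, hy, h⟩ := exists_min_cmu (P := fun y => a < y /\ y < b) g
    ⟨(a + b) / 2, °, °⟩ (fun y hy => hb y hy.1 hy.2)
  refine ⟨g y, ?_⟩
  filter_upwards [Ioo_mem_nhdsGT hy.1] with z hz
  exact (hm z y hz.1 hz.2.le hy.2).eq_of_mu (h z ⟨hz.1, hz.2.trans hy.2⟩)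
theorem mono_germ_left {N : ℕ} (g : ℝ -> Clu) {a b : ℝ} (hab : a < b)
    (hm : ∀ y y', a < y -> y <= y' -> y' < b -> qle (g y) (g y'))
    (hb : ∀ y, a < y -> y < b -> Bd N (g y)) : ∃ s, ∀ᶠ y in 𝓝[<] b, g y = s := by
  obtain ⟨y, hy, h⟩ := exists_max_cmu (P := fun y => a < y /\ y < b) g
    ⟨(a + b) / 2, °, °⟩ (fun y hy => hb y hy.1 hy.2)
  refine ⟨g y, ?_⟩
  filter_upwards [Ioo_mem_nhdsLT hy.2] with z hz
  exact ((hm y z hy.1 hz.1.le hz.2).eq_of_mu (h z ⟨hy.1.trans hz.1, hz.2⟩)).symm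

structure TMod (K : Sys) (f : ℝ -> ℝ -> PT) (x0 x1 y0 y1 : ℝ) : Prop extends
    Model K f x0 x1 y0 y1 where
  wV : ∀ x y y', x0 <= x -> x <= x1 -> y0 <= y -> y <= y' -> y' <= y1 -> qle (f x y).w (f x y').w
  eV : ∀ x y y', x0 <= x -> x <= x1 -> y0 <= y -> y <= y' -> y' <= y1 -> qle (f x y).e (f x y').e
  sH : ∀ y x x', y0 <= y -> y <= y1 -> x0 <= x -> x <= x' -> x' <= x1 -> qle (f x y).s (f x' y).s
  nH : ∀ y x x', y0 <= y -> y <= y1 -> x0 <= x -> x <= x' -> x' <= x1 -> qle (f x y).n (f x' y).n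
  reV : ∀ x y y', x0 <= x -> x <= x1 -> y0 < y -> y < y1 -> y0 < y' -> y' < y1 -> (f x y).re = (f x y').re
  reH : ∀ y x x', y0 <= y -> y <= y1 -> x0 < x -> x < x1 -> x0 < x' -> x' < x1 -> (f x y).re = (f x' y).re
variable {K : Sys} {f : ℝ -> ℝ -> PT} {x0 x1 y0 y1 : ℝ}
theorem TMod.tr (h : TMod K f x0 x1 y0 y1) : TMod K (fT f) y0 y1 x0 x1 where
  toModel := h.toModel.tr
  wV := h.sH
  eV := h.nH
  sH := h.wV
  nH := h.eV
  reV := h.reH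
  reH := h.reV
theorem TMod.restr (h : TMod K f x0 x1 y0 y1) {u0 u1 v0 v1 : ℝ} (hu0 : x0 <= u0)
    (hu1 : u1 <= x1) (hv0 : y0 <= v0) (hv1 : v1 <= y1) : TMod K f u0 u1 v0 v1 where
  toModel := h.toModel.restr hu0 hu1 hv0 hv1
  wV x y y' h1 h2 h3 h4 h5 := h.wV x y y' ° ° ° h4 °
  eV x y y' h1 h2 h3 h4 h5 := h.eV x y y' ° ° ° h4 °
  sH x y y' h1 h2 h3 h4 h5 := h.sH x y y' ° ° ° h4 °
  nH x y y' h1 h2 h3 h4 h5 := h.nH x y y' ° ° ° h4 °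
  reV x y y' h1 h2 h3 h4 h5 h6 := h.reV x y y' ° ° °
    ° ° °
  reH x y y' h1 h2 h3 h4 h5 h6 := h.reH x y y' ° ° °
    ° ° °

/-- on a vertical segment where `c` is constant, `n = s = c` -/
theorem Model.const_ns (h : Model K f x0 x1 y0 y1) {x a b : ℝ} {C : Clu} (hx0 : x0 <= x)
    (hx1 : x <= x1) (ha : y0 <= a) (hb : b <= y1) (hc : ∀ y, a < y -> y < b -> (f x y).c = C) :
    ∀ y, a < y -> y < b -> (f x y).n = C /\ (f x y).s = C := by
  intro y h1 h2
  constructor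
  . have e1 := h.gN x y hx0 hx1 ° °
    have e2 : ∀ᶠ y' in 𝓝[>] y, (f x y').c = C := by
      filter_upwards [Ioo_mem_nhdsGT h2] with z hz using hc z (h1.trans hz.1) hz.2
    exact eventually_eq_unique e1 e2
  . have e1 := h.gS x y hx0 hx1 ° °
    have e2 : ∀ᶠ y' in 𝓝[<] y, (f x y').c = C := by
      filter_upwards [Ioo_mem_nhdsLT h1] with z hz using hc z hz.1 (hz.2.trans h2)
    exact eventually_eq_unique e1 e2
theorem Model.const_ew (h : Model K f x0 x1 y0 y1) {y a b : ℝ} {C : Clu} (hy0 : y0 <= y)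
    (hy1 : y <= y1) (ha : x0 <= a) (hb : b <= x1) (hc : ∀ x, a < x -> x < b -> (f x y).c = C) :
    ∀ x, a < x -> x < b -> (f x y).e = C /\ (f x y).w = C :=
  h.tr.const_ns (x := y) hy0 hy1 ha hb hc
theorem TMod.germN (h : TMod K f x0 x1 y0 y1) {x y : ℝ} (h1 : x0 <= x) (h2 : x <= x1)
    (h3 : y0 <= y) (h4 : y < y1) : ∃ s, ∀ᶠ y' in 𝓝[>] y, f x y' = s := by
  obtain ⟨sw, hw⟩ := mono_germ_right (N := K.n) (fun y => (f x y).w) h4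
    (fun u v q1 q2 q3 => h.wV x u v h1 h2 ° q2 q3.le)
    (fun u q1 q2 => (h.val x u h1 h2 ° q2.le).bw)
  obtain ⟨se, he⟩ := mono_germ_right (N := K.n) (fun y => (f x y).e) h4
    (fun u v q1 q2 q3 => h.eV x u v h1 h2 ° q2 q3.le)
    (fun u q1 q2 => (h.val x u h1 h2 ° q2.le).be)
  have hc := h.gN x y h1 h2 h3 h4
  set C := (f x y).n
  obtain ⟨u, hu, hcu⟩ := (mem_nhdsGT_iff_exists_Ioo_subset' h4).1 (hc.and (Ioo_mem_nhdsGT h4))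
  set m := (y + y1) / 2
  refine ⟨⟨(f x m).re, C, C, se, C, sw⟩, ?_⟩
  filter_upwards [hw, he, Ioo_mem_nhdsGT hu] with z z1 z2 z3
  have hzu := hcu z3
  have hns := h.const_ns (a := y) (b := min u y1) (C := C) h1 h2 h3 (min_le_right _ _)
    (fun w q1 q2 => (hcu ⟨q1, q2.trans_le (min_le_left _ _)⟩).1) z z3.1 (lt_min z3.2 hzu.2.2)
  ext1
  . exact h.reV x z m h1 h2 (by linarith [hzu.2.1]) hzu.2.2 (by simp only [m]; linarith)
      (by simp only [m]; linarith)
  . exact hzu.1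
  . exact hns.1
  . exact z2
  . exact hns.2
  . exact z1
theorem TMod.germS (h : TMod K f x0 x1 y0 y1) {x y : ℝ} (h1 : x0 <= x) (h2 : x <= x1)
    (h3 : y0 < y) (h4 : y <= y1) : ∃ s, ∀ᶠ y' in 𝓝[<] y, f x y' = s := by
  obtain ⟨sw, hw⟩ := mono_germ_left (N := K.n) (fun y => (f x y).w) h3
    (fun u v q1 q2 q3 => h.wV x u v h1 h2 q1.le q2 °)
    (fun u q1 q2 => (h.val x u h1 h2 q1.le °).bw)
  obtain ⟨se, he⟩ := mono_germ_left (N := K.n) (fun y => (f x y).e) h3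
    (fun u v q1 q2 q3 => h.eV x u v h1 h2 q1.le q2 °)
    (fun u q1 q2 => (h.val x u h1 h2 q1.le °).be)
  have hc := h.gS x y h1 h2 h3 h4
  set C := (f x y).s
  obtain ⟨u, hu, hcu⟩ := (mem_nhdsLT_iff_exists_Ioo_subset' h3).1 (hc.and (Ioo_mem_nhdsLT h3))
  set m := (y0 + y) / 2
  refine ⟨⟨(f x m).re, C, C, se, C, sw⟩, ?_⟩
  filter_upwards [hw, he, Ioo_mem_nhdsLT hu] with z z1 z2 z3
  have hzu := hcu z3
  have hns := h.const_ns (a := max u y0) (b := y) (C := C) h1 h2 (le_max_right _ _) h4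
    (fun w q1 q2 => (hcu ⟨(le_max_left _ _).trans_lt q1, q2⟩).1) z (max_lt z3.1 hzu.2.1) z3.2
  ext1
  . exact h.reV x z m h1 h2 hzu.2.1 (by linarith [hzu.2.2]) (by simp only [m]; linarith)
      (by simp only [m]; linarith)
  . exact hzu.1
  . exact hns.1
  . exact z2
  . exact hns.2
  . exact z1
theorem Valid.bdP {p : PT} (h : Valid K p) : BdP K.n p := ⟨h.bc, h.bn, h.be, h.bs, h.bw⟩
theorem TMod.wordV (h : TMod K f x0 x1 y0 y1) (hy : y0 < y1) {x : ℝ} (h1 : x0 <= x) (h2 : x <= x1) :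
    ∃ w, IsTr (fun y => f x y) y0 y1 w /\ Red w /\ BdW K.n w := by
  obtain ⟨w, hw, hr⟩ := IsTr.exists_of_germs (g := fun y => f x y) hy
    (fun y q1 q2 => h.germN h1 h2 q1 q2) (fun y q1 q2 => h.germS h1 h2 q1 q2)
  refine ⟨w, hw, hr, ?_, fun p hp => ?_⟩
  . have := hw.length_le hr (fun p => cmu p.c + cmu p.w + cmu p.e) (3 * 2 ^ K.n) ?_ ?_ ?_
      (-(3 * 2 ^ K.n)) ?_
    . unfold Lb
      zify
      linarith
    . intro u v q1 q2 q3
      have a1 := (h.monoY h1 h2 q1.le q2 q3.le).mu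
      have a2 := (h.wV x u v h1 h2 q1.le q2 q3.le).mu
      have a3 := (h.eV x u v h1 h2 q1.le q2 q3.le).mu
      linarith
    . intro y q1 q2
      have hv := h.val x y h1 h2 q1.le q2.le
      have := cmu_bound hv.bc
      have := cmu_bound hv.bw
      have := cmu_bound hv.be
      linarith
    . intro m s s' q1 q2 e1 e2 k1 k2
      have aux : ∀ p p' : PT, qle p.c p'.c -> qle p.w p'.w -> qle p.e p'.e ->
          cmu p.c + cmu p.w + cmu p.e = cmu p'.c + cmu p'.w + cmu p'.e ->
          p.c = p'.c /\ p.w = p'.w /\ p.e = p'.e := by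
        intro p p' a1 a2 a3 a4
        have b1 := a1.mu
        have b2 := a2.mu
        have b3 := a3.mu
        exact ⟨a1.eq_of_mu °, a2.eq_of_mu °, a3.eq_of_mu °⟩
      obtain ⟨z, z1, z2⟩ := (e1.and (Ioo_mem_nhdsLT q1)).exists
      obtain ⟨z', z1', z2'⟩ := (e2.and (Ioo_mem_nhdsGT q2)).exists
      have A := aux (f x z) (f x m) (h.monoY h1 h2 z2.1.le z2.2.le q2.le)
        (h.wV x z m h1 h2 z2.1.le z2.2.le q2.le) (h.eV x z m h1 h2 z2.1.le z2.2.le q2.le)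
        (by rw [z1]; exact k1)
      have B := aux (f x m) (f x z') (h.monoY h1 h2 q1.le z2'.1.le z2'.2.le)
        (h.wV x m z' h1 h2 q1.le z2'.1.le z2'.2.le) (h.eV x m z' h1 h2 q1.le z2'.1.le z2'.2.le)
        (by rw [z1']; exact k2)
      have hcc : ∀ y, z <= y -> y <= z' -> (f x y).c = (f x m).c := by
        intro y g1 g2
        have c1 := h.monoY h1 h2 z2.1.le g1 (by linarith [z2'.2])
        have c2 := h.monoY h1 h2 (by linarith [z2.1]) g2 z2'.2.le
        rw [A.1] at c1
        rw [<- B.1] at c2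
        exact c2.antisymm c1
      have hns := h.const_ns (a := z) (b := z') (C := (f x m).c) h1 h2 z2.1.le z2'.2.le
        (fun y g1 g2 => hcc y g1.le g2.le)
      -- pick points close to m on both sides
      obtain ⟨u, u1, u2⟩ := (e1.and (Ioo_mem_nhdsLT z2.2)).exists
      obtain ⟨u', u1', u2'⟩ := (e2.and (Ioo_mem_nhdsGT z2'.1)).exists
      have hm := hns m z2.2 z2'.1
      have hu := hns u u2.1 (by linarith [u2.2, z2'.1])
      have hu' := hns u' (by linarith [u2'.1, z2.2]) u2'.2
      constructor
      . rw [<- u1]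
        ext1
        . exact h.reV x u m h1 h2 (by linarith [z2.1, u2.1]) (by linarith [u2.2]) q1 q2
        . exact hcc u u2.1.le (by linarith [u2.2, z2'.1])
        . rw [hu.1, hm.1]
        . rw [u1, <- z1]; exact A.2.2
        . rw [hu.2, hm.2]
        . rw [u1, <- z1]; exact A.2.1
      . rw [<- u1']
        ext1
        . exact h.reV x m u' h1 h2 q1 q2 (by linarith [u2'.1]) (by linarith [u2'.2, z2'.2])
        . exact (hcc u' (by linarith [u2'.1, z2.2]) u2'.2.le).symm
        . rw [hu'.1, hm.1]
        . rw [u1', <- z1']; exact B.2.2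
        . rw [hu'.2, hm.2]
        . rw [u1', <- z1']; exact B.2.1
    . intro y q1 q2
      have hv := h.val x y h1 h2 q1.le q2.le
      have := cmu_bound hv.bc
      have := cmu_bound hv.bw
      have := cmu_bound hv.be
      linarith
  . obtain ⟨y, q1, q2, rfl⟩ := hw.mem_exists p hp
    exact (h.val x y h1 h2 q1.le q2.le).bdP
theorem BdP.tr {n : ℕ} {p : PT} (h : BdP n p) : BdP n p.tr := ⟨h.c, h.e, h.n, h.w, h.s⟩
theorem TMod.wordH (h : TMod K f x0 x1 y0 y1) (hx : x0 < x1) {y : ℝ} (h1 : y0 <= y) (h2 : y <= y1) :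
    ∃ w, IsTr (fun x => f x y) x0 x1 w /\ Red w /\ BdW K.n w := by
  obtain ⟨w, hw, hr, hb⟩ := h.tr.wordV hx h1 h2
  refine ⟨w.map PT.tr, ?_, hr.map fun a b h => PT.tr_inj h, by simpa using hb.1, ?_⟩
  . exact hw.map PT.tr
  . intro p hp
    obtain ⟨p', hp', rfl⟩ := List.mem_map.1 hp
    exact (hb.2 p' hp').tr

/-- reduced label -/
structure RLab (f : ℝ -> ℝ -> PT) (x0 x1 y0 y1 : ℝ) (q : Lab) : Prop extends
    HasLab f x0 x1 y0 y1 q where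
  rl : Red q.l
  rr : Red q.r
  rb : Red q.b
  rt : Red q.t
theorem TMod.exists_lab (h : TMod K f x0 x1 y0 y1) (hx : x0 < x1) (hy : y0 < y1) :
    ∃ q, RLab f x0 x1 y0 y1 q /\ BdL K.n q /\ OddL q := by
  obtain ⟨l, l1, l2, l3⟩ := h.wordV hy le_rfl hx.le
  obtain ⟨r, r1, r2, r3⟩ := h.wordV hy hx.le le_rfl
  obtain ⟨b, b1, b2, b3⟩ := h.wordH hx le_rfl hy.le
  obtain ⟨t, t1, t2, t3⟩ := h.wordH hx hy.le le_rfl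
  exact ⟨⟨f x0 y0, f x1 y0, f x0 y1, f x1 y1, l, r, b, t⟩,
    ⟨⟨rfl, rfl, rfl, rfl, l1, r1, b1, t1⟩, l2, r2, b2, t2⟩,
    ⟨(h.val _ _ le_rfl hx.le le_rfl hy.le).bdP, (h.val _ _ hx.le le_rfl le_rfl hy.le).bdP,
      (h.val _ _ le_rfl hx.le hy.le le_rfl).bdP, (h.val _ _ hx.le le_rfl hy.le le_rfl).bdP,
      l3, r3, b3, t3⟩, ⟨l1.odd, r1.odd, b1.odd, t1.odd⟩⟩
theorem RLab.unique {q q' : Lab} (h : RLab f x0 x1 y0 y1 q) (h' : RLab f x0 x1 y0 y1 q') :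
    q = q' := by
  ext1
  . rw [<- h.sw, h'.sw]
  . rw [<- h.se, h'.se]
  . rw [<- h.nw, h'.nw]
  . rw [<- h.ne, h'.ne]
  . exact h.l.unique h'.l h.rl h'.rl
  . exact h.r.unique h'.r h.rr h'.rr
  . exact h.b.unique h'.b h.rb h'.rb
  . exact h.t.unique h'.t h.rt h'.rt
theorem RLab.tr {q : Lab} (h : RLab f x0 x1 y0 y1 q) : RLab (fT f) y0 y1 x0 x1 q.tr where
  toHasLab := h.toHasLab.tr
  rl := h.rb.map fun _ _ h => PT.tr_inj h
  rr := h.rt.map fun _ _ h => PT.tr_inj h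
  rb := h.rl.map fun _ _ h => PT.tr_inj h
  rt := h.rr.map fun _ _ h => PT.tr_inj h

/-- the rectangle is derivable -/
def DD (K : Sys) (f : ℝ -> ℝ -> PT) (x0 x1 y0 y1 : ℝ) : Prop :=
  ∃ q, RLab f x0 x1 y0 y1 q /\ Der K q
theorem TMod.bdL (h : TMod K f x0 x1 y0 y1) {q : Lab} (hq : RLab f x0 x1 y0 y1 q) :
    BdL K.n q /\ OddL q := by
  obtain ⟨q', h1, h2⟩ := h.exists_lab hq.b.lt hq.l.lt
  rw [hq.unique h1]
  exact h2
theorem TMod.DD_of_rule (h : TMod K f x0 x1 y0 y1) {q : Lab} (hq : RLab f x0 x1 y0 y1 q)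
    (hr : Rule K (derList K) q) : DD K f x0 x1 y0 y1 :=
  ⟨q, hq, Der_iff.2 ⟨(h.bdL hq).1, hr, (h.bdL hq).2⟩⟩
theorem DD.joinX {xm : ℝ} (h : TMod K f x0 x1 y0 y1) (h1 : DD K f x0 xm y0 y1)
    (h2 : DD K f xm x1 y0 y1) : DD K f x0 x1 y0 y1 := by
  obtain ⟨p, hp, dp⟩ := h1
  obtain ⟨q, hq, dq⟩ := h2
  have hrl := hp.r.unique hq.l hp.rr hq.rl
  refine h.DD_of_rule (q := ⟨p.sw, q.se, p.nw, q.ne, p.l, q.r, cat p.b p.se q.b, cat p.t p.ne q.t⟩)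
    ⟨⟨hp.sw, hq.se, hp.nw, hq.ne, hp.l, hq.r, hp.b.cat hp.se hq.b, hp.t.cat hp.ne hq.t⟩,
      hp.rl, hq.rr, hp.rb.cat hq.rb hp.b.odd, hp.rt.cat hq.rt hp.t.odd⟩
    (.inr (.inl ⟨p, dp, q, dq, hrl, ?_, ?_, ?_, rfl⟩))
  . intro v hv
    obtain ⟨y, y1, y2, rfl⟩ := hp.r.mem_exists v hv
    exact h.re _ _ hp.b.lt hq.b.lt y1 y2
  . rw [<- hp.se, hq.sw]
  . rw [<- hp.ne, hq.nw]
theorem DD.tr (h : TMod K f x0 x1 y0 y1) (h1 : DD K f x0 x1 y0 y1) : DD K (fT f) y0 y1 x0 x1 := by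
  obtain ⟨p, hp, dp⟩ := h1
  exact h.tr.DD_of_rule hp.tr (.inr (.inr (.inl ⟨p, dp, rfl⟩)))
theorem DD.joinY {ym : ℝ} (h : TMod K f x0 x1 y0 y1) (h1 : DD K f x0 x1 y0 ym)
    (h2 : DD K f x0 x1 ym y1) : DD K f x0 x1 y0 y1 := by
  obtain ⟨p, hp, dp⟩ := id h1
  obtain ⟨q, hq, dq⟩ := id h2
  have a1 := hp.l.lt
  have a2 := hq.l.lt
  have := DD.joinX h.tr (DD.tr (h.restr le_rfl le_rfl le_rfl a2.le) h1)
    (DD.tr (h.restr le_rfl le_rfl a1.le le_rfl) h2)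
  exact this.tr h.tr
end

section
variable {K : Sys} {f : ℝ -> ℝ -> PT} {x0 x1 y0 y1 : ℝ}

/-! ### Rectangles with constant interior -/
theorem Model.const_kap (h : Model K f x0 x1 y0 y1) {C : Clu}
    (hC : ∀ x y, x0 < x -> x < x1 -> y0 < y -> y < y1 -> (f x y).c = C) {x y : ℝ} (h1 : x0 < x)
    (h2 : x < x1) (h3 : y0 < y) (h4 : y < y1) : f x y = kap C := by
  have a := h.const_ns h1.le h2.le le_rfl le_rfl (fun y h3 h4 => hC x y h1 h2 h3 h4) y h3 h4
  have b := h.const_ew h3.le h4.le le_rfl le_rfl (fun x h1 h2 => hC x y h1 h2 h3 h4) x h1 h2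
  ext1
  . exact h.re x y h1 h2 h3 h4
  . exact hC x y h1 h2 h3 h4
  . exact a.1
  . exact b.1
  . exact a.2
  . exact b.2
theorem Model.cov_l (h : Model K f x0 x1 y0 y1) (hx : x0 < x1) (hy : y0 < y1) {C : Clu}
    (hC : ∀ x y, x0 < x -> x < x1 -> y0 < y -> y < y1 -> (f x y).c = C) {L : PT}
    (hL : ∀ y, y0 < y -> y < y1 -> f x0 y = L) : covF K L.re L.c C (f x0 y1).c := by
  intro a ha
  set m := (y0 + y1) / 2 with hm
  have m1 : y0 < m := by rw [hm]; linarith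
  have m2 : m < y1 := by rw [hm]; linarith
  obtain ⟨x', y', q1, q2, q3, q4, q5⟩ := h.fF x0 m le_rfl hx.le m1.le m2.le a
    (by rw [hL m m1 m2]; exact ha)
  have hmem : mb a (f x' y').c.1 := by
    rcases q5 with q | q
    . exact q.2.1
    . exact q.1
  rcases q1.eq_or_lt with rfl | q1
  . rcases q4.eq_or_lt with rfl | q4
    . exact .inr (.inr hmem)
    . rw [hL y' ° q4] at q5
      have hn := h.const_ns (C := L.c) le_rfl hx.le le_rfl le_rfl
        (fun y h3 h4 => by rw [hL y h3 h4]) m m1 m2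
      rw [hL m m1 m2] at hn
      rcases q5 with ⟨q6, q7, q8⟩ | ⟨q6, q7⟩
      . rcases q8 with q8 | q8
        . rw [hn.1] at q8; exact absurd q7 q8.1
        . exact .inl ⟨q6, q8.2⟩
      . rcases q7 with q7 | q7
        . exact absurd q7 hx.ne
        . exact absurd q7 q4.ne
  . right; left
    have := h.mono (x := (x0 + x') / 2) (x' := x') ° ° q2 m1.le q3 q4
    rw [hC _ _ ° ° m1 m2] at this
    exact this.1 a hmem
theorem Model.cov_C (h : Model K f x0 x1 y0 y1) (hx : x0 < x1) (hy : y0 < y1) {C : Clu}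
    (hC : ∀ x y, x0 < x -> x < x1 -> y0 < y -> y < y1 -> (f x y).c = C) {T R : PT}
    (hT : ∀ x, x0 < x -> x < x1 -> f x y1 = T) (hR : ∀ y, y0 < y -> y < y1 -> f x1 y = R) :
    covF K true C T.c R.c := by
  intro a ha
  set m := (y0 + y1) / 2 with hm
  have m1 : y0 < m := by rw [hm]; linarith
  have m2 : m < y1 := by rw [hm]; linarith
  set k := (x0 + x1) / 2 with hk
  have k1 : x0 < k := by rw [hk]; linarith
  have k2 : k < x1 := by rw [hk]; linarith
  obtain ⟨x', y', q1, q2, q3, q4, q5⟩ := h.fF k m k1.le k2.le m1.le m2.le a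
    (by rw [hC k m k1 k2 m1 m2]; exact ha)
  have hmem : mb a (f x' y').c.1 := by
    rcases q5 with q | q
    . exact q.2.1
    . exact q.1
  rcases q2.eq_or_lt with rfl | q2
  . have := h.monoY (x := x') hx.le le_rfl m1.le q3 q4
    rw [hR m m1 m2] at this
    exact .inr (.inr (this.1 a hmem))
  rcases q4.eq_or_lt with rfl | q4
  . have := h.monoX (y := y') k1.le q1 q2.le hy.le le_rfl
    rw [hT k k1 k2] at this
    exact .inr (.inl (this.1 a hmem))
  . rw [h.const_kap hC ° q2 ° q4] at q5
    rcases q5 with ⟨q6, q7, q8⟩ | ⟨q6, q7⟩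
    . rcases q8 with q8 | q8
      . exact absurd q7 q8.1
      . exact .inl ⟨rfl, q8.2⟩
    . rcases q7 with q7 | q7
      . exact absurd q7 q2.ne
      . exact absurd q7 q4.ne

/-- closed rectangle with constant interior and constant open edges -/
structure CBox (K : Sys) (f : ℝ -> ℝ -> PT) (x0 x1 y0 y1 : ℝ) : Prop where
  mod : TMod K f x0 x1 y0 y1
  hC : ∃ C, ∀ x y, x0 < x -> x < x1 -> y0 < y -> y < y1 -> (f x y).c = C
  hl : ∃ s, ∀ y, y0 < y -> y < y1 -> f x0 y = s
  hr : ∃ s, ∀ y, y0 < y -> y < y1 -> f x1 y = s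
  hb : ∃ s, ∀ x, x0 < x -> x < x1 -> f x y0 = s
  ht : ∃ s, ∀ x, x0 < x -> x < x1 -> f x y1 = s
theorem CBox.tr (h : CBox K f x0 x1 y0 y1) : CBox K (fT f) y0 y1 x0 x1 where
  mod := h.mod.tr
  hC := by
    obtain ⟨C, hC⟩ := h.hC
    exact ⟨C, fun x y h1 h2 h3 h4 => hC y x h3 h4 h1 h2⟩
  hl := by obtain ⟨s, hs⟩ := h.hb; exact ⟨s.tr, fun x h1 h2 => by simp only [fT, hs x h1 h2]⟩
  hr := by obtain ⟨s, hs⟩ := h.ht; exact ⟨s.tr, fun x h1 h2 => by simp only [fT, hs x h1 h2]⟩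
  hb := by obtain ⟨s, hs⟩ := h.hl; exact ⟨s.tr, fun x h1 h2 => by simp only [fT, hs x h1 h2]⟩
  ht := by obtain ⟨s, hs⟩ := h.hr; exact ⟨s.tr, fun x h1 h2 => by simp only [fT, hs x h1 h2]⟩
theorem CBox.vert (h : CBox K f x0 x1 y0 y1) {x : ℝ} (h1 : x0 <= x) (h2 : x <= x1) :
    ∃ s, ∀ y, y0 < y -> y < y1 -> f x y = s := by
  rcases tri_cases h1 h2 with rfl | rfl | h3
  . exact h.hl
  . exact h.hr
  . obtain ⟨C, hC⟩ := h.hC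
    exact ⟨kap C, fun y h4 h5 => h.mod.const_kap hC h3.1 h3.2 h4 h5⟩
theorem CBox.restr (h : CBox K f x0 x1 y0 y1) {u0 u1 v0 v1 : ℝ} (hu0 : x0 <= u0) (hu : u0 < u1)
    (hu1 : u1 <= x1) (hv0 : y0 <= v0) (hv : v0 < v1) (hv1 : v1 <= y1) : CBox K f u0 u1 v0 v1 where
  mod := h.mod.restr hu0 hu1 hv0 hv1
  hC := by
    obtain ⟨C, hC⟩ := h.hC
    exact ⟨C, fun x y h1 h2 h3 h4 => hC x y ° ° ° °⟩
  hl := by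
    obtain ⟨s, hs⟩ := h.vert hu0 °
    exact ⟨s, fun y h1 h2 => hs y ° °⟩
  hr := by
    obtain ⟨s, hs⟩ := h.vert (x := u1) ° hu1
    exact ⟨s, fun y h1 h2 => hs y ° °⟩
  hb := by
    obtain ⟨s, hs⟩ := h.tr.vert hv0 °
    exact ⟨s.tr, fun x h1 h2 => by rw [<- hs x ° °]; rfl⟩
  ht := by
    obtain ⟨s, hs⟩ := h.tr.vert (x := v1) ° hv1
    exact ⟨s.tr, fun x h1 h2 => by rw [<- hs x ° °]; rfl⟩
theorem CBox.DD (h : CBox K f x0 x1 y0 y1) (hx : x0 < x1) (hy : y0 < y1) : DD K f x0 x1 y0 y1 := by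
  obtain ⟨C, hC⟩ := h.hC
  obtain ⟨L, hL⟩ := h.hl
  obtain ⟨R, hR⟩ := h.hr
  obtain ⟨B, hB⟩ := h.hb
  obtain ⟨T, hT⟩ := h.ht
  have M := h.mod
  set m := (y0 + y1) / 2 with hm
  have m1 : y0 < m := by rw [hm]; linarith
  have m2 : m < y1 := by rw [hm]; linarith
  set k := (x0 + x1) / 2 with hk
  have k1 : x0 < k := by rw [hk]; linarith
  have k2 : k < x1 := by rw [hk]; linarith
  have Mt := M.toModel.tr
  have Md := M.toModel.dual
  have Mdt := Md.tr
  have eL := M.const_ns (C := L.c) le_rfl hx.le le_rfl le_rfl (fun y h3 h4 => by rw [hL y h3 h4]) m m1 m2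
  have eR := M.const_ns (C := R.c) hx.le le_rfl le_rfl le_rfl (fun y h3 h4 => by rw [hR y h3 h4]) m m1 m2
  have eB := M.const_ew (C := B.c) le_rfl hy.le le_rfl le_rfl (fun y h3 h4 => by rw [hB y h3 h4]) k k1 k2
  have eT := M.const_ew (C := T.c) hy.le le_rfl le_rfl le_rfl (fun y h3 h4 => by rw [hT y h3 h4]) k k1 k2
  have eLe : L.e = C := by
    rw [<- hL m m1 m2]
    refine eventually_eq_unique (M.gE x0 m le_rfl hx m1.le m2.le) ?_
    filter_upwards [Ioo_mem_nhdsGT hx] with z hz using hC z m hz.1 hz.2 m1 m2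
  have eRw : R.w = C := by
    rw [<- hR m m1 m2]
    refine eventually_eq_unique (M.gW x1 m hx le_rfl m1.le m2.le) ?_
    filter_upwards [Ioo_mem_nhdsLT hx] with z hz using hC z m hz.1 hz.2 m1 m2
  have eBn : B.n = C := by
    rw [<- hB k k1 k2]
    refine eventually_eq_unique (M.gN k y0 k1.le k2.le le_rfl hy) ?_
    filter_upwards [Ioo_mem_nhdsGT hy] with z hz using hC k z k1 k2 hz.1 hz.2
  have eTs : T.s = C := by
    rw [<- hT k k1 k2]
    refine eventually_eq_unique (M.gS k y1 k1.le k2.le hy le_rfl) ?_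
    filter_upwards [Ioo_mem_nhdsLT hy] with z hz using hC k z k1 k2 hz.1 hz.2
  rw [hL m m1 m2] at eL
  rw [hR m m1 m2] at eR
  rw [hB k k1 k2] at eB
  rw [hT k k1 k2] at eT
  refine M.DD_of_rule (q := ⟨f x0 y0, f x1 y0, f x0 y1, f x1 y1, [L], [R], [B], [T]⟩)
    ⟨⟨rfl, rfl, rfl, rfl, .one hy hL, .one hy hR, .one hx hB, .one hx hT⟩, trivial, trivial,
      trivial, trivial⟩ (.inl ?_)
  have key : RBase K ⟨f x0 y0, f x1 y0, f x0 y1, f x1 y1, [L], [R], [B], [T]⟩ := by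
    constructor
    case l => rfl
    case r => rfl
    case b => rfl
    case t => rfl
    case vsw => exact M.val _ _ le_rfl hx.le le_rfl hy.le
    case vse => exact M.val _ _ hx.le le_rfl le_rfl hy.le
    case vnw => exact M.val _ _ le_rfl hx.le hy.le le_rfl
    case vne => exact M.val _ _ hx.le le_rfl hy.le le_rfl
    case vl => exact hL m m1 m2 ▸ M.val x0 m le_rfl hx.le m1.le m2.le
    case vr => exact hR m m1 m2 ▸ M.val x1 m hx.le le_rfl m1.le m2.le
    case vb => exact hB k k1 k2 ▸ M.val k y0 k1.le k2.le le_rfl hy.le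
    case vt => exact hT k k1 k2 ▸ M.val k y1 k1.le k2.le hy.le le_rfl
    case vC =>
      change Valid K (kap L.e)
      rw [eLe, <- M.const_kap hC k1 k2 m1 m2]
      exact M.val k m k1.le k2.le m1.le m2.le
    case ln => exact eL.1
    case ls => exact eL.2
    case rn => exact eR.1
    case rs => exact eR.2
    case rw' => exact eRw.trans eLe.symm
    case be => exact eB.1
    case bw => exact eB.2
    case bn => exact eBn.trans eLe.symm
    case te => exact eT.1
    case tw => exact eT.2
    case ts => exact eTs.trans eLe.symm
    case swn =>
      refine eventually_eq_unique (M.gN x0 y0 le_rfl hx.le le_rfl hy) ?_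
      filter_upwards [Ioo_mem_nhdsGT hy] with z hz
      rw [hL z hz.1 hz.2]; rfl
    case swe =>
      refine eventually_eq_unique (M.gE x0 y0 le_rfl hx le_rfl hy.le) ?_
      filter_upwards [Ioo_mem_nhdsGT hx] with z hz
      rw [hB z hz.1 hz.2]; rfl
    case sen =>
      refine eventually_eq_unique (M.gN x1 y0 hx.le le_rfl le_rfl hy) ?_
      filter_upwards [Ioo_mem_nhdsGT hy] with z hz
      rw [hR z hz.1 hz.2]; rfl
    case sew =>
      refine eventually_eq_unique (M.gW x1 y0 hx le_rfl le_rfl hy.le) ?_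
      filter_upwards [Ioo_mem_nhdsLT hx] with z hz
      rw [hB z hz.1 hz.2]; rfl
    case nws =>
      refine eventually_eq_unique (M.gS x0 y1 le_rfl hx.le hy le_rfl) ?_
      filter_upwards [Ioo_mem_nhdsLT hy] with z hz
      rw [hL z hz.1 hz.2]; rfl
    case nwe =>
      refine eventually_eq_unique (M.gE x0 y1 le_rfl hx hy.le le_rfl) ?_
      filter_upwards [Ioo_mem_nhdsGT hx] with z hz
      rw [hT z hz.1 hz.2]; rfl
    case nes =>
      refine eventually_eq_unique (M.gS x1 y1 hx.le le_rfl hy le_rfl) ?_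
      filter_upwards [Ioo_mem_nhdsLT hy] with z hz
      rw [hR z hz.1 hz.2]; rfl
    case new =>
      refine eventually_eq_unique (M.gW x1 y1 hx le_rfl hy.le le_rfl) ?_
      filter_upwards [Ioo_mem_nhdsLT hx] with z hz
      rw [hT z hz.1 hz.2]; rfl
    case fC =>
      change covF K true L.e T.c R.c
      rw [eLe]; exact M.cov_C hx hy hC hT hR
    case fl =>
      change covF K L.re L.c L.e (f x0 y1).c
      rw [eLe]; exact M.cov_l hx hy hC hL
    case fb =>
      change covF K B.re B.c L.e (f x1 y0).c
      rw [eLe]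
      exact Mt.cov_l (L := B.tr) hy hx (fun x y h1 h2 h3 h4 => hC y x h3 h4 h1 h2)
        (fun y h1 h2 => by simp only [fT, hB y h1 h2])
    case pC =>
      change covP K true L.e L.c B.c
      rw [eLe]
      exact Md.cov_C (C := C.swap) (T := L.du) (R := B.du) ° °
        (fun x y h1 h2 h3 h4 => by
          simp only [fD, PT.du_c, hC (-y) (-x) ° ° ° °])
        (fun x h1 h2 => by simp only [fD, neg_neg, hL (-x) ° °])
        (fun x h1 h2 => by simp only [fD, neg_neg, hB (-x) ° °])
    case pr =>
      change covP K R.re R.c L.e (f x1 y0).c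
      rw [eLe]
      have := Mdt.cov_l (C := C.swap) (L := R.du.tr) ° °
        (fun x y h1 h2 h3 h4 => by
          simp only [fT, fD, PT.tr_c, PT.du_c, hC (-x) (-y) ° ° ° °])
        (fun x h1 h2 => by simp only [fT, fD, neg_neg, hR (-x) ° °])
      simp only [fT, fD, neg_neg] at this
      exact this
    case pt =>
      change covP K T.re T.c L.e (f x0 y1).c
      rw [eLe]
      have := Md.cov_l (C := C.swap) (L := T.du) ° °
        (fun x y h1 h2 h3 h4 => by
          simp only [fD, PT.du_c, hC (-y) (-x) ° ° ° °])
        (fun x h1 h2 => by simp only [fD, neg_neg, hT (-x) ° °])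
      simp only [fD, neg_neg] at this
      exact this
  exact key
theorem CBox.DD_sub (h : CBox K f x0 x1 y0 y1) {u0 u1 v0 v1 : ℝ} (hu0 : x0 <= u0) (hu : u0 < u1)
    (hu1 : u1 <= x1) (hv0 : y0 <= v0) (hv : v0 < v1) (hv1 : v1 <= y1) : Temporal.DD K f u0 u1 v0 v1 :=
  (h.restr hu0 hu hu1 hv0 hv hv1).DD hu hv
end

section
variable {K : Sys} {f : ℝ -> ℝ -> PT} {x0 x1 y0 y1 : ℝ}
theorem ev_gt {a : ℝ} {P : ℝ -> Prop} (h : ∀ᶠ y in 𝓝[>] a, P y) :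
    ∃ δ > 0, ∀ y, a < y -> y < a + δ -> P y := by
  obtain ⟨u, hu, h⟩ := mem_nhdsGT_iff_exists_Ioo_subset.1 h
  exact ⟨u - a, sub_pos.2 hu, fun y h1 h2 => h ⟨h1, °⟩⟩
theorem ev_lt {a : ℝ} {P : ℝ -> Prop} (h : ∀ᶠ y in 𝓝[<] a, P y) :
    ∃ δ > 0, ∀ y, a - δ < y -> y < a -> P y := by
  obtain ⟨u, hu, h⟩ := mem_nhdsLT_iff_exists_Ioo_subset.1 h
  exact ⟨a - u, sub_pos.2 hu, fun y h1 h2 => h ⟨°, h2⟩⟩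
theorem TMod.NEbox (h : TMod K f x0 x1 y0 y1) {x y : ℝ} (h1 : x0 <= x) (h2 : x < x1) (h3 : y0 <= y)
    (h4 : y < y1) : ∃ ε > 0, x + ε <= x1 /\ y + ε <= y1 /\ CBox K f x (x + ε) y (y + ε) := by
  obtain ⟨⟨u, v⟩, ⟨u1, u2, v1, v2⟩, hmin⟩ := exists_min_cmu (N := K.n)
    (P := fun p : ℝ × ℝ => x < p.1 /\ p.1 < x1 /\ y < p.2 /\ p.2 < y1) (fun p => (f p.1 p.2).c)
    ⟨((x + x1) / 2, (y + y1) / 2), by simp only; constructor <;> [linarith; constructor <;> [linarith; constructor <;> linarith]]⟩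
    (fun p hp => (h.val p.1 p.2 (by linarith [hp.1]) (by linarith [hp.2.1]) (by linarith [hp.2.2.1])
      (by linarith [hp.2.2.2])).bc)
  simp only at u1 u2 v1 v2 hmin
  have hC : ∀ x' y', x < x' -> x' < u -> y < y' -> y' < v -> (f x' y').c = (f u v).c := by
    intro x' y' q1 q2 q3 q4
    exact (h.mono ° q2.le u2.le ° q4.le v2.le).eq_of_mu
      (hmin (x', y') ⟨q1, °, q3, °⟩)
  obtain ⟨sl, hl⟩ := h.germN h1 h2.le h3 h4
  obtain ⟨sb, hb⟩ := h.tr.germN h3 h4.le h1 h2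
  obtain ⟨δ1, d1, hl⟩ := ev_gt hl
  obtain ⟨δ2, d2, hb⟩ := ev_gt hb
  obtain ⟨ε, e1, e2⟩ := exists_between (a₁ := (0:ℝ)) (a₂ := min (min δ1 δ2) (min (u - x) (v - y)))
    (lt_min (lt_min d1 d2) (lt_min ° °))
  simp only [lt_min_iff] at e2
  obtain ⟨⟨e3, e4⟩, e5, e6⟩ := e2
  have M := h.restr (u0 := x) (u1 := u) (v0 := y) (v1 := v) h1 u2.le h3 v2.le
  refine ⟨ε, e1, °, °, h.restr h1 ° h3 °,
    ⟨_, fun x' y' q1 q2 q3 q4 => hC x' y' q1 ° q3 °⟩,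
    ⟨sl, fun y' q1 q2 => hl y' q1 °⟩,
    ⟨_, fun y' q1 q2 => M.const_kap hC ° ° q1 °⟩,
    ⟨sb.tr, fun x' q1 q2 => by rw [<- hb x' q1 °]; rfl⟩,
    ⟨_, fun x' q1 q2 => M.const_kap hC q1 ° ° °⟩⟩
theorem TMod.SWbox (h : TMod K f x0 x1 y0 y1) {x y : ℝ} (h1 : x0 < x) (h2 : x <= x1) (h3 : y0 < y)
    (h4 : y <= y1) : ∃ ε > 0, x0 <= x - ε /\ y0 <= y - ε /\ CBox K f (x - ε) x (y - ε) y := by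
  obtain ⟨⟨u, v⟩, ⟨u1, u2, v1, v2⟩, hmin⟩ := exists_max_cmu (N := K.n)
    (P := fun p : ℝ × ℝ => x0 < p.1 /\ p.1 < x /\ y0 < p.2 /\ p.2 < y) (fun p => (f p.1 p.2).c)
    ⟨((x0 + x) / 2, (y0 + y) / 2), by simp only; constructor <;> [linarith; constructor <;> [linarith; constructor <;> linarith]]⟩
    (fun p hp => (h.val p.1 p.2 (by linarith [hp.1]) (by linarith [hp.2.1]) (by linarith [hp.2.2.1])
      (by linarith [hp.2.2.2])).bc)
  simp only at u1 u2 v1 v2 hmin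
  have hC : ∀ x' y', u < x' -> x' < x -> v < y' -> y' < y -> (f x' y').c = (f u v).c := by
    intro x' y' q1 q2 q3 q4
    exact ((h.mono u1.le q1.le ° v1.le q3.le °).eq_of_mu
      (hmin (x', y') ⟨°, q2, °, q4⟩)).symm
  obtain ⟨sl, hl⟩ := h.germS h1.le h2 h3 h4
  obtain ⟨sb, hb⟩ := h.tr.germS h3.le h4 h1 h2
  obtain ⟨δ1, d1, hl⟩ := ev_lt hl
  obtain ⟨δ2, d2, hb⟩ := ev_lt hb
  obtain ⟨ε, e1, e2⟩ := exists_between (a₁ := (0:ℝ)) (a₂ := min (min δ1 δ2) (min (x - u) (y - v)))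
    (lt_min (lt_min d1 d2) (lt_min ° °))
  simp only [lt_min_iff] at e2
  obtain ⟨⟨e3, e4⟩, e5, e6⟩ := e2
  have M := h.restr (u0 := u) (u1 := x) (v0 := v) (v1 := y) u1.le h2 v1.le h4
  refine ⟨ε, e1, °, °, h.restr ° h2 ° h4,
    ⟨_, fun x' y' q1 q2 q3 q4 => hC x' y' ° q2 ° q4⟩,
    ⟨_, fun y' q1 q2 => M.const_kap hC ° ° ° q2⟩,
    ⟨sl, fun y' q1 q2 => hl y' ° q2⟩,
    ⟨_, fun x' q1 q2 => M.const_kap hC ° q2 ° °⟩,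
    ⟨sb.tr, fun x' q1 q2 => by rw [<- hb x' ° q2]; rfl⟩⟩

/-! ### Local goodness and the covering lemma -/

def SEg (D : ℝ -> ℝ -> ℝ -> ℝ -> Prop) (b c x y : ℝ) : Prop :=
  ∃ ε > 0, ∀ p p' r r', x <= p -> p < p' -> p' <= x + ε -> p' <= b -> y - ε <= r -> c <= r -> r < r' -> r' <= y ->
    D p p' r r'
def NEg (D : ℝ -> ℝ -> ℝ -> ℝ -> Prop) (b d x y : ℝ) : Prop :=
  ∃ ε > 0, ∀ p p' r r', x <= p -> p < p' -> p' <= x + ε -> p' <= b -> y <= r -> r < r' -> r' <= y + ε -> r' <= d ->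
    D p p' r r'
def SWg (D : ℝ -> ℝ -> ℝ -> ℝ -> Prop) (a c x y : ℝ) : Prop :=
  ∃ ε > 0, ∀ p p' r r', x - ε <= p -> a <= p -> p < p' -> p' <= x -> y - ε <= r -> c <= r -> r < r' -> r' <= y ->
    D p p' r r'
def NWg (D : ℝ -> ℝ -> ℝ -> ℝ -> Prop) (a d x y : ℝ) : Prop :=
  ∃ ε > 0, ∀ p p' r r', x - ε <= p -> a <= p -> p < p' -> p' <= x -> y <= r -> r < r' -> r' <= y + ε -> r' <= d ->
    D p p' r r'
theorem strip {a b : ℝ} (hab : a < b) (P : ℝ -> ℝ -> ℝ -> Prop)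
    (hj : ∀ p m p' δ, a <= p -> p < m -> m < p' -> p' <= b -> 0 < δ -> P p m δ -> P m p' δ -> P p p' δ)
    (hr : ∀ x, a <= x -> x <= b -> ∃ ε > 0, ∀ p p' δ, x <= p -> p < p' -> p' <= x + ε -> p' <= b -> 0 < δ ->
      δ <= ε -> P p p' δ)
    (hl : ∀ x, a <= x -> x <= b -> ∃ ε > 0, ∀ p p' δ, x - ε <= p -> a <= p -> p < p' -> p' <= x -> 0 < δ ->
      δ <= ε -> P p p' δ) :
    ∃ ε > 0, ∀ p p' δ, a <= p -> p < p' -> p' <= b -> 0 < δ -> δ <= ε -> P p p' δ := by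
  refine bis hab (fun u v => ∃ ε > 0, ∀ p p' δ, u <= p -> p < p' -> p' <= v -> 0 < δ -> δ <= ε -> P p p' δ)
    ?_ ?_ ?_
  . rintro x y z q1 q2 q3 q4 ⟨e1, e1p, h1⟩ ⟨e2, e2p, h2⟩
    refine ⟨min e1 e2, lt_min e1p e2p, fun p p' δ r1 r2 r3 r4 r5 => ?_⟩
    have r6 := r5.trans (min_le_left _ _)
    have r7 := r5.trans (min_le_right _ _)
    rcases le_or_gt p' y with g | g
    . exact h1 p p' δ r1 r2 g r4 r6
    rcases le_or_gt y p with g' | g'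
    . exact h2 p p' δ g' r2 r3 r4 r7
    exact hj p y p' δ ° g' g ° r4 (h1 p y δ r1 g' le_rfl r4 r6)
      (h2 y p' δ le_rfl g r3 r4 r7)
  . intro x q1 q2
    obtain ⟨ε, e, h⟩ := hr x q1 q2.le
    filter_upwards [Ioo_mem_nhdsGT (show x < min (x + ε) b from lt_min ° q2)] with v hv
    have := hv.2.trans_le (min_le_left _ _)
    have := hv.2.trans_le (min_le_right _ _)
    exact ⟨ε, e, fun p p' δ r1 r2 r3 r4 r5 => h p p' δ r1 r2 ° ° r4 r5⟩
  . intro x q1 q2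
    obtain ⟨ε, e, h⟩ := hl x q1.le q2
    filter_upwards [Ioo_mem_nhdsLT (show max (x - ε) a < x from max_lt ° q1)] with v hv
    have := (le_max_left _ _).trans_lt hv.1
    have := (le_max_right _ _).trans_lt hv.1
    exact ⟨ε, e, fun p p' δ r1 r2 r3 r4 r5 => h p p' δ ° ° r2 r3 r4 r5⟩
theorem cover {a b c d : ℝ} (hab : a < b) (hcd : c < d) (D : ℝ -> ℝ -> ℝ -> ℝ -> Prop)
    (hjX : ∀ p m p' r r', a <= p -> p < m -> m < p' -> p' <= b -> c <= r -> r < r' -> r' <= d ->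
      D p m r r' -> D m p' r r' -> D p p' r r')
    (hjY : ∀ p p' r m r', a <= p -> p < p' -> p' <= b -> c <= r -> r < m -> m < r' -> r' <= d ->
      D p p' r m -> D p p' m r' -> D p p' r r')
    (hg : ∀ x y, a <= x -> x <= b -> c <= y -> y <= d ->
      SEg D b c x y /\ NEg D b d x y /\ SWg D a c x y /\ NWg D a d x y) : D a b c d := by
  refine bis hcd (fun r r' => D a b r r') (fun x y z q1 q2 q3 q4 h1 h2 =>
    hjY a b x y z le_rfl hab le_rfl q1 q2 q3 q4 h1 h2) ?_ ?_
  . intro y q1 q2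
    obtain ⟨ε, e, h⟩ := strip hab (fun p p' δ => y + δ <= d -> D p p' y (y + δ))
      (fun p m p' δ r1 r2 r3 r4 r5 h1 h2 h3 => hjX p m p' y (y + δ) r1 r2 r3 r4 q1 ° h3
        (h1 h3) (h2 h3))
      (fun x r1 r2 => by
        obtain ⟨ε, e, h⟩ := (hg x y r1 r2 q1 q2.le).2.1
        exact ⟨ε, e, fun p p' δ t1 t2 t3 t4 t5 t6 t7 => h p p' _ _ t1 t2 t3 t4 le_rfl °
          ° t7⟩)
      (fun x r1 r2 => by
        obtain ⟨ε, e, h⟩ := (hg x y r1 r2 q1 q2.le).2.2.2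
        exact ⟨ε, e, fun p p' δ t1 t2 t3 t4 t5 t6 t7 => h p p' _ _ t1 t2 t3 t4 le_rfl °
          ° t7⟩)
    filter_upwards [Ioo_mem_nhdsGT (show y < min (y + ε) d from lt_min ° q2)] with v hv
    have g1 := hv.2.trans_le (min_le_left _ _)
    have g2 := hv.2.trans_le (min_le_right _ _)
    have := h a b (v - y) le_rfl hab le_rfl (by linarith [hv.1]) ° °
    simpa using this
  . intro y q1 q2
    obtain ⟨ε, e, h⟩ := strip hab (fun p p' δ => c <= y - δ -> D p p' (y - δ) y)
      (fun p m p' δ r1 r2 r3 r4 r5 h1 h2 h3 => hjX p m p' (y - δ) y r1 r2 r3 r4 h3 ° q2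
        (h1 h3) (h2 h3))
      (fun x r1 r2 => by
        obtain ⟨ε, e, h⟩ := (hg x y r1 r2 q1.le q2).1
        exact ⟨ε, e, fun p p' δ t1 t2 t3 t4 t5 t6 t7 => h p p' _ _ t1 t2 t3 t4 ° t7
          ° le_rfl⟩)
      (fun x r1 r2 => by
        obtain ⟨ε, e, h⟩ := (hg x y r1 r2 q1.le q2).2.2.1
        exact ⟨ε, e, fun p p' δ t1 t2 t3 t4 t5 t6 t7 => h p p' _ _ t1 t2 t3 t4 ° t7
          ° le_rfl⟩)
    filter_upwards [Ioo_mem_nhdsLT (show max (y - ε) c < y from max_lt ° q1)] with v hv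
    have g1 := (le_max_left _ _).trans_lt hv.1
    have g2 := (le_max_right _ _).trans_lt hv.1
    have := h a b (y - v) le_rfl hab le_rfl (by linarith [hv.2]) ° °
    simpa using this
theorem TMod.NEgood (h : TMod K f x0 x1 y0 y1) {x y : ℝ} (h1 : x0 <= x) (h3 : y0 <= y) :
    NEg (DD K f) x1 y1 x y := by
  rcases le_or_gt x1 x with h2 | h2
  . exact ⟨1, one_pos, fun p p' r r' q1 q2 q3 q4 => °⟩
  rcases le_or_gt y1 y with h4 | h4
  . exact ⟨1, one_pos, fun p p' r r' q1 q2 q3 q4 q5 q6 q7 q8 => °⟩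
  obtain ⟨ε, e, e1, e2, hb⟩ := h.NEbox h1 h2 h3 h4
  exact ⟨ε, e, fun p p' r r' q1 q2 q3 q4 q5 q6 q7 q8 => hb.DD_sub q1 q2 q3 q5 q6 q7⟩
theorem TMod.SWgood (h : TMod K f x0 x1 y0 y1) {x y : ℝ} (h2 : x <= x1) (h4 : y <= y1) :
    SWg (DD K f) x0 y0 x y := by
  rcases le_or_gt x x0 with h1 | h1
  . exact ⟨1, one_pos, fun p p' r r' q1 q2 q3 q4 => °⟩
  rcases le_or_gt y y0 with h3 | h3
  . exact ⟨1, one_pos, fun p p' r r' q1 q2 q3 q4 q5 q6 q7 q8 => °⟩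
  obtain ⟨ε, e, e1, e2, hb⟩ := h.SWbox h1 h2 h3 h4
  exact ⟨ε, e, fun p p' r r' q1 q2 q3 q4 q5 q6 q7 q8 => hb.DD_sub q1 q3 q4 q5 q7 q8⟩

/-- covering lemma for derivability -/
theorem TMod.cover (h : TMod K f x0 x1 y0 y1) (hx : x0 < x1) (hy : y0 < y1)
    (hg : ∀ x y, x0 <= x -> x <= x1 -> y0 <= y -> y <= y1 ->
      SEg (DD K f) x1 y0 x y /\ NWg (DD K f) x0 y1 x y) : DD K f x0 x1 y0 y1 := by
  refine Temporal.cover hx hy (DD K f) ?_ ?_ ?_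
  . intro p m p' r r' q1 q2 q3 q4 q5 q6 q7 d1 d2
    exact DD.joinX (h.restr q1 q4 q5 q7) d1 d2
  . intro p p' r m r' q1 q2 q3 q4 q5 q6 q7 d1 d2
    exact DD.joinY (h.restr q1 q3 q4 q7) d1 d2
  . intro x y q1 q2 q3 q4
    exact ⟨(hg x y q1 q2 q3 q4).1, h.NEgood q1 q3, h.SWgood q2 q4, (hg x y q1 q2 q3 q4).2⟩
end

section
variable {K : Sys} {f : ℝ -> ℝ -> PT} {x0 x1 y0 y1 : ℝ}

/-! ### Fans are derivable -/

def GSE (K : Sys) (f : ℝ -> ℝ -> PT) (x y : ℝ) : Prop :=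
  ∃ ε > 0, ∀ p p' r r', x <= p -> p < p' -> p' <= x + ε -> y - ε <= r -> r < r' -> r' <= y -> DD K f p p' r r'
def GNW (K : Sys) (f : ℝ -> ℝ -> PT) (x y : ℝ) : Prop :=
  ∃ ε > 0, ∀ p p' r r', x - ε <= p -> p < p' -> p' <= x -> y <= r -> r < r' -> r' <= y + ε -> DD K f p p' r r'
theorem GSE.seg {b c x y : ℝ} (h : GSE K f x y) : SEg (DD K f) b c x y := by
  obtain ⟨ε, e, h⟩ := h
  exact ⟨ε, e, fun p p' r r' q1 q2 q3 q4 q5 q6 q7 q8 => h p p' r r' q1 q2 q3 q5 q7 q8⟩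
theorem GNW.nwg {b c x y : ℝ} (h : GNW K f x y) : NWg (DD K f) b c x y := by
  obtain ⟨ε, e, h⟩ := h
  exact ⟨ε, e, fun p p' r r' q1 q2 q3 q4 q5 q6 q7 q8 => h p p' r r' q1 q3 q4 q5 q6 q7⟩
theorem Model.cov_l' (h : Model K f x0 x1 y0 y1) (hx : x0 < x1) (hy : y0 < y1) {L : PT}
    (hL : ∀ y, y0 < y -> y < y1 -> f x0 y = L) : covF K L.re L.c L.e (f x0 y1).c := by
  intro a ha
  set m := (y0 + y1) / 2 with hm
  have m1 : y0 < m := by rw [hm]; linarith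
  have m2 : m < y1 := by rw [hm]; linarith
  obtain ⟨x', y', q1, q2, q3, q4, q5⟩ := h.fF x0 m le_rfl hx.le m1.le m2.le a
    (by rw [hL m m1 m2]; exact ha)
  have hmem : mb a (f x' y').c.1 := by
    rcases q5 with q | q
    . exact q.2.1
    . exact q.1
  rcases q1.eq_or_lt with rfl | q1
  . rcases q4.eq_or_lt with rfl | q4
    . exact .inr (.inr hmem)
    . rw [hL y' ° q4] at q5
      have hn := h.const_ns (C := L.c) le_rfl hx.le le_rfl le_rfl
        (fun y h3 h4 => by rw [hL y h3 h4]) m m1 m2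
      rw [hL m m1 m2] at hn
      rcases q5 with ⟨q6, q7, q8⟩ | ⟨q6, q7⟩
      . rcases q8 with q8 | q8
        . rw [hn.1] at q8; exact absurd q7 q8.1
        . exact .inl ⟨q6, q8.2⟩
      . rcases q7 with q7 | q7
        . exact absurd q7 hx.ne
        . exact absurd q7 q4.ne
  . right; left
    have hE := h.gE x0 m le_rfl hx m1.le m2.le
    obtain ⟨z, z1, z2⟩ := (hE.and (Ioo_mem_nhdsGT q1)).exists
    have := h.mono (x := z) (x' := x') z2.1.le z2.2.le q2 m1.le q3 q4
    rw [z1, hL m m1 m2] at this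
    exact this.1 a hmem
theorem TMod.leftbox (h : TMod K f x0 x1 y0 y1) (hx : x0 < x1) {s : PT}
    (hs : ∀ y, y0 < y -> y < y1 -> f x0 y = s) {v1 v2 : ℝ} (h1 : y0 < v1) (h2 : v1 < v2)
    (h3 : v2 < y1) : ∃ ε > 0, x0 + ε <= x1 /\ CBox K f x0 (x0 + ε) v1 v2 := by
  set u1 := (y0 + v1) / 2 with hu1
  set u2 := (y1 + v2) / 2 with hu2
  have a1 : y0 < u1 := by rw [hu1]; linarith
  have a2 : u1 < v1 := by rw [hu1]; linarith
  have a3 : v2 < u2 := by rw [hu2]; linarith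
  have a4 : u2 < y1 := by rw [hu2]; linarith
  obtain ⟨δ1, d1, g1⟩ := ev_gt (h.gE x0 u1 le_rfl hx ° °)
  obtain ⟨δ2, d2, g2⟩ := ev_gt (h.gE x0 u2 le_rfl hx ° °)
  rw [hs u1 ° °] at g1
  rw [hs u2 ° °] at g2
  obtain ⟨δ, d3, d4⟩ := exists_between (a₁ := (0:ℝ)) (a₂ := min (min δ1 δ2) (x1 - x0))
    (lt_min (lt_min d1 d2) °)
  simp only [lt_min_iff] at d4
  have hC : ∀ x y, x0 < x -> x < x0 + δ -> u1 < y -> y < u2 -> (f x y).c = s.e := by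
    intro x y q1 q2 q3 q4
    have e1 := h.monoY (x := x) q1.le ° a1.le q3.le °
    have e2 := h.monoY (x := x) q1.le ° ° q4.le a4.le
    rw [g1 x q1 °] at e1
    rw [g2 x q1 °] at e2
    exact e2.antisymm e1
  have M := h.restr (u0 := x0) (u1 := x0 + δ) (v0 := u1) (v1 := u2) le_rfl ° °
    °
  refine ⟨δ / 2, °, °, h.restr le_rfl ° ° °,
    ⟨s.e, fun x y q1 q2 q3 q4 => hC x y q1 ° ° °⟩,
    ⟨s, fun y q1 q2 => hs y ° °⟩,
    ⟨_, fun y q1 q2 => M.const_kap hC ° ° ° °⟩,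
    ⟨_, fun x q1 q2 => M.const_kap hC q1 ° ° °⟩,
    ⟨_, fun x q1 q2 => M.const_kap hC q1 ° ° °⟩⟩
theorem TMod.topbox (h : TMod K f x0 x1 y0 y1) (hy : y0 < y1) {s : PT}
    (hs : ∀ x, x0 < x -> x < x1 -> f x y1 = s) {v1 v2 : ℝ} (h1 : x0 < v1) (h2 : v1 < v2)
    (h3 : v2 < x1) : ∃ ε > 0, y0 <= y1 - ε /\ CBox K f v1 v2 (y1 - ε) y1 := by
  set u1 := (x0 + v1) / 2 with hu1
  set u2 := (x1 + v2) / 2 with hu2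
  have a1 : x0 < u1 := by rw [hu1]; linarith
  have a2 : u1 < v1 := by rw [hu1]; linarith
  have a3 : v2 < u2 := by rw [hu2]; linarith
  have a4 : u2 < x1 := by rw [hu2]; linarith
  obtain ⟨δ1, d1, g1⟩ := ev_lt (h.gS u1 y1 ° ° hy le_rfl)
  obtain ⟨δ2, d2, g2⟩ := ev_lt (h.gS u2 y1 ° ° hy le_rfl)
  rw [hs u1 ° °] at g1
  rw [hs u2 ° °] at g2
  obtain ⟨δ, d3, d4⟩ := exists_between (a₁ := (0:ℝ)) (a₂ := min (min δ1 δ2) (y1 - y0))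
    (lt_min (lt_min d1 d2) °)
  simp only [lt_min_iff] at d4
  have hC : ∀ x y, u1 < x -> x < u2 -> y1 - δ < y -> y < y1 -> (f x y).c = s.s := by
    intro x y q1 q2 q3 q4
    have e1 := h.monoX (y := y) a1.le q1.le ° ° q4.le
    have e2 := h.monoX (y := y) ° q2.le a4.le ° q4.le
    rw [g1 y ° q4] at e1
    rw [g2 y ° q4] at e2
    exact e2.antisymm e1
  have M := h.restr (u0 := u1) (u1 := u2) (v0 := y1 - δ) (v1 := y1) ° °
    ° le_rfl
  refine ⟨δ / 2, °, °, h.restr ° ° ° le_rfl,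
    ⟨s.s, fun x y q1 q2 q3 q4 => hC x y ° ° ° q4⟩,
    ⟨_, fun y q1 q2 => M.const_kap hC ° ° ° q2⟩,
    ⟨_, fun y q1 q2 => M.const_kap hC ° ° ° q2⟩,
    ⟨_, fun x q1 q2 => M.const_kap hC ° ° ° °⟩,
    ⟨s, fun x q1 q2 => hs x ° °⟩⟩
theorem pigeon {α : Type} (P : ℝ -> α -> Prop) : ∀ l : List α,
    (∀ z ∈ l, ∃ ε > 0, ∀ η, 0 < η -> η < ε -> ¬ P η z) ->
    ∃ ε > (0:ℝ), ∀ z ∈ l, ∀ η, 0 < η -> η < ε -> ¬ P η z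
  | [], _ => ⟨1, one_pos, by simp⟩
  | z :: l, h => by
    obtain ⟨ε, e, h1⟩ := pigeon P l fun z hz => h z (List.mem_cons_of_mem _ hz)
    obtain ⟨ε', e', h2⟩ := h z List.mem_cons_self
    refine ⟨min ε ε', lt_min e e', fun w hw η q1 q2 => ?_⟩
    rcases List.mem_cons.1 hw with rfl | hw
    . exact h2 η q1 (q2.trans_le (min_le_right _ _))
    . exact h1 w hw η q1 (q2.trans_le (min_le_left _ _))
theorem Red.one {α : Type} (s : α) : Red [s] := trivial

/-- the core of the fan lemma -/
theorem TMod.fan_square (h : TMod K f x0 x1 y0 y1) {sL sT : PT}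
    (hL : ∀ y, y0 < y -> y < y1 -> f x0 y = sL) (hT : ∀ x, x0 < x -> x < x1 -> f x y1 = sT)
    (hD : ∀ p p' r r', x0 <= p -> p < p' -> p' < x1 -> y0 < r -> r < r' -> r' <= y1 -> (x0 < p \/ r' < y1) ->
      DD K f p p' r r') {q : Lab} {η : ℝ} (hη : 0 < η) (hηx : x0 + η < x1) (hηy : y0 < y1 - η)
    (hq : RLab f x0 (x0 + η) (y1 - η) y1 q)
    (hfr : ∀ ε > 0, ∃ η', 0 < η' /\ η' < ε /\ RLab f x0 (x0 + η') (y1 - η') y1 q) :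
    DD K f x0 (x0 + η) (y1 - η) y1 := by
  have hx : x0 < x1 := °
  have hy : y0 < y1 := °
  obtain ⟨sr, hsr⟩ := h.germS (x := x0 + η) (y := y1) ° ° hy le_rfl
  obtain ⟨sb, hsb⟩ := h.tr.germN (x := y1 - η) (y := x0) ° ° le_rfl hx
  replace hsb : ∀ᶠ x in 𝓝[>] x0, f x (y1 - η) = sb.tr := hsb.mono fun x hx => by rw [<- hx]; rfl
  obtain ⟨δ1, d1, hsr⟩ := ev_lt hsr
  obtain ⟨δ2, d2, hsb⟩ := ev_gt hsb
  obtain ⟨θ, t1, t2, hq'⟩ := hfr (min (min δ1 δ2) η) (lt_min (lt_min d1 d2) hη)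
  simp only [lt_min_iff] at t2
  obtain ⟨⟨t2, t3⟩, t4⟩ := t2
  obtain ⟨p1, L1, D1⟩ := hD (x0 + θ) (x0 + η) (y1 - θ) y1 ° ° hηx
    ° ° le_rfl (.inl °)
  obtain ⟨p2, L2, D2⟩ := hD x0 (x0 + θ) (y1 - η) (y1 - θ) ° ° °
    hηy ° ° (.inr °)
  obtain ⟨p3, L3, D3⟩ := hD (x0 + θ) (x0 + η) (y1 - η) (y1 - θ) ° ° hηx
    hηy ° ° (.inr °)
  have M := h.restr (u0 := x0) (u1 := x0 + η) (v0 := y1 - η) (v1 := y1) le_rfl hηx.le hηy.le le_rfl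
  have qsw : q.sw = sL := by rw [<- hq.sw]; exact hL _ ° °
  have qne : q.ne = sT := by rw [<- hq.ne]; exact hT _ ° °
  have p1se : p1.se = sr := by rw [<- L1.se]; exact hsr _ ° °
  have p2se : p2.se = sb.tr := by rw [<- L2.se]; exact hsb _ ° °
  -- right word
  have r2 : p3.r.reverse.head? = some sr := by
    obtain ⟨s, s1, s2⟩ := L3.r.last
    rw [List.head?_reverse, s1]
    congr 1
    refine eventually_eq_unique s2 ?_
    filter_upwards [Ioo_mem_nhdsLT (show y1 - δ1 < y1 - θ by linarith)] with z hz
    exact hsr z hz.1 (by linarith [hz.2])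
  have qr : q.r = p3.r := by
    refine hq.r.unique (L3.r.ext_last r2 ° ?_) hq.rr L3.rr
    intro z z1 z2
    exact hsr z ° z2
  have b2 : p3.b.head? = some sb.tr := by
    obtain ⟨s, s1, s2⟩ := L3.b.head
    rw [s1]
    congr 1
    refine eventually_eq_unique s2 ?_
    filter_upwards [Ioo_mem_nhdsGT (show x0 + θ < x0 + δ2 by linarith)] with z hz
    exact hsb z (by linarith [hz.1]) hz.2
  have qb : q.b = p3.b := by
    refine hq.b.unique (L3.b.extend ° b2 ?_ ?_) hq.rb L3.rb
    . intro z z1 z2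
      exact hsb z ° °
    . exact hsb _ ° °
  refine M.DD_of_rule hq (.inr (.inr (.inr (.inl ⟨p1, D1, p2, D2, p3, D3, ?_⟩))))
  constructor
  case e1 =>
    rw [<- qr]
    exact L1.l.unique hq'.r L1.rl hq'.rr
  case e2 =>
    rw [<- qb]
    exact L2.t.unique hq'.b L2.rt hq'.rb
  case e3 => exact L1.b.unique L3.t L1.rb L3.rt
  case e4 => rw [<- L1.sw, L3.nw]
  case e5 => rw [<- L1.se, L3.ne]
  case e6 => exact L2.r.unique L3.l L2.rr L3.rl
  case e7 => rw [<- L2.se, L3.sw]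
  case e8 => rw [<- L2.ne, L3.nw]
  case e9 => rw [<- L3.se, <- L3.nw, hq.se, hq'.se]
  case t1 =>
    rw [qne]
    exact L1.t.unique (.one ° fun x q1 q2 => hT x ° °) L1.rt (Red.one _)
  case t2 => rw [qne, <- L1.nw]; exact hT _ ° °
  case t3 => rw [qne, <- L1.ne]; exact hT _ ° °
  case l1 =>
    rw [qsw]
    exact L2.l.unique (.one ° fun x q1 q2 => hL x ° °) L2.rl (Red.one _)
  case l2 => rw [qsw, <- L2.nw]; exact hL _ ° °
  case l3 => rw [qsw, <- L2.sw]; exact hL _ ° °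
  case r1 =>
    rw [p1se]
    exact L1.r.unique (.one ° fun x q1 q2 => hsr x ° °) L1.rr (Red.one _)
  case r2 => rw [p1se]; exact r2
  case b1 =>
    rw [p2se]
    exact L2.b.unique (.one ° fun x q1 q2 => hsb x ° °) L2.rb (Red.one _)
  case b2 => rw [p2se]; exact b2
  case re1 =>
    intro p hp
    obtain ⟨z, z1, z2, rfl⟩ := L1.l.mem_exists p hp
    exact h.re _ _ ° ° ° °
  case re2 =>
    intro p hp
    obtain ⟨z, z1, z2, rfl⟩ := L1.b.mem_exists p hp
    exact h.re _ _ ° ° ° °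
  case re3 =>
    intro p hp
    obtain ⟨z, z1, z2, rfl⟩ := L2.r.mem_exists p hp
    exact h.re _ _ ° ° ° °
  case re4 =>
    intro p hp
    obtain ⟨z, z1, z2, rfl⟩ := L2.t.mem_exists p hp
    exact h.re _ _ ° ° ° °
  case re5 =>
    rw [<- L3.nw]
    exact h.re _ _ ° ° ° °
  case z0 => rw [<- hq.nw]; exact h.val _ _ le_rfl hx.le hy.le le_rfl
  case z0s =>
    rw [qsw, <- hq.nw]
    refine eventually_eq_unique (h.gS x0 y1 le_rfl hx.le hy le_rfl) ?_
    filter_upwards [Ioo_mem_nhdsLT hy] with z hz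
    rw [hL z hz.1 hz.2]
  case z0e =>
    rw [qne, <- hq.nw]
    refine eventually_eq_unique (h.gE x0 y1 le_rfl hx hy.le le_rfl) ?_
    filter_upwards [Ioo_mem_nhdsGT hx] with z hz
    rw [hT z hz.1 hz.2]
  case cF =>
    rw [qsw, <- hq.nw]
    exact h.cov_l' hx hy hL
  case cP =>
    rw [qne, <- hq.nw]
    have := h.toModel.dual.cov_l' (L := sT.du) ° °
        (fun x h1 h2 => by simp only [fD, neg_neg, hT (-x) ° °])
    simp only [fD, neg_neg] at this
    exact this
  case se => rw [<- hq.se, L3.se]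
  case l =>
    rw [qsw]
    exact hq.l.unique (.one ° fun x q1 q2 => hL x ° °) hq.rl (Red.one _)
  case r => exact qr
  case b => exact qb
  case t =>
    rw [qne]
    exact hq.t.unique (.one ° fun x q1 q2 => hT x ° °) hq.rt (Red.one _)
theorem TMod.SE_of_interior (h : TMod K f x0 x1 y0 y1) (hx : x0 < x1) (hy : y0 < y1)
    (hg : ∀ x y, x0 < x -> x < x1 -> y0 < y -> y < y1 -> GSE K f x y /\ GNW K f x y) : GSE K f x0 y1 := by
  obtain ⟨sL, hL⟩ := h.germS le_rfl hx.le hy le_rfl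
  obtain ⟨sT, hT⟩ := h.tr.germN hy.le le_rfl le_rfl hx
  replace hT : ∀ᶠ x in 𝓝[>] x0, f x y1 = sT.tr := hT.mono fun x hx => by rw [<- hx]; rfl
  obtain ⟨δ1, d1, hL⟩ := ev_lt hL
  obtain ⟨δ2, d2, hT⟩ := ev_gt hT
  obtain ⟨δ, d3, d4⟩ := exists_between (a₁ := (0:ℝ)) (a₂ := min (min δ1 δ2) (min (x1 - x0) (y1 - y0)))
    (lt_min (lt_min d1 d2) (lt_min ° °))
  simp only [lt_min_iff] at d4
  obtain ⟨⟨d4, d5⟩, d6, d7⟩ := d4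
  have M := h.restr (u0 := x0) (u1 := x0 + δ) (v0 := y1 - δ) (v1 := y1) le_rfl °
    ° le_rfl
  have hL' : ∀ y, y1 - δ < y -> y < y1 -> f x0 y = sL := fun y h1 h2 => hL y ° h2
  have hT' : ∀ x, x0 < x -> x < x0 + δ -> f x y1 = sT.tr := fun y h1 h2 => hT y h1 °
  have hD : ∀ p p' r r', x0 <= p -> p < p' -> p' < x0 + δ -> y1 - δ < r -> r < r' -> r' <= y1 ->
      (x0 < p \/ r' < y1) -> DD K f p p' r r' := by
    intro p p' r r' q1 q2 q3 q4 q5 q6 q7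
    refine (M.restr q1 q3.le q4.le q6).cover q2 q5 ?_
    intro x y s1 s2 s3 s4
    rcases eq_or_lt_of_le (q1.trans s1) with rfl | hxx
    . -- left edge
      have hr : r' < y1 := q7.resolve_left °
      constructor
      . obtain ⟨ε, e1, e2, hb⟩ := M.leftbox ° hL' (v1 := (y1 - δ + y) / 2) (v2 := y)
          ° ° °
        refine ⟨min ε (y - (y1 - δ + y) / 2), lt_min e1 °, ?_⟩
        intro a a' b b' t1 t2 t3 t4 t5 t6 t7 t8
        have := min_le_left ε (y - (y1 - δ + y) / 2)
        have := min_le_right ε (y - (y1 - δ + y) / 2)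
        exact hb.DD_sub t1 t2 ° ° t7 t8
      . exact ⟨1, one_pos, fun a a' b b' t1 t2 t3 t4 => °⟩
    rcases eq_or_lt_of_le (s4.trans q6) with rfl | hyy
    . constructor
      . obtain ⟨ε, e1, e2, hb⟩ := M.topbox ° hT' (v1 := x) (v2 := (x0 + δ + x) / 2)
          ° ° °
        refine ⟨min ε ((x0 + δ + x) / 2 - x), lt_min e1 °, ?_⟩
        intro a a' b b' t1 t2 t3 t4 t5 t6 t7 t8
        have := min_le_left ε ((x0 + δ + x) / 2 - x)
        have := min_le_right ε ((x0 + δ + x) / 2 - x)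
        exact hb.DD_sub t1 t2 ° ° t7 t8
      . exact ⟨1, one_pos, fun a a' b b' t1 t2 t3 t4 t5 t6 t7 t8 => °⟩
    obtain ⟨g1, g2⟩ := hg x y hxx ° ° hyy
    exact ⟨g1.seg, g2.nwg⟩
  have hfr : ∃ q, ∀ ε > 0, ∃ η', 0 < η' /\ η' < ε /\ RLab f x0 (x0 + η') (y1 - η') y1 q := by
    by_contra hcon
    push Not at hcon
    obtain ⟨ε, e, hε⟩ := pigeon (fun η q => RLab f x0 (x0 + η) (y1 - η) y1 q) (labList K.n)
      (fun q _ => by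
        obtain ⟨ε, e, h⟩ := hcon q
        exact ⟨ε, e, fun η h1 h2 => h η h1 h2⟩)
    obtain ⟨η, n1, n2⟩ := exists_between (a₁ := (0:ℝ)) (a₂ := min ε δ) (lt_min e d3)
    rw [lt_min_iff] at n2
    obtain ⟨q, hq1, hq2, -⟩ := (M.restr (u0 := x0) (u1 := x0 + η) (v0 := y1 - η) (v1 := y1) le_rfl
      ° ° le_rfl).exists_lab ° °
    exact hε q (mem_labList.2 hq2) η n1 n2.1 hq1
  obtain ⟨q, hfr⟩ := hfr
  refine ⟨δ / 2, °, ?_⟩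
  intro p p' r r' q1 q2 q3 q4 q5 q6
  by_cases hc : x0 < p \/ r' < y1
  . exact hD p p' r r' q1 q2 ° ° q5 q6 hc
  rw [not_or, not_lt, not_lt] at hc
  obtain rfl : p = x0 := le_antisymm hc.1 q1
  obtain rfl : r' = y1 := le_antisymm q6 hc.2
  obtain ⟨η, n1, n2, hq⟩ := hfr (min (p' - p) (r' - r)) (lt_min ° °)
  rw [lt_min_iff] at n2
  have S := M.fan_square hL' hT' hD n1 ° ° hq hfr
  have S2 := hD (p + η) p' (r' - η) r' ° ° ° °
    ° le_rfl (.inl °)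
  have S3 := hD p p' r (r' - η) le_rfl ° ° ° °
    ° (.inr °)
  exact DD.joinY (M.restr le_rfl ° ° le_rfl) S3
    (DD.joinX (M.restr le_rfl ° ° le_rfl) S S2)
end

section
variable {K : Sys} {f : ℝ -> ℝ -> PT} {x0 x1 y0 y1 : ℝ}
theorem GSE.toNW (h : TMod K f x0 x1 y0 y1) {x y : ℝ} (h1 : x0 <= x) (h2 : x < x1) (h3 : y0 < y)
    (h4 : y <= y1) (g : GSE K f x y) : GNW K (fT f) y x := by
  obtain ⟨ε, e, g⟩ := g
  obtain ⟨δ, d3, d4⟩ := exists_between (a₁ := (0:ℝ)) (a₂ := min ε (min (x1 - x) (y - y0)))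
    (lt_min e (lt_min ° °))
  simp only [lt_min_iff] at d4
  refine ⟨δ, d3, fun p p' r r' q1 q2 q3 q4 q5 q6 => ?_⟩
  exact (g r r' p p' q4 q5 ° ° q2 q3).tr
    (h.restr ° ° ° °)
theorem GNW.toSE (h : TMod K f x0 x1 y0 y1) {x y : ℝ} (h1 : x0 < x) (h2 : x <= x1) (h3 : y0 <= y)
    (h4 : y < y1) (g : GNW K f x y) : GSE K (fT f) y x := by
  obtain ⟨ε, e, g⟩ := g
  obtain ⟨δ, d3, d4⟩ := exists_between (a₁ := (0:ℝ)) (a₂ := min ε (min (x - x0) (y1 - y)))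
    (lt_min e (lt_min ° °))
  simp only [lt_min_iff] at d4
  refine ⟨δ, d3, fun p p' r r' q1 q2 q3 q4 q5 q6 => ?_⟩
  exact (g r r' p p' ° q5 ° ° q2 °).tr
    (h.restr ° ° ° °)
theorem TMod.NW_of_interior (h : TMod K f x0 x1 y0 y1) (hx : x0 < x1) (hy : y0 < y1)
    (hg : ∀ x y, x0 < x -> x < x1 -> y0 < y -> y < y1 -> GSE K f x y /\ GNW K f x y) : GNW K f x1 y0 := by
  have := h.tr.SE_of_interior hy hx (fun y x a1 a2 a3 a4 =>
    ⟨(hg x y a3 a4 a1 a2).2.toSE h a3 a4.le a1.le a2, (hg x y a3 a4 a1 a2).1.toNW h a3.le a4 a1 a2.le⟩)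
  exact this.toNW h.tr le_rfl hy hx le_rfl

/-- Claim 1: no bad interior points implies derivability -/
theorem TMod.DD_of_interior (h : TMod K f x0 x1 y0 y1) (hx : x0 < x1) (hy : y0 < y1)
    (hg : ∀ x y, x0 < x -> x < x1 -> y0 < y -> y < y1 -> GSE K f x y /\ GNW K f x y) :
    DD K f x0 x1 y0 y1 := by
  refine h.cover hx hy fun x y h1 h2 h3 h4 => ⟨?_, ?_⟩
  . rcases h2.eq_or_lt with rfl | h2
    . exact ⟨1, one_pos, fun p p' r r' q1 q2 q3 q4 q5 q6 q7 q8 => absurd q2 °⟩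
    rcases h3.eq_or_lt with rfl | h3
    . exact ⟨1, one_pos, fun p p' r r' q1 q2 q3 q4 q5 q6 q7 q8 => absurd q7 °⟩
    exact ((h.restr (u0 := x) (v1 := y) h1 le_rfl le_rfl h4).SE_of_interior h2 h3
      (fun u v a1 a2 a3 a4 => hg u v ° a2 a3 °)).seg
  . rcases h1.eq_or_lt with rfl | h1
    . exact ⟨1, one_pos, fun p p' r r' q1 q2 q3 q4 q5 q6 q7 q8 => absurd q3 °⟩
    rcases h4.eq_or_lt with rfl | h4
    . exact ⟨1, one_pos, fun p p' r r' q1 q2 q3 q4 q5 q6 q7 q8 => absurd q6 °⟩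
    exact ((h.restr (u1 := x) (v0 := y) le_rfl h2 h3 le_rfl).NW_of_interior h1 h4
      (fun u v a1 a2 a3 a4 => hg u v a1 ° ° a4)).nwg
end

section
variable {K : Sys} {f : ℝ -> ℝ -> PT} {x0 x1 y0 y1 : ℝ}

/-! ### Boundary conditions of gap cells -/
theorem Model.ptT (h : Model K f x0 x1 y0 y1) {xm x Y : ℝ} {Cp : Clu} (h1 : x0 <= xm) (h2 : xm < x)
    (h3 : x < x1) (h4 : y0 <= Y) (h5 : Y < y1)
    (hi : ∀ u v, xm <= u -> u <= x1 -> Y < v -> v <= y1 -> (f u v).c = Cp) :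
    covF K true (f x Y).w (f x Y).c Cp := by
  intro a ha
  obtain ⟨δ, d, hw⟩ := ev_lt (h.gW x Y ° h3.le h4 h5.le)
  obtain ⟨b, b1, b2⟩ := exists_between (max_lt h2 (show x - δ < x by linarith))
  rw [max_lt_iff] at b1
  have hb := hw b ° b2
  obtain ⟨x', y', q1, q2, q3, q4, q5⟩ := h.fF b Y ° ° h4 h5.le a
    (by rw [hb]; exact ha)
  have hmem : mb a (f x' y').c.1 := by
    rcases q5 with q | q
    . exact q.2.1
    . exact q.1
  rcases q3.eq_or_lt with rfl | q3
  . rcases lt_or_ge x' x with q6 | q6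
    . left
      have hc := hw x' ° q6
      have he := (h.const_ew (y := Y) (a := max (x - δ) xm) (b := x) h4 h5.le (h1.trans (le_max_right _ _)) h3.le
        (fun u g1 g2 => hw u (by linarith [(max_lt_iff.1 g1).1]) g2) x'
        (by rw [max_lt_iff]; constructor <;> linarith) q6).1
      rcases q5 with ⟨_, q7, q8⟩ | ⟨_, q8⟩
      . rcases q8 with q8 | q8
        . exact absurd ha (by rw [<- he]; exact q8.2)
        . refine ⟨rfl, ?_⟩
          rw [<- hc]; exact q8.2
      . rcases q8 with rfl | rfl <;> linarith
    . right; left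
      exact (h.monoX ° q6 q2 h4 h5.le).1 a hmem
  . right; right
    rw [<- hi x' y' ° q2 q3 q4]; exact hmem
theorem Model.ptR (h : Model K f x0 x1 y0 y1) {yp y X : ℝ} {Cp : Clu} (h1 : y0 <= yp) (h2 : yp < y)
    (h3 : y < y1) (h4 : x0 <= X) (h5 : X < x1)
    (hi : ∀ u v, X < u -> u <= x1 -> yp <= v -> v <= y1 -> (f u v).c = Cp) :
    covF K true (f X y).s (f X y).c Cp :=
  h.tr.ptT h1 h2 h3 h4 h5 (fun u v q1 q2 q3 q4 => hi v u q3 q4 q1 q2)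
theorem Model.ptL (h : Model K f x0 x1 y0 y1) {ym y X : ℝ} {Cm : Clu} (h1 : ym <= y1) (h2 : y < ym)
    (h3 : y0 < y) (h4 : X <= x1) (h5 : x0 < X)
    (hi : ∀ u v, x0 <= u -> u < X -> y0 <= v -> v <= ym -> (f u v).c = Cm) :
    covP K true (f X y).n (f X y).c Cm := by
  have := h.dual.ptT (xm := -ym) (x := -y) (Y := -X) (Cp := Cm.swap) ° °
    ° ° °
    (fun u v q1 q2 q3 q4 => by
      simp only [fD, PT.du_c]
      rw [hi (-v) (-u) ° ° ° °])
  simp only [fD, neg_neg] at this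
  exact this
theorem Model.ptB (h : Model K f x0 x1 y0 y1) {xp x Y : ℝ} {Cm : Clu} (h1 : xp <= x1) (h2 : x < xp)
    (h3 : x0 < x) (h4 : Y <= y1) (h5 : y0 < Y)
    (hi : ∀ u v, x0 <= u -> u <= xp -> y0 <= v -> v < Y -> (f u v).c = Cm) :
    covP K true (f x Y).e (f x Y).c Cm :=
  h.tr.ptL h1 h2 h3 h4 h5 (fun u v q1 q2 q3 q4 => hi v u q3 q4 q1 q2)
theorem Compat.tr {Cm Cp : Clu} {q : Lab} (h : Compat K Cm Cp q) : Compat K Cm Cp q.tr where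
  re1 v hv := by
    obtain ⟨w, hw, rfl⟩ := List.mem_map.1 (show v ∈ q.b.map PT.tr from hv); exact h.re3 w hw
  re2 v hv := by
    obtain ⟨w, hw, rfl⟩ := List.mem_map.1 (show v ∈ q.t.map PT.tr from hv); exact h.re4 w hw
  re3 v hv := by
    obtain ⟨w, hw, rfl⟩ := List.mem_map.1 (show v ∈ q.l.map PT.tr from hv); exact h.re1 w hw
  re4 v hv := by
    obtain ⟨w, hw, rfl⟩ := List.mem_map.1 (show v ∈ q.r.map PT.tr from hv); exact h.re2 w hw
  re5 := h.re5
  re6 := h.re7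
  re7 := h.re6
  re8 := h.re8
  nwn := h.see
  nww := h.ses
  ses := h.nww
  see := h.nwn
  sww := h.sws
  sws := h.sww
  nen := h.nee
  nee := h.nen
  l v hv := by
    obtain ⟨w, hw, rfl⟩ := List.mem_map.1 (show v ∈ q.b.map PT.tr from hv); exact h.b w hw
  b v hv := by
    obtain ⟨w, hw, rfl⟩ := List.mem_map.1 (show v ∈ q.l.map PT.tr from hv); exact h.l w hw
  t v hv := by
    obtain ⟨w, hw, rfl⟩ := List.mem_map.1 (show v ∈ q.r.map PT.tr from hv); exact h.r w hw
  r v hv := by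
    obtain ⟨w, hw, rfl⟩ := List.mem_map.1 (show v ∈ q.t.map PT.tr from hv); exact h.t w hw
  okt v hv := by
    obtain ⟨w, hw, rfl⟩ := List.mem_map.1 (show v ∈ (q.ne :: q.r).map PT.tr from hv); exact h.okr w hw
  okr v hv := by
    obtain ⟨w, hw, rfl⟩ := List.mem_map.1 (show v ∈ (q.ne :: q.t).map PT.tr from hv); exact h.okt w hw
  okl v hv := by
    obtain ⟨w, hw, rfl⟩ := List.mem_map.1 (show v ∈ (q.sw :: q.b).map PT.tr from hv); exact h.okb w hw
  okb v hv := by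
    obtain ⟨w, hw, rfl⟩ := List.mem_map.1 (show v ∈ (q.sw :: q.l).map PT.tr from hv); exact h.okl w hw
theorem Der.tr {q : Lab} (h : Der K q) : Der K q.tr := by
  have h' := Der_iff.1 h
  refine Der_iff.2 ⟨?_, .inr (.inr (.inl ⟨q, h, rfl⟩)), ?_⟩
  . obtain ⟨⟨a1, a2, a3, a4, a5, a6, a7, a8⟩, _⟩ := h'
    have : ∀ w, BdW K.n w -> BdW K.n (w.map PT.tr) := by
      intro w hw
      refine ⟨?_, ?_⟩
      . simpa using hw.1
      . intro p hp
        obtain ⟨p', hp', rfl⟩ := List.mem_map.1 hp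
        exact (hw.2 p' hp').tr
    exact ⟨a1.tr, a3.tr, a2.tr, a4.tr, this _ a7, this _ a8, this _ a5, this _ a6⟩
  . obtain ⟨a1, a2, a3, a4⟩ := h'.2.2
    constructor <;> simpa [Lab.tr]

/-- build a compatible label from pointwise data -/
theorem RLab.compat {q : Lab} {Cm Cp : Clu} (hq : RLab f x0 x1 y0 y1 q) 
    (re : ∀ x y, x0 <= x -> x <= x1 -> y0 <= y -> y <= y1 -> (f x y).re = true)
    (hn : ∀ x, x0 <= x -> x <= x1 -> (f x y1).n = Cp) (hs : ∀ x, x0 <= x -> x <= x1 -> (f x y0).s = Cm)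
    (he : ∀ y, y0 <= y -> y <= y1 -> (f x1 y).e = Cp) (hw : ∀ y, y0 <= y -> y <= y1 -> (f x0 y).w = Cm)
    (okt : ∀ x, x0 < x -> x <= x1 -> covF K true (f x y1).w (f x y1).c Cp)
    (okr : ∀ y, y0 < y -> y <= y1 -> covF K true (f x1 y).s (f x1 y).c Cp)
    (okl : ∀ y, y0 <= y -> y < y1 -> covP K true (f x0 y).n (f x0 y).c Cm)
    (okb : ∀ x, x0 <= x -> x < x1 -> covP K true (f x y0).e (f x y0).c Cm) : Compat K Cm Cp q := by
  have hx := hq.b.lt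
  have hy := hq.l.lt
  have ml := hq.l.mem_exists
  have mr := hq.r.mem_exists
  have mb' := hq.b.mem_exists
  have mt := hq.t.mem_exists
  have lx := le_refl x0
  have lx' := le_refl x1
  have ly := le_refl y0
  have ly' := le_refl y1
  have gl : ∀ (P : PT -> Prop), (∀ y, y0 < y -> y < y1 -> P (f x0 y)) -> ∀ v ∈ q.l, P v := by
    intro P hP v hv; obtain ⟨z, z1, z2, rfl⟩ := ml v hv; exact hP z z1 z2
  have gr : ∀ (P : PT -> Prop), (∀ y, y0 < y -> y < y1 -> P (f x1 y)) -> ∀ v ∈ q.r, P v := by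
    intro P hP v hv; obtain ⟨z, z1, z2, rfl⟩ := mr v hv; exact hP z z1 z2
  have gb : ∀ (P : PT -> Prop), (∀ x, x0 < x -> x < x1 -> P (f x y0)) -> ∀ v ∈ q.b, P v := by
    intro P hP v hv; obtain ⟨z, z1, z2, rfl⟩ := mb' v hv; exact hP z z1 z2
  have gt : ∀ (P : PT -> Prop), (∀ x, x0 < x -> x < x1 -> P (f x y1)) -> ∀ v ∈ q.t, P v := by
    intro P hP v hv; obtain ⟨z, z1, z2, rfl⟩ := mt v hv; exact hP z z1 z2
  have gc : ∀ (P : PT -> Prop) (v : PT) (l : List PT), P v -> (∀ u ∈ l, P u) -> ∀ u ∈ v :: l, P u := by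
    intro P v l h1 h2 u hu
    rcases List.mem_cons.1 hu with rfl | hu
    . exact h1
    . exact h2 u hu
  exact {
    re1 := gl _ fun y h1 h2 => re _ _ lx hx.le h1.le h2.le
    re2 := gr _ fun y h1 h2 => re _ _ hx.le lx' h1.le h2.le
    re3 := gb _ fun y h1 h2 => re _ _ h1.le h2.le ly hy.le
    re4 := gt _ fun y h1 h2 => re _ _ h1.le h2.le hy.le ly'
    re5 := by rw [<- hq.sw]; exact re _ _ lx hx.le ly hy.le
    re6 := by rw [<- hq.se]; exact re _ _ hx.le lx' ly hy.le
    re7 := by rw [<- hq.nw]; exact re _ _ lx hx.le hy.le ly'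
    re8 := by rw [<- hq.ne]; exact re _ _ hx.le lx' hy.le ly'
    nwn := by rw [<- hq.nw]; exact hn _ lx hx.le
    nww := by rw [<- hq.nw]; exact hw _ hy.le ly'
    ses := by rw [<- hq.se]; exact hs _ hx.le lx'
    see := by rw [<- hq.se]; exact he _ ly hy.le
    sww := by rw [<- hq.sw]; exact hw _ ly hy.le
    sws := by rw [<- hq.sw]; exact hs _ lx hx.le
    nen := by rw [<- hq.ne]; exact hn _ hx.le lx'
    nee := by rw [<- hq.ne]; exact he _ hy.le ly'
    l := gl (fun v => v.w = Cm) fun y h1 h2 => hw y h1.le h2.le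
    b := gb (fun v => v.s = Cm) fun y h1 h2 => hs y h1.le h2.le
    t := gt (fun v => v.n = Cp) fun y h1 h2 => hn y h1.le h2.le
    r := gr (fun v => v.e = Cp) fun y h1 h2 => he y h1.le h2.le
    okt := gc (fun v => covF K true v.w v.c Cp) _ _ (by rw [<- hq.ne]; exact okt _ hx lx')
      (gt (fun v => covF K true v.w v.c Cp) fun x h1 h2 => okt x h1 h2.le)
    okr := gc (fun v => covF K true v.s v.c Cp) _ _ (by rw [<- hq.ne]; exact okr _ hy ly')
      (gr (fun v => covF K true v.s v.c Cp) fun x h1 h2 => okr x h1 h2.le)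
    okl := gc (fun v => covP K true v.n v.c Cm) _ _ (by rw [<- hq.sw]; exact okl _ ly hy)
      (gl (fun v => covP K true v.n v.c Cm) fun x h1 h2 => okl x h1.le h2)
    okb := gc (fun v => covP K true v.e v.c Cm) _ _ (by rw [<- hq.sw]; exact okb _ lx hx)
      (gb (fun v => covP K true v.e v.c Cm) fun x h1 h2 => okb x h1.le h2) }
end

section
variable {K : Sys} {f : ℝ -> ℝ -> PT} {x0 x1 y0 y1 : ℝ}

/-- a vertical line thickened to a rectangle -/
noncomputable def thick (f : ℝ -> ℝ -> PT) (X : ℝ) : ℝ -> ℝ -> PT := fun u y =>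
  ⟨(f X y).re, (f X y).c, (f X y).n, if u < 1 then (f X y).c else (f X y).e, (f X y).s,
    if 0 < u then (f X y).c else (f X y).w⟩
theorem thick_valid {X u y : ℝ} (h : Valid K (f X y)) (hr : (f X y).re = true) :
    Valid K (thick f X u y) := by
  obtain ⟨t, t1, t2, t3⟩ := h.ex hr
  refine ⟨h.bc, h.bn, ?_, h.bs, ?_, ?_, h.sc, h.cn, ?_, fun _ => ⟨t, t1, fun a ha => ?_, fun b hb => ?_⟩,
    fun h' => absurd hr (by rw [show (f X y).re = false from h']; simp)⟩
  . simp only [thick]; split_ifs; exacts [h.bc, h.be]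
  . simp only [thick]; split_ifs; exacts [h.bc, h.bw]
  . simp only [thick]; split_ifs; exacts [qle_refl _, h.wc]
  . simp only [thick]; split_ifs; exacts [qle_refl _, h.ce]
  . simp only [thick]; split_ifs
    . exact .inr (.inr ha)
    . exact t2 a ha
  . simp only [thick]; split_ifs
    . exact .inr (.inr hb)
    . exact t3 b hb
theorem TMod.thick (h : TMod K f x0 x1 y0 y1) {X v0 v1 : ℝ} (h1 : x0 < X) (h2 : X < x1)
    (h3 : y0 < v0) (h5 : v1 < y1) : TMod K (thick f X) 0 1 v0 v1 where
  val u y q1 q2 q3 q4 := thick_valid (h.val X y h1.le h2.le ° °)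
    (h.re X y h1 h2 ° °)
  re u y q1 q2 q3 q4 := h.re X y h1 h2 ° °
  gN u y q1 q2 q3 q4 := h.gN X y h1.le h2.le ° °
  gS u y q1 q2 q3 q4 := h.gS X y h1.le h2.le ° °
  gE u y q1 q2 q3 q4 := Eventually.of_forall fun u' => by simp [Temporal.thick, q2]
  gW u y q1 q2 q3 q4 := Eventually.of_forall fun u' => by simp [Temporal.thick, q1]
  fF u y q1 q2 q3 q4 a ha := ⟨1, y, q2, le_rfl, le_rfl, q4, .inr ⟨ha, .inl rfl⟩⟩
  fP u y q1 q2 q3 q4 a ha := ⟨0, y, le_rfl, q1, q3, le_rfl, .inr ⟨ha, .inl rfl⟩⟩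
  wV u y y' q1 q2 q3 q4 q5 := by
    simp only [Temporal.thick]; split_ifs
    . exact h.monoY h1.le h2.le ° q4 °
    . exact h.wV X y y' h1.le h2.le ° q4 °
  eV u y y' q1 q2 q3 q4 q5 := by
    simp only [Temporal.thick]; split_ifs
    . exact h.monoY h1.le h2.le ° q4 °
    . exact h.eV X y y' h1.le h2.le ° q4 °
  sH y u u' q1 q2 q3 q4 q5 := qle_refl _
  nH y u u' q1 q2 q3 q4 q5 := qle_refl _
  reV u y y' q1 q2 q3 q4 q5 q6 := by
    simp only [Temporal.thick]
    rw [h.re X y h1 h2 ° °, h.re X y' h1 h2 ° °]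
  reH y u u' q1 q2 q3 q4 q5 q6 := rfl
theorem TMod.thickDD (h : TMod K f x0 x1 y0 y1) {X v0 v1 : ℝ} (h1 : x0 < X) (h2 : X < x1)
    (h3 : y0 < v0) (h4 : v0 < v1) (h5 : v1 < y1) : DD K (Temporal.thick f X) 0 1 v0 v1 := by
  have M := h.thick h1 h2 h3 h5
  have key : ∀ p p' r r', 0 < p -> p < p' -> p' < 1 -> v0 < r -> r < r' -> r' < v1 ->
      (∃ s, ∀ y, r < y -> y < r' -> f X y = s) -> CBox K (Temporal.thick f X) p p' r r' := by
    rintro p p' r r' q1 q2 q3 q4 q5 q6 ⟨s, hs⟩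
    have e : ∀ u y, 0 < u -> u < 1 -> Temporal.thick f X u y =
        ⟨(f X y).re, (f X y).c, (f X y).n, (f X y).c, (f X y).s, (f X y).c⟩ := by
      intro u y g1 g2
      simp [Temporal.thick, g1, g2]
    refine ⟨M.restr q1.le q3.le q4.le q6.le, ⟨s.c, fun u y g1 g2 g3 g4 => ?_⟩,
      ⟨⟨s.re, s.c, s.n, s.c, s.s, s.c⟩, fun y g3 g4 => ?_⟩,
      ⟨⟨s.re, s.c, s.n, s.c, s.s, s.c⟩, fun y g3 g4 => ?_⟩,
      ⟨Temporal.thick f X p r, fun u g3 g4 => ?_⟩, ⟨Temporal.thick f X p r', fun u g3 g4 => ?_⟩⟩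
    . simp only [Temporal.thick, hs y g3 g4]
    . rw [e _ _ q1 °, hs y g3 g4]
    . rw [e _ _ ° q3, hs y g3 g4]
    . rw [e _ _ q1 °, e u r ° °]
    . rw [e _ _ q1 °, e u r' ° °]
  refine M.DD_of_interior one_pos h4 fun u y q1 q2 q3 q4 => ⟨?_, ?_⟩
  . obtain ⟨s, hs⟩ := h.germS h1.le h2.le (show y0 < y by linarith) °
    obtain ⟨δ, d, hs⟩ := ev_lt hs
    obtain ⟨ε, e3, e4⟩ := exists_between (a₁ := (0:ℝ)) (a₂ := min δ (min (1 - u) (y - v0)))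
      (lt_min d (lt_min ° °))
    simp only [lt_min_iff] at e4
    refine ⟨ε, e3, fun p p' r r' g1 g2 g3 g4 g5 g6 => ?_⟩
    exact (key u (u + ε) (y - ε) y q1 ° ° ° °
      ° ⟨s, fun z z1 z2 => hs z ° z2⟩).DD_sub g1 g2 g3 g4 g5 g6
  . obtain ⟨s, hs⟩ := h.germN h1.le h2.le (show y0 <= y by linarith) (show y < y1 by linarith)
    obtain ⟨δ, d, hs⟩ := ev_gt hs
    obtain ⟨ε, e3, e4⟩ := exists_between (a₁ := (0:ℝ)) (a₂ := min δ (min u (v1 - y)))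
      (lt_min d (lt_min ° °))
    simp only [lt_min_iff] at e4
    refine ⟨ε, e3, fun p p' r r' g1 g2 g3 g4 g5 g6 => ?_⟩
    exact (key (u - ε) u y (y + ε) ° ° ° ° °
      ° ⟨s, fun z z1 z2 => hs z z1 °⟩).DD_sub g1 g2 g3 g4 g5 g6
theorem TMod.wall (h : TMod K f x0 x1 y0 y1) {X v0 v1 : ℝ} {Cm Cp : Clu} (h1 : x0 < X) (h2 : X < x1)
    (h3 : y0 < v0) (h4 : v0 < v1) (h5 : v1 < y1)
    (hn : (f X v1).n = Cp) (hs : (f X v0).s = Cm)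
    (he : ∀ y, v0 <= y -> y <= v1 -> (f X y).e = Cp) (hw : ∀ y, v0 <= y -> y <= v1 -> (f X y).w = Cm)
    (okr : ∀ y, v0 < y -> y <= v1 -> covF K true (f X y).s (f X y).c Cp)
    (okl : ∀ y, v0 <= y -> y < v1 -> covP K true (f X y).n (f X y).c Cm) :
    ∃ o, Der K o /\ Compat K Cm Cp o /\ o.sw.c = (f X v0).c /\ o.ne.c = (f X v1).c := by
  obtain ⟨o, ho, hd⟩ := h.thickDD h1 h2 h3 h4 h5
  refine ⟨o, hd, ho.compat ?_ ?_ ?_ ?_ ?_ ?_ ?_ ?_ ?_, by rw [<- ho.sw]; rfl, by rw [<- ho.ne]; rfl⟩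
  . intro u y q1 q2 q3 q4; exact h.re X y h1 h2 ° °
  . intro u q1 q2; exact hn
  . intro u q1 q2; exact hs
  . intro y q1 q2; simp [Temporal.thick, he y q1 q2]
  . intro y q1 q2; simp [Temporal.thick, hw y q1 q2]
  . intro u q1 q2 a ha
    simp only [Temporal.thick, q1, if_true] at ha ⊢
    exact .inr (.inl ha)
  . exact okr
  . exact okl
  . intro u q1 q2 a ha
    simp only [Temporal.thick, q2, if_true] at ha ⊢
    exact .inr (.inl ha)

/-- gap cells -/
theorem TMod.cell (h : TMod K f x0 x1 y0 y1) {xm xp yp ym : ℝ} {Cm Cp : Clu} (h1 : x0 < xm)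
    (h2 : xm <= xp) (h3 : xp < x1) (h4 : y0 < yp) (h5 : yp <= ym) (h6 : ym < y1)
    (hne : xm < xp \/ yp < ym)
    (hN : ∀ u v, xm <= u -> u <= x1 -> ym < v -> v <= y1 -> (f u v).c = Cp)
    (hE : ∀ u v, xp < u -> u <= x1 -> yp <= v -> v <= y1 -> (f u v).c = Cp)
    (hW : ∀ u v, x0 <= u -> u < xm -> y0 <= v -> v <= ym -> (f u v).c = Cm)
    (hS : ∀ u v, x0 <= u -> u <= xp -> y0 <= v -> v < yp -> (f u v).c = Cm)
    (hg : ∀ x y, xm < x -> x < xp -> yp < y -> y < ym -> GSE K f x y /\ GNW K f x y) :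
    ∃ o, Der K o /\ Compat K Cm Cp o /\ o.sw.c = (f xm yp).c /\ o.ne.c = (f xp ym).c := by
  have n : ∀ x, xm <= x -> x <= xp -> (f x ym).n = Cp := fun x q1 q2 => by
    refine eventually_eq_unique (h.gN x ym ° ° ° °) ?_
    filter_upwards [Ioo_mem_nhdsGT h6] with z hz
    exact hN x z q1 ° hz.1 hz.2.le
  have e : ∀ y, yp <= y -> y <= ym -> (f xp y).e = Cp := fun x q1 q2 => by
    refine eventually_eq_unique (h.gE xp x ° ° ° °) ?_
    filter_upwards [Ioo_mem_nhdsGT h3] with z hz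
    exact hE z x hz.1 hz.2.le q1 °
  have s : ∀ x, xm <= x -> x <= xp -> (f x yp).s = Cm := fun x q1 q2 => by
    refine eventually_eq_unique (h.gS x yp ° ° ° °) ?_
    filter_upwards [Ioo_mem_nhdsLT h4] with z hz
    exact hS x z ° q2 hz.1.le hz.2
  have w : ∀ y, yp <= y -> y <= ym -> (f xm y).w = Cm := fun x q1 q2 => by
    refine eventually_eq_unique (h.gW xm x ° ° ° °) ?_
    filter_upwards [Ioo_mem_nhdsLT h1] with z hz
    exact hW z x hz.1.le hz.2 ° q2
  have okt : ∀ x, xm < x -> x <= xp -> covF K true (f x ym).w (f x ym).c Cp := fun x q1 q2 =>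
    h.ptT h1.le q1 ° ° h6 hN
  have okr : ∀ y, yp < y -> y <= ym -> covF K true (f xp y).s (f xp y).c Cp := fun x q1 q2 =>
    h.ptR h4.le q1 ° ° h3 hE
  have okl : ∀ y, yp <= y -> y < ym -> covP K true (f xm y).n (f xm y).c Cm := fun x q1 q2 =>
    h.ptL h6.le q2 ° ° h1 hW
  have okb : ∀ x, xm <= x -> x < xp -> covP K true (f x yp).e (f x yp).c Cm := fun x q1 q2 =>
    h.ptB h3.le q2 ° ° h4 hS
  rcases h2.eq_or_lt with rfl | h2'
  . exact h.wall h1 h3 h4 (by simpa using hne) h6 (n _ le_rfl le_rfl) (s _ le_rfl le_rfl) e w okr okl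
  rcases h5.eq_or_lt with rfl | h5'
  . obtain ⟨o, o1, o2, o3, o4⟩ := h.tr.wall (Cm := Cm) (Cp := Cp) h4 h6 h1 h2' h3 (e _ le_rfl le_rfl)
      (w _ le_rfl le_rfl) n s okt okb
    exact ⟨o.tr, o1.tr, o2.tr, o3, o4⟩
  obtain ⟨o, o1, o2⟩ := (h.restr h1.le h3.le h4.le h6.le).DD_of_interior h2' h5' hg
  refine ⟨o, o2, o1.compat (fun x y q1 q2 q3 q4 => h.re x y ° ° °
    °) n s e w okt okr okl okb, by rw [<- o1.sw], by rw [<- o1.ne]⟩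
end

section
variable {K : Sys} {f : ℝ -> ℝ -> PT} {x0 x1 y0 y1 : ℝ}
theorem TMod.optX {p p' r r' : ℝ} (h : TMod K f p p' r r') (hp : p < p') (m : ℝ)
    (hl : ∀ q, p < q -> q <= p' -> q <= m -> DD K f p q r r')
    (hr : ∀ q, q < p' -> p <= q -> m <= q -> DD K f q p' r r') : DD K f p p' r r' := by
  rcases le_or_gt m p with h1 | h1
  . exact hr p hp le_rfl h1
  rcases le_or_gt p' m with h2 | h2
  . exact hl p' hp le_rfl h2
  exact DD.joinX h (hl m h1 h2.le le_rfl) (hr m h2 h1.le le_rfl)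
theorem TMod.optY {p p' r r' : ℝ} (h : TMod K f p p' r r') (hp : r < r') (m : ℝ)
    (hl : ∀ q, r < q -> q <= r' -> q <= m -> DD K f p p' r q)
    (hr : ∀ q, q < r' -> r <= q -> m <= q -> DD K f p p' q r') : DD K f p p' r r' := by
  rcases le_or_gt m r with h1 | h1
  . exact hr r hp le_rfl h1
  rcases le_or_gt r' m with h2 | h2
  . exact hl r' hp le_rfl h2
  exact DD.joinY h (hl m h1 h2.le le_rfl) (hr m h2 h1.le le_rfl)
theorem TMod.good_nbhd (h : TMod K f x0 x1 y0 y1) {x y : ℝ} (h1 : x0 < x) (h2 : x < x1) (h3 : y0 < y)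
    (h4 : y < y1) (g1 : GSE K f x y) (g2 : GNW K f x y) : ∃ ε > 0, ∀ p p' r r', x - ε <= p -> p < p' ->
    p' <= x + ε -> y - ε <= r -> r < r' -> r' <= y + ε -> DD K f p p' r r' := by
  obtain ⟨ε1, e1, g1⟩ := g1
  obtain ⟨ε2, e2, g2⟩ := g2
  obtain ⟨ε3, e3, g3⟩ := h.NEgood h1.le h3.le
  obtain ⟨ε4, e4, g4⟩ := h.SWgood h2.le h4.le
  obtain ⟨δ, d3, d4⟩ := exists_between (a₁ := (0:ℝ)) (a₂ := min (min (min ε1 ε2) (min ε3 ε4))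
    (min (min (x - x0) (x1 - x)) (min (y - y0) (y1 - y))))
    (lt_min (lt_min (lt_min e1 e2) (lt_min e3 e4)) (lt_min (lt_min ° °)
      (lt_min ° °)))
  simp only [lt_min_iff] at d4
  obtain ⟨⟨⟨d1, d2⟩, d5, d6⟩, ⟨d7, d8⟩, d9, d10⟩ := d4
  refine ⟨δ, d3, fun p p' r r' q1 q2 q3 q4 q5 q6 => ?_⟩
  have M : ∀ a b c d, p <= a -> b <= p' -> r <= c -> d <= r' -> TMod K f a b c d := fun a b c d k1 k2 k3 k4 =>
    h.restr ° ° ° °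
  refine (M _ _ _ _ le_rfl le_rfl le_rfl le_rfl).optX q2 x (fun u k1 k2 k3 => ?_) (fun u k1 k2 k3 => ?_)
  . refine (M _ _ _ _ le_rfl k2 le_rfl le_rfl).optY q5 y (fun v l1 l2 l3 => ?_) (fun v l1 l2 l3 => ?_)
    . exact g4 _ _ _ _ ° ° k1 k3 ° ° l1 l3
    . exact g2 _ _ _ _ ° k1 k3 l3 l1 °
  . refine (M _ _ _ _ k2 le_rfl le_rfl le_rfl).optY q5 y (fun v l1 l2 l3 => ?_) (fun v l1 l2 l3 => ?_)
    . exact g1 _ _ _ _ k3 k1 ° ° l1 l3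
    . exact g3 _ _ _ _ k3 k1 ° ° l3 l1 ° °
theorem good_of_nbhd {x y ε : ℝ} (hg : ∀ p p' r r', x - ε <= p -> p < p' ->
    p' <= x + ε -> y - ε <= r -> r < r' -> r' <= y + ε -> DD K f p p' r r') {u v : ℝ} (h1 : |u - x| < ε)
    (h2 : |v - y| < ε) : GSE K f u v /\ GNW K f u v := by
  rw [abs_lt] at h1 h2
  obtain ⟨δ, d3, d4⟩ := exists_between (a₁ := (0:ℝ)) (a₂ := min (min (ε - (u - x)) (ε + (u - x)))
    (min (ε - (v - y)) (ε + (v - y)))) (lt_min (lt_min ° °)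
      (lt_min ° °))
  simp only [lt_min_iff] at d4
  obtain ⟨⟨d1, d2⟩, d5, d6⟩ := d4
  exact ⟨⟨δ, d3, fun p p' r r' q1 q2 q3 q4 q5 q6 => hg _ _ _ _ ° q2 °
    ° q5 °⟩, ⟨δ, d3, fun p p' r r' q1 q2 q3 q4 q5 q6 => hg _ _ _ _ °
    q2 ° ° q5 °⟩⟩

structure Bad (K : Sys) (f : ℝ -> ℝ -> PT) (x0 x1 y0 y1 x y : ℝ) : Prop where
  h1 : x0 < x
  h2 : x < x1
  h3 : y0 < y
  h4 : y < y1
  bad : ¬ (GSE K f x y /\ GNW K f x y)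
theorem TMod.bad_closed (h : TMod K f x0 x1 y0 y1) {x y : ℝ} (h1 : x0 < x) (h2 : x < x1) (h3 : y0 < y)
    (h4 : y < y1) (ha : ∀ δ > 0, ∃ u v, Bad K f x0 x1 y0 y1 u v /\ |u - x| < δ /\ |v - y| < δ) :
    Bad K f x0 x1 y0 y1 x y := by
  refine ⟨h1, h2, h3, h4, fun hg => ?_⟩
  obtain ⟨ε, e, hn⟩ := h.good_nbhd h1 h2 h3 h4 hg.1 hg.2
  obtain ⟨u, v, hb, a1, a2⟩ := ha ε e
  exact hb.bad (good_of_nbhd hn a1 a2)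

/-- bad points accumulate strictly from SE or NW -/
theorem TMod.bad_acc (h : TMod K f x0 x1 y0 y1) {x y : ℝ} (hb : Bad K f x0 x1 y0 y1 x y) :
    (∀ δ > 0, ∃ u v, Bad K f x0 x1 y0 y1 u v /\ x < u /\ u < x + δ /\ y - δ < v /\ v < y) \/
    (∀ δ > 0, ∃ u v, Bad K f x0 x1 y0 y1 u v /\ x - δ < u /\ u < x /\ y < v /\ v < y + δ) := by
  obtain ⟨h1, h2, h3, h4, hb⟩ := hb
  rw [not_and_or] at hb
  rcases hb with hb | hb
  . left
    intro δ d
    by_contra hc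
    push Not at hc
    obtain ⟨ε, e3, e4⟩ := exists_between (a₁ := (0:ℝ)) (a₂ := min δ (min (x1 - x) (y - y0)))
      (lt_min d (lt_min ° °))
    simp only [lt_min_iff] at e4
    refine hb ((h.restr (u0 := x) (u1 := x + ε) (v0 := y - ε) (v1 := y) h1.le ° °
      h4.le).SE_of_interior ° ° fun u v q1 q2 q3 q4 => ?_)
    by_contra hg
    exact absurd q4 (not_lt.2 (hc u v ⟨°, °, °, °, hg⟩ q1
      ° °))
  . right
    intro δ d
    by_contra hc
    push Not at hc
    obtain ⟨ε, e3, e4⟩ := exists_between (a₁ := (0:ℝ)) (a₂ := min δ (min (x - x0) (y1 - y)))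
      (lt_min d (lt_min ° °))
    simp only [lt_min_iff] at e4
    refine hb ((h.restr (u0 := x - ε) (u1 := x) (v0 := y) (v1 := y + ε) ° h2.le h3.le
      °).NW_of_interior ° ° fun u v q1 q2 q3 q4 => ?_)
    by_contra hg
    have := hc u v ⟨°, °, °, °, hg⟩ ° q2 q3
    linarith

/-- a box in which all bad points have the same quadrant clusters -/
structure BB (K : Sys) (f : ℝ -> ℝ -> PT) (x0 x1 y0 y1 : ℝ) (Cm Cp : Clu) : Prop where
  mod : TMod K f x0 x1 y0 y1
  lo : ∀ x y u v, Bad K f x0 x1 y0 y1 x y -> x0 <= u -> u < x -> y0 <= v -> v < y -> (f u v).c = Cm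
  hi : ∀ x y u v, Bad K f x0 x1 y0 y1 x y -> x < u -> u <= x1 -> y < v -> v <= y1 -> (f u v).c = Cp
  ne : Cm ≠ Cp
variable {Cm Cp : Clu} {x y u v a b : ℝ}
theorem BB.lo_kap (h : BB K f x0 x1 y0 y1 Cm Cp) (hb : Bad K f x0 x1 y0 y1 x y) (h1 : x0 < u)
    (h2 : u < x) (h3 : y0 < v) (h4 : v < y) : f u v = kap Cm :=
  (h.mod.restr (u0 := x0) (u1 := x) (v0 := y0) (v1 := y) le_rfl hb.h2.le le_rfl hb.h4.le).const_kap
    (fun s t q1 q2 q3 q4 => h.lo x y s t hb q1.le q2 q3.le q4) h1 h2 h3 h4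
theorem BB.hi_kap (h : BB K f x0 x1 y0 y1 Cm Cp) (hb : Bad K f x0 x1 y0 y1 x y) (h1 : x < u)
    (h2 : u < x1) (h3 : y < v) (h4 : v < y1) : f u v = kap Cp :=
  (h.mod.restr (u0 := x) (u1 := x1) (v0 := y) (v1 := y1) hb.h1.le le_rfl hb.h3.le le_rfl).const_kap
    (fun s t q1 q2 q3 q4 => h.hi x y s t hb q1 q2.le q3 q4.le) h1 h2 h3 h4
theorem BB.anti (h : BB K f x0 x1 y0 y1 Cm Cp) (hb : Bad K f x0 x1 y0 y1 x y)
    (hc : Bad K f x0 x1 y0 y1 u v) (h1 : x < u) (h2 : y < v) : False := by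
  have e1 := h.lo u v ((x + u) / 2) ((y + v) / 2) hc (by linarith [hb.h1]) °
    (by linarith [hb.h3]) °
  have e2 := h.hi x y ((x + u) / 2) ((y + v) / 2) hb ° (by linarith [hc.h2])
    ° (by linarith [hc.h4])
  exact h.ne (e1.symm.trans e2)

/-- incomparable points are ordered by `x - y` -/
theorem incomp (h1 : ¬ (x < u /\ y < v)) (h2 : ¬ (u < x /\ v < y)) (hs : x - y <= u - v) :
    x <= u /\ v <= y := by
  constructor
  . by_contra hc; push Not at hc; exact h2 ⟨hc, °⟩
  . by_contra hc; push Not at hc; exact h1 ⟨°, hc⟩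
theorem BB.ord (h : BB K f x0 x1 y0 y1 Cm Cp) (hb : Bad K f x0 x1 y0 y1 x y)
    (hc : Bad K f x0 x1 y0 y1 u v) (hs : x - y <= u - v) : x <= u /\ v <= y :=
  incomp (fun q => h.anti hb hc q.1 q.2) (fun q => h.anti hc hb q.1 q.2) hs
theorem BB.strict (h : BB K f x0 x1 y0 y1 Cm Cp) (hb : Bad K f x0 x1 y0 y1 x y)
    (hc : Bad K f x0 x1 y0 y1 u v) (hd : Bad K f x0 x1 y0 y1 a b) (h1 : x - y < u - v)
    (h2 : u - v < a - b) : x < a /\ b < y := by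
  have o1 := h.ord hb hc h1.le
  have o2 := h.ord hc hd h2.le
  constructor
  . by_contra hn
    have e1 : x = u := °
    have e2 : u = a := °
    subst e1 e2
    rcases h.mod.bad_acc hc with g | g
    . obtain ⟨s, t, q1, q2, q3, q4, q5⟩ := g (v - b) °
      exact h.anti hd q1 q2 °
    . obtain ⟨s, t, q1, q2, q3, q4, q5⟩ := g (y - v) °
      exact h.anti q1 hb q3 °
  . by_contra hn
    have e1 : y = v := °
    have e2 : v = b := °
    subst e1 e2
    rcases h.mod.bad_acc hc with g | g
    . obtain ⟨s, t, q1, q2, q3, q4, q5⟩ := g (a - u) °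
      exact h.anti q1 hd ° q5
    . obtain ⟨s, t, q1, q2, q3, q4, q5⟩ := g (u - x) °
      exact h.anti hb q1 ° q4

/-- accumulation from the right and from the left in the order by `x - y` -/
def AccR (K : Sys) (f : ℝ -> ℝ -> PT) (x0 x1 y0 y1 x y : ℝ) : Prop :=
  ∀ δ > 0, ∃ u v, Bad K f x0 x1 y0 y1 u v /\ x - y < u - v /\ u - v < x - y + δ
def AccL (K : Sys) (f : ℝ -> ℝ -> PT) (x0 x1 y0 y1 x y : ℝ) : Prop :=
  ∀ δ > 0, ∃ u v, Bad K f x0 x1 y0 y1 u v /\ x - y - δ < u - v /\ u - v < x - y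
theorem BB.acc (h : BB K f x0 x1 y0 y1 Cm Cp) (hb : Bad K f x0 x1 y0 y1 x y) :
    AccR K f x0 x1 y0 y1 x y \/ AccL K f x0 x1 y0 y1 x y := by
  refine (h.mod.bad_acc hb).imp (fun g δ d => ?_) (fun g δ d => ?_)
  . obtain ⟨u, v, q1, q2, q3, q4, q5⟩ := g (δ / 2) °
    exact ⟨u, v, q1, °, °⟩
  . obtain ⟨u, v, q1, q2, q3, q4, q5⟩ := g (δ / 2) °
    exact ⟨u, v, q1, °, °⟩
theorem BB.accR (h : BB K f x0 x1 y0 y1 Cm Cp) (hb : Bad K f x0 x1 y0 y1 x y)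
    (ha : AccR K f x0 x1 y0 y1 x y) : ∀ δ > 0, ∃ u v, Bad K f x0 x1 y0 y1 u v /\ x < u /\ u < x + δ /\
      y - δ < v /\ v < y := by
  intro δ d
  obtain ⟨u, v, q1, q2, q3⟩ := ha δ d
  obtain ⟨s, t, r1, r2, r3⟩ := ha (u - v - (x - y)) °
  have := h.strict hb r1 q1 r2 °
  exact ⟨u, v, q1, this.1, °, °, this.2⟩
theorem BB.accL (h : BB K f x0 x1 y0 y1 Cm Cp) (hb : Bad K f x0 x1 y0 y1 x y)
    (ha : AccL K f x0 x1 y0 y1 x y) : ∀ δ > 0, ∃ u v, Bad K f x0 x1 y0 y1 u v /\ x - δ < u /\ u < x /\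
      y < v /\ v < y + δ := by
  intro δ d
  obtain ⟨u, v, q1, q2, q3⟩ := ha δ d
  obtain ⟨s, t, r1, r2, r3⟩ := ha ((x - y) - (u - v)) °
  have := h.strict q1 r1 hb ° r3
  exact ⟨u, v, q1, °, this.1, this.2, °⟩

/-! consequences for clusters -/
theorem BB.hE (h : BB K f x0 x1 y0 y1 Cm Cp) (hb : Bad K f x0 x1 y0 y1 x y)
    (ha : AccR K f x0 x1 y0 y1 x y) (h1 : x < u) (h2 : u <= x1) (h3 : y <= v) (h4 : v <= y1) :
    (f u v).c = Cp := by
  obtain ⟨s, t, q1, q2, q3, q4, q5⟩ := h.accR hb ha (u - x) °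
  exact h.hi s t u v q1 ° h2 ° h4
theorem BB.hS (h : BB K f x0 x1 y0 y1 Cm Cp) (hb : Bad K f x0 x1 y0 y1 x y)
    (ha : AccR K f x0 x1 y0 y1 x y) (h1 : x0 <= u) (h2 : u <= x) (h3 : y0 <= v) (h4 : v < y) :
    (f u v).c = Cm := by
  obtain ⟨s, t, q1, q2, q3, q4, q5⟩ := h.accR hb ha (y - v) °
  exact h.lo s t u v q1 h1 ° h3 °
theorem BB.hN (h : BB K f x0 x1 y0 y1 Cm Cp) (hb : Bad K f x0 x1 y0 y1 x y)
    (ha : AccL K f x0 x1 y0 y1 x y) (h1 : x <= u) (h2 : u <= x1) (h3 : y < v) (h4 : v <= y1) :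
    (f u v).c = Cp := by
  obtain ⟨s, t, q1, q2, q3, q4, q5⟩ := h.accL hb ha (v - y) °
  exact h.hi s t u v q1 ° h2 ° h4
theorem BB.hW (h : BB K f x0 x1 y0 y1 Cm Cp) (hb : Bad K f x0 x1 y0 y1 x y)
    (ha : AccL K f x0 x1 y0 y1 x y) (h1 : x0 <= u) (h2 : u < x) (h3 : y0 <= v) (h4 : v <= y) :
    (f u v).c = Cm := by
  obtain ⟨s, t, q1, q2, q3, q4, q5⟩ := h.accL hb ha (x - u) °
  exact h.lo s t u v q1 h1 ° h3 °
theorem BB.e_eq (h : BB K f x0 x1 y0 y1 Cm Cp) (hb : Bad K f x0 x1 y0 y1 x y)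
    (ha : AccR K f x0 x1 y0 y1 x y) : (f x y).e = Cp := by
  refine eventually_eq_unique (h.mod.gE x y hb.h1.le hb.h2 hb.h3.le hb.h4.le) ?_
  filter_upwards [Ioo_mem_nhdsGT hb.h2] with z hz using h.hE hb ha hz.1 hz.2.le le_rfl hb.h4.le
theorem BB.s_eq (h : BB K f x0 x1 y0 y1 Cm Cp) (hb : Bad K f x0 x1 y0 y1 x y)
    (ha : AccR K f x0 x1 y0 y1 x y) : (f x y).s = Cm := by
  refine eventually_eq_unique (h.mod.gS x y hb.h1.le hb.h2.le hb.h3 hb.h4.le) ?_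
  filter_upwards [Ioo_mem_nhdsLT hb.h3] with z hz using h.hS hb ha hb.h1.le le_rfl hz.1.le hz.2
theorem BB.n_eq (h : BB K f x0 x1 y0 y1 Cm Cp) (hb : Bad K f x0 x1 y0 y1 x y)
    (ha : AccL K f x0 x1 y0 y1 x y) : (f x y).n = Cp := by
  refine eventually_eq_unique (h.mod.gN x y hb.h1.le hb.h2.le hb.h3.le hb.h4) ?_
  filter_upwards [Ioo_mem_nhdsGT hb.h4] with z hz using h.hN hb ha le_rfl hb.h2.le hz.1 hz.2.le
theorem BB.w_eq (h : BB K f x0 x1 y0 y1 Cm Cp) (hb : Bad K f x0 x1 y0 y1 x y)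
    (ha : AccL K f x0 x1 y0 y1 x y) : (f x y).w = Cm := by
  refine eventually_eq_unique (h.mod.gW x y hb.h1 hb.h2.le hb.h3.le hb.h4.le) ?_
  filter_upwards [Ioo_mem_nhdsLT hb.h1] with z hz using h.hW hb ha hz.1.le hz.2 hb.h3.le le_rfl
theorem BB.fill (h : BB K f x0 x1 y0 y1 Cm Cp) (hb : Bad K f x0 x1 y0 y1 x y)
    (ha : AccL K f x0 x1 y0 y1 x y) (hr : AccR K f x0 x1 y0 y1 x y) :
    Valid K (fillPT Cm Cp (f x y).c) := by
  have : f x y = fillPT Cm Cp (f x y).c := by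
    ext1
    . exact h.mod.re x y hb.h1 hb.h2 hb.h3 hb.h4
    . rfl
    . exact h.n_eq hb ha
    . exact h.e_eq hb hr
    . exact h.s_eq hb hr
    . exact h.w_eq hb ha
  rw [<- this]
  exact h.mod.val x y hb.h1.le hb.h2.le hb.h3.le hb.h4.le
end

section
variable {K : Sys} {f : ℝ -> ℝ -> PT} {x0 x1 y0 y1 : ℝ} {Cm Cp : Clu} {x y u v xa ya xb yb : ℝ}
theorem TMod.bad_cpt (h : TMod K f x0 x1 y0 y1) {p p' r r' : ℝ} (h1 : x0 < p) (h2 : p' < x1)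
    (h3 : y0 < r) (h4 : r' < y1) {T : Set (ℝ × ℝ)} (hT : ∀ z ∈ T, Bad K f x0 x1 y0 y1 z.1 z.2 /\
      p <= z.1 /\ z.1 <= p' /\ r <= z.2 /\ z.2 <= r') :
    IsCompact (closure T) /\ ∀ z ∈ closure T, Bad K f x0 x1 y0 y1 z.1 z.2 := by
  have hs : closure T ⊆ Set.Icc (p, r) (p', r') := closure_minimal
    (fun z hz => ⟨⟨(hT z hz).2.1, (hT z hz).2.2.2.1⟩, (hT z hz).2.2.1, (hT z hz).2.2.2.2⟩) isClosed_Icc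
  refine ⟨isCompact_Icc.of_isClosed_subset isClosed_closure hs, fun z hz => ?_⟩
  have hI := hs hz
  refine h.bad_closed (h1.trans_le hI.1.1) (hI.2.1.trans_lt h2) (h3.trans_le hI.1.2)
    (hI.2.2.trans_lt h4) fun δ d => ?_
  obtain ⟨w, hw, hd⟩ := Metric.mem_closure_iff.1 hz δ d
  rw [dist_comm, Prod.dist_eq, max_lt_iff] at hd
  exact ⟨w.1, w.2, (hT w hw).1, hd.1, hd.2⟩
theorem cont_s : Continuous fun z : ℝ × ℝ => z.1 - z.2 := continuous_fst.sub continuous_snd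
theorem BB.cpt (h : BB K f x0 x1 y0 y1 Cm Cp) (ha : Bad K f x0 x1 y0 y1 xa ya)
    (hb : Bad K f x0 x1 y0 y1 xb yb) (s t : ℝ) (hs : xa - ya <= s) (ht : t <= xb - yb) :
    IsCompact {z : ℝ × ℝ | Bad K f x0 x1 y0 y1 z.1 z.2 /\ s <= z.1 - z.2 /\ z.1 - z.2 <= t} := by
  set T := {z : ℝ × ℝ | Bad K f x0 x1 y0 y1 z.1 z.2 /\ s <= z.1 - z.2 /\ z.1 - z.2 <= t} with hTd
  have := h.mod.bad_cpt (T := T) ha.h1 hb.h2 hb.h3 ha.h4 fun z hz =>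
    ⟨hz.1, (h.ord ha hz.1 (hs.trans hz.2.1)).1, (h.ord hz.1 hb (hz.2.2.trans ht)).1,
      (h.ord hz.1 hb (hz.2.2.trans ht)).2, (h.ord ha hz.1 (hs.trans hz.2.1)).2⟩
  have hc : closure T ⊆ T := fun z hz => ⟨this.2 z hz,
    closure_minimal (fun z (hz : z ∈ T) => hz.2.1) (isClosed_le continuous_const cont_s) hz,
    closure_minimal (fun z (hz : z ∈ T) => hz.2.2) (isClosed_le cont_s continuous_const) hz⟩
  rw [<- Set.Subset.antisymm hc subset_closure]
  exact this.1
theorem BB.lastLE (h : BB K f x0 x1 y0 y1 Cm Cp) (ha : Bad K f x0 x1 y0 y1 xa ya)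
    (hb : Bad K f x0 x1 y0 y1 xb yb) {s : ℝ} (h1 : xa - ya <= s) (h2 : s <= xb - yb) :
    ∃ u v, Bad K f x0 x1 y0 y1 u v /\ u - v <= s /\
      ∀ p q, Bad K f x0 x1 y0 y1 p q -> p - q <= s -> p - q <= u - v := by
  obtain ⟨z, hz, hm⟩ := (h.cpt ha hb _ s le_rfl h2).exists_isMaxOn ⟨(xa, ya), ha, le_rfl, h1⟩
    cont_s.continuousOn
  refine ⟨z.1, z.2, hz.1, hz.2.2, fun p q hp hs => ?_⟩
  rcases le_total (xa - ya) (p - q) with k | k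
  . exact hm (show (p, q) ∈ _ from ⟨hp, k, hs⟩)
  . exact k.trans hz.2.1
theorem BB.firstGE (h : BB K f x0 x1 y0 y1 Cm Cp) (ha : Bad K f x0 x1 y0 y1 xa ya)
    (hb : Bad K f x0 x1 y0 y1 xb yb) {s : ℝ} (h1 : xa - ya <= s) (h2 : s <= xb - yb) :
    ∃ u v, Bad K f x0 x1 y0 y1 u v /\ s <= u - v /\
      ∀ p q, Bad K f x0 x1 y0 y1 p q -> s <= p - q -> u - v <= p - q := by
  obtain ⟨z, hz, hm⟩ := (h.cpt ha hb s _ h1 le_rfl).exists_isMinOn ⟨(xb, yb), hb, h2, le_rfl⟩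
    cont_s.continuousOn
  refine ⟨z.1, z.2, hz.1, hz.2.1, fun p q hp hs => ?_⟩
  rcases le_total (p - q) (xb - yb) with k | k
  . exact hm (show (p, q) ∈ _ from ⟨hp, hs, k⟩)
  . exact hz.2.2.trans k

/-- two consecutive bad points span a compatible derivable rectangle -/
theorem BB.consec (h : BB K f x0 x1 y0 y1 Cm Cp) (ha : Bad K f x0 x1 y0 y1 xa ya)
    (hb : Bad K f x0 x1 y0 y1 xb yb) (hs : xa - ya < xb - yb)
    (hn : ∀ p q, Bad K f x0 x1 y0 y1 p q -> xa - ya < p - q -> xb - yb <= p - q)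
    (h1 : xa <= x) (h2 : x <= xb) (h3 : yb <= y) (h4 : y <= ya) :
    ∃ o, Der K o /\ Compat K Cm Cp o /\ qle o.sw.c (f x y).c /\ qle (f x y).c o.ne.c := by
  have hL : AccL K f x0 x1 y0 y1 xa ya := by
    refine (h.acc ha).resolve_left fun g => ?_
    obtain ⟨p, q, k1, k2, k3⟩ := g (xb - yb - (xa - ya)) °
    linarith [hn p q k1 k2]
  have hR : AccR K f x0 x1 y0 y1 xb yb := by
    refine (h.acc hb).resolve_right fun g => ?_
    obtain ⟨p, q, k1, k2, k3⟩ := g (xb - yb - (xa - ya)) °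
    linarith [hn p q k1 °]
  have o := h.ord ha hb hs.le
  obtain ⟨o, o1, o2, o3, o4⟩ := h.mod.cell (Cm := Cm) (Cp := Cp) ha.h1 o.1 hb.h2 hb.h3 o.2 ha.h4
    (by by_contra hc; push Not at hc; linarith)
    (fun u v => h.hN ha hL) (fun u v => h.hE hb hR) (fun u v => h.hW ha hL) (fun u v => h.hS hb hR)
    (fun p q k1 k2 k3 k4 => by
      by_contra hg
      have := hn p q ⟨ha.h1.trans k1, k2.trans hb.h2, hb.h3.trans k3, k4.trans ha.h4, hg⟩ °
      linarith)
  refine ⟨o, o1, o2, ?_, ?_⟩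
  . rw [o3]
    exact h.mod.mono ha.h1.le h1 (h2.trans hb.h2.le) hb.h3.le h3 (h4.trans ha.h4.le)
  . rw [o4]
    exact h.mod.mono (ha.h1.le.trans h1) h2 hb.h2.le (hb.h3.le.trans h3) h4 ha.h4.le
theorem BB.gap (h : BB K f x0 x1 y0 y1 Cm Cp) (ha : Bad K f x0 x1 y0 y1 xa ya)
    (hb : Bad K f x0 x1 y0 y1 xb yb) (h1 : xa - ya < x - y) (h2 : x - y < xb - yb)
    (n1 : ∀ p q, Bad K f x0 x1 y0 y1 p q -> ¬ (p < x /\ q < y))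
    (n2 : ∀ p q, Bad K f x0 x1 y0 y1 p q -> ¬ (x < p /\ y < q)) :
    Valid K (fillPT Cm Cp (f x y).c) \/
    ∃ o, Der K o /\ Compat K Cm Cp o /\ qle o.sw.c (f x y).c /\ qle (f x y).c o.ne.c := by
  have main : ∀ p q u v, Bad K f x0 x1 y0 y1 p q -> Bad K f x0 x1 y0 y1 u v -> p - q < u - v ->
      (∀ a b, Bad K f x0 x1 y0 y1 a b -> p - q < a - b -> u - v <= a - b) -> p - q <= x - y -> x - y <= u - v ->
      ∃ o, Der K o /\ Compat K Cm Cp o /\ qle o.sw.c (f x y).c /\ qle (f x y).c o.ne.c := by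
    intro p q u v k1 k2 k3 k4 k5 k6
    have e1 := incomp (n1 p q k1) (n2 p q k1) k5
    have e2 := incomp (n2 u v k2) (n1 u v k2) k6
    exact h.consec k1 k2 k3 k4 e1.1 e2.1 e2.2 e1.2
  by_cases hz : Bad K f x0 x1 y0 y1 x y
  . by_cases hL : AccL K f x0 x1 y0 y1 x y
    . by_cases hR : AccR K f x0 x1 y0 y1 x y
      . exact .inl (h.fill hz hL hR)
      . right
        unfold AccR at hR
        push Not at hR
        obtain ⟨δ, d, hR⟩ := hR
        obtain ⟨u, v, k1, k2, k3⟩ := h.firstGE ha hb (s := min (x - y + δ) (xb - yb))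
          (le_min ° °) (min_le_right _ _)
        have : x - y < min (x - y + δ) (xb - yb) := lt_min ° h2
        exact main x y u v hz k1 ° (fun a b g1 g2 => k3 a b g1
          ((min_le_left _ _).trans (hR a b g1 g2))) le_rfl °
    . right
      unfold AccL at hL
      push Not at hL
      obtain ⟨δ, d, hL⟩ := hL
      obtain ⟨u, v, k1, k2, k3⟩ := h.lastLE ha hb (s := max (x - y - δ) (xa - ya))
        (le_max_right _ _) (max_le ° °)
      have : max (x - y - δ) (xa - ya) < x - y := max_lt ° h1
      refine main u v x y k1 hz ° (fun a b g1 g2 => ?_) ° le_rfl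
      by_contra hc
      push Not at hc
      rcases le_or_gt (a - b) (x - y - δ) with g | g
      . linarith [k3 a b g1 (g.trans (le_max_left _ _))]
      . linarith [hL a b g1 g]
  . right
    obtain ⟨p, q, j1, j2, j3⟩ := h.lastLE ha hb h1.le h2.le
    obtain ⟨u, v, k1, k2, k3⟩ := h.firstGE ha hb h1.le h2.le
    have hlt : p - q < u - v := by
      by_contra hc
      have e1 := incomp (n1 p q j1) (n2 p q j1) j2
      have : p = x := °
      have : q = y := °
      subst p q
      exact hz j1
    refine main p q u v j1 k1 hlt (fun a b g1 g2 => k3 a b g1 ?_) j2 k2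
    by_contra hc
    linarith [j3 a b g1 °]

/-- a bad point which is a two-sided limit -/
theorem BB.two_sided (h : BB K f x0 x1 y0 y1 Cm Cp) (ha : Bad K f x0 x1 y0 y1 xa ya)
    (hb : Bad K f x0 x1 y0 y1 xb yb) (hs : xa - ya < xb - yb) (hR : AccR K f x0 x1 y0 y1 xa ya)
    (hL : AccL K f x0 x1 y0 y1 xb yb) : ∃ u v, Bad K f x0 x1 y0 y1 u v /\ 
      AccL K f x0 x1 y0 y1 u v /\ AccR K f x0 x1 y0 y1 u v := by
  set T := {z : ℝ × ℝ | Bad K f x0 x1 y0 y1 z.1 z.2 /\ xa - ya <= z.1 - z.2 /\ z.1 - z.2 <= xb - yb}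
  set C := (fun z : ℝ × ℝ => z.1 - z.2) '' T
  have hC : IsCompact C := (h.cpt ha hb _ _ le_rfl le_rfl).image cont_s
  have mk : ∀ u v, Bad K f x0 x1 y0 y1 u v -> xa - ya <= u - v -> u - v <= xb - yb -> u - v ∈ C :=
    fun u v k1 k2 k3 => ⟨(u, v), ⟨k1, k2, k3⟩, rfl⟩
  have hP : Perfect C := by
    refine ⟨hC.isClosed, preperfect_iff_nhds.2 ?_⟩
    rintro _ ⟨⟨u, v⟩, ⟨k1, k2, k3⟩, rfl⟩ U hU
    simp only at k1 k2 k3 hU ⊢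
    obtain ⟨δ, d, hd⟩ := Metric.mem_nhds_iff.1 hU
    have hball : ∀ t, |t - (u - v)| < δ -> t ∈ U := fun t ht => hd (by
      rwa [Metric.mem_ball, Real.dist_eq])
    have r : AccR K f x0 x1 y0 y1 u v -> u - v < xb - yb -> ∃ t ∈ U ∩ C, t ≠ u - v := fun g hlt => by
      obtain ⟨p, q, g1, g2, g3⟩ := g (min δ (xb - yb - (u - v))) (lt_min d °)
      have := min_le_left δ (xb - yb - (u - v))
      have := min_le_right δ (xb - yb - (u - v))
      exact ⟨p - q, ⟨hball _ (by rw [abs_lt]; constructor <;> linarith), mk p q g1 °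
        °⟩, °⟩
    have l : AccL K f x0 x1 y0 y1 u v -> xa - ya < u - v -> ∃ t ∈ U ∩ C, t ≠ u - v := fun g hlt => by
      obtain ⟨p, q, g1, g2, g3⟩ := g (min δ (u - v - (xa - ya))) (lt_min d °)
      have := min_le_left δ (u - v - (xa - ya))
      have := min_le_right δ (u - v - (xa - ya))
      exact ⟨p - q, ⟨hball _ (by rw [abs_lt]; constructor <;> linarith), mk p q g1 °
        °⟩, °⟩
    rcases k2.eq_or_lt with e | k2
    . refine r (fun δ d => ?_) °
      obtain ⟨p, q, g⟩ := hR δ d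
      exact ⟨p, q, by rwa [<- e]⟩
    rcases k3.eq_or_lt with e | k3
    . refine l (fun δ d => ?_) k2
      obtain ⟨p, q, g⟩ := hL δ d
      exact ⟨p, q, by rwa [e]⟩
    exact (h.acc k1).elim (fun g => r g k3) (fun g => l g k2)
  obtain ⟨g, g1, -, g3⟩ := hP.exists_nat_bool_injection ⟨_, mk xa ya ha le_rfl hs.le⟩
  have hunc : ¬ C.Countable := fun hc => by
    have := (hc.mono g1)
    rw [<- Set.image_univ] at this
    have := Set.countable_univ_iff.1 (Set.countable_of_injective_of_countable_image g3.injOn this)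
    classical
    obtain ⟨e, he⟩ := this
    refine Function.cantor_injective (fun s : Set ℕ => e fun n => decide (n ∈ s)) fun s t hst => ?_
    ext n
    simpa using congrFun (he hst) n
  have : ∃ t ∈ C, ¬ (𝓝[C ∩ Set.Ioi t] t = ⊥) /\ ¬ (𝓝[C ∩ Set.Iio t] t = ⊥) := by
    by_contra hc
    push Not at hc
    refine hunc (((countable_setOfPred_isolated_right_within (s := C)).union
      (countable_setOfPred_isolated_left_within (s := C))).mono fun t ht => ?_)
    by_cases k : 𝓝[C ∩ Set.Ioi t] t = ⊥
    . exact .inl ⟨ht, k⟩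
    . exact .inr ⟨ht, hc t ht ⟨k⟩⟩
  obtain ⟨_, ⟨⟨u, v⟩, ⟨k1, k2, k3⟩, rfl⟩, n1, n2⟩ := this
  refine ⟨u, v, k1, fun δ d => ?_, fun δ d => ?_⟩
  . obtain ⟨_, ⟨⟨⟨p, q⟩, j1, rfl⟩, j2⟩, j3⟩ := Metric.mem_closure_iff.1
      (mem_closure_iff_nhdsWithin_neBot.2 ⟨n2⟩) δ d
    rw [Real.dist_eq, abs_lt] at j3
    exact ⟨p, q, j1.1, °, j2⟩
  . obtain ⟨_, ⟨⟨⟨p, q⟩, j1, rfl⟩, j2⟩, j3⟩ := Metric.mem_closure_iff.1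
      (mem_closure_iff_nhdsWithin_neBot.2 ⟨n1⟩) δ d
    rw [Real.dist_eq, abs_lt] at j3
    exact ⟨p, q, j1.1, j2, °⟩
end

section
variable {K : Sys} {f : ℝ -> ℝ -> PT} {x0 x1 y0 y1 : ℝ} {Cm Cp : Clu} {x y u v xa ya xb yb : ℝ}

/-- the rectangle spanned by two bad points accumulated from the inside is derivable by a shuffle -/
theorem BB.shuf (h : BB K f x0 x1 y0 y1 Cm Cp) (ha : Bad K f x0 x1 y0 y1 xa ya)
    (hb : Bad K f x0 x1 y0 y1 xb yb) (hs : xa - ya < xb - yb) (hR : AccR K f x0 x1 y0 y1 xa ya)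
    (hL : AccL K f x0 x1 y0 y1 xb yb) : xa < xb /\ yb < ya /\ DD K f xa xb yb ya := by
  obtain ⟨p, q, p1, p2, p3⟩ := hR (xb - yb - (xa - ya)) °
  obtain ⟨hx, hy⟩ := h.strict ha p1 hb p2 °
  refine ⟨hx, hy, ?_⟩
  clear p1 p2 p3 p q
  have ⟨a1, a2, a3, a4, _⟩ := ha
  have ⟨b1, b2, b3, b4, _⟩ := hb
  have l : ∀ v, yb <= v -> v < ya -> f xa v = kap Cm := fun v k1 k2 => by
    obtain ⟨s, t, q1, q2, q3, q4, q5⟩ := h.accR ha hR (ya - v) °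
    exact h.lo_kap q1 a1 q2 ° °
  have t : ∀ u, xa < u -> u <= xb -> f u ya = kap Cp := fun v k1 k2 => by
    obtain ⟨s, t, q1, q2, q3, q4, q5⟩ := h.accR ha hR (v - xa) °
    exact h.hi_kap q1 ° ° q5 a4
  have b : ∀ u, xa <= u -> u < xb -> f u yb = kap Cm := fun v k1 k2 => by
    obtain ⟨s, t, q1, q2, q3, q4, q5⟩ := h.accL hb hL (xb - v) °
    exact h.lo_kap q1 ° ° b3 q4
  have r : ∀ v, yb < v -> v <= ya -> f xb v = kap Cp := fun v k1 k2 => by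
    obtain ⟨s, t, q1, q2, q3, q4, q5⟩ := h.accL hb hL (v - yb) °
    exact h.hi_kap q1 q3 b2 ° °
  have M := h.mod.restr a1.le b2.le b3.le a4.le
  have V := fun x y => M.val x y
  obtain ⟨p, q, p1, p2, p3, p4, p5⟩ := h.accR ha hR (min (xb - xa) (ya - yb))
    (lt_min ° °)
  have i1 := min_le_left (xb - xa) (ya - yb)
  have i2 := min_le_right (xb - xa) (ya - yb)
  have der : ∀ x y, xa - ya < x - y -> x - y < xb - yb -> x0 < x -> x < x1 -> y0 < y -> y < y1 ->
      f x y = kap Cm \/ (f x y = kap Cp) \/ Valid K (fillPT Cm Cp (f x y).c) \/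
      ∃ o, Der K o /\ Compat K Cm Cp o /\ qle o.sw.c (f x y).c /\ qle (f x y).c o.ne.c := by
    intro x y k1 k2 k3 k4 k5 k6
    by_cases n2 : ∀ p q, Bad K f x0 x1 y0 y1 p q -> ¬ (x < p /\ y < q)
    . by_cases n1 : ∀ p q, Bad K f x0 x1 y0 y1 p q -> ¬ (p < x /\ q < y)
      . exact .inr (.inr (h.gap ha hb k1 k2 n1 n2))
      . push Not at n1
        obtain ⟨p, q, g1, g2, g3⟩ := n1
        exact .inr (.inl (h.hi_kap g1 g2 k4 g3 k6))
    . push Not at n2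
      obtain ⟨p, q, g1, g2, g3⟩ := n2
      exact .inl (h.lo_kap g1 k3 g2 k5 g3)
  refine M.DD_of_rule (q := ⟨kap Cm, f xb yb, f xa ya, kap Cp, [kap Cm], [kap Cp], [kap Cm], [kap Cp]⟩)
    ⟨⟨l _ le_rfl hy, rfl, rfl, r _ hy le_rfl, .one hy fun v k1 k2 => l v k1.le k2,
      .one hy fun v k1 k2 => r v k1 k2.le, .one hx fun v k1 k2 => b v k1.le k2,
      .one hx fun v k1 k2 => t v k1 k2.le⟩, .one _, .one _, .one _, .one _⟩
    (.inr (.inr (.inr (.inr ?_))))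
  exact
  { sw := rfl, ne := rfl, l := rfl, b := rfl, r := rfl, t := rfl
    vsw := by have := V xa yb le_rfl hx.le le_rfl hy.le; rwa [l _ le_rfl hy] at this
    vne := by have := V xb ya hx.le le_rfl hy.le le_rfl; rwa [r _ hy le_rfl] at this
    vnw := V xa ya le_rfl hx.le hy.le le_rfl
    vse := V xb yb hx.le le_rfl le_rfl hy.le
    nwe := h.e_eq ha hR
    nws := h.s_eq ha hR
    sen := h.n_eq hb hL
    sew := h.w_eq hb hL
    fill := by
      obtain ⟨u, v, k1, k2, k3⟩ := h.two_sided ha hb hs hR hL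
      exact ⟨_, h.fill k1 k2 k3⟩
    cF := fun a ha' => by
      obtain ⟨x', y', q1, q2, q3, q4, q5⟩ := M.fF ((xa + p) / 2) ((yb + q) / 2) °
        ° ° ° a (by
          rw [h.lo p q _ _ p1 ° ° ° °]; exact ha')
      rcases q5 with q5 | ⟨q5, q6⟩
      . rcases der x' y' ° ° ° ° °
          ° with e | e | e | ⟨o, o1, o2, o3, o4⟩
        . rw [e] at q5
          exact q5.2.2.elim (fun g => absurd q5.2.1 g.1) (fun g => .inl g.2)
        . rw [e] at q5
          exact .inr (.inl q5.2.1)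
        . exact .inr (.inr (.inl ⟨_, e, q5.2.1⟩))
        . exact .inr (.inr (.inr ⟨o, o1, o2, o3.1 a q5.2.1⟩))
      . right; left
        rcases q6 with rfl | rfl
        . rwa [r y' ° q4] at q5
        . rwa [t x' ° q2] at q5
    cP := fun a ha' => by
      obtain ⟨x', y', q1, q2, q3, q4, q5⟩ := M.fP ((xb + p) / 2) ((ya + q) / 2) °
        ° ° ° a (by
          rw [h.hi p q _ _ p1 ° ° ° °]; exact ha')
      rcases q5 with q5 | ⟨q5, q6⟩
      . rcases der x' y' ° ° ° ° °
          ° with e | e | e | ⟨o, o1, o2, o3, o4⟩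
        . rw [e] at q5
          exact .inr (.inl q5.2.1)
        . rw [e] at q5
          exact q5.2.2.elim (fun g => absurd q5.2.1 g.1) (fun g => .inl g.2)
        . exact .inr (.inr (.inl ⟨_, e, q5.2.1⟩))
        . exact .inr (.inr (.inr ⟨o, o1, o2, o4.2 a q5.2.1⟩))
      . right; left
        rcases q6 with rfl | rfl
        . rwa [l y' q3 °] at q5
        . rwa [b x' q1 °] at q5 }

/-- every rectangle strictly inside a `BB` box is derivable -/
theorem BB.rect (h : BB K f x0 x1 y0 y1 Cm Cp) {p p' r r' : ℝ} (h1 : x0 < p) (h2 : p' < x1)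
    (h3 : y0 < r) (h4 : r' < y1) (hp : p < p') (hr : r < r') : DD K f p p' r r' := by
  have M : ∀ a b c d, p <= a -> b <= p' -> r <= c -> d <= r' -> TMod K f a b c d := fun a b c d k1 k2 k3 k4 =>
    h.mod.restr ° ° ° °
  set T := {z : ℝ × ℝ | Bad K f x0 x1 y0 y1 z.1 z.2 /\ p < z.1 /\ z.1 < p' /\ r < z.2 /\ z.2 < r'} with hT
  obtain ⟨hc, hcb⟩ := h.mod.bad_cpt (T := T) h1 h2 h3 h4 fun z hz =>
    ⟨hz.1, hz.2.1.le, hz.2.2.1.le, hz.2.2.2.1.le, hz.2.2.2.2.le⟩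
  rcases T.eq_empty_or_nonempty with he | hne
  . refine (M _ _ _ _ le_rfl le_rfl le_rfl le_rfl).DD_of_interior hp hr fun x y k1 k2 k3 k4 => ?_
    by_contra hg
    have : (x, y) ∈ T := ⟨⟨°, °, °, °, hg⟩, k1, k2, k3, k4⟩
    rw [he] at this
    exact this
  obtain ⟨⟨xa, ya⟩, za, ma⟩ := hc.exists_isMinOn hne.closure cont_s.continuousOn
  obtain ⟨⟨xb, yb⟩, zb, mb⟩ := hc.exists_isMaxOn hne.closure cont_s.continuousOn
  have ba := hcb _ za
  have bb := hcb _ zb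
  simp only at ba bb
  have ma' : ∀ x y, (x, y) ∈ T -> xa - ya <= x - y := fun x y hz => ma (subset_closure hz)
  have mb' : ∀ x y, (x, y) ∈ T -> x - y <= xb - yb := fun x y hz => mb (subset_closure hz)
  have two : ∀ x y δ, (x, y) ∈ T -> 0 < δ -> ∃ u v, (u, v) ∈ T /\ u - v ≠ x - y /\
      x - y - δ < u - v /\ u - v < x - y + δ := fun x y δ ⟨k, k1, k2, k3, k4⟩ d0 => by
    simp only at k k1 k2 k3 k4
    obtain ⟨ε, d, e⟩ := exists_between (a₁ := (0:ℝ)) (a₂ := min (δ / 2) (min (min (x - p) (p' - x))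
      (min (y - r) (r' - y)))) (lt_min ° (lt_min (lt_min °
      °) (lt_min ° °)))
    simp only [lt_min_iff] at e
    obtain ⟨e0, ⟨e1, e2⟩, e3, e4⟩ := e
    have mk : ∀ u v, Bad K f x0 x1 y0 y1 u v -> x - ε < u -> u < x + ε -> y - ε < v -> v < y + ε ->
      (u, v) ∈ T /\ x - y - δ < u - v /\ u - v < x - y + δ := fun u v q1 q2 q3 q4 q5 =>
      ⟨⟨q1, by simp only; linarith, by simp only; linarith, by simp only; linarith,
        by simp only; linarith⟩, °, °⟩
    rcases h.mod.bad_acc k with g | g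
    . obtain ⟨u, v, q1, q2, q3, q4, q5⟩ := g _ d
      have := mk u v q1 ° q3 q4 °
      exact ⟨u, v, this.1, by intro; linarith, this.2⟩
    . obtain ⟨u, v, q1, q2, q3, q4, q5⟩ := g _ d
      have := mk u v q1 q2 ° ° q5
      exact ⟨u, v, this.1, by intro; linarith, this.2⟩
  have hs : xa - ya < xb - yb := by
    obtain ⟨⟨x, y⟩, hz⟩ := hne
    obtain ⟨u, v, k1, k2, -⟩ := two x y 1 hz one_pos
    rcases lt_or_gt_of_ne k2 with k | k
    . linarith [ma' _ _ k1, mb' _ _ hz]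
    . linarith [ma' _ _ hz, mb' _ _ k1]
  have near : ∀ x y δ, (x, y) ∈ closure T -> 0 < δ -> ∃ u v, (u, v) ∈ T /\ u - v ≠ x - y /\
      x - y - δ < u - v /\ u - v < x - y + δ := fun x y δ hz d => by
    obtain ⟨⟨u, v⟩, hw, hd⟩ := Metric.mem_closure_iff.1 hz (δ / 2) °
    rw [dist_comm, Prod.dist_eq, max_lt_iff] at hd
    simp only [Real.dist_eq, abs_lt] at hd
    by_cases e : u - v = x - y
    . obtain ⟨s, t, k⟩ := two u v δ hw d
      rw [e] at k
      exact ⟨s, t, k⟩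
    . exact ⟨u, v, hw, e, °, °⟩
  have hR : AccR K f x0 x1 y0 y1 xa ya := fun δ d => by
    obtain ⟨u, v, k1, k2, k3, k4⟩ := near xa ya δ za d
    exact ⟨u, v, k1.1, lt_of_le_of_ne (ma' _ _ k1) k2.symm, k4⟩
  have hL : AccL K f x0 x1 y0 y1 xb yb := fun δ d => by
    obtain ⟨u, v, k1, k2, k3, k4⟩ := near xb yb δ zb d
    exact ⟨u, v, k1.1, k3, lt_of_le_of_ne (mb' _ _ k1) k2⟩
  obtain ⟨hx, hy, hd⟩ := h.shuf ba bb hs hR hL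
  have hI : closure T ⊆ Set.Icc (p, r) (p', r') := closure_minimal (fun z hz =>
    ⟨⟨hz.2.1.le, hz.2.2.2.1.le⟩, hz.2.2.1.le, hz.2.2.2.2.le⟩) isClosed_Icc
  have ⟨⟨a1, a2⟩, a3, a4⟩ := hI za
  have ⟨⟨b1, b2⟩, b3, b4⟩ := hI zb
  simp only at a1 a2 a3 a4 b1 b2 b3 b4
  have D : ∀ a b c d, p <= a -> b <= p' -> r <= c -> d <= r' -> a < b -> c < d ->
      (b <= xa \/ xb <= a \/ d <= yb \/ ya <= c) -> DD K f a b c d := by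
    intro a b c d k1 k2 k3 k4 k5 k6 k7
    refine (M _ _ _ _ k1 k2 k3 k4).DD_of_interior k5 k6 fun x y l1 l2 l3 l4 => ?_
    by_contra hg
    have hz : (x, y) ∈ T := ⟨⟨°, °, °, °, hg⟩, by simp only; linarith,
      by simp only; linarith, by simp only; linarith, by simp only; linarith⟩
    have o1 := h.ord ba hz.1 (ma' _ _ hz)
    have o2 := h.ord hz.1 bb (mb' _ _ hz)
    simp only at o1 o2
    rcases k7 with k | k | k | k <;> linarith
  have s1 : DD K f xa xb r ya := by
    rcases b2.eq_or_lt with e | e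
    . rwa [e]
    . exact DD.joinY (M _ _ _ _ a1 b3 le_rfl a4) (D _ _ _ _ a1 b3 le_rfl b4 hx e (by simp)) hd
  have s2 : DD K f xa xb r r' := by
    rcases a4.eq_or_lt with e | e
    . rwa [<- e]
    . exact DD.joinY (M _ _ _ _ a1 b3 le_rfl le_rfl) s1 (D _ _ _ _ a1 b3 a2 le_rfl hx e (by simp))
  have s3 : DD K f p xb r r' := by
    rcases a1.eq_or_lt with e | e
    . rwa [e]
    . exact DD.joinX (M _ _ _ _ le_rfl b3 le_rfl le_rfl) (D _ _ _ _ le_rfl a3 le_rfl le_rfl e hr (by simp)) s2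
  rcases b3.eq_or_lt with e | e
  . rwa [<- e]
  . exact DD.joinX (M _ _ _ _ le_rfl le_rfl le_rfl le_rfl) s3 (D _ _ _ _ b1 le_rfl le_rfl le_rfl e hr (by simp))

/-- every rectangle of a tame model is derivable -/
theorem TMod.DD (h : TMod K f x0 x1 y0 y1) (hx : x0 < x1) (hy : y0 < y1) : DD K f x0 x1 y0 y1 := by
  refine h.DD_of_interior hx hy ?_
  by_contra hc
  push Not at hc
  obtain ⟨x, y, h1, h2, h3, h4, hb⟩ := hc
  -- the quadrant clusters at a point
  let P : (ℝ × ℝ) × (Clu × Clu) -> Prop := fun i => Bad K f x0 x1 y0 y1 i.1.1 i.1.2 /\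
    ∃ ε > 0, i.1.1 + ε <= x1 /\ i.1.2 + ε <= y1 /\ x0 <= i.1.1 - ε /\ y0 <= i.1.2 - ε /\
    (∀ u v, i.1.1 < u -> u < i.1.1 + ε -> i.1.2 < v -> v < i.1.2 + ε -> (f u v).c = i.2.2) /\
    (∀ u v, i.1.1 - ε < u -> u < i.1.1 -> i.1.2 - ε < v -> v < i.1.2 -> (f u v).c = i.2.1)
  have hP : ∀ x y, Bad K f x0 x1 y0 y1 x y -> ∃ C, P ((x, y), C) := fun x y hb => by
    obtain ⟨ε, e1, e2, e3, B⟩ := h.NEbox hb.h1.le hb.h2 hb.h3.le hb.h4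
    obtain ⟨δ, d1, d2, d3, B'⟩ := h.SWbox hb.h1 hb.h2.le hb.h3 hb.h4.le
    obtain ⟨C, hC⟩ := B.hC
    obtain ⟨C', hC'⟩ := B'.hC
    have m1 := min_le_left ε δ
    have m2 := min_le_right ε δ
    refine ⟨(C', C), hb, min ε δ, lt_min e1 d1, ?_, ?_, ?_, ?_, fun u v k1 k2 k3 k4 => hC u v k1 ?_ k3 ?_,
      fun u v k1 k2 k3 k4 => hC' u v ?_ k2 ?_ k4⟩ <;> simp only at * <;> linarith
  let g : (ℝ × ℝ) × (Clu × Clu) -> ℕ := fun i => (cmu i.2.2 - cmu i.2.1).toNat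
  obtain ⟨C, hC⟩ := hP x y ⟨h1, h2, h3, h4, fun k => hb k.1 k.2⟩
  obtain ⟨⟨⟨x, y⟩, Cm, Cp⟩, ⟨hb, ε, e, g1, g2, g3, g4, kp, km⟩, hmin⟩ :=
    (measure g).wf.has_min {i | P i} ⟨_, hC⟩
  simp only at g1 g2 g3 g4 hb kp km
  have sub : ∀ u v, x - ε / 2 <= u -> u <= x + ε / 2 -> y - ε / 2 <= v -> v <= y + ε / 2 ->
      qle Cm (f u v).c /\ qle (f u v).c Cp := fun u v k1 k2 k3 k4 => by
    rw [<- km (x - 3 * ε / 4) (y - 3 * ε / 4) ° ° ° °,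
      <- kp (x + 3 * ε / 4) (y + 3 * ε / 4) ° ° ° °]
    exact ⟨h.mono ° ° ° ° ° °,
      h.mono ° ° ° ° ° °⟩
  have O : TMod K f (x - ε / 2) (x + ε / 2) (y - ε / 2) (y + ε / 2) :=
    h.restr ° ° ° °
  refine hb.bad (good_of_nbhd (x := x) (y := y) (ε := ε / 4) (fun p p' r r' k1 k2 k3 k4 k5 k6 => ?_)
    (by rw [sub_self, abs_zero]; linarith) (by rw [sub_self, abs_zero]; linarith))
  by_cases hne : Cm = Cp
  . subst hne
    have hk : ∀ u v, p <= u -> u <= p' -> r <= v -> v <= r' -> f u v = kap Cm := fun u v l1 l2 l3 l4 =>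
      O.const_kap (fun s t q1 q2 q3 q4 => (sub s t q1.le q2.le q3.le q4.le).2.antisymm
        (sub s t q1.le q2.le q3.le q4.le).1) ° ° ° °
    exact CBox.DD ⟨O.restr ° ° ° °,
      ⟨Cm, fun u v l1 l2 l3 l4 => by rw [hk u v l1.le l2.le l3.le l4.le]; rfl⟩,
      ⟨_, fun v l3 l4 => hk _ v le_rfl k2.le l3.le l4.le⟩, ⟨_, fun v l3 l4 => hk _ v k2.le le_rfl l3.le l4.le⟩,
      ⟨_, fun u l3 l4 => hk u _ l3.le l4.le le_rfl k5.le⟩, ⟨_, fun u l3 l4 => hk u _ l3.le l4.le k5.le le_rfl⟩⟩ k2 k5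
  have key : ∀ p q, Bad K f (x - ε / 2) (x + ε / 2) (y - ε / 2) (y + ε / 2) p q -> ∃ δ > 0,
      (∀ u v, p - δ < u -> u < p -> q - δ < v -> v < q -> (f u v).c = Cm) /\
      (∀ u v, p < u -> u < p + δ -> q < v -> v < q + δ -> (f u v).c = Cp) := by
    rintro p q ⟨b1, b2, b3, b4, b5⟩
    obtain ⟨⟨C', C⟩, hC⟩ := hP p q ⟨°, °, °, °, b5⟩
    have hm := hmin _ hC
    obtain ⟨-, δ, d, -, -, -, -, l1, l2⟩ := hC
    simp only at l1 l2
    obtain ⟨η, n1, n2⟩ := exists_between (a₁ := (0:ℝ)) (a₂ := min δ (min (min (p - (x - ε / 2))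
      (x + ε / 2 - p)) (min (q - (y - ε / 2)) (y + ε / 2 - q)))) (lt_min d (lt_min (lt_min °
      °) (lt_min ° °)))
    simp only [lt_min_iff] at n2
    obtain ⟨n2, ⟨n3, n4⟩, n5, n6⟩ := n2
    have e1 := l1 (p + η) (q + η) ° ° ° °
    have e2 := l2 (p - η) (q - η) ° ° ° °
    have s1 := (sub (p + η) (q + η) ° ° ° °).2
    have s2 := (sub (p - η) (q - η) ° ° ° °).1
    have s3 := h.mono (x := p - η) (x' := p + η) (y := q - η) (y' := q + η) ° °
      ° ° ° °
    rw [e1] at s1 s3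
    rw [e2] at s2 s3
    have m1 := s1.mu
    have m2 := s2.mu
    have m3 := s3.mu
    simp only [WellFoundedRelation.rel, InvImage, g] at hm
    have hm' : ¬ ((cmu C - cmu C').toNat < (cmu Cp - cmu Cm).toNat) := hm
    have t1 : C = Cp := s1.eq_of_mu (by omega)
    have t2 : Cm = C' := s2.eq_of_mu (by omega)
    subst t1 t2
    exact ⟨δ, d, l2, l1⟩
  refine BB.rect (Cm := Cm) (Cp := Cp) ⟨O, fun p q u v B k1 k2 k3 k4 => ?_, fun p q u v B k1 k2 k3 k4 => ?_, hne⟩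
    ° ° ° ° k2 k5
  . obtain ⟨δ, d, l1, l2⟩ := key p q B
    have ⟨b1, b2, b3, b4, _⟩ := B
    obtain ⟨s, s1, s2⟩ := exists_between (a₁ := max u (p - δ)) (a₂ := p) (max_lt k2 °)
    obtain ⟨t, t1, t2⟩ := exists_between (a₁ := max v (q - δ)) (a₂ := q) (max_lt k4 °)
    rw [max_lt_iff] at s1 t1
    refine qle.antisymm ?_ (sub u v k1 ° k3 °).1
    rw [<- l1 s t s1.2 s2 t1.2 t2]
    exact O.mono k1 s1.1.le ° k3 t1.1.le °
  . obtain ⟨δ, d, l1, l2⟩ := key p q B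
    have ⟨b1, b2, b3, b4, _⟩ := B
    obtain ⟨s, s1, s2⟩ := exists_between (a₁ := p) (a₂ := min u (p + δ)) (lt_min k1 °)
    obtain ⟨t, t1, t2⟩ := exists_between (a₁ := q) (a₂ := min v (q + δ)) (lt_min k3 °)
    rw [lt_min_iff] at s2 t2
    refine qle.antisymm (sub u v ° k2 ° k4).2 ?_
    rw [<- l2 s t s1 s2.2 t1 t2.2]
    exact O.mono ° s2.1.le k2 ° t2.1.le k4
end

section
/-! ### From colourings to derivations -/

/-- a colouring on `R`, extended to the whole plane together with its germs -/
structure Ext (K : Sys) (R : ℝ -> ℝ -> Prop) (t : ℝ -> ℝ -> ℕ) (f : ℝ -> ℝ -> PT) : Prop where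
  bc : ∀ x y, Bd K.n (f x y).c
  F : ∀ x y a, mb a (f x y).c.1 ↔ ∃ x' y', x <= x' /\ y <= y' /\ R x' y' /\ t x' y' = a
  P : ∀ x y a, mb a (f x y).c.2 ↔ ∃ x' y', x' <= x /\ y' <= y /\ R x' y' /\ t x' y' = a
  al : ∀ x y, R x y -> K.al (t x y) (f x y).c
  re : ∀ x y, (f x y).re = true ↔ R x y
  gN : ∀ x y, ∀ᶠ y' in 𝓝[>] y, (f x y').c = (f x y).n
  gS : ∀ x y, ∀ᶠ y' in 𝓝[<] y, (f x y').c = (f x y).s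
  gE : ∀ x y, ∀ᶠ x' in 𝓝[>] x, (f x' y).c = (f x y).e
  gW : ∀ x y, ∀ᶠ x' in 𝓝[<] x, (f x' y).c = (f x y).w
variable {K : Sys} {R : ℝ -> ℝ -> Prop} {t : ℝ -> ℝ -> ℕ} {f : ℝ -> ℝ -> PT}
theorem Ext.tr (h : Ext K R t f) : Ext K (fun x y => R y x) (fun x y => t y x) (fT f) where
  bc x y := h.bc y x
  F x y a := (h.F y x a).trans ⟨fun ⟨u, v, a, b, c⟩ => ⟨v, u, b, a, c⟩,
    fun ⟨u, v, a, b, c⟩ => ⟨v, u, b, a, c⟩⟩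
  P x y a := (h.P y x a).trans ⟨fun ⟨u, v, a, b, c⟩ => ⟨v, u, b, a, c⟩,
    fun ⟨u, v, a, b, c⟩ => ⟨v, u, b, a, c⟩⟩
  al x y := h.al y x
  re x y := h.re y x
  gN x y := h.gE y x
  gS x y := h.gW y x
  gE x y := h.gN y x
  gW x y := h.gS y x
theorem Ext.dual (h : Ext K R t f) :
    Ext K.dual (fun x y => R (-y) (-x)) (fun x y => t (-y) (-x)) (fD f) where
  bc x y := (h.bc _ _).swap
  F x y a := (h.P (-y) (-x) a).trans
    ⟨fun ⟨u, v, a, b, c⟩ => ⟨-v, -u, °, °, by simpa using c⟩,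
      fun ⟨u, v, a, b, c⟩ => ⟨-v, -u, °, °, c⟩⟩
  P x y a := (h.F (-y) (-x) a).trans
    ⟨fun ⟨u, v, a, b, c⟩ => ⟨-v, -u, °, °, by simpa using c⟩,
      fun ⟨u, v, a, b, c⟩ => ⟨-v, -u, °, °, c⟩⟩
  al x y := h.al (-y) (-x)
  re x y := h.re _ _
  gN x y := ((tendsto_neg_GT y).eventually (h.gW (-y) (-x))).mono fun _ h => congrArg Prod.swap h
  gE x y := ((tendsto_neg_GT x).eventually (h.gS (-y) (-x))).mono fun _ h => congrArg Prod.swap h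
  gS x y := ((tendsto_neg_LT y).eventually (h.gE (-y) (-x))).mono fun _ h => congrArg Prod.swap h
  gW x y := ((tendsto_neg_LT x).eventually (h.gN (-y) (-x))).mono fun _ h => congrArg Prod.swap h
theorem Ext.mono (h : Ext K R t f) {x x' y y' : ℝ} (hx : x <= x') (hy : y <= y') :
    qle (f x y).c (f x' y').c := by
  refine ⟨fun a ha => ?_, fun a ha => ?_⟩
  . obtain ⟨u, v, h1, h2, h3⟩ := (h.F _ _ _).1 ha
    exact (h.F _ _ _).2 ⟨u, v, hx.trans h1, hy.trans h2, h3⟩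
  . obtain ⟨u, v, h1, h2, h3⟩ := (h.P _ _ _).1 ha
    exact (h.P _ _ _).2 ⟨u, v, h1.trans hx, h2.trans hy, h3⟩
theorem Ext.le_n (h : Ext K R t f) {x x' y y' : ℝ} (hx : x <= x') (hy : y < y') :
    qle (f x y).n (f x' y').c := by
  obtain ⟨v, h1, h2⟩ := ((h.gN x y).and (Ioo_mem_nhdsGT hy)).exists
  rw [<- h1]; exact h.mono hx h2.2.le
theorem Ext.le_e (h : Ext K R t f) {x x' y y' : ℝ} (hx : x < x') (hy : y <= y') :
    qle (f x y).e (f x' y').c := h.tr.le_n (x := y) hy hx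
theorem Ext.mem_n (h : Ext K R t f) {x y x' y' : ℝ} (hx : x <= x') (hy : y < y') (hR : R x' y') :
    mb (t x' y') (f x y).n.1 := by
  obtain ⟨v, h1, h2⟩ := ((h.gN x y).and (Ioo_mem_nhdsGT hy)).exists
  rw [<- h1]; exact (h.F _ _ _).2 ⟨x', y', hx, h2.2.le, hR, rfl⟩
theorem Ext.mem_e (h : Ext K R t f) {x y x' y' : ℝ} (hx : x < x') (hy : y <= y') (hR : R x' y') :
    mb (t x' y') (f x y).e.1 := h.tr.mem_n (x := y) (x' := y') hy hx hR
theorem Ext.exF (h : Ext K R t f) {x y : ℝ} {a : ℕ} (ha : mb a (f x y).c.1) :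
    (R x y /\ a = t x y) \/ mb a (f x y).n.1 \/ mb a (f x y).e.1 := by
  obtain ⟨u, v, h1, h2, h3, rfl⟩ := (h.F _ _ _).1 ha
  rcases h1.eq_or_lt with rfl | h1
  . rcases h2.eq_or_lt with rfl | h2
    . exact .inl ⟨h3, rfl⟩
    . exact .inr (.inl (h.mem_n le_rfl h2 h3))
  . exact .inr (.inr (h.mem_e h1 h2 h3))
theorem Ext.exP (h : Ext K R t f) {x y : ℝ} {a : ℕ} (ha : mb a (f x y).c.2) :
    (R x y /\ a = t x y) \/ mb a (f x y).s.2 \/ mb a (f x y).w.2 := by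
  have := h.dual.exF (x := -y) (y := -x) (a := a) (by simpa [fD] using ha)
  simpa [fD, or_comm (a := mb a (f x y).s.2)] using this
theorem Ext.cn (h : Ext K R t f) (x y : ℝ) : qle (f x y).c (f x y).n /\ Bd K.n (f x y).n := by
  obtain ⟨v, h1, h2⟩ := ((h.gN x y).and self_mem_nhdsWithin).exists
  rw [<- h1]; exact ⟨h.mono le_rfl (le_of_lt h2), h.bc _ _⟩
theorem Ext.sc (h : Ext K R t f) (x y : ℝ) : qle (f x y).s (f x y).c /\ Bd K.n (f x y).s := by
  obtain ⟨v, h1, h2⟩ := ((h.gS x y).and self_mem_nhdsWithin).exists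
  rw [<- h1]; exact ⟨h.mono le_rfl (le_of_lt h2), h.bc _ _⟩
theorem Ext.valid (h : Ext K R t f) (x y : ℝ) : Valid K (f x y) where
  bc := h.bc x y
  bn := (h.cn x y).2
  be := (h.tr.cn y x).2
  bs := (h.sc x y).2
  bw := (h.tr.sc y x).2
  wc := (h.tr.sc y x).1
  sc := (h.sc x y).1
  cn := (h.cn x y).1
  ce := (h.tr.cn y x).1
  ex hr := ⟨t x y, h.al x y ((h.re x y).1 hr), fun _ ha => (h.exF ha).imp And.right id,
    fun _ ha => (h.exP ha).imp And.right id⟩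
  du hr := by
    have : ¬ R x y := by rw [<- h.re, hr]; simp
    exact ⟨fun _ ha => (h.exF ha).resolve_left fun h => this h.1,
      fun _ ha => (h.exP ha).resolve_left fun h => this h.1⟩
theorem Ext.fF (h : Ext K R t f) {x1 y1 : ℝ} (x y : ℝ) (hx : x <= x1) (hy : y <= y1) (a : ℕ)
    (ha : mb a (f x y).c.1) : ∃ x' y', x <= x' /\ x' <= x1 /\ y <= y' /\ y' <= y1 /\
      (realF K (f x' y') a \/ (mb a (f x' y').c.1 /\ (x' = x1 \/ y' = y1))) := by
  by_cases hb : mb a (f x1 y).c.1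
  . exact ⟨x1, y, hx, le_rfl, le_rfl, hy, .inr ⟨hb, .inl rfl⟩⟩
  by_cases hb' : mb a (f x y1).c.1
  . exact ⟨x, y1, le_rfl, hx, hy, le_rfl, .inr ⟨hb', .inr rfl⟩⟩
  obtain ⟨u, v, h1, h2, h3⟩ := (h.F _ _ _).1 ha
  obtain ⟨⟨u, v⟩, ⟨h1, h2, h3, h4⟩, hm⟩ := exists_max_cmu (P := fun z : ℝ × ℝ => x <= z.1 /\
    y <= z.2 /\ R z.1 z.2 /\ t z.1 z.2 = a) (fun z => (f z.1 z.2).c) ⟨(u, v), h1, h2, h3⟩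
    fun z _ => h.bc _ _
  dsimp only at h1 h2 h3 h4 hm
  refine ⟨u, v, h1, ?_, h2, ?_, .inl ⟨(h.re _ _).2 h3, (h.F _ _ _).2 ⟨u, v, le_rfl, le_rfl, h3, h4⟩, ?_⟩⟩
  . by_contra hc; exact hb ((h.F _ _ _).2 ⟨u, v, (not_le.1 hc).le, h2, h3, h4⟩)
  . by_contra hc; exact hb' ((h.F _ _ _).2 ⟨u, v, h1, (not_le.1 hc).le, h3, h4⟩)
  have hal : K.al a (f u v).c := h4 ▸ h.al u v h3
  by_cases hn : mb a (f u v).n.1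
  . right
    refine ⟨.inl ?_, hal⟩
    obtain ⟨v', e1, e2⟩ := ((h.gN u v).and self_mem_nhdsWithin).exists
    rw [<- e1, h.F] at hn
    obtain ⟨p, q, q1, q2, q3⟩ := hn
    refine ((h.cn u v).1.eq_of_mu ((h.le_n q1 (lt_of_lt_of_le e2 q2)).mu.trans
      (hm (p, q) ⟨h1.trans q1, (h2.trans (le_of_lt e2)).trans q2, q3⟩))).symm
  by_cases he : mb a (f u v).e.1
  . right
    refine ⟨.inr ?_, hal⟩
    obtain ⟨v', e1, e2⟩ := ((h.gE u v).and self_mem_nhdsWithin).exists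
    rw [<- e1, h.F] at he
    obtain ⟨p, q, q1, q2, q3⟩ := he
    refine ((h.tr.cn v u).1.eq_of_mu ((h.le_e (lt_of_lt_of_le e2 q1) q2).mu.trans
      (hm (p, q) ⟨(h1.trans (le_of_lt e2)).trans q1, h2.trans q2, q3⟩))).symm
  . exact .inl ⟨hn, he⟩
theorem Ext.nH (h : Ext K R t f) (y : ℝ) {x x' : ℝ} (hx : x <= x') :
    qle (f x y).n (f x' y).n := by
  obtain ⟨v, h1, h2⟩ := ((h.gN x y).and (h.gN x' y)).exists
  rw [<- h1, <- h2]; exact h.mono hx le_rfl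
theorem Ext.sH (h : Ext K R t f) (y : ℝ) {x x' : ℝ} (hx : x <= x') :
    qle (f x y).s (f x' y).s := by
  obtain ⟨v, h1, h2⟩ := ((h.gS x y).and (h.gS x' y)).exists
  rw [<- h1, <- h2]; exact h.mono hx le_rfl

/-- the open triangle -/
def Tri (x y : ℝ) : Prop := 0 < x /\ x < y /\ y < 1
theorem Ext.tmod (h : Ext K Tri t f) {x0 x1 y0 y1 : ℝ} (hx : 0 <= x0) (hxy : x1 <= y0)
    (hy : y1 <= 1) : TMod K f x0 x1 y0 y1 where
  val x y _ _ _ _ := h.valid x y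
  re x y h1 h2 h3 h4 := (h.re x y).2 ⟨°, °, °⟩
  gN x y _ _ _ _ := h.gN x y
  gS x y _ _ _ _ := h.gS x y
  gE x y _ _ _ _ := h.gE x y
  gW x y _ _ _ _ := h.gW x y
  fF x y _ h2 _ h4 a ha := h.fF x y h2 h4 a ha
  fP x y h1 h2 h3 h4 a ha := by
    obtain ⟨u, v, q1, q2, q3, q4, q5⟩ := h.dual.fF (x1 := -y0) (y1 := -x0) (-y) (-x)
      ° ° a (by simpa [fD] using ha)
    refine ⟨-v, -u, °, °, °, °, q5.imp ?_ ?_⟩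
    . exact fun h => h.dual
    . exact fun h => ⟨h.1, h.2.symm.imp (by intro h; linarith) (by intro h; linarith)⟩
  wV x y y' _ _ _ h4 _ := h.tr.sH x h4
  eV x y y' _ _ _ h4 _ := h.tr.nH x h4
  sH y x x' _ _ _ h4 _ := h.sH y h4
  nH y x x' _ _ _ h4 _ := h.nH y h4
  reV x y y' h1 h2 h3 h4 h5 h6 := by
    rw [Bool.eq_iff_iff, h.re, h.re]
    exact ⟨fun h => ⟨h.1, °, °⟩, fun h => ⟨h.1, °, °⟩⟩
  reH y x x' h1 h2 h3 h4 h5 h6 := by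
    rw [Bool.eq_iff_iff, h.re, h.re]
    exact ⟨fun h => ⟨°, °, h.2.2⟩, fun h => ⟨°, °, h.2.2⟩⟩

/-- the triangle on `[lo, hi]` is derivable -/
def TD (K : Sys) (f : ℝ -> ℝ -> PT) (lo hi : ℝ) : Prop :=
  ∃ q : TLab, q.nw = f lo hi /\ IsTr (fun y => f lo y) lo hi q.l /\ Red q.l /\
    IsTr (fun x => f x hi) lo hi q.t /\ Red q.t /\ TDer K q
theorem Ext.td (h : Ext K Tri t f) {lo hi : ℝ} (h0 : 0 <= lo) (h1 : lo < hi) (h2 : hi <= 1)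
    (q : TLab) (hnw : q.nw = f lo hi) (hl : IsTr (fun y => f lo y) lo hi q.l) (rl : Red q.l)
    (ht : IsTr (fun x => f x hi) lo hi q.t) (rt : Red q.t)
    (hq : TRule K (derList K) (tderList K) q) : TD K f lo hi := by
  refine ⟨q, hnw, hl, rl, ht, rt, TDer_iff.2 ⟨⟨hnw ▸ (h.valid _ _).bdP, ?_, ?_⟩, hq, hl.odd, ht.odd⟩⟩
  . obtain ⟨w, a, b, c⟩ := (h.tmod h0 (le_refl lo) h2).wordV h1 le_rfl le_rfl
    exact hl.unique a rl b ▸ c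
  . obtain ⟨w, a, b, c⟩ := (h.tmod h0 (le_refl hi) h2).wordH h1 le_rfl le_rfl
    exact ht.unique a rt b ▸ c
theorem Ext.tadd (h : Ext K Tri t f) {x y z : ℝ} (h0 : 0 <= x) (h1 : x < y) (h2 : y < z)
    (h3 : z <= 1) : TD K f x y -> TD K f y z -> TD K f x z := by
  rintro ⟨p, p1, p2, p3, p4, p5, p6⟩ ⟨o, o1, o2, o3, o4, o5, o6⟩
  obtain ⟨r, hr, dr⟩ := (h.tmod h0 (le_refl y) h3).DD h1 h2
  have nR : ¬ Tri y y := fun h => lt_irrefl _ h.2.1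
  refine h.td h0 (h1.trans h2) h3 ⟨r.nw, cat p.l r.sw r.l, cat r.t r.ne o.t⟩ hr.nw.symm
    (p2.cat hr.sw hr.l) (p3.cat hr.rl p2.odd) (hr.t.cat hr.ne o4) (hr.rt.cat o5 hr.t.odd)
    (.inr ⟨p, p6, o, o6, r, dr, ⟨?_, ?_, ?_, ?_, ?_, ?_, ?_, ?_, ?_, rfl⟩⟩)
  . exact hr.b.unique p4 hr.rb p5
  . exact hr.r.unique o2 hr.rr o3
  . rw [<- hr.sw, p1]
  . rw [<- hr.ne, o1]
  . intro s hs
    obtain ⟨u, q1, q2, rfl⟩ := hr.b.mem_exists s hs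
    exact (h.re _ _).2 ⟨°, q2, °⟩
  . intro s hs
    obtain ⟨u, q1, q2, rfl⟩ := hr.r.mem_exists s hs
    exact (h.re _ _).2 ⟨°, q1, °⟩
  . rw [<- hr.se, <- Bool.not_eq_true, h.re]; exact nR
  . intro a ha
    rw [<- hr.se] at ha ⊢
    obtain ⟨u, v, e1, e2, e3, rfl⟩ := (h.F _ _ _).1 ha
    exact h.mem_n e1 (by linarith [e3.2.1]) e3
  . intro a ha
    rw [<- hr.se] at ha ⊢
    obtain ⟨u, v, e1, e2, e3, rfl⟩ := (h.P _ _ _).1 ha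
    have := h.dual.mem_n (x := -y) (y := -y) (x' := -v) (y' := -u) °
      (by linarith [e3.2.1]) (by simpa using e3)
    simpa [fD] using this
theorem Ext.tbase (h : Ext K Tri t f) {lo hi : ℝ} (h0 : 0 <= lo) (h1 : lo < hi) (h2 : hi <= 1)
    {C : Clu} {L T : PT} (hC : ∀ u v, lo < u -> u < v -> v < hi -> (f u v).c = C)
    (hL : ∀ v, lo < v -> v < hi -> f lo v = L) (hT : ∀ u, lo < u -> u < hi -> f u hi = T) :
    TD K f lo hi := by
  obtain ⟨m, m1, m2⟩ := exists_between h1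
  obtain ⟨m', m3, m4⟩ := exists_between m2
  have hLc := fun v a b => congrArg PT.c (hL v a b)
  have hTc := fun v a b => congrArg PT.c (hT v a b)
  have eL := (h.tmod h0 (le_refl lo) h2).const_ns le_rfl le_rfl le_rfl le_rfl hLc m m1 m2
  have eT := (h.tmod h0 (le_refl hi) h2).const_ew le_rfl le_rfl le_rfl le_rfl hTc m m1 m2
  have LE : (f lo m).e = C := eventually_eq_unique (h.gE lo m) (by
    filter_upwards [Ioo_mem_nhdsGT m1] with z hz using hC z m hz.1 hz.2 m2)
  have TS : (f m hi).s = C := eventually_eq_unique (h.gS m hi) (by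
    filter_upwards [Ioo_mem_nhdsLT m2] with z hz using hC m z m1 hz.1 hz.2)
  have NS : (f lo hi).s = L.c := eventually_eq_unique (h.gS lo hi) (by
    filter_upwards [Ioo_mem_nhdsLT h1] with z hz using hLc z hz.1 hz.2)
  have NE : (f lo hi).e = T.c := eventually_eq_unique (h.gE lo hi) (by
    filter_upwards [Ioo_mem_nhdsGT h1] with z hz using hTc z hz.1 hz.2)
  have vL := h.valid lo m
  have vT := h.valid m hi
  have vC := h.valid m m'
  have hk : f m m' = kap C := (h.tmod (x0 := lo) (x1 := (m + m') / 2) (y0 := (m + m') / 2) (y1 := hi)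
    h0 le_rfl h2).const_kap (fun u v a b c d => hC u v a ° d)
    m1 ° ° m4
  rw [hL m m1 m2] at eL LE vL
  rw [hT m m1 m2] at eT TS vT
  rw [hk] at vC
  refine h.td h0 h1 h2 ⟨f lo hi, [L], [T]⟩ rfl (.one h1 hL) trivial (.one h1 hT) trivial (.inl ?_)
  have e1 : hd [L] = L := rfl
  have e2 : hd [T] = T := rfl
  have aC : ∀ u v, lo < u -> u < v -> v < hi -> K.al (t u v) C := fun u v a b c => by
    rw [<- hC u v a b c]; exact h.al u v ⟨°, b, °⟩
  refine ⟨rfl, rfl, h.valid _ _, ?_, ?_, ?_, ?_, ?_, rfl, ?_, ?_, ?_, ?_, ?_, ?_, ?_, ?_, ?_⟩ <;>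
    simp only [e1, e2, LE, TS, NS, NE, eL, eT, vL, vT, vC]
  . intro a ha
    rw [<- hC m m' m1 m3 m4, h.F] at ha
    obtain ⟨u, v, q1, q2, q3, rfl⟩ := ha
    by_cases hv : v < hi
    . exact .inl ⟨rfl, aC u v ° q3.2.1 hv⟩
    . rw [<- hTc m m1 m2]
      exact .inr (.inl ((h.F _ _ _).2 ⟨u, v, q1, not_lt.1 hv, q3, rfl⟩))
  . intro a ha
    rw [<- hLc m m1 m2, h.F] at ha
    obtain ⟨u, v, q1, q2, q3, rfl⟩ := ha
    by_cases hv : v < hi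
    . rcases q1.eq_or_lt with rfl | q1
      . have := hL v q3.2.1 hv
        exact .inl ⟨this ▸ (h.re _ _).2 q3, this ▸ h.al _ _ q3⟩
      . refine .inr (.inl ?_)
        rw [<- hC u v q1 q3.2.1 hv]
        exact (h.F _ _ _).2 ⟨u, v, le_rfl, le_rfl, q3, rfl⟩
    . exact .inr (.inr ((h.F _ _ _).2 ⟨u, v, q1, not_lt.1 hv, q3, rfl⟩))
  . intro a ha
    rw [<- hC m m' m1 m3 m4, h.P] at ha
    obtain ⟨u, v, q1, q2, q3, rfl⟩ := ha
    by_cases hu : lo < u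
    . exact .inl ⟨rfl, aC u v hu q3.2.1 °⟩
    . rw [<- hLc m' ° m4]
      exact .inr (.inl ((h.P _ _ _).2 ⟨u, v, not_lt.1 hu, q2, q3, rfl⟩))
  . intro a ha
    rw [<- hTc m m1 m2, h.P] at ha
    obtain ⟨u, v, q1, q2, q3, rfl⟩ := ha
    by_cases hu : lo < u
    . rcases q2.eq_or_lt with rfl | q2
      . have := hT u hu q3.2.1
        exact .inl ⟨this ▸ (h.re _ _).2 q3, this ▸ h.al _ _ q3⟩
      . refine .inr (.inl ?_)
        rw [<- hC u v hu q3.2.1 q2]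
        exact (h.P _ _ _).2 ⟨u, v, le_rfl, le_rfl, q3, rfl⟩
    . exact .inr (.inr ((h.P _ _ _).2 ⟨u, v, not_lt.1 hu, q2, q3, rfl⟩))
theorem Ext.td01 (h : Ext K Tri t f) : TD K f 0 1 := by
  refine bis one_pos _ (fun x y z a b c d => h.tadd a b c d) (fun x h0 h1 => ?_) (fun x h0 h1 => ?_)
  . obtain ⟨L, hL⟩ := (h.tmod (y1 := 1) h0 (le_refl x) le_rfl).germN le_rfl le_rfl le_rfl h1
    obtain ⟨ε, e1, hL⟩ := (mem_nhdsGT_iff_exists_Ioo_subset' h1).1 hL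
    obtain ⟨p, a1, a2⟩ := exists_between h1
    obtain ⟨q, a3, a4⟩ := exists_between a2
    obtain ⟨⟨u, v⟩, ⟨b1, b2, b3⟩, hm⟩ := exists_min_cmu (P := fun z : ℝ × ℝ => x < z.1 /\
      z.1 < z.2 /\ z.2 < 1) (fun z => (f z.1 z.2).c) ⟨(p, q), a1, a3, a4⟩ fun z _ => h.bc _ _
    dsimp only at b1 b2 b3
    have hC : ∀ r s, x < r -> r < s -> s < u -> (f r s).c = (f u v).c := fun r s c1 c2 c3 =>
      (h.mono ° °).eq_of_mu (hm (r, s) ⟨c1, c2, °⟩)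
    filter_upwards [Ioo_mem_nhdsGT e1, Ioo_mem_nhdsGT b1] with w w1 w2
    refine h.tbase h0 w1.1 (by linarith [w2.2]) (fun r s c1 c2 c3 => hC r s c1 c2 (c3.trans w2.2))
      (fun r c1 c2 => hL ⟨c1, c2.trans w1.2⟩) (T := kap (f u v).c) (fun r c1 c2 => ?_)
    exact (h.tmod (x0 := x) (x1 := (r + w) / 2) (y0 := (r + w) / 2) (y1 := u) h0 le_rfl
      °).const_kap (fun p q a b c d => hC p q a ° d) c1 °
      ° w2.2
  . obtain ⟨T, hT⟩ := (h.tmod (x0 := 0) le_rfl (le_refl x) h1).tr.germS le_rfl le_rfl h0 le_rfl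
    obtain ⟨ε, e1, hT⟩ := (mem_nhdsLT_iff_exists_Ioo_subset' h0).1 hT
    obtain ⟨p, a1, a2⟩ := exists_between h0
    obtain ⟨q, a3, a4⟩ := exists_between a2
    obtain ⟨⟨u, v⟩, ⟨b1, b2, b3⟩, hm⟩ := exists_max_cmu (P := fun z : ℝ × ℝ => 0 < z.1 /\
      z.1 < z.2 /\ z.2 < x) (fun z => (f z.1 z.2).c) ⟨(p, q), a1, a3, a4⟩ fun z _ => h.bc _ _
    dsimp only at b1 b2 b3
    have hC : ∀ r s, v < r -> r < s -> s < x -> (f r s).c = (f u v).c := fun r s c1 c2 c3 =>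
      ((h.mono ° °).eq_of_mu (hm (r, s) ⟨°, c2, c3⟩)).symm
    filter_upwards [Ioo_mem_nhdsLT e1, Ioo_mem_nhdsLT b3] with w w1 w2
    refine h.tbase (by linarith [w2.1]) w1.2 h1 (fun r s c1 c2 c3 => hC r s (w2.1.trans c1) c2 c3)
      (L := kap (f u v).c) (fun r c1 c2 => ?_)
      (T := T.tr) (fun r c1 c2 => congrArg PT.tr (hT ⟨w1.1.trans c1, c2⟩))
    exact (h.tmod (x0 := v) (x1 := (r + w) / 2) (y0 := (r + w) / 2) (y1 := x) ° le_rfl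
      h1).const_kap (fun p q a b c d => hC p q a ° d) w2.1 °
      ° c2
theorem Colouring.tder {G : ℕ -> Prop} {c : ℝ -> ℝ -> Clu} (hb : ∀ x y, Bd K.n (c x y))
    (h : Colouring K G c t) : ∃ q, TDer K q /\ TGoal G q := by
  classical
  have tlt : ∀ {x y}, Tri x y -> t x y < K.n := fun {x y} hr => by
    have h1 : (c x y).1.testBit (t x y) = true := (K.hal _ _ (h.al x y hr.1 hr.2.1 hr.2.2)).1
    by_contra hc
    rw [Nat.testBit_lt_two_pow ((hb x y).1.trans_le (Nat.pow_le_pow_right (by norm_num)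
      (not_lt.1 hc)))] at h1
    exact absurd h1 (by simp)
  choose A hA1 hA using fun x y : ℝ => exists_bits (fun a => ∃ x' y', x <= x' /\ y <= y' /\ Tri x' y' /\
    t x' y' = a) K.n
  choose B hB1 hB using fun x y : ℝ => exists_bits (fun a => ∃ x' y', x' <= x /\ y' <= y /\ Tri x' y' /\
    t x' y' = a) K.n
  have hA' : ∀ x y a, mb a (A x y) ↔ ∃ x' y', x <= x' /\ y <= y' /\ Tri x' y' /\ t x' y' = a :=
    fun x y a => (hA x y a).trans ⟨And.right, fun hh => ⟨by
      obtain ⟨u, v, -, -, h3, rfl⟩ := hh; exact tlt h3, hh⟩⟩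
  have hB' : ∀ x y a, mb a (B x y) ↔ ∃ x' y', x' <= x /\ y' <= y /\ Tri x' y' /\ t x' y' = a :=
    fun x y a => (hB x y a).trans ⟨And.right, fun hh => ⟨by
      obtain ⟨u, v, -, -, h3, rfl⟩ := hh; exact tlt h3, hh⟩⟩
  have mo : ∀ {x y x' y' : ℝ}, x <= x' -> y <= y' -> qle (A x y, B x y) (A x' y', B x' y') := by
    intro x y x' y' hx hy
    refine ⟨fun a ha => ?_, fun a ha => ?_⟩
    . obtain ⟨u, v, h1, h2, h3⟩ := (hA' _ _ _).1 ha
      exact (hA' _ _ _).2 ⟨u, v, hx.trans h1, hy.trans h2, h3⟩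
    . obtain ⟨u, v, h1, h2, h3⟩ := (hB' _ _ _).1 ha
      exact (hB' _ _ _).2 ⟨u, v, h1.trans hx, h2.trans hy, h3⟩
  choose n hn using fun x y : ℝ => mono_germ_right (N := K.n) (fun y => (A x y, B x y)) (lt_add_one y)
    (fun _ _ _ a _ => mo le_rfl a) (fun _ _ _ => ⟨hA1 _ _, hB1 _ _⟩)
  choose e he using fun x y : ℝ => mono_germ_right (N := K.n) (fun x => (A x y, B x y)) (lt_add_one x)
    (fun _ _ _ a _ => mo a le_rfl) (fun _ _ _ => ⟨hA1 _ _, hB1 _ _⟩)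
  choose s hs using fun x y : ℝ => mono_germ_left (N := K.n) (fun y => (A x y, B x y)) (sub_one_lt y)
    (fun _ _ _ a _ => mo le_rfl a) (fun _ _ _ => ⟨hA1 _ _, hB1 _ _⟩)
  choose w hw using fun x y : ℝ => mono_germ_left (N := K.n) (fun x => (A x y, B x y)) (sub_one_lt x)
    (fun _ _ _ a _ => mo a le_rfl) (fun _ _ _ => ⟨hA1 _ _, hB1 _ _⟩)
  have E : Ext K Tri t (fun x y => ⟨decide (Tri x y), (A x y, B x y), n x y, e x y, s x y, w x y⟩) := by
    refine ⟨fun _ _ => ⟨hA1 _ _, hB1 _ _⟩, hA', hB', fun x y hr => ?_, fun _ _ => decide_eq_true_iff,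
      hn, hs, he, hw⟩
    convert h.al x y hr.1 hr.2.1 hr.2.2 using 1
    refine Prod.ext (mb_ext fun a => ?_) (mb_ext fun a => ?_)
    . rw [hA', h.fut x y hr.1 hr.2.1 hr.2.2]
      exact ⟨fun ⟨u, v, a, b, c, d⟩ => ⟨u, v, a, b, c.2.1, c.2.2, d⟩,
        fun ⟨u, v, a, b, c, d, e⟩ => ⟨u, v, a, b, ⟨hr.1.trans_le a, c, d⟩, e⟩⟩
    . rw [hB', h.past x y hr.1 hr.2.1 hr.2.2]
      exact ⟨fun ⟨u, v, a, b, c, d⟩ => ⟨u, v, c.1, a, b, c.2.1, d⟩,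
        fun ⟨u, v, c, a, b, d, e⟩ => ⟨u, v, a, b, ⟨c, d, b.trans_lt hr.2.2⟩, e⟩⟩
  generalize (fun x y : ℝ => (⟨decide (Tri x y), (A x y, B x y), n x y, e x y, s x y, w x y⟩ : PT))
    = f at E
  obtain ⟨q, q1, q2, -, q3, -, q4⟩ := E.td01
  have z1 : ∀ v, (f 0 v).re = false /\ (f 0 v).c.2 = 0 := fun v => by
    refine ⟨by rw [<- Bool.not_eq_true, E.re]; exact fun h => lt_irrefl _ h.1, mb_ext fun a => ?_⟩
    rw [E.P]
    exact ⟨fun ⟨u, v, a, _, c, _⟩ => absurd c.1 (not_lt.2 a), fun h => by simp [mb] at h⟩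
  have z2 : ∀ v, (f v 1).re = false /\ (f v 1).c.1 = 0 := fun v => by
    refine ⟨by rw [<- Bool.not_eq_true, E.re]; exact fun h => lt_irrefl _ h.2.2, mb_ext fun a => ?_⟩
    rw [E.F]
    exact ⟨fun ⟨u, v, _, a, c, _⟩ => absurd c.2.2 (not_lt.2 a), fun h => by simp [mb] at h⟩
  refine ⟨q, q4, fun p hp => ?_, fun p hp => ?_, ?_⟩
  . rcases List.mem_cons.1 hp with rfl | hp
    . rw [q1]; exact z1 1
    . obtain ⟨v, -, -, rfl⟩ := q2.mem_exists p hp; exact z1 v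
  . rcases List.mem_cons.1 hp with rfl | hp
    . rw [q1]; exact z2 0
    . obtain ⟨v, -, -, rfl⟩ := q3.mem_exists p hp; exact z2 v
  . obtain ⟨x, y, h1, h2, h3, h4⟩ := h.goal
    obtain ⟨p, p1, p2⟩ := q2.head
    obtain ⟨v, v1, v2⟩ := (p2.and (Ioo_mem_nhdsGT (h1.trans h2))).exists
    refine ⟨t x y, ?_, h4⟩
    rw [hd, p1, Option.getD_some, <- v1, E.F]
    exact ⟨x, y, h1.le, v2.2.le, ⟨h1, h2, h3⟩, rfl⟩
end

section
/-! ### Primitive recursiveness of the decision procedure -/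

section prim

set_option synthInstance.maxSize 100000
set_option synthInstance.maxHeartbeats 2000000
set_option maxHeartbeats 4000000

class PF {α β : Type} [Primcodable α] [Primcodable β] (f : α -> β) : Prop where
  out : Primrec f

class PP {α : Type} [Primcodable α] (p : α -> Prop) : Prop where
  out : PrimrecPred p

def ptE : PT ≃ Bool × Clu × Clu × Clu × Clu × Clu :=
  ⟨fun p => (p.re, p.c, p.n, p.e, p.s, p.w), fun z => ⟨z.1, z.2.1, z.2.2.1, z.2.2.2.1, z.2.2.2.2.1,
    z.2.2.2.2.2⟩, fun _ => rfl, fun _ => rfl⟩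

instance : Primcodable PT := Primcodable.ofEquiv _ ptE

def labE : Lab ≃ PT × PT × PT × PT × List PT × List PT × List PT × List PT :=
  ⟨fun p => (p.sw, p.se, p.nw, p.ne, p.l, p.r, p.b, p.t), fun z => ⟨z.1, z.2.1, z.2.2.1, z.2.2.2.1,
    z.2.2.2.2.1, z.2.2.2.2.2.1, z.2.2.2.2.2.2.1, z.2.2.2.2.2.2.2⟩, fun _ => rfl, fun _ => rfl⟩

instance : Primcodable Lab := Primcodable.ofEquiv _ labE

def tlabE : TLab ≃ PT × List PT × List PT :=
  ⟨fun p => (p.nw, p.l, p.t), fun z => ⟨z.1, z.2.1, z.2.2⟩, fun _ => rfl, fun _ => rfl⟩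

instance : Primcodable TLab := Primcodable.ofEquiv _ tlabE
variable {α β γ : Type} [Primcodable α] [Primcodable β] [Primcodable γ]

@[irreducible] def mkPair {β γ : Type} (a : β) (b : γ) : β × γ := (a, b)
@[irreducible] def mkPT (r : Bool) (c n e s w : Clu) : PT := ⟨r, c, n, e, s, w⟩
@[irreducible] def mkLab (a b c d : PT) (l r u t : List PT) : Lab := ⟨a, b, c, d, l, r, u, t⟩
@[irreducible] def mkTLab (a : PT) (l t : List PT) : TLab := ⟨a, l, t⟩
theorem mkPair_eq {β γ : Type} (a : β) (b : γ) : (a, b) = mkPair a b := by rw [mkPair]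
theorem mkPT_eq (r c n e s w) : PT.mk r c n e s w = mkPT r c n e s w := by rw [mkPT]
theorem mkLab_eq (a b c d l r u t) : Lab.mk a b c d l r u t = mkLab a b c d l r u t := by rw [mkLab]
theorem mkTLab_eq (a l t) : TLab.mk a l t = mkTLab a l t := by rw [mkTLab]
instance pf_pair (f : α -> β) (g : α -> γ) [h : PF f] [h' : PF g] : PF fun x => mkPair (f x) (g x) := by
  simp only [<- mkPair_eq]; exact ⟨h.out.pair h'.out⟩
instance (f : α -> Bool) (c n e s w : α -> Clu) [hf : PF f] [hc : PF c] [hn : PF n] [he : PF e]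
    [hs : PF s] [hw : PF w] : PF fun x => mkPT (f x) (c x) (n x) (e x) (s x) (w x) := by
  simp only [<- mkPT_eq]
  exact ⟨(Primrec.of_equiv_symm (e := ptE)).comp
    (hf.out.pair (hc.out.pair (hn.out.pair (he.out.pair (hs.out.pair hw.out)))))⟩
instance (a b c d : α -> PT) (l r u t : α -> List PT) [ha : PF a] [hb : PF b] [hc : PF c] [hd : PF d]
    [hl : PF l] [hr : PF r] [hu : PF u] [ht : PF t] :
    PF fun x => mkLab (a x) (b x) (c x) (d x) (l x) (r x) (u x) (t x) := by
  simp only [<- mkLab_eq]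
  exact ⟨(Primrec.of_equiv_symm (e := labE)).comp (ha.out.pair (hb.out.pair (hc.out.pair (hd.out.pair
    (hl.out.pair (hr.out.pair (hu.out.pair ht.out)))))))⟩
instance (a : α -> PT) (l t : α -> List PT) [ha : PF a] [hl : PF l] [ht : PF t] :
    PF fun x => mkTLab (a x) (l x) (t x) := by
  simp only [<- mkTLab_eq]
  exact ⟨(Primrec.of_equiv_symm (e := tlabE)).comp (ha.out.pair (hl.out.pair ht.out))⟩
instance : PF fun x : α => x := ⟨.id⟩
instance (b : β) : PF fun _ : α => b := ⟨.const b⟩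
instance (f : α -> β × γ) [h : PF f] : PF fun x => (f x).1 := ⟨Primrec.fst.comp h.out⟩
instance (f : α -> β × γ) [h : PF f] : PF fun x => (f x).2 := ⟨Primrec.snd.comp h.out⟩
section pt
variable (f : α -> PT) [h : PF f]
instance pfPt : PF fun x => ptE (f x) := ⟨(Primrec.of_equiv (e := ptE)).comp h.out⟩
instance : PF fun x => (f x).re := inferInstanceAs (PF fun x => (ptE (f x)).1)
instance : PF fun x => (f x).c := inferInstanceAs (PF fun x => (ptE (f x)).2.1)
instance : PF fun x => (f x).n := inferInstanceAs (PF fun x => (ptE (f x)).2.2.1)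
instance : PF fun x => (f x).e := inferInstanceAs (PF fun x => (ptE (f x)).2.2.2.1)
instance : PF fun x => (f x).s := inferInstanceAs (PF fun x => (ptE (f x)).2.2.2.2.1)
instance : PF fun x => (f x).w := inferInstanceAs (PF fun x => (ptE (f x)).2.2.2.2.2)
end pt

section lab
variable (f : α -> Lab) [h : PF f]
instance pfLab : PF fun x => labE (f x) := ⟨(Primrec.of_equiv (e := labE)).comp h.out⟩
instance : PF fun x => (f x).sw := inferInstanceAs (PF fun x => (labE (f x)).1)
instance : PF fun x => (f x).se := inferInstanceAs (PF fun x => (labE (f x)).2.1)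
instance : PF fun x => (f x).nw := inferInstanceAs (PF fun x => (labE (f x)).2.2.1)
instance : PF fun x => (f x).ne := inferInstanceAs (PF fun x => (labE (f x)).2.2.2.1)
instance : PF fun x => (f x).l := inferInstanceAs (PF fun x => (labE (f x)).2.2.2.2.1)
instance : PF fun x => (f x).r := inferInstanceAs (PF fun x => (labE (f x)).2.2.2.2.2.1)
instance : PF fun x => (f x).b := inferInstanceAs (PF fun x => (labE (f x)).2.2.2.2.2.2.1)
instance : PF fun x => (f x).t := inferInstanceAs (PF fun x => (labE (f x)).2.2.2.2.2.2.2)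
end lab

section tlab
variable (f : α -> TLab) [h : PF f]
instance pfTlab : PF fun x => tlabE (f x) := ⟨(Primrec.of_equiv (e := tlabE)).comp h.out⟩
instance : PF fun x => (f x).nw := inferInstanceAs (PF fun x => (tlabE (f x)).1)
instance : PF fun x => (f x).l := inferInstanceAs (PF fun x => (tlabE (f x)).2.1)
instance : PF fun x => (f x).t := inferInstanceAs (PF fun x => (tlabE (f x)).2.2)
end tlab

/-! lists and numbers -/
section nat
variable (f g : α -> ℕ) [h : PF f] [h' : PF g]
instance : PF fun x => f x + g x := ⟨Primrec.nat_add.comp h.out h'.out⟩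
instance : PF fun x => f x * g x := ⟨Primrec.nat_mul.comp h.out h'.out⟩
instance : PF fun x => f x / g x := ⟨Primrec.nat_div.comp h.out h'.out⟩
instance : PF fun x => f x % g x := ⟨Primrec.nat_mod.comp h.out h'.out⟩
instance : PF fun x => (f x).unpair := ⟨Primrec.unpair.comp h.out⟩
instance : PF fun x => List.range (f x) := ⟨Primrec.list_range.comp h.out⟩
instance pf_pow : PF fun x => 2 ^ f x :=
  ⟨(Primrec.nat_iterate h.out (.const 1) (Primrec.nat_double.comp Primrec.snd).to₂).of_eq fun x => by
    induction f x with
    | zero => rfl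
    | succ n ih => rw [Function.iterate_succ_apply', ih, pow_succ, mul_comm]⟩
instance : PF fun n : ℕ => 2 ^ n := pf_pow fun n => n
instance : PP fun x => f x < g x := ⟨Primrec.nat_lt.comp h.out h'.out⟩
end nat

section list
variable (f g : α -> List β) (b : α -> β) [h : PF f] [h' : PF g] [hb : PF b]
instance : PF fun x => b x :: f x := ⟨Primrec.list_cons.comp hb.out h.out⟩
instance : PF fun x => some (b x) := ⟨Primrec.option_some.comp hb.out⟩
instance : PF fun x => f x ++ g x := ⟨Primrec.list_append.comp h.out h'.out⟩
instance : PF fun x => (f x).reverse := ⟨Primrec.list_reverse.comp h.out⟩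
instance : PF fun x => (f x).tail := ⟨Primrec.list_tail.comp h.out⟩
instance : PF fun x => (f x).head? := ⟨Primrec.list_head?.comp h.out⟩
instance : PF fun x => (f x).length := ⟨Primrec.list_length.comp h.out⟩
instance (k : α -> β -> γ) [hk : PF fun z : α × β => k z.1 z.2] : PF fun x => (f x).map (k x) :=
  ⟨Primrec.list_map h.out hk.out⟩
instance (k : α -> β -> List γ) [hk : PF fun z : α × β => k z.1 z.2] :
    PF fun x => (f x).flatMap (k x) := ⟨Primrec.list_flatMap h.out hk.out⟩
end list

/-! predicates -/
theorem PP.of_iff (p : α -> Prop) {q : α -> Prop} [hp : PP p] (h : ∀ x, q x ↔ p x) : PP q :=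
  ⟨hp.out.of_eq fun x => (h x).symm⟩
theorem PP.ofI {p q : α -> Prop} (h : ∀ x, q x -> p x)
    (h' : ∀ x, p x -> q x := by intro z h; casesm* _ /\ _; constructor <;> assumption)
    (hp : PP p := by infer_instance) : PP q :=
  PP.of_iff p fun x => ⟨h x, h' x⟩

section pred
variable (p q : α -> Prop) [hp : PP p] [hq : PP q]
instance : PP fun x => p x /\ q x := ⟨hp.out.and hq.out⟩
instance : PP fun x => p x \/ q x := ⟨hp.out.or hq.out⟩
instance : PP fun x => ¬ p x := ⟨hp.out.not⟩
instance : PP fun x => p x -> q x := PP.of_iff _ fun _ => imp_iff_not_or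
instance : PP fun x => (p x ↔ q x) := PP.of_iff _ fun _ => iff_iff_implies_and_implies
instance (f g : α -> β) [∀ x, Decidable (p x)] [h : PF f] [h' : PF g] :
    PF fun x => if p x then f x else g x := ⟨Primrec.ite hp.out h.out h'.out⟩
end pred
instance (f g : α -> β) [h : PF f] [h' : PF g] : PP fun x => f x = g x :=
  ⟨Primrec.eq.comp h.out h'.out⟩

section quant
variable (w : α -> List β) (f : α -> ℕ) (p : α -> β -> Prop) (r : α -> ℕ -> Prop)
  [hw : PF w] [hf : PF f] [hp : PP fun z : α × β => p z.1 z.2] [hr : PP fun z : α × ℕ => r z.1 z.2]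
instance : PP fun x => ∀ v ∈ w x, p x v :=
  ⟨(PrimrecRel.forall_mem_list (R := fun v x => p x v) (hp.out.comp (Primrec.snd.pair
    Primrec.fst))).comp hw.out Primrec.id⟩
instance : PP fun x => ∃ v ∈ w x, p x v :=
  ⟨(PrimrecRel.exists_mem_list (R := fun v x => p x v) (hp.out.comp (Primrec.snd.pair
    Primrec.fst))).comp hw.out Primrec.id⟩
instance : PP fun x => ∀ v < f x, r x v := PP.of_iff
  (fun x => ∀ v ∈ List.range (f x), r x v) fun x => by simp
instance : PP fun x => ∃ v < f x, r x v := PP.of_iff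
  (fun x => ∃ v ∈ List.range (f x), r x v) fun x => by simp
end quant
theorem mb_lt {a s : ℕ} (h : mb a s) : a < s := by
  by_contra h1
  rw [mb, Nat.testBit_lt_two_pow (lt_of_le_of_lt (not_lt.1 h1) Nat.lt_two_pow_self)] at h
  cases h

instance (f g : α -> ℕ) [PF f] [PF g] : PP fun x => mb (f x) (g x) :=
  PP.of_iff (fun x => g x / 2 ^ f x % 2 = 1) fun x => by
    rw [mb, Nat.testBit_eq_decide_div_mod_eq, decide_eq_true_iff]

section quant
variable (f : α -> ℕ) (r : α -> ℕ -> Prop) [hf : PF f] [hr : PP fun z : α × ℕ => r z.1 z.2]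
instance : PP fun x => ∀ v, mb v (f x) -> r x v :=
  have : PF fun z : α × ℕ => f z.1 := ⟨hf.out.comp Primrec.fst⟩
  PP.of_iff (fun x => ∀ v < f x, mb v (f x) -> r x v)
    fun _ => ⟨fun h v _ => h v, fun h v h' => h v (mb_lt h') h'⟩
instance : PP fun x => ∃ v, mb v (f x) /\ r x v :=
  have : PF fun z : α × ℕ => f z.1 := ⟨hf.out.comp Primrec.fst⟩
  PP.of_iff (fun x => ∃ v < f x, mb v (f x) /\ r x v)
    fun _ => ⟨fun ⟨v, h⟩ => ⟨v, mb_lt h.1, h⟩, fun ⟨v, _, h⟩ => ⟨v, h⟩⟩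
end quant
theorem PP.comp {p : β -> Prop} (h : PP p) (f : α -> β) (h' : PF f) : PP fun x => p (f x) :=
  ⟨h.out.comp h'.out⟩
theorem PF.comp {g : β -> γ} (h : PF g) (f : α -> β) (h' : PF f) : PF fun x => g (f x) :=
  ⟨h.out.comp h'.out⟩
theorem PF.p {f : α -> β} {g : α -> γ} (h : PF f) (h' : PF g) : PF fun x => (f x, g x) :=
  ⟨h.out.pair h'.out⟩

/-! the constituents of the rules -/
theorem pp_locOK : PP fun z : ℕ × ℕ × Clu × ℕ => locOK z.1 z.2.1 z.2.2.1 z.2.2.2 := by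
  unfold locOK; infer_instance
instance (N t e : α -> ℕ) (c : α -> Clu) [PF N] [PF t] [PF e] [PF c] :
    PP fun x => locOK (N x) (t x) (c x) (e x) := pp_locOK.comp _ (.p ‹PF N› (.p ‹PF t› (.p ‹PF c› ‹PF e›)))
theorem pp_al : PP fun z : ℕ × ℕ × Clu => (sysM z.1).al z.2.1 z.2.2 := by
  change PP fun z : ℕ × ℕ × Clu => sysAl z.1 z.2.1 z.2.2
  unfold sysAl; infer_instance
instance (m t : α -> ℕ) (c : α -> Clu) [PF m] [PF t] [PF c] :
    PP fun x => (sysM (m x)).al (t x) (c x) := pp_al.comp _ (.p ‹PF m› (.p ‹PF t› ‹PF c›))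
instance (m : α -> ℕ) [PF m] : PF fun x => (sysM (m x)).n :=
  inferInstanceAs (PF fun x => 2 ^ (m x + 1))

instance pf_cluList : PF cluList := by unfold cluList; simp only [mkPair_eq]; infer_instance
instance (n : α -> ℕ) [PF n] : PF fun x => cluList (n x) := pf_cluList.comp n ‹_›
instance pf_ptList : PF ptList := by unfold ptList; simp only [mkPT_eq]; infer_instance
instance (n : α -> ℕ) [PF n] : PF fun x => ptList (n x) := pf_ptList.comp n ‹_›
instance pf_wList : PF wList := by
  have h : PF fun n : ℕ => Lb n := by unfold Lb; infer_instance
  have h' : PF fun z : ℕ × ℕ × List (List PT) => z.2.2 ++ z.2.2.flatMap fun w =>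
    (ptList z.1).map fun p => p :: w := inferInstance
  refine ⟨(Primrec.nat_rec' h.out (.const [[]]) h'.out.to₂).of_eq fun n => ?_⟩
  unfold wList
  induction Lb n with
  | zero => rfl
  | succ k ih => rw [wordsLE, <- ih]
instance (n : α -> ℕ) [PF n] : PF fun x => wList (n x) := pf_wList.comp n ‹_›
instance pf_labList : PF labList := by unfold labList; simp only [mkLab_eq]; infer_instance
instance (n : α -> ℕ) [PF n] : PF fun x => labList (n x) := pf_labList.comp n ‹_›
instance pf_tlabList : PF tlabList := by unfold tlabList; simp only [mkTLab_eq]; infer_instance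
instance (n : α -> ℕ) [PF n] : PF fun x => tlabList (n x) := pf_tlabList.comp n ‹_›

instance (w : α -> List PT) [PF w] : PP fun x => allRe (w x) := by unfold allRe; infer_instance
instance (c : α -> Clu) [PF c] : PF fun x => kap (c x) := by unfold kap; simp only [mkPT_eq]; infer_instance
instance (p : α -> PT) [PF p] : PF fun x => PT.tr (p x) := by unfold PT.tr; simp only [mkPT_eq]; infer_instance
instance (p : α -> Lab) [PF p] : PF fun x => Lab.tr (p x) := by unfold Lab.tr; simp only [mkLab_eq]; infer_instance
instance (a b c : α -> Clu) [PF a] [PF b] [PF c] : PF fun x => fillPT (a x) (b x) (c x) := by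
  unfold fillPT; simp only [mkPT_eq]; infer_instance
instance (w : α -> List PT) [h : PF w] : PF fun x => hd (w x) := by
  unfold hd
  exact ⟨Primrec.option_getD.comp (Primrec.list_head?.comp h.out) (.const dPT)⟩
theorem cat_eq (v : PT) (w : List PT) : ∀ u : List PT, cat u v w =
    if u.length % 2 = 0 then u ++ w else if u.reverse.head? = some v /\ w.head? = some v then
      u.reverse.tail.reverse ++ w else u ++ v :: w
  | [] => by simp [cat]
  | [s] => by simp [cat]
  | s :: v' :: u => by
    rw [cat, cat_eq v w u]
    have : (s :: v' :: u).length % 2 = u.length % 2 := by simp only [List.length_cons]; omega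
    rw [this]
    by_cases h : u.length % 2 = 0
    . simp [h]
    . cases u using List.reverseRecOn with
      | nil => simp at h
      | append_singleton u x => simp only [h]; split_ifs <;> simp_all
instance (u w : α -> List PT) (v : α -> PT) [PF u] [PF v] [PF w] :
    PF fun x => cat (u x) (v x) (w x) := by
  simp only [cat_eq]; infer_instance

section covs
theorem pp_qle : PP fun z : Clu × Clu => qle z.1 z.2 := by unfold qle; infer_instance
instance (c d : α -> Clu) [PF c] [PF d] : PP fun x => qle (c x) (d x) :=
  pp_qle.comp _ (.p ‹PF c› ‹PF d›)
variable (m : α -> ℕ) (r : α -> Bool) (a b c : α -> Clu) (p : α -> PT)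
  [PF m] [PF r] [ha : PF a] [hb : PF b] [PF c] [PF p]
theorem pp_covF : PP fun z : ℕ × Bool × Clu × Clu × Clu =>
  covF (sysM z.1) z.2.1 z.2.2.1 z.2.2.2.1 z.2.2.2.2 := by unfold covF; infer_instance
instance : PP fun x => covF (sysM (m x)) (r x) (a x) (b x) (c x) :=
  pp_covF.comp _ (.p ‹PF m› (.p ‹PF r› (.p ‹PF a› (.p ‹PF b› ‹PF c›))))
theorem pp_covP : PP fun z : ℕ × Bool × Clu × Clu × Clu =>
  covP (sysM z.1) z.2.1 z.2.2.1 z.2.2.2.1 z.2.2.2.2 := by unfold covP; infer_instance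
instance : PP fun x => covP (sysM (m x)) (r x) (a x) (b x) (c x) :=
  pp_covP.comp _ (.p ‹PF m› (.p ‹PF r› (.p ‹PF a› (.p ‹PF b› ‹PF c›))))
end covs

local infixr:35 "⋏" => And.intro

instance pp_Bd (n : α -> ℕ) (c : α -> Clu) [PF n] [PF c] : PP fun x => Bd (n x) (c x) := by
  unfold Bd; infer_instance
instance pp_exal (m : α -> ℕ) (c : α -> Clu) (r : α -> ℕ -> Prop) [hm : PF m] [hc : PF c]
    [PP fun z : α × ℕ => r z.1 z.2] : PP fun x => ∃ t, (sysM (m x)).al t (c x) /\ r x t :=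
  have : PF fun z : α × ℕ => m z.1 := hm.comp _ inferInstance
  have : PF fun z : α × ℕ => c z.1 := hc.comp _ inferInstance
  PP.of_iff (fun x => ∃ t, mb t (c x).1 /\ (sysM (m x)).al t (c x) /\ r x t)
    fun _ => ⟨fun ⟨t, h⟩ => ⟨t, ((sysM _).hal _ _ h.1).1, h⟩, fun ⟨t, _, h⟩ => ⟨t, h⟩⟩
theorem pp_Valid : PP fun z : ℕ × PT => Valid (sysM z.1) z.2 := PP.ofI fun z h =>
    h.bc ⋏ h.bn ⋏ h.be ⋏ h.bs ⋏ h.bw ⋏ h.wc ⋏ h.sc ⋏ h.cn ⋏ h.ce ⋏ h.ex ⋏ h.du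
instance (m : α -> ℕ) (p : α -> PT) [PF m] [PF p] : PP fun x => Valid (sysM (m x)) (p x) :=
  pp_Valid.comp _ (.p ‹PF m› ‹PF p›)
instance pp_exV (m : α -> ℕ) (a b : α -> Clu) (r : α -> Clu -> Prop) [hm : PF m] [ha : PF a] [hb : PF b]
    [PP fun z : α × Clu => r z.1 z.2] :
    PP fun x => ∃ c, Valid (sysM (m x)) (fillPT (a x) (b x) c) /\ r x c :=
  have : PF fun z : α × Clu => m z.1 := hm.comp _ inferInstance
  have : PF fun z : α × Clu => a z.1 := ha.comp _ inferInstance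
  have : PF fun z : α × Clu => b z.1 := hb.comp _ inferInstance
  PP.of_iff (fun x => ∃ c ∈ cluList (sysM (m x)).n, Valid (sysM (m x)) (fillPT (a x) (b x) c) /\ r x c)
    fun _ => ⟨fun ⟨t, h⟩ => ⟨t, mem_cluList.2 h.1.bc, h⟩, fun ⟨t, _, h⟩ => ⟨t, h⟩⟩
instance (m : α -> ℕ) (a b : α -> Clu) [hm : PF m] [ha : PF a] [hb : PF b] :
    PP fun x => ∃ c, Valid (sysM (m x)) (fillPT (a x) (b x) c) :=
  have := pp_exV m a b fun _ c => c = c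
  PP.of_iff _ (hp := this) fun _ => by simp
theorem pp_RBase : PP fun z : ℕ × Lab => RBase (sysM z.1) z.2 := PP.ofI fun z h =>
    h.l ⋏ h.r ⋏ h.b ⋏ h.t ⋏ h.vsw ⋏ h.vse ⋏ h.vnw ⋏ h.vne ⋏ h.vl ⋏ h.vr ⋏ h.vb ⋏ h.vt ⋏ h.vC ⋏
    h.ln ⋏ h.ls ⋏ h.rn ⋏ h.rs ⋏ h.rw' ⋏ h.be ⋏ h.bw ⋏ h.bn ⋏ h.te ⋏ h.tw ⋏ h.ts ⋏ h.swn ⋏ h.swe ⋏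
    h.sen ⋏ h.sew ⋏ h.nws ⋏ h.nwe ⋏ h.nes ⋏ h.new ⋏ h.fC ⋏ h.fl ⋏ h.fb ⋏ h.pC ⋏ h.pr ⋏ h.pt
theorem pp_RJoin : PP fun z : Lab × Lab × Lab => RJoin z.1 z.2.1 z.2.2 := PP.ofI (fun z h =>
    h.rl ⋏ h.re ⋏ h.se ⋏ h.ne ⋏ h.eq) (hp := by simp only [mkLab_eq]; infer_instance)
theorem pp_RLim : PP fun z : ℕ × Lab × Lab × Lab × Lab => RLim (sysM z.1) z.2.1 z.2.2.1 z.2.2.2.1 z.2.2.2.2 := PP.ofI fun z h =>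
    h.e1 ⋏ h.e2 ⋏ h.e3 ⋏ h.e4 ⋏ h.e5 ⋏ h.e6 ⋏ h.e7 ⋏ h.e8 ⋏ h.e9 ⋏ h.t1 ⋏ h.t2 ⋏ h.t3 ⋏ h.l1 ⋏
    h.l2 ⋏ h.l3 ⋏ h.r1 ⋏ h.r2 ⋏ h.b1 ⋏ h.b2 ⋏ h.re1 ⋏ h.re2 ⋏ h.re3 ⋏ h.re4 ⋏ h.re5 ⋏ h.z0 ⋏ h.z0s
    ⋏ h.z0e ⋏ h.cF ⋏ h.cP ⋏ h.se ⋏ h.l ⋏ h.r ⋏ h.b ⋏ h.t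
theorem pp_Compat : PP fun z : ℕ × Clu × Clu × Lab => Compat (sysM z.1) z.2.1 z.2.2.1 z.2.2.2 := PP.ofI fun z h =>
    h.re1 ⋏ h.re2 ⋏ h.re3 ⋏ h.re4 ⋏ h.re5 ⋏ h.re6 ⋏ h.re7 ⋏ h.re8 ⋏ h.nwn ⋏ h.nww ⋏ h.ses ⋏ h.see
    ⋏ h.sww ⋏ h.sws ⋏ h.nen ⋏ h.nee ⋏ h.l ⋏ h.b ⋏ h.t ⋏ h.r ⋏ h.okt ⋏ h.okr ⋏ h.okl ⋏ h.okb
instance (m : α -> ℕ) (a b : α -> Clu) (q : α -> Lab) [PF m] [PF a] [PF b] [PF q] :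
    PP fun x => Compat (sysM (m x)) (a x) (b x) (q x) :=
  pp_Compat.comp _ (.p ‹PF m› (.p ‹PF a› (.p ‹PF b› ‹PF q›)))
theorem pp_RShuf : PP fun z : ℕ × List Lab × Lab => RShuf (sysM z.1) z.2.1 z.2.2 := PP.ofI fun z h =>
    h.sw ⋏ h.ne ⋏ h.l ⋏ h.b ⋏ h.r ⋏ h.t ⋏ h.vsw ⋏ h.vne ⋏ h.vnw ⋏ h.vse ⋏ h.nwe ⋏ h.nws ⋏ h.sen ⋏
    h.sew ⋏ h.fill ⋏ h.cF ⋏ h.cP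
theorem pp_OddL : PP fun z : Lab => OddL z := PP.ofI fun z h =>
    h.l ⋏ h.r ⋏ h.b ⋏ h.t
theorem pp_TBase : PP fun z : ℕ × Clu × TLab => TBase (sysM z.1) z.2.1 z.2.2 := PP.ofI fun z h =>
    h.l ⋏ h.t ⋏ h.vnw ⋏ h.vl ⋏ h.vt ⋏ h.vC ⋏ h.ln ⋏ h.ls ⋏ h.le ⋏ h.te ⋏ h.tw ⋏ h.ts ⋏ h.nws ⋏
    h.nwe ⋏ h.fC ⋏ h.fl ⋏ h.pC ⋏ h.pt
theorem pp_TJoin : PP fun z : TLab × TLab × Lab × TLab => TJoin z.1 z.2.1 z.2.2.1 z.2.2.2 := PP.ofI (fun z h =>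
    h.eb ⋏ h.er ⋏ h.sw ⋏ h.ne ⋏ h.re1 ⋏ h.re2 ⋏ h.sre ⋏ h.sA ⋏ h.sB ⋏ h.eq) (hp := by simp only [mkTLab_eq]; infer_instance)
theorem pp_OddT : PP fun z : TLab => OddT z := PP.ofI fun z h =>
    h.l ⋏ h.t
theorem pp_TGoal : PP fun z : ℕ × TLab => TGoal (fun a => mb z.1 a) z.2 := PP.ofI fun z h =>
    h.l ⋏ h.t ⋏ h.g

/-! the rule predicates and the least fixed points -/
theorem pp_Rule : PP fun z : ℕ × List Lab × Lab => Rule (sysM z.1) z.2.1 z.2.2 := by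
  have h1 : PP fun z : ℕ × List Lab × Lab => RBase (sysM z.1) z.2.2 :=
    pp_RBase.comp _ (.p inferInstance inferInstance)
  have h2 : PP fun z : ((ℕ × List Lab × Lab) × Lab) × Lab => RJoin z.1.2 z.2 z.1.1.2.2 :=
    pp_RJoin.comp _ (.p inferInstance (.p inferInstance inferInstance))
  have h3 : PP fun z : (((ℕ × List Lab × Lab) × Lab) × Lab) × Lab =>
      RLim (sysM z.1.1.1.1) z.1.1.2 z.1.2 z.2 z.1.1.1.2.2 :=
    pp_RLim.comp _ (.p inferInstance (.p inferInstance (.p inferInstance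
      (.p inferInstance inferInstance))))
  have h4 := pp_RShuf
  unfold Rule
  infer_instance
theorem pp_TRule : PP fun z : (ℕ × List Lab) × List TLab × TLab =>
    TRule (sysM z.1.1) z.1.2 z.2.1 z.2.2 := by
  have h1 : PP fun z : (ℕ × List Lab) × List TLab × TLab => TBase (sysM z.1.1) (hd z.2.2.l).e z.2.2 :=
    pp_TBase.comp _ (.p inferInstance (.p inferInstance inferInstance))
  have h2 : PP fun z : ((((ℕ × List Lab) × List TLab × TLab) × TLab) × TLab) × Lab =>
      TJoin z.1.1.2 z.1.2 z.2 z.1.1.1.2.2 :=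
    pp_TJoin.comp _ (.p inferInstance (.p inferInstance (.p inferInstance inferInstance)))
  unfold TRule
  infer_instance

open Classical in
theorem pf_fix {U : α -> List β} {R : α -> List β -> β -> Prop} (hU : PF U)
    (hR : PP fun z : α × List β × β => R z.1 z.2.1 z.2.2) :
    PF fun x => fixIter (U x) fun X q => decide (R x X q) := by
  have h1 : PrimrecRel fun (q : β) (z : α × List β) => R z.1 z.2 q :=
    hR.out.comp (.pair (Primrec.fst.comp .snd) (.pair (Primrec.snd.comp .snd) .fst))
  have h2 : Primrec₂ fun (x : α) (X : List β) => fixStep (U x) (fun X q => decide (R x X q)) X :=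
    (h1.listFilter.comp (hU.out.comp .fst) .id).of_eq fun _ => rfl
  exact ⟨Primrec.nat_iterate (Primrec.list_length.comp hU.out) (.const []) h2⟩
theorem pf_derList : PF fun m : ℕ => derList (sysM m) := by
  classical
  have h1 := pp_Rule
  have h2 : PP fun z : ℕ × List Lab × Lab => OddL z.2.2 := pp_OddL.comp _ inferInstance
  refine ⟨(pf_fix (U := fun m => labList (sysM m).n)
    (R := fun m X q => Rule (sysM m) X q /\ OddL q) inferInstance inferInstance).out.of_eq fun m => ?_⟩
  unfold derList
  congr!
theorem pf_tderList : PF fun m : ℕ => tderList (sysM m) := by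
  classical
  have h1 : PP fun z : ℕ × List TLab × TLab => TRule (sysM z.1) (derList (sysM z.1)) z.2.1 z.2.2 :=
    pp_TRule.comp _ (.p (.p inferInstance (pf_derList.comp _ inferInstance)) inferInstance)
  have h2 : PP fun z : ℕ × List TLab × TLab => OddT z.2.2 := pp_OddT.comp _ inferInstance
  refine ⟨(pf_fix (U := fun m => tlabList (sysM m).n)
    (R := fun m X q => TRule (sysM m) (derList (sysM m)) X q /\ OddT q)
      inferInstance inferInstance).out.of_eq fun m => ?_⟩
  unfold tderList
  congr!
theorem pp_final : PP fun m : ℕ => ∃ q ∈ tderList (sysM m), TGoal (fun a => mb m a) q := by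
  have h1 := pf_tderList
  have h2 : PP fun z : ℕ × TLab => TGoal (fun a => mb z.1 a) z.2 := pp_TGoal
  infer_instance
theorem valid_iff (φ : TForm) : TValid (fun p q : HalfPlane => p.val <= q.val) φ ↔
    ¬ ∃ q ∈ tderList (sysM (5 * Encodable.encode φ + 1)),
      TGoal (fun a => mb (5 * Encodable.encode φ + 1) a) q := by
  have h1 : TValid (fun p q : HalfPlane => p.val <= q.val) φ ↔
      ¬ TSatisfiable (fun p q : HalfPlane => p.val <= q.val) (.neg φ) := by
    simp [TValid, TSatisfiable, TSat]
  rw [h1, not_iff_not]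
  constructor
  . intro h
    obtain ⟨c, t, hb, hc⟩ := colouring_of_sat h
    exact hc.tder hb
  . rintro ⟨q, hq, hg⟩
    obtain ⟨c, t, hc⟩ := TDer.colouring hq hg
    exact sat_of_colouring hc

end prim
end

/-- The validity problem for temporal formulas over the frame `(D, ≤)`, where
`D = {(x,y) ∈ ℝ² : y > x}` and `≤` is the restriction to `D` of the componentwise
order on ℝ², is decidable. -/
theorem validity_halfplane_le_decidable :
    ComputablePred (fun φ : TForm =>
      TValid (fun p q : HalfPlane => p.val ≤ q.val) φ) :=
  PrimrecPred.computablePred ((pp_final.out.not.comp (Primrec.succ.comp (Primrec.nat_mul.comp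
    (.const 5) Primrec.encode))).of_eq fun φ => (valid_iff φ).symm)

end Temporal
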